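/- Orbital stability of the ZK ground state soliton (first part of Theorem 1): there exist constants α₀ > 0 and C > 0 with the following property. Let Q : ℝ³ → ℝ be the ground state, i.e. the unique positive radial smooth solution of −ΔQ + Q − Q² = 0 with Q and ∇Q square-integrable and Q(x) → 0 as |x| → ∞. Let 0 < α ≤ α₀ and let u : ℝ × ℝ³ → ℝ be such that t ↦ u(t,·) is a smooth curve in the Schwartz space 𝒮(ℝ³), u solves ∂_t u + ∂_x(Δu + u²) = 0 pointwise, and ‖u(0,·) − Q‖_{H¹} ≤ α, where ‖v‖_{H¹}² = ∫_{ℝ³}(v² + |∇v|²). Then there exist functions c : [0,∞) → (0,∞) and a = (a₁,a₂,a₃) : [0,∞) → ℝ³ such that for all t ≥ 0, ‖ c(t)² u(t, c(t)x + a₁(t), c(t)y + a₂(t), c(t)z + a₃(t)) − Q(x,y,z) ‖_{H¹} ≤ C α. -/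

import Mathlib

noncomputable section

open MeasureTheory Filter Real

/-- Partial derivative in the first spatial variable. -/
def pdx (f : ℝ → ℝ → ℝ → ℝ) (x y z : ℝ) : ℝ := deriv (fun a => f a y z) x

/-- Partial derivative in the second spatial variable. -/
def pdy (f : ℝ → ℝ → ℝ → ℝ) (x y z : ℝ) : ℝ := deriv (fun b => f x b z) y

/-- Partial derivative in the third spatial variable. -/
def pdz (f : ℝ → ℝ → ℝ → ℝ) (x y z : ℝ) : ℝ := deriv (fun c => f x y c) z

/-- Spatial Laplacian Δf = f_xx + f_yy + f_zz of a function of three real variables. -/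
def lap3 (f : ℝ → ℝ → ℝ → ℝ) (x y z : ℝ) : ℝ :=
  deriv (fun a => deriv (fun a' => f a' y z) a) x
    + deriv (fun b => deriv (fun b' => f x b' z) b) y
    + deriv (fun c => deriv (fun c' => f x y c') c) z

/-- `u` solves the 3D Zakharov–Kuznetsov equation ∂ₜu + ∂ₓ(Δu + u²) = 0 pointwise. -/
def IsZKSolution (u : ℝ → ℝ → ℝ → ℝ → ℝ) : Prop :=
  ∀ t x y z : ℝ,
    deriv (fun s => u s x y z) t
      + deriv (fun a => lap3 (u t) a y z + (u t a y z) ^ 2) x = 0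

/-- `t ↦ u(t,·)` is a smooth curve in the Schwartz space 𝒮(ℝ³): the function is jointly
smooth and every time derivative of every time slice is a Schwartz function. -/
def IsSchwartzCurve (u : ℝ → ℝ → ℝ → ℝ → ℝ) : Prop :=
  ContDiff ℝ (⊤ : ℕ∞) (fun p : ℝ × ℝ × ℝ × ℝ => u p.1 p.2.1 p.2.2.1 p.2.2.2) ∧
    ∀ (n : ℕ) (t : ℝ), ∃ S : SchwartzMap (ℝ × ℝ × ℝ) ℝ,
      ∀ x y z : ℝ, S (x, y, z) = iteratedDeriv n (fun s => u s x y z) t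

/-- The squared H¹ norm ∫_{ℝ³} (v² + |∇v|²). -/
def H1normSq (v : ℝ → ℝ → ℝ → ℝ) : ℝ :=
  ∫ p : ℝ × ℝ × ℝ,
    ((v p.1 p.2.1 p.2.2) ^ 2 + (pdx v p.1 p.2.1 p.2.2) ^ 2
      + (pdy v p.1 p.2.1 p.2.2) ^ 2 + (pdz v p.1 p.2.1 p.2.2) ^ 2)

/-- The H¹(ℝ³) norm. -/
def H1norm (v : ℝ → ℝ → ℝ → ℝ) : ℝ := Real.sqrt (H1normSq v)

/-- `Q` is the ground state: a positive radial smooth solution of −ΔQ + Q − Q² = 0 on ℝ³,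
vanishing at infinity, with Q and ∇Q square-integrable. -/
def IsGroundState (Q : ℝ → ℝ → ℝ → ℝ) : Prop :=
  ContDiff ℝ (⊤ : ℕ∞) (fun p : ℝ × ℝ × ℝ => Q p.1 p.2.1 p.2.2) ∧
  (∀ x y z : ℝ, 0 < Q x y z) ∧
  (∃ q : ℝ → ℝ, ∀ x y z : ℝ, Q x y z = q (Real.sqrt (x ^ 2 + y ^ 2 + z ^ 2))) ∧
  Tendsto (fun p : ℝ × ℝ × ℝ => Q p.1 p.2.1 p.2.2) (cocompact (ℝ × ℝ × ℝ)) (nhds 0) ∧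
  Integrable (fun p : ℝ × ℝ × ℝ => (Q p.1 p.2.1 p.2.2) ^ 2) ∧
  Integrable (fun p : ℝ × ℝ × ℝ =>
    (pdx Q p.1 p.2.1 p.2.2) ^ 2 + (pdy Q p.1 p.2.1 p.2.2) ^ 2 + (pdz Q p.1 p.2.1 p.2.2) ^ 2) ∧
  (∀ x y z : ℝ, -(lap3 Q x y z) + Q x y z - (Q x y z) ^ 2 = 0)

open Topology
open scoped ContDiff ENNReal

namespace ZK

open Set (Icc Ici Ioo Ioc Iio mem_Icc mem_Ici right_mem_Icc left_mem_Icc univ mem_univ)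
open Finset (mul_sum single_le_sum sum_nonneg sum_congr mem_univ sum_le_sum sum_add_distrib sum_mul sum_eq_zero)
open ENNReal (ofReal)

section CauchySchwarz

variable {α : Type*} [MeasurableSpace α] {μ : Measure α} {f g : α → ℝ}

/-- Cauchy–Schwarz inequality for integrals of real functions. -/
lemma integral_abs_mul_le_sqrt (hf : MemLp f 2 μ) (hg : MemLp g 2 μ) :
    ∫ x, |f x| * |g x| ∂μ ≤ √(∫ x, f x ^ 2 ∂μ) * √(∫ x, g x ^ 2 ∂μ) := by
  simpa [norm_eq_abs, sqrt_eq_rpow, sq_abs] using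
    integral_mul_norm_le_Lp_mul_Lq .two_two (by simpa using hf : MemLp f (.ofReal 2) μ)
      (by simpa using hg : MemLp g (.ofReal 2) μ)

lemma abs_integral_mul_le_sqrt (hf : MemLp f 2 μ) (hg : MemLp g 2 μ) :
    |∫ x, f x * g x ∂μ| ≤ √(∫ x, f x ^ 2 ∂μ) * √(∫ x, g x ^ 2 ∂μ) :=
  abs_integral_le_integral_abs.trans (by simpa only [abs_mul] using integral_abs_mul_le_sqrt hf hg)

lemma integral_mul_sq_le (hf : MemLp f 2 μ) (hg : MemLp g 2 μ) :
    (∫ x, f x * g x ∂μ) ^ 2 ≤ (∫ x, f x ^ 2 ∂μ) * ∫ x, g x ^ 2 ∂μ := by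
  have h := sq_le_sq' (neg_le_of_abs_le (abs_integral_mul_le_sqrt hf hg))
    (le_of_abs_le (abs_integral_mul_le_sqrt hf hg))
  rwa [mul_pow, sq_sqrt (integral_nonneg fun _ => sq_nonneg _),
    sq_sqrt (integral_nonneg fun _ => sq_nonneg _)] at h

/-- Fatou's lemma in terms of Bochner integrals of nonnegative functions. -/
lemma integrable_and_integral_le_of_tendsto {F : ℕ → α → ℝ} {f : α → ℝ} {b : ℕ → ℝ} {B : ℝ}
    (hF : ∀ n, Integrable (F n) μ) (hF0 : ∀ n x, 0 ≤ F n x)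
    (hf : ∀ x, Tendsto (fun n => F n x) atTop (𝓝 (f x)))
    (hb : ∀ n, ∫ x, F n x ∂μ ≤ b n) (hB : Tendsto b atTop (𝓝 B)) :
    Integrable f μ ∧ ∫ x, f x ∂μ ≤ B := by
  have hf0 : ∀ x, 0 ≤ f x := fun x => ge_of_tendsto' (hf x) fun n => hF0 n x
  have hlin := lintegral_liminf_le' (u := atTop) fun n => (hF n).1.aemeasurable.ennreal_ofReal
  simp_rw [fun x => (ENNReal.tendsto_ofReal (hf x)).liminf_eq, fun n =>
    (ofReal_integral_eq_lintegral_ofReal (hF n) (.of_forall (hF0 n))).symm] at hlin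
  replace hlin := hlin.trans <| (liminf_le_liminf (.of_forall fun n =>
    ENNReal.ofReal_le_ofReal (hb n))).trans (ENNReal.tendsto_ofReal hB).liminf_eq.le
  have hint : Integrable f μ := by
    refine ⟨aestronglyMeasurable_of_tendsto_ae atTop (fun n => (hF n).1)
      (.of_forall hf), ?_⟩
    rw [hasFiniteIntegral_iff_ofReal (.of_forall hf0)]
    exact hlin.trans_lt ENNReal.ofReal_lt_top
  rw [← ofReal_integral_eq_lintegral_ofReal hint (.of_forall hf0)] at hlin
  exact ⟨hint, (ENNReal.ofReal_le_ofReal_iff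
    (ge_of_tendsto' hB fun n => (integral_nonneg (hF0 n)).trans (hb n))).1 hlin⟩

end CauchySchwarz

/-- Three-dimensional space, in the coordinates used by the statement. -/
abbrev E3 := ℝ × ℝ × ℝ

variable {F Q e f g h k v w w' φ ψ : E3 → ℝ} {B C G' K M R S T a b c r r₀ s t x Λ ε η κ : ℝ} {p : E3}

instance : (volume : Measure E3).IsAddHaarMeasure :=
  Measure.prod.instIsAddHaarMeasure _ _

/-- The coordinate directions of `E3`. -/
def ev : Fin 3 → E3 := ![(1, 0, 0), (0, 1, 0), (0, 0, 1)]

/-- Partial derivative in the `i`-th coordinate direction. -/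
def D (i : Fin 3) (f : E3 → ℝ) (p : E3) : ℝ := fderiv ℝ f p (ev i)

/-- The squared length of the gradient. -/
def gradSq (f : E3 → ℝ) (p : E3) : ℝ := ∑ i, D i f p ^ 2

lemma gradSq_nonneg (f) (p) : 0 ≤ gradSq f p :=
  sum_nonneg fun _ _ => sq_nonneg _

lemma _root_.ContDiff.D (hf : ContDiff ℝ ∞ f) (i) : ContDiff ℝ ∞ (D i f) := by
  have : ContDiff ℝ ∞ (fderiv ℝ f) := hf.fderiv_right (by simp)
  exact this.clm_apply contDiff_const

lemma continuous_gradSq (hf : ContDiff ℝ ∞ f) : Continuous (gradSq f) :=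
  continuous_finsetSum _ fun i _ => (hf.D i).continuous.pow 2

section
variable (hf : DifferentiableAt ℝ f p)
include hf

section
variable (hg : DifferentiableAt ℝ g p)
include hg

lemma D_add (i) : D i (fun x => f x + g x) p = D i f p + D i g p := by
  unfold D; rw [show (fun x => f x + g x) = f + g from rfl, fderiv_add hf hg]; simp

lemma D_sub (i) : D i (fun x => f x - g x) p = D i f p - D i g p := by
  unfold D; rw [show (fun x => f x - g x) = f - g from rfl, fderiv_sub hf hg]; simp

lemma D_mul (i) : D i (fun x => f x * g x) p = D i f p * g p + f p * D i g p := by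
  unfold D; rw [show (fun x => f x * g x) = f * g from rfl, fderiv_mul hf hg]; simp; ring

end

omit hf in
lemma D_const_mul (c : ℝ) (hf : DifferentiableAt ℝ f p)
    (i) : D i (fun x => c * f x) p = c * D i f p := by
  unfold D; rw [fderiv_const_mul hf]; simp

lemma D_sq (i) : D i (fun x => f x ^ 2) p = 2 * f p * D i f p := by
  simp_rw [pow_two]; rw [D_mul hf hf]; ring

end

lemma _root_.HasCompactSupport.D (hf : HasCompactSupport f) (i) :
    HasCompactSupport (D i f) := hf.fderiv_apply (𝕜 := ℝ) (ev i)

lemma norm_fderiv_le_sum_abs_D (f) (p) : ‖fderiv ℝ f p‖ ≤ ∑ i, |D i f p| := by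
  refine ContinuousLinearMap.opNorm_le_bound _ (sum_nonneg fun _ _ => abs_nonneg _) ?_
  rintro ⟨x, y, z⟩
  have h : fderiv ℝ f p (x, y, z) = x * D 0 f p + y * D 1 f p + z * D 2 f p := by
    have : ((x, y, z) : E3) = x • ev 0 + y • ev 1 + z • ev 2 := by simp [ev]
    rw [this]; simp [D]
  have hx : |x| ≤ ‖((x, y, z) : E3)‖ := by simp [Prod.norm_def]
  have hy : |y| ≤ ‖((x, y, z) : E3)‖ := by simp [Prod.norm_def]
  have hz : |z| ≤ ‖((x, y, z) : E3)‖ := by simp [Prod.norm_def]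
  rw [h, Fin.sum_univ_three, norm_eq_abs]
  refine (abs_add_three _ _ _).trans ?_
  rw [abs_mul, abs_mul, abs_mul]
  nlinarith [abs_nonneg (D 0 f p), abs_nonneg (D 1 f p), abs_nonneg (D 2 f p)]

lemma norm_fderiv_sq_le (f) (p) : ‖fderiv ℝ f p‖ ^ 2 ≤ 3 * gradSq f p := by
  have h := norm_fderiv_le_sum_abs_D f p
  have h0 := norm_nonneg (fderiv ℝ f p)
  have : ‖fderiv ℝ f p‖ ^ 2 ≤ (∑ i, |D i f p|) ^ 2 := by gcongr
  refine this.trans ?_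
  simp only [gradSq, Fin.sum_univ_three]
  nlinarith [sq_abs (D 0 f p), sq_abs (D 1 f p), sq_abs (D 2 f p),
    sq_nonneg (|D 0 f p| - |D 1 f p|), sq_nonneg (|D 0 f p| - |D 2 f p|),
    sq_nonneg (|D 1 f p| - |D 2 f p|)]

lemma integral_D_eq_zero (hF : ContDiff ℝ 1 F) (hc : HasCompactSupport F)
    (i) : ∫ p, D i F p = 0 := by
  have hFd : Continuous (fun p => fderiv ℝ F p (ev i)) :=
    (hF.continuous_fderiv (by simp)).clm_apply continuous_const
  have hs : HasCompactSupport (fun p => fderiv ℝ F p (ev i)) := hc.fderiv_apply (𝕜 := ℝ) (ev i)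
  have := integral_mul_fderiv_eq_neg_fderiv_mul_of_integrable (μ := (volume : Measure E3))
    (f := fun _ => (1 : ℝ)) (g := F) (v := ev i) (by simp)
    (by simpa using hFd.integrable_of_hasCompactSupport hs)
    (by simpa using hF.continuous.integrable_of_hasCompactSupport hc)
    (fun x _ => by fun_prop) (fun x _ => hF.differentiable (by simp) x)
  simpa [D] using this

/-- Integration by parts when one factor has compact support. -/
lemma integral_mul_D_eq_neg (hf : ContDiff ℝ ∞ f) (hg : ContDiff ℝ ∞ g)
    (hc : HasCompactSupport f) (i) :
    ∫ p, f p * D i g p = - ∫ p, D i f p * g p := by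
  have hfg : ContDiff ℝ ∞ (fun p => f p * g p) := hf.mul hg
  have h1 := (hf.D i).continuous
  have h2 := (hg.D i).continuous
  have h := integral_D_eq_zero (hfg.of_le (by simp)) hc.mul_right i
  have e : ∀ p, D i (fun p => f p * g p) p = D i f p * g p + f p * D i g p := fun p =>
    D_mul (hf.differentiable (by simp) p) (hg.differentiable (by simp) p) i
  simp_rw [e] at h
  rw [integral_add] at h
  · linarith
  · exact (h1.mul hg.continuous).integrable_of_hasCompactSupport
      (hc.D i).mul_right
  · exact (hf.continuous.mul h2).integrable_of_hasCompactSupport hc.mul_right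

/-- The cutoff function at scale `1`. -/
def chi : ContDiffBump (0 : E3) := ⟨1, 2, by norm_num, by norm_num⟩

/-- The cutoff function at scale `R`. -/
def cut (R : ℝ) (p : E3) : ℝ := chi (R⁻¹ • p)

lemma contDiff_cut (R : ℝ) : ContDiff ℝ ∞ (cut R) := by
  unfold cut
  exact chi.contDiff.comp (contDiff_const_smul _)

lemma cut_nonneg (R : ℝ) (p) : 0 ≤ cut R p := chi.nonneg

lemma cut_le_one (R : ℝ) (p) : cut R p ≤ 1 := chi.le_one

lemma cut_eq_one (hR : 0 < R) (hp : ‖p‖ ≤ R) : cut R p = 1 := by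
  apply chi.one_of_mem_closedBall
  simp only [chi, mem_closedBall_zero_iff, norm_smul, norm_inv, norm_eq_abs, abs_of_pos hR]
  bound

lemma hasCompactSupport_cut (hR : 0 < R) : HasCompactSupport (cut R) :=
  chi.hasCompactSupport.comp_homeomorph (Homeomorph.smulOfNeZero R⁻¹ (inv_ne_zero hR.ne'))

lemma tendsto_cut (p) : Tendsto (fun n : ℕ => cut (n + 1) p) atTop (𝓝 1) := by
  apply tendsto_const_nhds.congr'
  filter_upwards [eventually_ge_atTop ⌈‖p‖⌉₊] with n hn
  refine (cut_eq_one (by positivity) ?_).symm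
  linarith [Nat.ceil_le.1 hn]

lemma D_comp_smul (hf : Differentiable ℝ f) (c : ℝ) (i) :
    D i (fun p => f (c • p)) = fun p => c * D i f (c • p) := by
  ext p
  unfold D
  have h := (hf (c • p)).hasFDerivAt.comp p
    ((hasFDerivAt_id p).const_smul c)
  have h2 : fderiv ℝ (fun p => f (c • p)) p = _ := h.fderiv
  rw [h2]; simp

lemma D_cut (R : ℝ) (i) : D i (cut R) = fun p => R⁻¹ * D i chi (R⁻¹ • p) :=
  D_comp_smul (chi.contDiff.differentiable (n := 1) (by simp)) _ _

lemma D_D_cut (R : ℝ) (i j) :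
    D j (D i (cut R)) = fun p => R⁻¹ * (R⁻¹ * D j (D i chi) (R⁻¹ • p)) := by
  have hc : ContDiff ℝ ∞ (D i chi) := chi.contDiff.D i
  rw [D_cut]
  ext p
  have hd : Differentiable ℝ (D i chi) := hc.differentiable (by simp)
  have : D j (fun p => R⁻¹ * D i chi (R⁻¹ • p)) p
      = R⁻¹ * D j (fun p => D i chi (R⁻¹ • p)) p :=
    D_const_mul (f := fun p => D i chi (R⁻¹ • p)) _ (by fun_prop) j
  rw [this, D_comp_smul hd]

/-- Uniform bounds for the first and second derivatives of the cutoffs. -/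
lemma exists_cut_bound : ∃ K : ℝ, 0 < K ∧ ∀ R : ℝ, 1 ≤ R → ∀ (i j : Fin 3) (p : E3),
    |D i (cut R) p| ≤ K / R ∧ |D j (D i (cut R)) p| ≤ K / R := by
  have hb : ∀ f : E3 → ℝ, Continuous f → HasCompactSupport f → ∃ C, ∀ p, |f p| ≤ C := by
    intro f hf hc
    obtain ⟨C, hC⟩ := hf.bounded_above_of_compact_support hc
    bound
  have h1 : ∀ i, ∃ C, ∀ p, |D i chi p| ≤ C := fun i =>
    hb _ (chi.contDiff.D i).continuous (chi.hasCompactSupport.D i)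
  have h2 : ∀ i j, ∃ C, ∀ p, |D j (D i chi) p| ≤ C := fun i j =>
    hb _ ((chi.contDiff.D i).D j).continuous
      ((chi.hasCompactSupport.D i).D j)
  choose C1 hC1 using h1
  choose C2 hC2 using h2
  have hC1' : ∀ i, 0 ≤ C1 i := fun i => (abs_nonneg _).trans (hC1 i 0)
  have hC2' : ∀ i j, 0 ≤ C2 i j := fun i j => (abs_nonneg _).trans (hC2 i j 0)
  refine ⟨1 + ∑ i, C1 i + ∑ i, ∑ j, C2 i j, ?_, ?_⟩
  · have := sum_nonneg fun i (_ : i ∈ Finset.univ) => hC1' i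
    have := sum_nonneg fun i (_ : i ∈ Finset.univ) =>
      sum_nonneg fun j (_ : j ∈ Finset.univ) => hC2' i j
    linarith
  intro R hR i j p
  have hR0 : 0 < R := by linarith
  have a1 := sum_nonneg fun i (_ : i ∈ Finset.univ) => hC1' i
  have a2 := sum_nonneg fun i (_ : i ∈ Finset.univ) =>
      sum_nonneg fun j (_ : j ∈ Finset.univ) => hC2' i j
  have b1 : C1 i ≤ ∑ i, C1 i := single_le_sum (fun i _ => hC1' i) (mem_univ i)
  have b2 : C2 i j ≤ ∑ i, ∑ j, C2 i j :=
    (single_le_sum (fun j _ => hC2' i j) (mem_univ j)).trans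
      (single_le_sum (f := fun i => ∑ j, C2 i j)
        (fun i _ => sum_nonneg fun j _ => hC2' i j) (mem_univ i))
  have hRi : R⁻¹ ≤ 1 := inv_le_one_of_one_le₀ hR
  have hRi0 : 0 < R⁻¹ := by positivity
  constructor
  · rw [D_cut, abs_mul, abs_of_pos hRi0, div_eq_inv_mul]
    gcongr
    linarith [hC1 i (R⁻¹ • p)]
  · rw [D_D_cut, abs_mul, abs_mul, abs_of_pos hRi0, div_eq_inv_mul]
    gcongr
    calc R⁻¹ * |D j (D i chi) (R⁻¹ • p)| ≤ 1 * C2 i j := by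
          gcongr; exact hC2 i j _
      _ ≤ _ := by linarith

/-- Smooth functions which are square integrable together with their gradient. -/
structure SobH (f : E3 → ℝ) : Prop where
  smooth : ContDiff ℝ ∞ f
  sq : Integrable (fun p => f p ^ 2)
  dsq : ∀ i, Integrable (fun p => D i f p ^ 2)

/-- The squared `L²` norm. -/
def mass (f : E3 → ℝ) : ℝ := ∫ p, f p ^ 2

/-- The squared `L²` norm of the gradient. -/
def dmass (f : E3 → ℝ) : ℝ := ∫ p, gradSq f p

lemma mass_nonneg (f) : 0 ≤ mass f := integral_nonneg fun _ => sq_nonneg _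

lemma dmass_nonneg (f) : 0 ≤ dmass f := integral_nonneg fun _ => gradSq_nonneg _ _

namespace SobH


variable (hf : SobH f)
include hf

lemma diff : Differentiable ℝ f := hf.smooth.differentiable (by simp)

lemma meas : AEStronglyMeasurable f :=
  hf.smooth.continuous.aestronglyMeasurable

lemma dmeas (i) : AEStronglyMeasurable (D i f) :=
  (hf.smooth.D i).continuous.aestronglyMeasurable

lemma memLp : MemLp f 2 := (memLp_two_iff_integrable_sq hf.meas).2 hf.sq

lemma dmemLp (i) : MemLp (D i f) 2 :=
  (memLp_two_iff_integrable_sq (hf.dmeas i)).2 (hf.dsq i)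

lemma integrable_mul (hg : SobH g) : Integrable (fun p => f p * g p) :=
  hf.memLp.integrable_mul hg.memLp

lemma integrable_gradSq : Integrable (gradSq f) :=
  integrable_finsetSum _ fun i _ => hf.dsq i

lemma dmass_eq : dmass f = ∑ i, ∫ p, D i f p ^ 2 :=
  integral_finsetSum _ fun i _ => hf.dsq i

omit hf in
lemma of_compact (hf : ContDiff ℝ ∞ f) (hc : HasCompactSupport f) : SobH f where
  smooth := hf
  sq := by
    have h2 : HasCompactSupport (fun p => f p ^ 2) := hc.comp_left (g := fun t => t ^ 2) (by simp)
    exact (hf.continuous.pow 2).integrable_of_hasCompactSupport h2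
  dsq i := by
    have h2 : HasCompactSupport (fun p => D i f p ^ 2) :=
      (hc.D i).comp_left (g := fun t => t ^ 2) (by simp)
    exact ((hf.D i).continuous.pow 2).integrable_of_hasCompactSupport h2

lemma add (hg : SobH g) : SobH (fun p => f p + g p) where
  smooth := hf.smooth.add hg.smooth
  sq := (hf.memLp.add hg.memLp).integrable_sq
  dsq i := by
    simp_rw [fun p => D_add (hf.diff p) (hg.diff p) i]
    exact ((hf.dmemLp i).add (hg.dmemLp i)).integrable_sq

lemma sub (hg : SobH g) : SobH (fun p => f p - g p) where
  smooth := hf.smooth.sub hg.smooth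
  sq := (hf.memLp.sub hg.memLp).integrable_sq
  dsq i := by
    simp_rw [fun p => D_sub (hf.diff p) (hg.diff p) i]
    exact ((hf.dmemLp i).sub (hg.dmemLp i)).integrable_sq

omit hf in
lemma const_mul (c : ℝ) (hf : SobH f) : SobH (fun p => c * f p) where
  smooth := contDiff_const.mul hf.smooth
  sq := by simp_rw [mul_pow]; exact hf.sq.const_mul _
  dsq i := by
    simp_rw [fun p => D_const_mul c (hf.diff p) i, mul_pow]
    exact (hf.dsq i).const_mul _

end SobH

lemma SobH.cut_mul (hf : ContDiff ℝ ∞ f) (n : ℕ) :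
    SobH (fun p => cut (n + 1) p * f p) :=
  SobH.of_compact ((contDiff_cut _).mul hf) (hasCompactSupport_cut (by positivity)).mul_right

lemma D_cut_mul (hf : Differentiable ℝ f) (R : ℝ) (i) (p) :
    D i (fun p => cut R p * f p) p = D i (cut R) p * f p + cut R p * D i f p :=
  D_mul ((contDiff_cut R).differentiable (by simp) p) (hf p) i

lemma tendsto_D_cut (i) (p) :
    Tendsto (fun n : ℕ => D i (cut (n + 1)) p) atTop (𝓝 0) := by
  obtain ⟨K, hK, hb⟩ := exists_cut_bound
  refine squeeze_zero_norm (a := fun n : ℕ => K / (n + 1)) (fun n => ?_) ?_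
  · exact (hb (n + 1) (by simp) i i p).1
  · exact tendsto_const_nhds.div_atTop (tendsto_atTop_add_const_right _ _
      tendsto_natCast_atTop_atTop)

lemma tendsto_integral_cut_mul (hF : Integrable F) :
    Tendsto (fun n : ℕ => ∫ p, cut (n + 1) p * F p) atTop (𝓝 (∫ p, F p)) := by
  refine tendsto_integral_of_dominated_convergence (fun p => ‖F p‖) (fun n =>
    (contDiff_cut _).continuous.aestronglyMeasurable.mul hF.1) hF.norm
    (fun n => .of_forall fun p => ?_) (.of_forall fun p => ?_)
  · rw [norm_mul, norm_of_nonneg (cut_nonneg _ _)]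
    exact mul_le_of_le_one_left (norm_nonneg _) (cut_le_one _ _)
  · simpa using (tendsto_cut p).mul_const (F p)

lemma tendsto_integral_cut_sq_mul (hF : Integrable F) :
    Tendsto (fun n : ℕ => ∫ p, cut (n + 1) p ^ 2 * F p) atTop (𝓝 (∫ p, F p)) := by
  refine tendsto_integral_of_dominated_convergence (fun p => ‖F p‖) (fun n =>
    ((contDiff_cut _).continuous.pow 2).aestronglyMeasurable.mul hF.1) hF.norm
    (fun n => .of_forall fun p => ?_) (.of_forall fun p => ?_)
  · rw [norm_mul, norm_of_nonneg (sq_nonneg _)]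
    exact mul_le_of_le_one_left (norm_nonneg _) (pow_le_one₀ (cut_nonneg _ _) (cut_le_one _ _))
  · simpa using ((tendsto_cut p).pow 2).mul_const (F p)

lemma tendsto_dmass_cut_mul (hf : SobH f) :
    Tendsto (fun n : ℕ => dmass (fun p => cut (n + 1) p * f p)) atTop (𝓝 (dmass f)) := by
  simp_rw [fun n : ℕ => (SobH.cut_mul hf.smooth n).dmass_eq, hf.dmass_eq]
  refine tendsto_finsetSum _ fun i _ => ?_
  obtain ⟨K, hK, hb⟩ := exists_cut_bound
  refine tendsto_integral_of_dominated_convergence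
    (fun p => 2 * K ^ 2 * f p ^ 2 + 2 * D i f p ^ 2) (fun n => ?_)
    ((hf.sq.const_mul _).add ((hf.dsq i).const_mul _))
    (fun n => .of_forall fun p => ?_) (.of_forall fun p => ?_)
  · exact ((SobH.cut_mul hf.smooth n).dsq i).aestronglyMeasurable
  · rw [D_cut_mul hf.diff, norm_eq_abs, abs_of_nonneg (sq_nonneg _)]
    have h1 := (hb (n + 1) (by simp) i i p).1
    have h2 : K / ((n : ℝ) + 1) ≤ K := div_le_self hK.le (by simp)
    have h3 : D i (cut (n + 1)) p ^ 2 ≤ K ^ 2 := sq_le_sq' (by linarith [(abs_le.1 h1).1])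
      (by linarith [(abs_le.1 h1).2])
    have h4 : cut (n + 1) p ^ 2 ≤ 1 := pow_le_one₀ (cut_nonneg _ _) (cut_le_one _ _)
    have h5 := mul_le_mul_of_nonneg_right h3 (sq_nonneg (f p))
    have h6 := mul_le_mul_of_nonneg_right h4 (sq_nonneg (D i f p))
    nlinarith [sq_nonneg (D i (cut (n + 1)) p * f p - cut (n + 1) p * D i f p)]
  · simp_rw [D_cut_mul hf.diff]
    simpa using (((tendsto_D_cut i p).mul_const (f p)).add
      ((tendsto_cut p).mul_const (D i f p))).pow 2

lemma tendsto_mass_cut_mul (hf : SobH f) :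
    Tendsto (fun n : ℕ => mass (fun p => cut (n + 1) p * f p)) atTop (𝓝 (mass f)) := by
  simp_rw [mass, mul_pow]
  exact tendsto_integral_cut_sq_mul hf.sq

/-- Gagliardo–Nirenberg inequality for compactly supported functions. -/
lemma exists_gn_compact : ∃ K : ℝ, 0 < K ∧ ∀ f : E3 → ℝ, ContDiff ℝ ∞ f → HasCompactSupport f →
    (∫ p, |f p| ^ 3) ^ 4 ≤ K * mass f ^ 3 * dmass f ^ 3 := by
  set C := lintegralPowLePowLIntegralFDerivConst (volume : Measure E3) (3 / 2) with hC
  refine ⟨((C : ℝ) ^ 4 + 1) * 12 ^ 3, by positivity, fun f hf hc => ?_⟩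
  have hS := SobH.of_compact hf hc
  have hp : Real.HolderConjugate (Module.finrank ℝ E3) (3 / 2) := by
    rw [holderConjugate_iff]; norm_num
  have hf2 : ContDiff ℝ ∞ (fun p => f p ^ 2) := hf.pow 2
  have hc2 : HasCompactSupport (fun p => f p ^ 2) :=
    hc.comp_left (g := fun t => t ^ 2) (by simp)
  have key := lintegral_pow_le_pow_lintegral_fderiv (μ := (volume : Measure E3))
    (hf2.of_le (by simp)) hc2 hp
  rw [← hC] at key
  set I := ∫ p, ‖fderiv ℝ (fun p => f p ^ 2) p‖ with hI
  have hI0 : 0 ≤ I := integral_nonneg fun _ => norm_nonneg _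
  have hcont : Continuous (fderiv ℝ (fun p => f p ^ 2)) := hf2.continuous_fderiv (by simp)
  have hcs : HasCompactSupport (fderiv ℝ (fun p => f p ^ 2)) := hc2.fderiv (𝕜 := ℝ)
  have e1 : ∫⁻ p, ‖fderiv ℝ (fun p => f p ^ 2) p‖ₑ = ofReal I :=
    (ofReal_integral_norm_eq_lintegral_enorm
      (hcont.integrable_of_hasCompactSupport hcs)).symm
  have hint3 : Integrable (fun p => |f p| ^ 3) := by
    have : HasCompactSupport (fun p => |f p| ^ 3) :=
      hc.comp_left (g := fun t => |t| ^ 3) (by simp)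
    exact ((continuous_abs.comp hf.continuous).pow 3).integrable_of_hasCompactSupport this
  have e2 : ∫⁻ p, ‖f p ^ 2‖ₑ ^ ((3 : ℝ) / 2) = ofReal (∫ p, |f p| ^ 3) := by
    rw [ofReal_integral_eq_lintegral_ofReal hint3
      (.of_forall fun p => by positivity)]
    congr 1; ext p
    rw [enorm_eq_ofReal_abs, ENNReal.ofReal_rpow_of_nonneg (abs_nonneg _) (by norm_num)]
    congr 1
    rw [abs_pow, ← rpow_natCast, ← rpow_mul (abs_nonneg _), ← rpow_natCast]
    norm_num
  rw [e1, e2, ENNReal.ofReal_rpow_of_nonneg hI0 (by norm_num)] at key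
  have key2 : ∫ p, |f p| ^ 3 ≤ C * I ^ ((3 : ℝ) / 2) := by
    have : ((C : ENNReal)) * ofReal (I ^ ((3 : ℝ) / 2))
        = ofReal (C * I ^ ((3 : ℝ) / 2)) := by
      simp
    rw [this] at key
    exact (ENNReal.ofReal_le_ofReal_iff (by positivity)).1 key
  have hIle : I ^ 2 ≤ 12 * (mass f * dmass f) := by
    have h1 : I ≤ ∫ p, |2 * f p| * |‖fderiv ℝ f p‖| := by
      apply integral_mono
      · exact (hcont.integrable_of_hasCompactSupport hcs).norm
      · apply Continuous.integrable_of_hasCompactSupport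
        · have := hf.continuous_fderiv (by simp)
          fun_prop
        · exact HasCompactSupport.mul_right
            (hc.comp_left (g := fun t => |2 * t|) (by simp))
      · intro p
        have : fderiv ℝ (fun p => f p ^ 2) p = (2 * f p) • fderiv ℝ f p := by
          simpa using ((hS.diff p).hasFDerivAt.pow 2).fderiv
        simp [this, norm_smul]
    have hcf : Continuous (fun p => ‖fderiv ℝ f p‖) := (hf.continuous_fderiv (by simp)).norm
    have hsq2 : Integrable (fun p => ‖fderiv ℝ f p‖ ^ 2) :=
      (hS.integrable_gradSq.const_mul 3).mono' (hcf.pow 2).aestronglyMeasurable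
        (.of_forall fun p => by
          rw [norm_eq_abs, abs_of_nonneg (sq_nonneg _)]; exact norm_fderiv_sq_le f p)
    have h2 := integral_abs_mul_le_sqrt (hS.const_mul 2).memLp
      ((memLp_two_iff_integrable_sq hcf.aestronglyMeasurable).2 hsq2)
    have h3 := pow_le_pow_left₀ hI0 (h1.trans h2) 2
    rw [mul_pow, sq_sqrt (integral_nonneg fun _ => sq_nonneg _),
      sq_sqrt (integral_nonneg fun _ => sq_nonneg _)] at h3
    have h4 : ∫ p, ‖fderiv ℝ f p‖ ^ 2 ≤ 3 * dmass f := by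
      rw [dmass, ← integral_const_mul]
      exact integral_mono hsq2 (hS.integrable_gradSq.const_mul 3) (norm_fderiv_sq_le f)
    have h5 : ∫ p, (2 * f p) ^ 2 = 4 * mass f := by
      rw [mass, ← integral_const_mul]; congr 1; ext p; ring
    rw [h5] at h3
    nlinarith [mass_nonneg f]
  have hT0 : 0 ≤ ∫ p, |f p| ^ 3 := integral_nonneg fun _ => by positivity
  calc (∫ p, |f p| ^ 3) ^ 4 ≤ (C * I ^ ((3 : ℝ) / 2)) ^ 4 := by gcongr
    _ = (C : ℝ) ^ 4 * (I ^ 2) ^ 3 := by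
        rw [mul_pow]; congr 1
        rw [← rpow_natCast, ← rpow_mul hI0, ← pow_mul, ← rpow_natCast]; norm_num
    _ ≤ (C : ℝ) ^ 4 * (12 * (mass f * dmass f)) ^ 3 := by gcongr
    _ = (C : ℝ) ^ 4 * 12 ^ 3 * mass f ^ 3 * dmass f ^ 3 := by ring
    _ ≤ _ := by
        have := mass_nonneg f; have := dmass_nonneg f
        gcongr; linarith

/-- Gagliardo–Nirenberg inequality. -/
lemma exists_gn : ∃ K : ℝ, 0 < K ∧ ∀ f : E3 → ℝ, SobH f →
    Integrable (fun p => |f p| ^ 3) ∧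
      (∫ p, |f p| ^ 3) ^ 4 ≤ K * mass f ^ 3 * dmass f ^ 3 := by
  obtain ⟨K, hK, h⟩ := exists_gn_compact
  refine ⟨K, hK, fun f hf => ?_⟩
  have hint : ∀ n : ℕ, Integrable (fun p => |cut (n + 1) p * f p| ^ 3) := fun n => by
    have hc : HasCompactSupport (fun p => cut ((n : ℝ) + 1) p * f p) :=
      (hasCompactSupport_cut (by positivity)).mul_right
    have : HasCompactSupport (fun p => |cut ((n : ℝ) + 1) p * f p| ^ 3) :=
      hc.comp_left (g := fun t => |t| ^ 3) (by simp)
    have h1 := (contDiff_cut ((n : ℝ) + 1)).continuous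
    have h2 := hf.smooth.continuous
    exact Continuous.integrable_of_hasCompactSupport (by fun_prop) this
  have hlim : Tendsto (fun n : ℕ => (K * mass (fun p => cut (n + 1) p * f p) ^ 3
      * dmass (fun p => cut (n + 1) p * f p) ^ 3) ^ ((1 : ℝ) / 4)) atTop
      (𝓝 ((K * mass f ^ 3 * dmass f ^ 3) ^ ((1 : ℝ) / 4))) := by
    refine Tendsto.rpow_const ?_ (Or.inr (by norm_num))
    exact ((tendsto_const_nhds).mul ((tendsto_mass_cut_mul hf).pow 3)).mul
      ((tendsto_dmass_cut_mul hf).pow 3)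
  have := integrable_and_integral_le_of_tendsto (f := fun p => |f p| ^ 3) hint
    (fun n p => by positivity)
    (fun p => by simpa using (((tendsto_cut p).mul_const (f p)).abs).pow 3)
    (fun n => ?_) hlim
  · refine ⟨this.1, ?_⟩
    have h0 : 0 ≤ ∫ p, |f p| ^ 3 := integral_nonneg fun _ => by positivity
    have := pow_le_pow_left₀ h0 this.2 4
    have hm := mass_nonneg f
    have hd := dmass_nonneg f
    rwa [← rpow_natCast _ 4, ← rpow_natCast _ 4, ← rpow_mul (by positivity),
      show (1 : ℝ) / 4 * ((4 : ℕ) : ℝ) = 1 by norm_num, rpow_one, rpow_natCast] at this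
  · have hn := h _ (SobH.cut_mul hf.smooth n).smooth
      (hasCompactSupport_cut (by positivity)).mul_right
    have h0 : 0 ≤ ∫ p, |cut ((n : ℝ) + 1) p * f p| ^ 3 := integral_nonneg fun _ => by positivity
    calc _ = ((∫ p, |cut ((n : ℝ) + 1) p * f p| ^ 3) ^ 4) ^ ((1 : ℝ) / 4) := by
          rw [← rpow_natCast, ← rpow_mul h0]; norm_num
      _ ≤ _ := rpow_le_rpow (by positivity) hn (by norm_num)

/-- Radial profiles of ground states, extended to even functions on the line. -/
structure Prof (f : ℝ → ℝ) : Prop where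
  smooth : ContDiff ℝ ∞ f
  even : ∀ x, f (-x) = f x
  pos : ∀ x, 0 < f x
  ode : ∀ x, x * deriv (deriv f) x + 2 * deriv f x = x * (f x - f x ^ 2)
  lim : Tendsto f atTop (𝓝 0)

namespace Prof

variable {f : ℝ → ℝ}
variable (hf : Prof f)
include hf

lemma hasDerivAt (x : ℝ) : HasDerivAt f (deriv f x) x :=
  (hf.smooth.differentiable (by simp) x).hasDerivAt

lemma contDiff_deriv : ContDiff ℝ ∞ (deriv f) :=
  ((contDiff_infty_iff_deriv (𝕜 := ℝ)).1 hf.smooth).2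

lemma hasDerivAt_deriv (x : ℝ) : HasDerivAt (deriv f) (deriv (deriv f) x) x :=
  (hf.contDiff_deriv.differentiable (by simp) x).hasDerivAt

lemma contDiff_deriv2 : ContDiff ℝ ∞ (deriv (deriv f)) :=
  ((contDiff_infty_iff_deriv (𝕜 := ℝ)).1 hf.contDiff_deriv).2

lemma continuous : Continuous f := hf.smooth.continuous

end Prof

/-- The function `r f(r)`. -/
def prw (f : ℝ → ℝ) (x : ℝ) : ℝ := x * f x

/-- The derivative of `r f(r)`. -/
def prw' (f : ℝ → ℝ) (x : ℝ) : ℝ := f x + x * deriv f x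

namespace Prof

variable {f : ℝ → ℝ}
variable (hf : Prof f)
include hf

lemma hasDerivAt_w (x : ℝ) : HasDerivAt (prw f) (prw' f x) x := by
  have := (hasDerivAt_id x).mul (hf.hasDerivAt x)
  exact this.congr_deriv (by simp [prw'])

lemma hasDerivAt_w' (x : ℝ) :
    HasDerivAt (prw' f) (prw f x - prw f x * f x) x := by
  have := (hf.hasDerivAt x).add ((hasDerivAt_id x).mul (hf.hasDerivAt_deriv x))
  have e : deriv f x + (1 * deriv f x + id x * deriv (deriv f) x)
      = prw f x - prw f x * f x := by
    have := hf.ode x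
    simp only [id, prw]; linarith
  rw [e] at this
  exact this

lemma deriv_zero : deriv f 0 = 0 := by
  have := hf.ode 0; simpa using this

lemma w_pos (hx : 0 < x) : 0 < prw f x := mul_pos hx (hf.pos x)

lemma continuous_w : Continuous (prw f) :=
  continuous_iff_continuousAt.2 fun x => (hf.hasDerivAt_w x).continuousAt

lemma continuous_w' : Continuous (prw' f) :=
  continuous_iff_continuousAt.2 fun x => (hf.hasDerivAt_w' x).continuousAt

end Prof

/-- If `g' ≥ c` on `[a, ∞)` then `g` grows at least linearly. -/
lemma le_of_hasDerivAt_ge {g g' : ℝ → ℝ} (hg : ∀ x ≥ a, HasDerivAt g (g' x) x)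
    (hc : ∀ x ≥ a, c ≤ g' x) (hx : a ≤ x) : g a + c * (x - a) ≤ g x := by
  have hm : MonotoneOn (fun x => g x - c * x) (Ici a) := by
    apply monotoneOn_of_hasDerivWithinAt_nonneg (f' := fun x => g' x - c) (convex_Ici a)
    · exact fun x hx => ((hg x hx).sub ((hasDerivAt_id x).const_mul c)).continuousAt
        |>.continuousWithinAt
    · intro x hx
      rw [interior_Ici] at hx
      exact (((hg x (le_of_lt hx)).sub ((hasDerivAt_id x).const_mul c)).congr_deriv
        (by simp)).hasDerivWithinAt
    · intro x hx
      rw [interior_Ici] at hx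
      simpa using hc x (le_of_lt hx)
  have := hm (mem_Ici.2 le_rfl) (mem_Ici.2 hx) hx
  simp only at this
  linarith

lemma monotoneOn_Ici_of_hasDerivAt {g g' : ℝ → ℝ} (hg : ∀ x ≥ a, HasDerivAt g (g' x) x) (hc : ∀ x > a, 0 ≤ g' x) :
    MonotoneOn g (Ici a) := by
  apply monotoneOn_of_hasDerivWithinAt_nonneg (f' := g') (convex_Ici a)
  · exact fun x hx => (hg x hx).continuousAt.continuousWithinAt
  · intro x hx
    rw [interior_Ici] at hx
    exact (hg x (le_of_lt hx)).hasDerivWithinAt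
  simp_all

lemma antitoneOn_Ici_of_hasDerivAt {g g' : ℝ → ℝ} (hg : ∀ x ≥ a, HasDerivAt g (g' x) x) (hc : ∀ x > a, g' x ≤ 0) :
    AntitoneOn g (Ici a) := by
  have := monotoneOn_Ici_of_hasDerivAt (g := fun x => - g x) (g' := fun x => - g' x)
    (fun x hx => (hg x hx).neg) (fun x hx => by simpa using hc x hx)
  intro x hx y hy hxy
  have := this hx hy hxy
  simp only at this
  linarith

lemma strictMonoOn_Icc_of_hasDerivAt {g g' : ℝ → ℝ} (hg : ∀ x ∈ Icc a b, ContinuousAt g x)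
    (hd : ∀ x ∈ Ioo a b, HasDerivAt g (g' x) x) (hc : ∀ x ∈ Ioo a b, 0 < g' x) :
    StrictMonoOn g (Icc a b) := by
  apply strictMonoOn_of_deriv_pos (convex_Icc a b)
  · exact fun x hx => (hg x hx).continuousWithinAt
  · intro x hx
    rw [interior_Icc] at hx
    rw [(hd x hx).deriv]; exact hc x hx

lemma strictAntiOn_Icc_of_hasDerivAt {g g' : ℝ → ℝ} (hg : ∀ x ∈ Icc a b, ContinuousAt g x)
    (hd : ∀ x ∈ Ioo a b, HasDerivAt g (g' x) x) (hc : ∀ x ∈ Ioo a b, g' x < 0) :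
    StrictAntiOn g (Icc a b) := by
  apply strictAntiOn_of_deriv_neg (convex_Icc a b)
  · exact fun x hx => (hg x hx).continuousWithinAt
  · intro x hx
    rw [interior_Icc] at hx
    rw [(hd x hx).deriv]; exact hc x hx

/-- A function that starts negative and can only cross zero downwards stays negative. -/
lemma neg_of_deriv_neg_at_zeros {g g' : ℝ → ℝ} (hg : ∀ x > a, HasDerivAt g (g' x) x) (hstart : ∃ ε > 0, ∀ x, a < x → x < a + ε → g x < 0)
    (hz : ∀ x > a, g x = 0 → g' x < 0) : ∀ x > a, g x < 0 := by
  by_contra! hcon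
  obtain ⟨b, hb, hgb⟩ := hcon
  obtain ⟨ε, hε, hst⟩ := hstart
  set S : Set ℝ := {x | x ∈ Icc (a + ε / 2) b ∧ 0 ≤ g x} with hS
  have hbε : a + ε ≤ b := by
    grind
  have hne : S.Nonempty := ⟨b, ⟨by linarith, le_rfl⟩, hgb⟩
  have hbdd : BddBelow S := ⟨a + ε / 2, fun x hx => hx.1.1⟩
  have hclosed : IsClosed S := by
    have hc : ContinuousOn g (Icc (a + ε / 2) b) := fun x hx =>
      (hg x (by linarith [hx.1])).continuousAt.continuousWithinAt
    exact (hc.preimage_isClosed_of_isClosed isClosed_Icc isClosed_Ici : IsClosed _)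
  set c := sInf S with hc
  have hcS : c ∈ S := hclosed.csInf_mem hne hbdd
  have hca : a + ε ≤ c := by
    grind
  have hlt : ∀ x, a + ε / 2 ≤ x → x < c → g x < 0 := by
    intro x hx hxc
    by_contra! h
    have : x ∈ S := ⟨⟨hx, by linarith [hcS.1.2]⟩, h⟩
    linarith [csInf_le hbdd this]
  have hgc : g c = 0 := by
    refine le_antisymm ?_ hcS.2
    have hcont := (hg c (by linarith)).continuousAt
    refine le_of_tendsto (hcont.tendsto.mono_left (nhdsWithin_le_nhds (s := Iio c))) ?_
    have : Ioo (a + ε / 2) c ∈ 𝓝[<] c := Ioo_mem_nhdsLT (by linarith)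
    filter_upwards [this] with x hx
    exact (hlt x hx.1.le hx.2).le
  have hd := hz c (by linarith) hgc
  have hslope := (hasDerivAt_iff_tendsto_slope_left_right.1 (hg c (by linarith))).1
  have : 0 ≤ g' c := by
    refine ge_of_tendsto hslope ?_
    have : Ioo (a + ε / 2) c ∈ 𝓝[<] c := Ioo_mem_nhdsLT (by linarith)
    filter_upwards [this] with x hx
    rw [slope_def_field, hgc]
    exact div_nonneg_of_nonpos (by linarith [hlt x hx.1.le hx.2]) (by linarith [hx.2])
  linarith

namespace Prof

variable {f : ℝ → ℝ}
variable (hf : Prof f)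
include hf

lemma exists_le_half : ∃ r₀ > 0, ∀ x ≥ r₀, f x ≤ 1 / 2 := by
  have := (hf.lim.eventually (gt_mem_nhds (show (0 : ℝ) < 1 / 2 by norm_num)))
  obtain ⟨r, hr⟩ := eventually_atTop.1 this
  exact ⟨max r 1, by positivity, fun x hx => (hr x (le_trans (le_max_left _ _) hx)).le⟩

lemma w'_nonpos (h0 : 0 < r₀) (hr : ∀ x ≥ r₀, f x ≤ 1 / 2) :
    ∀ x ≥ r₀, prw' f x ≤ 0 := by
  by_contra! hcon
  obtain ⟨a, ha, hpos⟩ := hcon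
  have hw' : ∀ x ≥ a, 0 ≤ prw f x - prw f x * f x := fun x hx => by
    have := hf.w_pos (x := x) (by linarith)
    have := hr x (by linarith)
    nlinarith
  have h1 : ∀ x ≥ a, 0 ≤ prw' f x := fun x hx => by
    linarith [le_of_hasDerivAt_ge (fun x _ => hf.hasDerivAt_w' x) hw' hx]
  have hwa := hf.w_pos (x := a) (by linarith)
  have h2 : ∀ x ≥ a, prw f a ≤ prw f x := fun x hx => by
    linarith [le_of_hasDerivAt_ge (fun x _ => hf.hasDerivAt_w x) h1 hx]
  set c := prw f a / 2 with hc
  have hc0 : 0 < c := by positivity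
  have h3 : ∀ x ≥ a, prw' f a + c * (x - a) ≤ prw' f x := fun x hx => by
    refine le_of_hasDerivAt_ge (fun x _ => hf.hasDerivAt_w' x) (fun y hy => ?_) hx
    have := h2 y hy
    have := hr y (by linarith)
    have := hf.w_pos (x := y) (by linarith)
    nlinarith
  have h4 : ∀ x ≥ a + 1, c ≤ prw' f x := fun x hx => by
    have := h3 x (by linarith)
    nlinarith
  have h5 : ∀ x ≥ a + 1, c * (x - (a + 1)) ≤ prw f x := fun x hx => by
    have := le_of_hasDerivAt_ge (fun x _ => hf.hasDerivAt_w x) h4 hx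
    grind
  have h6 : ∀ᶠ x in atTop, c / 2 ≤ f x := by
    filter_upwards [eventually_ge_atTop (2 * (a + 1))] with x hx
    have := h5 x (by linarith)
    have hx0 : 0 < x := by linarith
    unfold prw at this
    by_contra! hlt
    have : x * f x < x * (c / 2) := by gcongr
    nlinarith
  linarith [ge_of_tendsto hf.lim h6]

lemma w'_le_neg_half (h0 : 0 < r₀) (hr : ∀ x ≥ r₀, f x ≤ 1 / 2) :
    ∀ x ≥ r₀, prw' f x ≤ - prw f x / 2 := by
  have hneg := hf.w'_nonpos h0 hr
  by_contra! hcon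
  obtain ⟨a, ha, hpos⟩ := hcon
  set z := fun x => prw' f x + prw f x / 2 with hz
  have hdz : ∀ x, HasDerivAt z (prw f x - prw f x * f x + prw' f x / 2) x := fun x =>
    (hf.hasDerivAt_w' x).add ((hf.hasDerivAt_w x).div_const 2)
  have hz1 : ∀ x ≥ a, 0 ≤ (prw f x - prw f x * f x + prw' f x / 2) - z x / 2 := fun x hx => by
    have := hf.w_pos (x := x) (by linarith)
    have := hr x (by linarith)
    simp only [hz]
    nlinarith
  have hmono : MonotoneOn (fun x => z x * rexp (- x / 2)) (Ici a) := by
    have hd : ∀ x ≥ a, HasDerivAt (fun x => z x * rexp (- x / 2))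
        (((prw f x - prw f x * f x + prw' f x / 2) - z x / 2) * rexp (- x / 2)) x := by
      intro x _
      have h1 : HasDerivAt (fun x : ℝ => rexp (- x / 2)) (rexp (- x / 2) * (-1 / 2)) x :=
        (((hasDerivAt_id x).neg).div_const 2).exp
      exact ((hdz x).mul h1).congr_deriv (by ring)
    exact monotoneOn_Ici_of_hasDerivAt hd fun x hx =>
      mul_nonneg (hz1 x (le_of_lt hx)) (exp_pos _).le
  have hza : 0 < z a := by simp only [hz]; linarith
  have hzpos : ∀ x ≥ a, 0 < z x := fun x hx => by
    have := hmono (mem_Ici.2 le_rfl) (mem_Ici.2 hx) hx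
    simp only at this
    have h1 : 0 < z a * rexp (-a / 2) := by positivity
    exact pos_of_mul_pos_left (lt_of_lt_of_le h1 this) (exp_pos _).le
  have hzge : ∀ x ≥ a, z a ≤ z x := fun x hx => by
    have := le_of_hasDerivAt_ge (g := z) (c := 0) (fun x _ => hdz x)
      (fun y hy => by linarith [hz1 y hy, hzpos y hy]) hx
    linarith
  have hw : ∀ x ≥ a, 2 * z a ≤ prw f x := fun x hx => by
    grind
  have := le_of_hasDerivAt_ge (g := prw' f) (c := z a) (fun x _ => hf.hasDerivAt_w' x)
    (fun y (hy : y ≥ a) => by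
      have := hw y hy
      have := hr y (by linarith)
      nlinarith) (x := a + (|prw' f a| + 1) / z a) (by
        bound)
  have h2 := hneg (a + (|prw' f a| + 1) / z a) (by
    have : 0 ≤ (|prw' f a| + 1) / z a := by positivity
    linarith)
  rw [add_sub_cancel_left, mul_div_cancel₀ _ hza.ne'] at this
  linarith [neg_abs_le (prw' f a)]

/-- Exponential decay of the profile. -/
lemma exists_decay : ∃ C > 0, ∀ x ≥ 0,
    prw f x ≤ C * rexp (- x / 2) ∧ |prw' f x| ≤ C * rexp (- x / 2) := by
  obtain ⟨r₀, h0, hr⟩ := hf.exists_le_half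
  have hneg := hf.w'_nonpos h0 hr
  have hhalf := hf.w'_le_neg_half h0 hr
  have hanti : AntitoneOn (fun x => prw f x * rexp (x / 2)) (Ici r₀) := by
    refine antitoneOn_Ici_of_hasDerivAt
      (g' := fun x => (prw' f x + prw f x / 2) * rexp (x / 2)) (fun x _ => ?_) fun x hx => ?_
    · have h1 : HasDerivAt (fun x : ℝ => rexp (x / 2)) (rexp (x / 2) * (1 / 2)) x :=
        ((hasDerivAt_id x).div_const 2).exp
      exact ((hf.hasDerivAt_w x).mul h1).congr_deriv (by ring)
    · exact mul_nonpos_of_nonpos_of_nonneg (by linarith [hhalf x (le_of_lt hx)]) (exp_pos _).le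
  set C₁ := prw f r₀ * rexp (r₀ / 2) with hC₁
  have hw1 : ∀ x ≥ r₀, prw f x ≤ C₁ * rexp (- x / 2) := fun x hx => by
    have := hanti (mem_Ici.2 le_rfl) (mem_Ici.2 hx) hx
    simp only at this
    have e : prw f x = prw f x * rexp (x / 2) * rexp (- x / 2) := by
      rw [mul_assoc, ← exp_add]; simp [neg_div]
    rw [e]
    gcongr
  have hmono : MonotoneOn (prw' f) (Ici r₀) :=
    monotoneOn_Ici_of_hasDerivAt (fun x _ => hf.hasDerivAt_w' x) fun x hx => by
      have := hf.w_pos (x := x) (by linarith)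
      have := hr x (le_of_lt hx)
      nlinarith
  have hw2 : ∀ x ≥ r₀ + 1, |prw' f x| ≤ C₁ * rexp (1 / 2) * rexp (- x / 2) := fun x hx => by
    have h1 : - prw' f x ≤ prw f (x - 1) := by
      have hD : ∀ y ∈ Icc (x - 1) x, HasDerivAt (fun y => prw f y - prw' f x * y)
          (prw' f y - prw' f x) y := fun y _ => by
        exact ((hf.hasDerivAt_w y).sub ((hasDerivAt_id y).const_mul (prw' f x))).congr_deriv
          (by simp)
      have hA : AntitoneOn (fun y => prw f y - prw' f x * y) (Icc (x - 1) x) := by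
        apply antitoneOn_of_deriv_nonpos (convex_Icc _ _)
        · exact fun y hy => (hD y hy).continuousAt.continuousWithinAt
        · exact fun y hy => (hD y (interior_subset hy)).differentiableAt.differentiableWithinAt
        · intro y hy
          have hy' := interior_subset hy
          rw [(hD y hy').deriv]
          linarith [hmono (mem_Ici.2 (by linarith [hy'.1])) (mem_Ici.2 (by linarith)) hy'.2]
      have := hA (left_mem_Icc.2 (by linarith)) (right_mem_Icc.2 (by linarith))
        (by linarith)
      simp only at this
      linarith [hf.w_pos (x := x) (by linarith)]
    rw [abs_of_nonpos (hneg x (by linarith)), mul_assoc, ← exp_add]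
    grind
  have hcont : ContinuousOn (fun x => prw f x * rexp (x / 2) + |prw' f x| * rexp (x / 2))
      (Icc 0 (r₀ + 1)) := by
    have := hf.continuous_w
    have := hf.continuous_w'
    fun_prop
  obtain ⟨K, hK⟩ := isCompact_Icc.bddAbove_image hcont
  have hC₁0 : 0 < C₁ := mul_pos (hf.w_pos h0) (exp_pos _)
  have he1 : 1 ≤ rexp (1 / 2) := by simp
  refine ⟨C₁ * rexp (1 / 2) + |K|, by positivity, fun x hx => ?_⟩
  rcases le_or_gt x (r₀ + 1) with h | h
  · have := hK ⟨x, ⟨hx, h⟩, rfl⟩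
    simp only at this
    have hwn : 0 ≤ prw f x := mul_nonneg hx (hf.pos x).le
    have h1 : prw f x * rexp (x / 2) ≤ |K| := by
      have : 0 ≤ |prw' f x| * rexp (x / 2) := by positivity
      linarith [le_abs_self K]
    have h2 : |prw' f x| * rexp (x / 2) ≤ |K| := by
      have : 0 ≤ prw f x * rexp (x / 2) := by positivity
      linarith [le_abs_self K]
    have e : rexp (- x / 2) = (rexp (x / 2))⁻¹ := by rw [← exp_neg]; congr 1; ring
    rw [e]
    have hp := exp_pos (x / 2)
    have : 0 < C₁ * rexp (1 / 2) := by positivity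
    constructor
    · rw [← div_eq_mul_inv, le_div_iff₀ hp]; linarith
    · rw [← div_eq_mul_inv, le_div_iff₀ hp]; linarith
  · constructor
    · refine (hw1 x (by linarith)).trans ?_
      gcongr
      nlinarith [abs_nonneg K]
    · refine (hw2 x h.le).trans ?_
      bound

end Prof

lemma tendsto_of_sq_le {g : ℝ → ℝ} (h : ∀ x ≥ 0, g x ^ 2 ≤ C * rexp (-x)) :
    Tendsto (fun x => x * g x ^ 2) atTop (𝓝 0) ∧ Tendsto g atTop (𝓝 0) := by
  have h1 : Tendsto (fun x => x * g x ^ 2) atTop (𝓝 0) := by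
    refine squeeze_zero_norm' ?_ (by simpa using
      (tendsto_pow_mul_exp_neg_atTop_nhds_zero 1).const_mul C)
    filter_upwards [eventually_ge_atTop 0] with x hx
    rw [norm_of_nonneg (by positivity)]
    nlinarith [h x hx]
  refine ⟨h1, squeeze_zero_norm' ?_ (by simpa using h1.sqrt)⟩
  filter_upwards [eventually_ge_atTop 1] with x hx
  exact abs_le_sqrt (by nlinarith [sq_nonneg (g x)])

namespace Prof

variable {f : ℝ → ℝ}
variable (hf : Prof f)
include hf

lemma exists_decay_sq : ∃ C > 0, ∀ x ≥ 0,
    prw f x ^ 2 ≤ C * rexp (-x) ∧ prw' f x ^ 2 ≤ C * rexp (-x) := by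
  obtain ⟨C, hC, h⟩ := hf.exists_decay
  refine ⟨C ^ 2, by positivity, fun x hx => ?_⟩
  have e : C ^ 2 * rexp (-x) = (C * rexp (-x / 2)) ^ 2 := by
    rw [mul_pow, ← exp_nat_mul]; congr 2; push_cast; ring
  obtain ⟨h1, h2⟩ := h x hx
  rw [e]
  exact ⟨pow_le_pow_left₀ (mul_nonneg hx (hf.pos x).le) h1 2, sq_le_sq.2 (h2.trans (le_abs_self _))⟩

lemma tendsto_mul_deriv : Tendsto (fun x => x * deriv f x) atTop (𝓝 0) := by
  obtain ⟨C, -, h⟩ := hf.exists_decay_sq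
  have := (tendsto_of_sq_le fun x hx => (h x hx).2).2.sub hf.lim
  rw [sub_zero] at this
  exact this.congr fun x => by simp [prw']

lemma tendsto_deriv : Tendsto (deriv f) atTop (𝓝 0) := by
  have := hf.tendsto_mul_deriv.mul tendsto_inv_atTop_zero
  rw [mul_zero] at this
  refine this.congr' ?_
  filter_upwards [eventually_gt_atTop 0] with x hx
  field_simp

lemma energy_nonneg (hx : 0 ≤ x) :
    0 ≤ deriv f x ^ 2 / 2 - f x ^ 2 / 2 + f x ^ 3 / 3 := by
  set e := fun x => deriv f x ^ 2 / 2 - f x ^ 2 / 2 + f x ^ 3 / 3 with he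
  have hd : ∀ x, HasDerivAt e (deriv f x * (deriv (deriv f) x - f x + f x ^ 2)) x := fun x =>
    (((((hf.hasDerivAt_deriv x).pow 2).div_const 2).sub
      (((hf.hasDerivAt x).pow 2).div_const 2)).add
      (((hf.hasDerivAt x).pow 3).div_const 3)).congr_deriv (by simp; ring)
  have hanti : AntitoneOn e (Ici 0) := by
    refine antitoneOn_Ici_of_hasDerivAt (fun x _ => hd x) fun x hx => ?_
    have := hf.ode x
    have e1 : x * (deriv f x * (deriv (deriv f) x - f x + f x ^ 2)) = - 2 * deriv f x ^ 2 := by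
      grind
    by_contra! hlt
    have := mul_pos hx hlt
    nlinarith [sq_nonneg (deriv f x)]
  have hlim : Tendsto e atTop (𝓝 0) := by
    have := (((hf.tendsto_deriv.pow 2).div_const 2).sub ((hf.lim.pow 2).div_const 2)).add
      ((hf.lim.pow 3).div_const 3)
    simpa using this
  refine le_of_tendsto hlim ?_
  filter_upwards [eventually_ge_atTop x] with y hy
  exact hanti (mem_Ici.2 hx) (mem_Ici.2 (hx.trans hy)) hy

lemma ge_of_deriv_eq_zero (hx : 0 ≤ x) (h : deriv f x = 0) :
    3 / 2 ≤ f x := by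
  have h1 := hf.energy_nonneg hx
  have h2 := hf.pos x
  rw [h] at h1
  have : 0 ≤ f x ^ 2 * (f x - 3 / 2) := by nlinarith
  simp_all

lemma zero_ge : 3 / 2 ≤ f 0 := hf.ge_of_deriv_eq_zero le_rfl hf.deriv_zero

lemma deriv_neg : ∀ x > 0, deriv f x < 0 := by
  refine neg_of_deriv_neg_at_zeros (g' := deriv (deriv f))
    (fun x _ => hf.hasDerivAt_deriv x) ?_ ?_
  · have h1 : ∀ᶠ x in 𝓝 (0 : ℝ), 1 < f x :=
      hf.continuous.continuousAt.eventually (lt_mem_nhds (by linarith [hf.zero_ge]))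
    obtain ⟨ε, hε, h⟩ := Metric.eventually_nhds_iff.1 h1
    refine ⟨ε, hε, fun x hx hxε => ?_⟩
    have hd : ∀ x, HasDerivAt (fun x => x ^ 2 * deriv f x) (x ^ 2 * (f x - f x ^ 2)) x := fun x =>
      (((hasDerivAt_id x).pow 2).mul (hf.hasDerivAt_deriv x)).congr_deriv (by
        have := hf.ode x
        simp
        linear_combination x * this)
    have hs := strictAntiOn_Icc_of_hasDerivAt (a := 0) (b := x)
      (fun y _ => (hd y).continuousAt) (fun y _ => hd y) (fun y hy => by
        have h1 : 1 < f y := h (by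
          rw [dist_zero_right, norm_of_nonneg hy.1.le]; linarith [hy.2])
        have h2 : 0 < y ^ 2 := by have := hy.1; positivity
        have h3 : f y - f y ^ 2 < 0 := by nlinarith
        exact mul_neg_of_pos_of_neg h2 h3)
    have := hs (left_mem_Icc.2 hx.le) (right_mem_Icc.2 hx.le) hx
    simp only [ne_eq, OfNat.ofNat_ne_zero, not_false_eq_true, zero_pow, zero_mul] at this
    have hx2 : 0 < x ^ 2 := by positivity
    by_contra! hcon
    linarith [mul_nonneg hx2.le hcon]
  · intro x hx h
    have h1 := hf.ge_of_deriv_eq_zero hx.le h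
    have h2 := hf.ode x
    rw [h] at h2
    by_contra! hcon
    have h3 : x * (f x - f x ^ 2) < 0 := mul_neg_of_pos_of_neg hx (by nlinarith)
    linarith [mul_nonneg hx.le hcon]

lemma strictAntiOn : StrictAntiOn f (Ici 0) := by
  apply strictAntiOn_of_deriv_neg (convex_Ici 0) hf.continuous.continuousOn
  intro x hx
  rw [interior_Ici] at hx
  exact hf.deriv_neg x hx

lemma le_zero (hx : 0 ≤ x) : f x ≤ f 0 :=
  hf.strictAntiOn.antitoneOn (mem_Ici.2 le_rfl) (mem_Ici.2 hx) hx

lemma le_zero' (x : ℝ) : f x ≤ f 0 := by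
  rcases le_total 0 x with h | h
  · exact hf.le_zero h
  · rw [← hf.even]; exact hf.le_zero (by linarith)

/-- The function `2 - 2f - r f'`, whose unique zero is `r*`. -/
def G (f : ℝ → ℝ) (x : ℝ) : ℝ := 2 - 2 * f x - x * deriv f x

lemma hasDerivAt_G (x : ℝ) :
    HasDerivAt (G f) (- deriv f x - x * (f x - f x ^ 2)) x := by
  have := (((hf.hasDerivAt x).const_mul 2).const_sub 2).sub
    ((hasDerivAt_id x).mul (hf.hasDerivAt_deriv x))
  exact this.congr_deriv (by
    have := hf.ode x
    simp
    linarith)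

lemma G_deriv_pos (hx : 0 < x) (h : G f x = 0) :
    0 < - deriv f x - x * (f x - f x ^ 2) := by
  have h1 := hf.deriv_neg x hx
  have h2 : 1 < f x := by unfold G at h; nlinarith
  have h3 : x * (f x - f x ^ 2) < 0 := mul_neg_of_pos_of_neg hx (by nlinarith)
  linarith

lemma G_pos_of_zero (ha : 0 < a) (h : G f a = 0) :
    ∀ x > a, 0 < G f x := by
  have := neg_of_deriv_neg_at_zeros (a := a) (g := fun x => - G f x)
    (g' := fun x => - (- deriv f x - x * (f x - f x ^ 2)))
    (fun x _ => (hf.hasDerivAt_G x).neg) ?_ ?_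
  · simp_all
  · have hs := hasDerivAt_iff_tendsto_slope_left_right.1 (hf.hasDerivAt_G a) |>.2
    have := hs.eventually (lt_mem_nhds (hf.G_deriv_pos ha h))
    obtain ⟨b, hb, hb'⟩ := (mem_nhdsGT_iff_exists_Ioo_subset).1 this
    refine ⟨b - a, by simpa using hb, fun x hx hx' => ?_⟩
    have : 0 < slope (G f) a x := hb' ⟨hx, by linarith⟩
    rw [slope_def_field, h, sub_zero] at this
    simp_all
  · intro x hx h'
    linarith [hf.G_deriv_pos (x := x) (by linarith) (by linarith)]

lemma exists_rstar : ∃ r > 0, G f r = 0 ∧ (∀ x, 0 ≤ x → x < r → G f x < 0) ∧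
    ∀ x > r, 0 < G f x := by
  have hcont : Continuous (G f) :=
    continuous_iff_continuousAt.2 fun x => (hf.hasDerivAt_G x).continuousAt
  have h0 : G f 0 < 0 := by simp [G]; linarith [hf.zero_ge]
  have hlim : Tendsto (G f) atTop (𝓝 2) := by
    have := ((hf.lim.const_mul 2).const_sub 2).sub hf.tendsto_mul_deriv
    simp only [mul_zero, sub_zero] at this
    exact this
  obtain ⟨b, hb⟩ := ((hlim.eventually (lt_mem_nhds (show (0 : ℝ) < 2 by norm_num))).and
    (eventually_gt_atTop 0)).exists
  have key : ∀ b > 0, 0 < G f b → ∃ r ∈ Ioo 0 b, G f r = 0 := fun b hb hG => by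
    have := intermediate_value_Ioo hb.le (hcont.continuousOn (s := Icc 0 b))
    exact this ⟨h0, hG⟩
  obtain ⟨r, hr, hGr⟩ := key b hb.2 hb.1
  refine ⟨r, hr.1, hGr, fun x hx hxr => ?_, hf.G_pos_of_zero hr.1 hGr⟩
  rcases hx.eq_or_lt with rfl | hx
  · exact h0
  by_contra! hcon
  rcases hcon.eq_or_lt with h | h
  · exact absurd hGr (hf.G_pos_of_zero hx h.symm r hxr).ne'
  · obtain ⟨s, hs, hGs⟩ := key x hx h
    exact absurd hGr (hf.G_pos_of_zero hs.1 hGs r (hs.2.trans hxr)).ne'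

/-- The Pohozaev-type quantity. -/
def P (f : ℝ → ℝ) (x : ℝ) : ℝ :=
  prw f x * prw' f x - x * prw' f x ^ 2 + x * prw f x ^ 2 - prw f x ^ 3

lemma hasDerivAt_P (x : ℝ) : HasDerivAt (P f) (prw f x ^ 2 * G f x) x := by
  have hw := hf.hasDerivAt_w x
  have hw' := hf.hasDerivAt_w' x
  have := (((hw.mul hw').sub ((hasDerivAt_id x).mul (hw'.pow 2))).add
    ((hasDerivAt_id x).mul (hw.pow 2))).sub (hw.pow 3)
  exact this.congr_deriv (by simp [G, prw, prw']; ring)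

lemma tendsto_P : Tendsto (P f) atTop (𝓝 0) := by
  obtain ⟨C, -, h⟩ := hf.exists_decay_sq
  obtain ⟨h1, h2⟩ := tendsto_of_sq_le fun x hx => (h x hx).1
  obtain ⟨h1', h2'⟩ := tendsto_of_sq_le fun x hx => (h x hx).2
  have := (((h2.mul h2').sub h1').add h1).sub (h2.pow 3)
  simp only [mul_zero, sub_zero, add_zero, ne_eq, OfNat.ofNat_ne_zero, not_false_eq_true,
    zero_pow] at this
  exact this

lemma P_neg (hx : 0 < x) : P f x < 0 := by
  obtain ⟨r, hr, -, h1, h2⟩ := hf.exists_rstar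
  have hP0 : P f 0 = 0 := by simp [P, prw]
  rcases le_or_gt x r with h | h
  · have := strictAntiOn_Icc_of_hasDerivAt (a := 0) (b := r)
      (fun y _ => (hf.hasDerivAt_P y).continuousAt) (fun y _ => hf.hasDerivAt_P y)
      (fun y hy => by
        have := hf.w_pos hy.1
        exact mul_neg_of_pos_of_neg (by positivity) (h1 y hy.1.le hy.2))
    have := this (left_mem_Icc.2 hr.le) (mem_Icc.2 ⟨hx.le, h⟩) hx
    linarith
  · have hs := strictMonoOn_Icc_of_hasDerivAt (a := x) (b := x + 1)
      (fun y _ => (hf.hasDerivAt_P y).continuousAt) (fun y _ => hf.hasDerivAt_P y)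
      (fun y hy => by
        have := hf.w_pos (hx.trans hy.1)
        exact mul_pos (by positivity) (h2 y (h.trans hy.1)))
    have hlt := hs (left_mem_Icc.2 (by linarith)) (right_mem_Icc.2 (by linarith))
      (by linarith)
    have hm : MonotoneOn (P f) (Ici x) :=
      monotoneOn_Ici_of_hasDerivAt (fun y _ => hf.hasDerivAt_P y) fun y hy =>
        mul_nonneg (by positivity) (h2 y (h.trans hy)).le
    have : P f (x + 1) ≤ 0 := by
      refine ge_of_tendsto hf.tendsto_P ?_
      filter_upwards [eventually_ge_atTop (x + 1)] with y hy
      exact hm (mem_Ici.2 (by linarith)) (mem_Ici.2 (by linarith)) hy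
    linarith

/-- The logarithmic slope `-r f'/f`. -/
def theta (f : ℝ → ℝ) (x : ℝ) : ℝ := - (x * deriv f x) / f x

lemma hasDerivAt_theta (hx : 0 < x) :
    HasDerivAt (theta f) (- P f x / prw f x ^ 2) x := by
  have hfx := hf.pos x
  have h0 : f x ≠ 0 := hfx.ne'
  have h1 : x ≠ 0 := hx.ne'
  have := ((((hasDerivAt_id x).mul (hf.hasDerivAt_deriv x))).neg).div (hf.hasDerivAt x) h0
  refine this.congr_deriv ?_
  have := hf.ode x
  simp only [P, prw, prw', id, Pi.neg_apply, Pi.mul_apply]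
  field_simp
  grind

lemma continuous_theta : Continuous (theta f) := by
  have h1 := hf.contDiff_deriv.continuous
  have h2 := hf.continuous
  exact ((continuous_id.mul h1).neg).div h2 fun x => (hf.pos x).ne'

lemma theta_deriv_pos (hx : 0 < x) : 0 < - P f x / prw f x ^ 2 := by
  have := hf.P_neg hx
  have := hf.w_pos hx
  bound

lemma theta_strictMonoOn : StrictMonoOn (theta f) (Ici 0) := by
  apply strictMonoOn_of_deriv_pos (convex_Ici 0) hf.continuous_theta.continuousOn
  intro x hx
  rw [interior_Ici] at hx
  rw [(hf.hasDerivAt_theta hx).deriv]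
  exact hf.theta_deriv_pos hx

/-- Existence of the radius at which the two-parameter supersolution changes sign. -/
lemma exists_rstar_theta : ∃ r > 0, 0 < theta f r ∧ theta f r < 2 ∧
    (2 - theta f r) * f r = 2 := by
  obtain ⟨r, hr, hG, -, -⟩ := hf.exists_rstar
  have hp := hf.pos r
  have e : (2 - theta f r) * f r = 2 := by
    unfold theta; unfold G at hG; field_simp; linarith
  refine ⟨r, hr, ?_, ?_, e⟩
  · have := hf.theta_strictMonoOn (mem_Ici.2 le_rfl) (mem_Ici.2 hr.le) hr
    simpa [theta] using this
  · by_contra! h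
    nlinarith

/-- Quantitative comparison of `f` and `theta f` around `r*`. -/
lemma exists_ratio_bound (hr : 0 < r) (R : ℝ) : ∃ c > 0, ∀ x, 0 ≤ x → x ≤ R →
    c * (theta f x - theta f r) ^ 2 ≤ (f r - f x) * (theta f x - theta f r) := by
  have hA : 0 < f (r / 2) - f r := by
    have := hf.strictAntiOn (mem_Ici.2 (by linarith)) (mem_Ici.2 hr.le)
      (show r / 2 < r by linarith)
    linarith
  have hθ0 : theta f 0 = 0 := by simp [theta]
  have hθr : 0 < theta f r := by
    linarith [hf.theta_strictMonoOn (mem_Ici.2 le_rfl) (mem_Ici.2 hr.le) hr]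
  set R' := max R r with hR'
  set K := Icc (r / 2) R' with hK
  have hKc : IsCompact K := isCompact_Icc
  have hKpos : ∀ x ∈ K, 0 < x := fun x hx => by linarith [hx.1]
  have hcont : ContinuousOn (fun x => - deriv f x / (- P f x / prw f x ^ 2)) K := by
    have h1 := hf.contDiff_deriv.continuous
    have h2 := hf.continuous_w
    have h3 : Continuous (P f) :=
      continuous_iff_continuousAt.2 fun x => (hf.hasDerivAt_P x).continuousAt
    refine ContinuousOn.div (by fun_prop) (ContinuousOn.div (by fun_prop) (by fun_prop) ?_) ?_
    · intro x hx; have := hf.w_pos (hKpos x hx); positivity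
    · intro x hx; exact (hf.theta_deriv_pos (hKpos x hx)).ne'
  have hrK : r ∈ K := ⟨by linarith, le_max_right _ _⟩
  obtain ⟨x₀, hx₀, hmin⟩ := hKc.exists_isMinOn ⟨r, hrK⟩ hcont
  set m := - deriv f x₀ / (- P f x₀ / prw f x₀ ^ 2) with hm
  have hm0 : 0 < m := div_pos (by linarith [hf.deriv_neg x₀ (hKpos x₀ hx₀)])
    (hf.theta_deriv_pos (hKpos x₀ hx₀))
  have hmono : AntitoneOn (fun x => f x + m * theta f x) K := by
    apply antitoneOn_of_deriv_nonpos (convex_Icc _ _)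
    · have := hf.continuous; have := hf.continuous_theta; fun_prop
    · intro x hx
      have hxK := interior_subset hx
      exact ((hf.hasDerivAt x).add ((hf.hasDerivAt_theta (hKpos x hxK)).const_mul
        m)).differentiableAt.differentiableWithinAt
    · intro x hx
      have hxK := interior_subset hx
      have hd : HasDerivAt (fun x => f x + m * theta f x) _ x :=
        (hf.hasDerivAt x).add ((hf.hasDerivAt_theta (hKpos x hxK)).const_mul m)
      rw [hd.deriv]
      have hle := hmin hxK
      simp only [Set.mem_ofPred_eq] at hle
      rw [← hm] at hle
      rw [le_div_iff₀ (hf.theta_deriv_pos (hKpos x hxK))] at hle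
      linarith
  refine ⟨min m ((f (r / 2) - f r) / theta f r), lt_min hm0 (div_pos hA hθr), fun x hx hxR => ?_⟩
  rcases le_or_gt x (r / 2) with h | h
  · have h1 : theta f x < theta f r := hf.theta_strictMonoOn (mem_Ici.2 hx)
      (mem_Ici.2 hr.le) (by linarith)
    have h2 : 0 ≤ theta f x := by
      rw [← hθ0]
      exact hf.theta_strictMonoOn.monotoneOn (mem_Ici.2 le_rfl) (mem_Ici.2 hx) hx
    have h3 : f (r / 2) ≤ f x := hf.strictAntiOn.antitoneOn (mem_Ici.2 hx)
      (mem_Ici.2 (by linarith)) h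
    have h4 : min m ((f (r / 2) - f r) / theta f r) ≤ (f (r / 2) - f r) / theta f r :=
      min_le_right _ _
    rw [le_div_iff₀ hθr] at h4
    have h5 : 0 < min m ((f (r / 2) - f r) / theta f r) := lt_min hm0 (div_pos hA hθr)
    set c := min m ((f (r / 2) - f r) / theta f r)
    have : c * (theta f r - theta f x) ≤ f x - f r := by nlinarith
    nlinarith
  · have hxK : x ∈ K := ⟨h.le, hxR.trans (le_max_left _ _)⟩
    have hle : min m ((f (r / 2) - f r) / theta f r) ≤ m := min_le_left _ _
    refine (mul_le_mul_of_nonneg_right hle (sq_nonneg _)).trans ?_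
    rcases le_total x r with h' | h'
    · have h1 := hmono hxK hrK h'
      have h2 := hf.theta_strictMonoOn.monotoneOn (mem_Ici.2 hx) (mem_Ici.2 hr.le) h'
      simp only at h1
      nlinarith
    · have h1 := hmono hrK hxK h'
      have h2 := hf.theta_strictMonoOn.monotoneOn (mem_Ici.2 hr.le) (mem_Ici.2 hx) h'
      simp only at h1
      nlinarith

end Prof

/-- Continuous induction: a continuous function that is negative initially and cannot vanish
at the end of an interval on which it is negative stays negative. -/
lemma neg_of_inductive {g : ℝ → ℝ} (hg : Continuous g)
    (hstart : ∃ ε > 0, ∀ x, a < x → x < a + ε → g x < 0)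
    (hz : ∀ c > a, (∀ x, a < x → x < c → g x < 0) → g c ≠ 0) : ∀ x > a, g x < 0 := by
  by_contra! hcon
  obtain ⟨b, hb, hgb⟩ := hcon
  obtain ⟨ε, hε, hst⟩ := hstart
  set S : Set ℝ := {x | x ∈ Icc (a + ε / 2) b ∧ 0 ≤ g x} with hS
  have hbε : a + ε ≤ b := by
    grind
  have hne : S.Nonempty := ⟨b, ⟨by linarith, le_rfl⟩, hgb⟩
  have hbdd : BddBelow S := ⟨a + ε / 2, fun x hx => hx.1.1⟩
  have hclosed : IsClosed S := isClosed_Icc.inter (isClosed_Ici.preimage hg)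
  set c := sInf S with hc
  have hcS : c ∈ S := hclosed.csInf_mem hne hbdd
  have hlt : ∀ x, a < x → x < c → g x < 0 := by
    intro x hx hxc
    rcases lt_or_ge x (a + ε) with h | h
    · exact hst x hx h
    by_contra! h'
    have : x ∈ S := ⟨⟨by linarith, by linarith [hcS.1.2]⟩, h'⟩
    linarith [csInf_le hbdd this]
  have hca : a < c := by linarith [hcS.1.1]
  refine hz c hca hlt (le_antisymm ?_ hcS.2)
  refine le_of_tendsto (hg.continuousAt.tendsto.mono_left
    (nhdsWithin_le_nhds (s := Iio c))) ?_
  filter_upwards [Ioo_mem_nhdsLT hca] with x hx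
  exact (hlt x hx.1 hx.2).le

namespace Prof

variable {f f₁ f₂ : ℝ → ℝ}
/-- The regular factor of Yanagida's generalized Pohozaev quantity. -/
def jY (f : ℝ → ℝ) (x : ℝ) : ℝ :=
  prw' f x ^ 2 / 2 - f x * prw' f x / 5 - prw f x ^ 2 / 2 - 3 / 50 * f x ^ 2
    + prw f x ^ 2 * f x / 3

/-- Yanagida's generalized Pohozaev quantity. -/
def JY (f : ℝ → ℝ) (x : ℝ) : ℝ := x ^ (2 / 5 : ℝ) * jY f x

section
variable (hf : Prof f)
include hf

lemma continuous_jY : Continuous (jY f) := by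
  have := hf.continuous
  have := hf.continuous_w
  have := hf.continuous_w'
  unfold jY; fun_prop

lemma continuous_JY : Continuous (JY f) :=
  (continuous_id.rpow_const fun _ => Or.inr (by norm_num)).mul hf.continuous_jY

lemma hasDerivAt_JY (hx : 0 < x) :
    HasDerivAt (JY f) (2 / 5 * x ^ (2 / 5 - 1 : ℝ) * ((6 / 25 - x ^ 2) * f x ^ 2)) x := by
  have h0 := hf.hasDerivAt x
  have h1 := hf.hasDerivAt_w x
  have h2 := hf.hasDerivAt_w' x
  have hj := (((((h2.pow 2).div_const 2).sub ((h0.mul h2).div_const 5)).sub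
    ((h1.pow 2).div_const 2)).sub ((h0.pow 2).const_mul (3 / 50))).add
    (((h1.pow 2).mul h0).div_const 3)
  have := ((hasDerivAt_id x).rpow_const (p := 2 / 5) (Or.inl hx.ne')).mul hj
  refine this.congr_deriv ?_
  have e : x ^ (2 / 5 : ℝ) = x * x ^ (2 / 5 - 1 : ℝ) := by
    rw [rpow_sub_one hx.ne']; field_simp
  simp only [id, prw, prw', Pi.pow_apply, Pi.add_apply, Pi.sub_apply, Pi.mul_apply]
  rw [e]
  norm_num
  ring

lemma tendsto_JY : Tendsto (JY f) atTop (𝓝 0) := by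
  obtain ⟨C, hC, hd⟩ := hf.exists_decay_sq
  refine squeeze_zero_norm' ?_ (by simpa using
    (tendsto_pow_mul_exp_neg_atTop_nhds_zero 1).const_mul (C * 3 + C * f 0))
  filter_upwards [eventually_ge_atTop 1] with x hx
  have hx0 : 0 < x := by linarith
  obtain ⟨h2, h3⟩ := hd x hx0.le
  have hfp := hf.pos x
  have hpow : x ^ (2 / 5 : ℝ) ≤ x := by
    simpa using rpow_le_rpow_of_exponent_le hx (by norm_num : (2 / 5 : ℝ) ≤ 1)
  have hj : |jY f x| ≤ (C * 3 + C * f 0) * rexp (-x) := by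
    have a4 : f x ^ 2 ≤ prw f x ^ 2 := by gcongr; unfold prw; nlinarith
    have a5 := mul_le_mul h2 (hf.le_zero' x) hfp.le (by positivity)
    have a6 := sq_nonneg (f x + prw' f x)
    have a7 := sq_nonneg (f x - prw' f x)
    have a8 : 0 ≤ prw f x ^ 2 * f x := by positivity
    have a9 := sq_nonneg (f x)
    have b1 := sq_nonneg (prw' f x)
    unfold jY
    rw [abs_le]
    constructor <;> nlinarith
  rw [norm_eq_abs, JY, abs_mul, abs_of_pos (rpow_pos_of_pos hx0 _)]
  refine (mul_le_mul hpow hj (abs_nonneg _) hx0.le).trans (le_of_eq ?_)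
  ring_nf

omit hf in
lemma JY_zero (f : ℝ → ℝ) : JY f 0 = 0 := by
  unfold JY; simp

lemma JY_pos (hx : 0 < x) : 0 < JY f x := by
  set b : ℝ := √(6 / 25) with hb
  have hb0 : 0 < b := by positivity
  have hb2 : b ^ 2 = 6 / 25 := by rw [hb, sq_sqrt (by norm_num)]
  rcases le_or_gt x b with h | h
  · have hs := strictMonoOn_Icc_of_hasDerivAt (a := 0) (b := b)
      (fun y _ => hf.continuous_JY.continuousAt) (fun y hy => hf.hasDerivAt_JY hy.1)
      (fun y hy => by
        have h1 := hf.pos y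
        have h2 := rpow_pos_of_pos hy.1 (2 / 5 - 1 : ℝ)
        have h3 : 0 < 6 / 25 - y ^ 2 := by nlinarith [hy.1, hy.2]
        positivity)
    have := hs (left_mem_Icc.2 hb0.le) (mem_Icc.2 ⟨hx.le, h⟩) hx
    rwa [JY_zero] at this
  · have hneg : ∀ y > b, 2 / 5 * y ^ (2 / 5 - 1 : ℝ) * ((6 / 25 - y ^ 2) * f y ^ 2) < 0 := by
      intro y hy
      have h1 := hf.pos y
      have h2 := rpow_pos_of_pos (hb0.trans hy) (2 / 5 - 1 : ℝ)
      have h3 : 6 / 25 - y ^ 2 < 0 := by nlinarith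
      exact mul_neg_of_pos_of_neg (by positivity) (mul_neg_of_neg_of_pos h3 (by positivity))
    have hs := strictAntiOn_Icc_of_hasDerivAt (a := x) (b := x + 1)
      (fun y _ => hf.continuous_JY.continuousAt)
      (fun y hy => hf.hasDerivAt_JY (hx.trans hy.1)) (fun y hy => hneg y (h.trans hy.1))
    have hlt := hs (left_mem_Icc.2 (by linarith)) (right_mem_Icc.2 (by linarith))
      (by linarith)
    have hm : AntitoneOn (JY f) (Ici x) :=
      antitoneOn_Ici_of_hasDerivAt
        (fun y (hy : y ≥ x) => hf.hasDerivAt_JY (show 0 < y by linarith)) fun y hy =>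
        (hneg y (h.trans hy)).le
    have : 0 ≤ JY f (x + 1) := by
      refine le_of_tendsto hf.tendsto_JY ?_
      filter_upwards [eventually_ge_atTop (x + 1)] with y hy
      exact hm (mem_Ici.2 (by linarith)) (mem_Ici.2 (by linarith)) hy
    linarith

end

variable (h₁ : Prof f₁)
include h₁

variable (h₂ : Prof f₂)
include h₂

lemma eq_of_zero_eq (h : f₁ 0 = f₂ 0) : f₁ = f₂ := by
  set K := 2 + f₁ 0 + f₂ 0 with hK
  set z := fun x => prw f₁ x - prw f₂ x with hz
  set z' := fun x => prw' f₁ x - prw' f₂ x with hz'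
  have hdz : ∀ x, HasDerivAt z (z' x) x := fun x => (h₁.hasDerivAt_w x).sub (h₂.hasDerivAt_w x)
  have hdz' : ∀ x, HasDerivAt z' (z x * (1 - f₁ x - f₂ x)) x := fun x =>
    ((h₁.hasDerivAt_w' x).sub (h₂.hasDerivAt_w' x)).congr_deriv (by simp only [hz, prw]; ring)
  have hd : ∀ x ≥ 0, HasDerivAt (fun x => (z x ^ 2 + z' x ^ 2) * rexp (- K * x))
      ((2 * z x * z' x * (2 - f₁ x - f₂ x) - K * (z x ^ 2 + z' x ^ 2)) * rexp (- K * x)) x := by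
    intro x _
    have h1 : HasDerivAt (fun x : ℝ => rexp (- K * x)) (rexp (- K * x) * (- K * 1)) x :=
      ((hasDerivAt_id x).const_mul (- K)).exp
    exact ((((hdz x).pow 2).add ((hdz' x).pow 2)).mul h1).congr_deriv (by
      simp only [Pi.add_apply, Pi.pow_apply]
      push_cast
      ring)
  have hanti := antitoneOn_Ici_of_hasDerivAt hd (fun x hx => by
    refine mul_nonpos_of_nonpos_of_nonneg ?_ (exp_pos _).le
    have a1 := h₁.pos x
    have a2 := h₂.pos x
    have a3 := h₁.le_zero (le_of_lt hx)
    have a4 := h₂.le_zero (le_of_lt hx)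
    have hb : |2 - f₁ x - f₂ x| ≤ K := by grind
    have hK0 : 0 ≤ K := (abs_nonneg _).trans hb
    have c1 : 2 * z x * z' x * (2 - f₁ x - f₂ x) ≤ |2 * z x * z' x| * |2 - f₁ x - f₂ x| := by
      rw [← abs_mul]; exact le_abs_self _
    have c2 : |2 * z x * z' x| ≤ z x ^ 2 + z' x ^ 2 := by
      rw [abs_le]; constructor <;> nlinarith [sq_nonneg (z x + z' x), sq_nonneg (z x - z' x)]
    have c3 : |2 * z x * z' x| * |2 - f₁ x - f₂ x| ≤ (z x ^ 2 + z' x ^ 2) * K := by gcongr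
    linarith)
  have hzero : ∀ x ≥ 0, z x = 0 := fun x hx => by
    have := hanti (mem_Ici.2 le_rfl) (mem_Ici.2 hx) hx
    simp only [hz, hz', prw, prw', h] at this
    simp only [zero_mul, sub_self, ne_eq, OfNat.ofNat_ne_zero, not_false_eq_true, zero_pow,
      add_zero, mul_zero] at this
    have hp : 0 < rexp (- K * x) := exp_pos _
    have := nonpos_of_mul_nonpos_left this hp
    simp only [hz, prw]
    nlinarith [sq_nonneg (x * f₁ x - x * f₂ x),
      sq_nonneg (f₁ x + x * deriv f₁ x - (f₂ x + x * deriv f₂ x))]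
  have hpos : ∀ x > 0, f₁ x = f₂ x := fun x hx => by
    have := hzero x (le_of_lt hx)
    simp only [hz, prw, ← mul_sub] at this
    grind
  funext x
  rcases lt_trichotomy x 0 with hx | rfl | hx
  · rw [← h₁.even, ← h₂.even]; exact hpos _ (by linarith)
  · exact h
  · exact hpos x hx

lemma not_zero_lt : ¬ f₁ 0 < f₂ 0 := by
  intro h0
  set N := fun x => prw' f₂ x * prw f₁ x - prw f₂ x * prw' f₁ x with hN
  set R := fun x => f₂ x / f₁ x with hR
  set X := fun x => R x ^ 2 * JY f₁ x - JY f₂ x with hX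
  have hdN : ∀ x, HasDerivAt N (prw f₁ x * prw f₂ x * (f₁ x - f₂ x)) x := fun x =>
    (((h₂.hasDerivAt_w' x).mul (h₁.hasDerivAt_w x)).sub
      ((h₂.hasDerivAt_w x).mul (h₁.hasDerivAt_w' x))).congr_deriv (by ring)
  have hNc : Continuous N := continuous_iff_continuousAt.2 fun x => (hdN x).continuousAt
  have hdR : ∀ x > 0, HasDerivAt R (N x / prw f₁ x ^ 2) x := fun x hx =>
    ((h₂.hasDerivAt x).div (h₁.hasDerivAt x) (h₁.pos x).ne').congr_deriv (by
      have := (h₁.pos x).ne'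
      have := ne_of_gt hx
      simp only [hN, prw, prw']
      field_simp
      ring)
  have hRc : Continuous R := h₂.continuous.div h₁.continuous fun x => (h₁.pos x).ne'
  have hRpos : ∀ x, 0 < R x := fun x => div_pos (h₂.pos x) (h₁.pos x)
  have hRf : ∀ x, R x * f₁ x = f₂ x := fun x => div_mul_cancel₀ _ (h₁.pos x).ne'
  have hXc : Continuous X := ((hRc.pow 2).mul h₁.continuous_JY).sub h₂.continuous_JY
  have hdX : ∀ x > 0, HasDerivAt X (2 * R x * (N x / prw f₁ x ^ 2) * JY f₁ x) x := fun x hx =>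
    ((((hdR x hx).pow 2).mul (h₁.hasDerivAt_JY hx)).sub (h₂.hasDerivAt_JY hx)).congr_deriv (by
      simp only [Pi.pow_apply]
      grind)
  have hX0 : X 0 = 0 := by simp [hX, JY_zero]
  have hN0 : N 0 = 0 := by simp [hN, prw]
  have hXlt : ∀ c > 0, (∀ x, 0 < x → x < c → N x < 0) → StrictAntiOn X (Icc 0 c) := by
    intro c hc hneg
    refine strictAntiOn_Icc_of_hasDerivAt (fun y _ => hXc.continuousAt)
      (fun y hy => hdX y hy.1) fun y hy => ?_
    have a1 := hRpos y
    have a2 := h₁.w_pos hy.1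
    have a3 := h₁.JY_pos hy.1
    have a4 : N y / prw f₁ y ^ 2 < 0 := div_neg_of_neg_of_pos (hneg y hy.1 hy.2) (by positivity)
    have : 0 < 2 * R y := by positivity
    exact mul_neg_of_neg_of_pos (mul_neg_of_pos_of_neg this a4) a3
  have hNlt : ∀ c > 0, (∀ x, 0 < x → x < c → f₁ x < f₂ x) → N c < 0 := by
    intro c hc hlt
    have := strictAntiOn_Icc_of_hasDerivAt (a := 0) (b := c) (fun y _ => hNc.continuousAt)
      (fun y _ => hdN y) fun y hy => by
        have := mul_pos (h₁.w_pos hy.1) (h₂.w_pos hy.1)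
        exact mul_neg_of_pos_of_neg this (by linarith [hlt y hy.1 hy.2])
    have := this (left_mem_Icc.2 hc.le) (right_mem_Icc.2 hc.le) hc
    rwa [hN0] at this
  have hNneg : ∀ x > 0, N x < 0 := by
    refine neg_of_inductive hNc ?_ ?_
    · have : ∀ᶠ x in 𝓝 (0 : ℝ), f₁ x < f₂ x :=
        h₁.continuous.continuousAt.eventually_lt h₂.continuous.continuousAt h0
      obtain ⟨ε, hε, h⟩ := Metric.eventually_nhds_iff.1 this
      refine ⟨ε, hε, fun x hx hxε => hNlt x hx fun y hy hyx => h ?_⟩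
      rw [dist_zero_right, norm_of_nonneg hy.le]; linarith
    · intro c hc hneg hNc0
      have hXc' := hXlt c hc hneg (left_mem_Icc.2 (le_of_lt hc))
        (right_mem_Icc.2 (le_of_lt hc)) hc
      rw [hX0] at hXc'
      have hcp := rpow_pos_of_pos hc (2 / 5 : ℝ)
      have e1 : prw' f₂ c = R c * prw' f₁ c := by
        have a1 := h₁.w_pos hc
        have a2 : prw f₂ c = R c * prw f₁ c := by simp only [prw]; rw [← hRf c]; ring
        grind
      have e2 : X c = c ^ (2 / 5 : ℝ) * (prw f₂ c ^ 2 * (f₁ c - f₂ c) / 3) := by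
        simp only [hX, JY, jY, e1, prw]
        rw [← hRf c]
        ring
      have hlt : f₁ c < f₂ c := by
        by_contra! hcon
        have : 0 ≤ X c := by
          rw [e2]
          positivity
        linarith
      have hRanti : StrictAntiOn R (Icc 0 c) :=
        strictAntiOn_Icc_of_hasDerivAt (fun y _ => hRc.continuousAt) (fun y hy => hdR y hy.1)
          fun y hy => div_neg_of_neg_of_pos (hneg y hy.1 hy.2)
            (by have := h₁.w_pos hy.1; positivity)
      have hRc1 : 1 < R c := (one_lt_div (h₁.pos c)).2 hlt
      have := hNlt c hc fun x hx hxc => by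
        have := hRanti (mem_Icc.2 ⟨hx.le, hxc.le⟩) (right_mem_Icc.2 (le_of_lt hc)) hxc
        exact (one_lt_div (h₁.pos x)).1 (hRc1.trans this)
      exact this.ne hNc0
  have hX1 : X 1 < 0 := by
    have := hXlt 1 one_pos (fun x hx _ => hNneg x hx) (left_mem_Icc.2 zero_le_one)
      (right_mem_Icc.2 zero_le_one) one_pos
    rwa [hX0] at this
  have hRle : ∀ x ≥ 0, R x ≤ R 0 := fun x hx => by
    have hanti : StrictAntiOn R (Icc 0 x) :=
      strictAntiOn_Icc_of_hasDerivAt (fun y _ => hRc.continuousAt) (fun y hy => hdR y hy.1)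
        fun y hy => div_neg_of_neg_of_pos (hNneg y hy.1)
          (by have := h₁.w_pos hy.1; positivity)
    exact hanti.antitoneOn (left_mem_Icc.2 hx) (right_mem_Icc.2 hx) hx
  have hXlim : Tendsto X atTop (𝓝 0) := by
    have h1 : Tendsto (fun x => R x ^ 2 * JY f₁ x) atTop (𝓝 0) := by
      refine squeeze_zero_norm' (a := fun x => R 0 ^ 2 * |JY f₁ x|) ?_ ?_
      · filter_upwards [eventually_ge_atTop 0] with x hx
        have := hRle x hx
        have := (hRpos x).le
        rw [norm_eq_abs, abs_mul, abs_of_nonneg (sq_nonneg _)]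
        gcongr
      · simpa using (h₁.tendsto_JY.abs).const_mul (R 0 ^ 2)
    simpa using h1.sub h₂.tendsto_JY
  have : (0 : ℝ) ≤ X 1 := by
    refine le_of_tendsto hXlim ?_
    filter_upwards [eventually_ge_atTop 1] with x hx
    exact (hXlt x (by linarith) fun y hy _ => hNneg y hy).antitoneOn
      (mem_Icc.2 ⟨zero_le_one, hx⟩) (right_mem_Icc.2 (by linarith)) hx
  linarith

/-- Uniqueness of ground state profiles. -/
theorem unique : f₁ = f₂ :=
  eq_of_zero_eq h₁ h₂ (le_antisymm (not_lt.1 (not_zero_lt h₂ h₁)) (not_lt.1 (not_zero_lt h₁ h₂)))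

end Prof

section
variable (hF : Differentiable ℝ F)
include hF

lemma deriv_fst_eq_D (x y z : ℝ) :
    deriv (fun a => F (a, y, z)) x = D 0 F (x, y, z) := by
  have h : HasDerivAt (fun a : ℝ => ((a, y, z) : E3)) (1, 0, 0) x :=
    (hasDerivAt_id x).prodMk ((hasDerivAt_const x y).prodMk (hasDerivAt_const x z))
  exact ((hF (x, y, z)).hasFDerivAt.comp_hasDerivAt x h).deriv

lemma deriv_snd_eq_D (x y z : ℝ) :
    deriv (fun b => F (x, b, z)) y = D 1 F (x, y, z) := by
  have h : HasDerivAt (fun b : ℝ => ((x, b, z) : E3)) (0, 1, 0) y :=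
    (hasDerivAt_const y x).prodMk ((hasDerivAt_id y).prodMk (hasDerivAt_const y z))
  exact ((hF (x, y, z)).hasFDerivAt.comp_hasDerivAt y h).deriv

lemma deriv_thd_eq_D (x y z : ℝ) :
    deriv (fun c => F (x, y, c)) z = D 2 F (x, y, z) := by
  have h : HasDerivAt (fun c : ℝ => ((x, y, c) : E3)) (0, 0, 1) z :=
    (hasDerivAt_const z x).prodMk ((hasDerivAt_const z y).prodMk (hasDerivAt_id z))
  exact ((hF (x, y, z)).hasFDerivAt.comp_hasDerivAt z h).deriv

end

/-- The Laplacian on `E3`. -/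
def lap (F : E3 → ℝ) (p : E3) : ℝ := ∑ i, D i (D i F) p

lemma lap3_eq_lap (hF : ContDiff ℝ ∞ F) (x y z : ℝ) :
    lap3 (fun x y z => F (x, y, z)) x y z = lap F (x, y, z) := by
  have hd : Differentiable ℝ F := hF.differentiable (by simp)
  have hD : ∀ i, Differentiable ℝ (D i F) := fun i => (hF.D i).differentiable (by simp)
  simp only [lap3, deriv_fst_eq_D hd, deriv_snd_eq_D hd, deriv_thd_eq_D hd, deriv_fst_eq_D (hD 0),
    deriv_snd_eq_D (hD 1), deriv_thd_eq_D (hD 2), lap, Fin.sum_univ_three]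

lemma H1normSq_eq (hF : SobH F) :
    H1normSq (fun x y z => F (x, y, z)) = mass F + dmass F := by
  have hd := hF.diff
  rw [mass, dmass, ← integral_add hF.sq hF.integrable_gradSq, H1normSq]
  congr 1
  ext p
  simp only [pdx, pdy, pdz, deriv_fst_eq_D hd, deriv_snd_eq_D hd, deriv_thd_eq_D hd, gradSq,
    Fin.sum_univ_three]
  ring

/-- The Euclidean length on `E3`. -/
def rho (p : E3) : ℝ := √(p.1 ^ 2 + p.2.1 ^ 2 + p.2.2 ^ 2)

/-- A ground state on `E3` together with its radial profile. -/
structure GS (f : ℝ → ℝ) (Q : E3 → ℝ) : Prop where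
  prof : Prof f
  sob : SobH Q
  rad : ∀ p, Q p = f (rho p)
  eqn : ∀ p, lap Q p = Q p - Q p ^ 2

lemma deriv_even {f : ℝ → ℝ} (hf : Differentiable ℝ f) (he : ∀ x, f (-x) = f x) (x : ℝ) :
    deriv f (-x) = - deriv f x := by
  have h1 : HasDerivAt (fun x => f (-x)) (deriv f (-x) * (-1)) x :=
    (hf (-x)).hasDerivAt.comp x (hasDerivAt_neg x)
  rw [show (fun x => f (-x)) = f from funext he] at h1
  linarith [h1.deriv]

lemma deriv_odd {f : ℝ → ℝ} (hf : Differentiable ℝ f) (he : ∀ x, f (-x) = - f x) (x : ℝ) :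
    deriv f (-x) = deriv f x := by
  have h1 : HasDerivAt (fun x => f (-x)) (deriv f (-x) * (-1)) x :=
    (hf (-x)).hasDerivAt.comp x (hasDerivAt_neg x)
  rw [show (fun x => f (-x)) = fun x => - f x from funext he] at h1
  linarith [h1.unique (hf x).hasDerivAt.neg]

lemma hasDerivAt_sqrt_sq_add (hx : x ≠ 0) (b : ℝ) :
    HasDerivAt (fun b => √(x ^ 2 + b ^ 2)) (b / √(x ^ 2 + b ^ 2)) b := by
  have h0 : 0 < x ^ 2 + b ^ 2 := by positivity
  have h1 : HasDerivAt (fun b => x ^ 2 + b ^ 2) (2 * b) b := by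
    simpa using ((hasDerivAt_id b).pow 2).const_add (x ^ 2)
  have := h1.sqrt h0.ne'
  grind

/-- The transversal second derivative of a radial function on an axis. -/
lemma deriv_deriv_radial {f : ℝ → ℝ} (hf : ContDiff ℝ ∞ f) (hx : 0 < x) :
    deriv (fun b => deriv (fun b' => f (√(x ^ 2 + b' ^ 2))) b) 0 = deriv f x / x := by
  have hd : Differentiable ℝ f := hf.differentiable (by simp)
  have hd' : Differentiable ℝ (deriv f) :=
    ((contDiff_infty_iff_deriv (𝕜 := ℝ)).1 hf).2.differentiable (by simp)
  have h1 : ∀ b, deriv (fun b' => f (√(x ^ 2 + b' ^ 2))) b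
      = b * (deriv f (√(x ^ 2 + b ^ 2)) / √(x ^ 2 + b ^ 2)) := fun b => by
    have := (hd (√(x ^ 2 + b ^ 2))).hasDerivAt.comp b (hasDerivAt_sqrt_sq_add hx.ne' b)
    exact this.deriv.trans (by ring)
  simp_rw [h1]
  have e : √(x ^ 2 + 0 ^ 2) = x := by simp [sqrt_sq hx.le]
  have h2 : DifferentiableAt ℝ (fun b => deriv f (√(x ^ 2 + b ^ 2)) / √(x ^ 2 + b ^ 2)) 0 := by
    have hs := (hasDerivAt_sqrt_sq_add hx.ne' 0).differentiableAt
    exact ((hd' _).comp (0 : ℝ) hs).div hs (by rw [e]; exact hx.ne')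
  simp_all

theorem _root_.IsGroundState.gs {Q : ℝ → ℝ → ℝ → ℝ} (hQ : IsGroundState Q) :
    GS (fun x => Q x 0 0) (fun p => Q p.1 p.2.1 p.2.2) := by
  obtain ⟨hs, hpos, ⟨q, hq⟩, hlim, hsq, hdsq, heq⟩ := hQ
  set F : E3 → ℝ := fun p => Q p.1 p.2.1 p.2.2 with hF
  have hs : ContDiff ℝ ∞ F := hs
  have hd : Differentiable ℝ F := hs.differentiable (by simp)
  set f : ℝ → ℝ := fun x => Q x 0 0 with hf
  have hfs : ContDiff ℝ ∞ f := hs.comp (contDiff_id.prodMk (contDiff_const (c := ((0, 0) : ℝ × ℝ))))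
  have hrad : ∀ x y z, Q x y z = f (√(x ^ 2 + y ^ 2 + z ^ 2)) := fun x y z => by
    simp_all
  have heven : ∀ x, f (-x) = f x := fun x => by grind
  have hfd : Differentiable ℝ f := hfs.differentiable (by simp)
  have hfd' : Differentiable ℝ (deriv f) :=
    ((contDiff_infty_iff_deriv (𝕜 := ℝ)).1 hfs).2.differentiable (by simp)
  have hodd := deriv_even hfd heven
  have heven2 := deriv_odd hfd' hodd
  have hpode : ∀ x > 0, x * deriv (deriv f) x + 2 * deriv f x = x * (f x - f x ^ 2) := by
    intro x hx
    have h1 := heq x 0 0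
    have ey : (fun b => deriv (fun b' => Q x b' 0) b)
        = fun b => deriv (fun b' => f (√(x ^ 2 + b' ^ 2))) b := by
      simp_rw [hrad x]; simp
    have ez : (fun c => deriv (fun c' => Q x 0 c') c)
        = fun c => deriv (fun c' => f (√(x ^ 2 + c' ^ 2))) c := by
      simp_rw [hrad x]; simp
    rw [lap3, ey, ez, deriv_deriv_radial hfs hx] at h1
    have ex : deriv (fun a => deriv (fun a' => Q a' 0 0) a) x = deriv (deriv f) x := rfl
    have ex' : Q x 0 0 = f x := rfl
    rw [ex, ex'] at h1
    have hx0 := ne_of_gt hx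
    grind
  refine ⟨⟨hfs, heven, fun x => hpos _ _ _, fun x => ?_, ?_⟩, ⟨hs, hsq, fun i => ?_⟩,
    fun p => hrad _ _ _, fun p => ?_⟩
  · rcases lt_trichotomy x 0 with hx | rfl | hx
    · grind
    · grind
    · exact hpode x hx
  · have h1 : Tendsto (fun x : ℝ => ((x, 0, 0) : E3)) atTop (cocompact E3) := by
      rw [← Metric.cobounded_eq_cocompact, ← tendsto_norm_atTop_iff_cobounded]
      refine tendsto_atTop_mono (fun x => ?_) tendsto_id
      calc x ≤ ‖x‖ := le_norm_self x
        _ ≤ ‖((x, 0, 0) : E3)‖ := norm_fst_le ((x, 0, 0) : E3)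
    exact hlim.comp h1
  · have hm := (((hs.D i).continuous.pow 2).aestronglyMeasurable (μ := volume))
    refine hdsq.mono' hm (.of_forall fun p => ?_)
    have e1 : pdx Q p.1 p.2.1 p.2.2 = D 0 F p := deriv_fst_eq_D hd _ _ _
    have e2 : pdy Q p.1 p.2.1 p.2.2 = D 1 F p := deriv_snd_eq_D hd _ _ _
    have e3 : pdz Q p.1 p.2.1 p.2.2 = D 2 F p := deriv_thd_eq_D hd _ _ _
    rw [e1, e2, e3, norm_of_nonneg (sq_nonneg _)]
    fin_cases i <;> simp only [Fin.zero_eta, Fin.mk_one, Fin.reduceFinMk] <;>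
      nlinarith [sq_nonneg (D 0 F p), sq_nonneg (D 1 F p), sq_nonneg (D 2 F p)]
  · linarith [heq p.1 p.2.1 p.2.2, lap3_eq_lap hs p.1 p.2.1 p.2.2]

/-- Uniqueness of the ground state. -/
theorem _root_.IsGroundState.eq {Q₁ Q₂ : ℝ → ℝ → ℝ → ℝ} (h₁ : IsGroundState Q₁)
    (h₂ : IsGroundState Q₂) : Q₁ = Q₂ := by
  have h := h₁.gs.prof.unique h₂.gs.prof
  funext x y z
  have e1 := h₁.gs.rad (x, y, z)
  have e2 := h₂.gs.rad (x, y, z)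
  simp only at e1 e2
  rw [e1, e2]
  exact congrFun h _

/-- The coordinates of a point of `E3`. -/
def co (p : E3) : Fin 3 → ℝ := ![p.1, p.2.1, p.2.2]

lemma rho_sq (p) : rho p ^ 2 = ∑ i, co p i ^ 2 := by
  unfold rho
  rw [sq_sqrt (by positivity)]
  simp [Fin.sum_univ_three, co]

lemma rho_nonneg (p) : 0 ≤ rho p := sqrt_nonneg _

lemma continuous_rho : Continuous rho := by unfold rho; fun_prop

lemma eq_sum_co (p) : p = ∑ i, co p i • ev i := by
  simp [Fin.sum_univ_three, co, ev]

lemma abs_co_le_rho (p) (i) : |co p i| ≤ rho p := by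
  refine abs_le_of_sq_le_sq ?_ (rho_nonneg p)
  rw [rho_sq]
  exact single_le_sum (f := fun i => co p i ^ 2) (fun i _ => sq_nonneg _)
    (mem_univ i)

lemma norm_le_rho (p) : ‖p‖ ≤ rho p := by
  simp only [Prod.norm_def, norm_eq_abs, max_le_iff]
  exact ⟨abs_co_le_rho p 0, abs_co_le_rho p 1, abs_co_le_rho p 2⟩

lemma fderiv_apply_eq_sum (h) (p v) :
    fderiv ℝ h p v = ∑ j, co v j * D j h p := by
  conv_lhs => rw [eq_sum_co v]
  simp [D]

/-- Linear maps preserving the Euclidean length. -/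
def Iso (L : E3 →L[ℝ] E3) : Prop := ∀ p, rho (L p) = rho p

namespace Iso

variable {L : E3 →L[ℝ] E3}
variable (hL : Iso L)
include hL

lemma orth (i j) :
    ∑ k, co (L (ev i)) k * co (L (ev j)) k = if i = j then 1 else 0 := by
  have key : ∀ p q : E3, ∑ k, co (L p) k * co (L q) k = ∑ k, co p k * co q k := fun p q => by
    have h1 : rho (L (p + q)) ^ 2 = rho (p + q) ^ 2 := by rw [hL]
    have h2 : rho (L p) ^ 2 = rho p ^ 2 := by rw [hL]
    have h3 : rho (L q) ^ 2 = rho q ^ 2 := by rw [hL]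
    rw [map_add] at h1
    simp only [rho_sq, Fin.sum_univ_three] at *
    simp only [co, Prod.fst_add, Prod.snd_add, Matrix.cons_val_zero, Matrix.cons_val_one,
      Matrix.cons_val] at *
    linarith
  rw [key]
  fin_cases i <;> fin_cases j <;> simp [co, ev, Fin.sum_univ_three]

lemma orth' (i j) :
    ∑ k, co (L (ev k)) i * co (L (ev k)) j = if i = j then 1 else 0 := by
  set M : Matrix (Fin 3) (Fin 3) ℝ := Matrix.of fun i j => co (L (ev j)) i with hM
  have h1 : M.transpose * M = 1 := by
    ext i j
    rw [Matrix.mul_apply, Matrix.one_apply, ← hL.orth i j]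
    rfl
  have h2 : M * M.transpose = 1 := mul_eq_one_comm.1 h1
  have := congrFun (congrFun h2 i) j
  bound

omit hL in
lemma D_comp (L : E3 →L[ℝ] E3) (hh : Differentiable ℝ h) (i) (p) :
    D i (fun p => h (L p)) p = ∑ j, co (L (ev i)) j * D j h (L p) := by
  unfold D
  have := ((hh (L p)).hasFDerivAt.comp p L.hasFDerivAt).fderiv
  rw [show (fun p => h (L p)) = h ∘ L from rfl, this, ContinuousLinearMap.comp_apply,
    fderiv_apply_eq_sum]
  rfl

lemma gradSq_comp (hh : Differentiable ℝ h) (p) :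
    gradSq (fun p => h (L p)) p = gradSq h (L p) := by
  simp only [gradSq, D_comp L hh]
  have h00 := hL.orth' 0 0
  have h01 := hL.orth' 0 1
  have h02 := hL.orth' 0 2
  have h11 := hL.orth' 1 1
  have h12 := hL.orth' 1 2
  have h22 := hL.orth' 2 2
  simp only [Fin.sum_univ_three, if_true, Fin.reduceEq, if_false] at *
  grind

lemma injective : Function.Injective L := by
  rw [injective_iff_map_eq_zero]
  intro p hp
  have h := hL p
  rw [hp] at h
  have h2 := norm_le_rho p
  have h3 : rho (0 : E3) = 0 := by simp [rho]
  rw [← h, h3] at h2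
  exact norm_le_zero_iff.1 h2

/-- An isometry as a continuous linear equivalence. -/
def equiv (hL : Iso L) : E3 ≃L[ℝ] E3 :=
  (LinearEquiv.ofInjectiveEndo (L : E3 →ₗ[ℝ] E3) hL.injective).toContinuousLinearEquiv

lemma equiv_apply (p) : hL.equiv p = L p := rfl

lemma abs_det : |LinearMap.det (L : E3 →ₗ[ℝ] E3)| = 1 := by
  set B : Set E3 := {p | rho p < 1} with hB
  have himg : (L : E3 →ₗ[ℝ] E3) '' B = B := by
    ext q
    constructor
    · rintro ⟨p, hp, rfl⟩
      show rho (L p) < 1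
      rw [hL]; exact hp
    · intro hq
      refine ⟨hL.equiv.symm q, ?_, ?_⟩
      · show rho _ < 1
        rw [← hL, ← hL.equiv_apply, ContinuousLinearEquiv.apply_symm_apply]; exact hq
      · exact hL.equiv.apply_symm_apply q
  have h := Measure.addHaar_image_linearMap (volume : Measure E3) (L : E3 →ₗ[ℝ] E3) B
  rw [himg] at h
  have hopen : IsOpen B := isOpen_lt continuous_rho continuous_const
  have hpos : volume B ≠ 0 := (hopen.measure_pos volume ⟨0, by simp [hB, rho]⟩).ne'
  have hfin : volume B ≠ ⊤ := by
    refine ((measure_mono (t := Metric.ball (0 : E3) 1) fun p hp => ?_).trans_lt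
      measure_ball_lt_top).ne
    rw [mem_ball_zero_iff]
    exact (norm_le_rho p).trans_lt hp
  have h2 : ofReal |LinearMap.det (L : E3 →ₗ[ℝ] E3)| = 1 := by
    have h3 : 1 * volume B = ofReal |LinearMap.det (L : E3 →ₗ[ℝ] E3)| * volume B := by
      rw [one_mul]; exact h
    exact ((ENNReal.mul_left_inj hpos hfin).1 h3).symm
  simp_all

lemma measurePreserving : MeasurePreserving hL.equiv (volume : Measure E3) volume := by
  refine ⟨hL.equiv.continuous.measurable, ?_⟩
  have hdet : LinearMap.det (L : E3 →ₗ[ℝ] E3) ≠ 0 := by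
    intro h0
    have := hL.abs_det
    rw [h0] at this
    simp at this
  have := Measure.map_linearMap_addHaar_eq_smul_addHaar (volume : Measure E3) hdet
  have e : Measure.map (⇑hL.equiv) (volume : Measure E3) = Measure.map (L : E3 →ₗ[ℝ] E3) volume :=
    rfl
  rw [e, this, abs_inv, hL.abs_det]
  simp

lemma integral_comp (F : E3 → ℝ) : ∫ p, F (L p) = ∫ p, F p :=
  hL.measurePreserving.integral_comp hL.equiv.toHomeomorph.measurableEmbedding F

lemma integrable_comp (hF : Integrable F) :
    Integrable (fun p => F (L p)) :=
  (hL.measurePreserving.integrable_comp_emb hL.equiv.toHomeomorph.measurableEmbedding).2 hF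

lemma hasCompactSupport_comp (hh : HasCompactSupport h) :
    HasCompactSupport (fun p => h (L p)) :=
  hh.comp_homeomorph hL.equiv.toHomeomorph

lemma comp {L' : E3 →L[ℝ] E3} (hL' : Iso L') : Iso (L.comp L') := fun p => by
  rw [ContinuousLinearMap.comp_apply, hL, hL']

end Iso

/-- Smooth compactly supported functions. -/
structure Test (h : E3 → ℝ) : Prop where
  smooth : ContDiff ℝ ∞ h
  cpt : HasCompactSupport h

namespace Test

variable {L : E3 →L[ℝ] E3}
variable (hh : Test h)
include hh

lemma sob : SobH h := SobH.of_compact hh.smooth hh.cpt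

lemma diff : Differentiable ℝ h := hh.sob.diff

lemma add (hk : Test k) : Test (fun p => h p + k p) :=
  ⟨hh.smooth.add hk.smooth, hh.cpt.add hk.cpt⟩

omit hh in
lemma const_mul (c : ℝ) (hh : Test h) : Test (fun p => c * h p) :=
  ⟨contDiff_const.mul hh.smooth, hh.cpt.mul_left⟩

lemma sub (hk : Test k) : Test (fun p => h p - k p) := by
  have := hh.add (hk.const_mul (-1))
  grind

lemma comp (hL : Iso L) : Test (fun p => h (L p)) :=
  ⟨hh.smooth.comp L.contDiff, hL.hasCompactSupport_comp hh.cpt⟩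

end Test

/-- The quadratic form of the linearized operator `-Δ + 1 - 2Q`. -/
def form (Q h : E3 → ℝ) : ℝ := ∫ p, (gradSq h p + (1 - 2 * Q p) * h p ^ 2)

namespace GS

variable {f : ℝ → ℝ} {L : E3 →L[ℝ] E3}
variable (hQ : GS f Q)
include hQ

lemma pos (p) : 0 < Q p := by rw [hQ.rad]; exact hQ.prof.pos _

lemma le (p) : Q p ≤ f 0 := by rw [hQ.rad]; exact hQ.prof.le_zero' _

lemma f0_pos : 0 < f 0 := hQ.prof.pos 0

lemma continuous : Continuous Q := hQ.sob.smooth.continuous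

lemma comp_iso (hL : Iso L) (p) : Q (L p) = Q p := by
  rw [hQ.rad, hQ.rad, hL]

/-- Multiplication by a bounded continuous function built from `Q` preserves integrability. -/
lemma integrable_mul (hF : Integrable F) :
    Integrable (fun p => Q p * F p) :=
  hF.bdd_mul (c := f 0) hQ.continuous.aestronglyMeasurable (.of_forall fun p => by
    rw [norm_of_nonneg (hQ.pos p).le]; exact hQ.le p)

lemma integrable_pot (hF : Integrable F) :
    Integrable (fun p => (1 - 2 * Q p) * F p) := by
  have := hF.sub ((hQ.integrable_mul hF).const_mul 2)
  exact this.congr (.of_forall fun p => by simp only [Pi.sub_apply]; ring)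

lemma integrable_form (hh : SobH h) :
    Integrable (fun p => gradSq h p + (1 - 2 * Q p) * h p ^ 2) :=
  hh.integrable_gradSq.add (hQ.integrable_pot hh.sq)

lemma form_eq (hh : SobH h) :
    form Q h = dmass h + mass h - 2 * ∫ p, Q p * h p ^ 2 := by
  have h2 := hQ.integrable_mul hh.sq
  have h3 : Integrable (fun p => gradSq h p + h p ^ 2) := hh.integrable_gradSq.add hh.sq
  rw [dmass, mass, ← integral_const_mul, ← integral_add hh.integrable_gradSq hh.sq,
    ← integral_sub h3 (h2.const_mul 2), form]
  congr 1
  ext p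
  ring

lemma form_comp (hL : Iso L) (hh : Differentiable ℝ h) :
    form Q (fun p => h (L p)) = form Q h := by
  unfold form
  rw [← hL.integral_comp (fun p => gradSq h p + (1 - 2 * Q p) * h p ^ 2)]
  congr 1
  ext p
  rw [hL.gradSq_comp hh, hQ.comp_iso hL]

lemma form_parallelogram (hh : SobH h) (hk : SobH k) :
    form Q (fun p => h p + k p) + form Q (fun p => h p - k p) = 2 * form Q h + 2 * form Q k := by
  have i1 := hQ.integrable_form (hh.add hk)
  have i2 := hQ.integrable_form (hh.sub hk)
  have i3 := hQ.integrable_form hh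
  have i4 := hQ.integrable_form hk
  unfold form
  rw [← integral_add i1 i2, ← integral_const_mul, ← integral_const_mul,
    ← integral_add (i3.const_mul 2) (i4.const_mul 2)]
  congr 1
  ext p
  simp only [gradSq, D_add (hh.diff p) (hk.diff p), D_sub (hh.diff p) (hk.diff p),
    Fin.sum_univ_three]
  ring

end GS

lemma mass_comp {L : E3 →L[ℝ] E3} (hL : Iso L) (h) :
    mass (fun p => h (L p)) = mass h := hL.integral_comp fun p => h p ^ 2

lemma mass_parallelogram (hh : SobH h) (hk : SobH k) :
    mass (fun p => h p + k p) + mass (fun p => h p - k p) = 2 * mass h + 2 * mass k := by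
  unfold mass
  rw [← integral_add (hh.add hk).sq (hh.sub hk).sq, ← integral_const_mul, ← integral_const_mul,
    ← integral_add (hh.sq.const_mul 2) (hk.sq.const_mul 2)]
  congr 1
  ext p
  ring

lemma dmass_parallelogram (hh : SobH h) (hk : SobH k) :
    dmass (fun p => h p + k p) + dmass (fun p => h p - k p) = 2 * dmass h + 2 * dmass k := by
  unfold dmass
  rw [← integral_add (hh.add hk).integrable_gradSq (hh.sub hk).integrable_gradSq,
    ← integral_const_mul, ← integral_const_mul,
    ← integral_add (hh.integrable_gradSq.const_mul 2) (hk.integrable_gradSq.const_mul 2)]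
  congr 1
  ext p
  simp only [gradSq, D_add (hh.diff p) (hk.diff p), D_sub (hh.diff p) (hk.diff p),
    Fin.sum_univ_three]
  ring

section
variable (hF : ContDiff ℝ ∞ F)
include hF

lemma D_comm (i j) (p) :
    D i (D j F) p = D j (D i F) p := by
  have hF' : Differentiable ℝ (fderiv ℝ F) :=
    (hF.fderiv_right (m := ∞) (by simp)).differentiable (by simp)
  have key : ∀ i j : Fin 3, D i (D j F) p = fderiv ℝ (fderiv ℝ F) p (ev i) (ev j) := fun i j => by
    have h := ((hF' p).hasFDerivAt.clm_apply (hasFDerivAt_const (ev j) p)).fderiv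
    have e : D i (D j F) p = fderiv ℝ (fun q => fderiv ℝ F q (ev j)) p (ev i) := rfl
    rw [e, h]
    simp
  rw [key, key]
  exact second_derivative_symmetric (𝕜 := ℝ) (f := F)
    (fun q => (hF.differentiable (by simp) q).hasFDerivAt) (hF' p).hasFDerivAt _ _

lemma differentiable_D (i) : Differentiable ℝ (D i F) :=
  (hF.D i).differentiable (by simp)

lemma contDiff_lap : ContDiff ℝ ∞ (lap F) :=
  ContDiff.sum fun i _ => (hF.D i).D i

omit hF in
lemma D_sum {ι : Type*} (s : Finset ι) {F : ι → E3 → ℝ} (hF : ∀ i ∈ s, DifferentiableAt ℝ (F i) p) (j) :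
    D j (fun p => ∑ i ∈ s, F i p) p = ∑ i ∈ s, D j (F i) p := by
  unfold D
  rw [fderiv_fun_sum hF]
  simp

lemma lap_add {G : E3 → ℝ} (hG : ContDiff ℝ ∞ G) (p) :
    lap (fun p => F p + G p) p = lap F p + lap G p := by
  have e : ∀ i, D i (fun p => F p + G p) = fun p => D i F p + D i G p := fun i => funext fun p =>
    D_add (hF.differentiable (by simp) p) (hG.differentiable (by simp) p) i
  simp only [lap, e, fun i => D_add (differentiable_D hF i p) (differentiable_D hG i p) i,
    sum_add_distrib]

omit hF in
lemma lap_const_mul (c : ℝ) (hF : ContDiff ℝ ∞ F) (p) :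
    lap (fun p => c * F p) p = c * lap F p := by
  have e : ∀ i, D i (fun p => c * F p) = fun p => c * D i F p := fun i => funext fun p =>
    D_const_mul c (hF.differentiable (by simp) p) i
  simp only [lap, e, fun i => D_const_mul c (differentiable_D hF i p) i, mul_sum]

lemma lap_D (j) (p) :
    lap (D j F) p = D j (lap F) p := by
  unfold lap
  rw [D_sum _ fun i _ => differentiable_D (hF.D i) i p]
  refine sum_congr rfl fun i _ => ?_
  rw [show D i (D j F) = D j (D i F) from funext fun q => D_comm hF i j q]
  exact D_comm (hF.D i) i j p

omit hF in
lemma contDiff_co (j) : ContDiff ℝ ∞ (fun p : E3 => co p j) := by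
  fin_cases j
  · exact contDiff_fst
  · exact contDiff_fst.comp contDiff_snd
  · exact contDiff_snd.comp contDiff_snd

omit hF in
lemma D_co (i j) (p) : D i (fun p => co p j) p = if i = j then 1 else 0 := by
  have h0 : HasFDerivAt (fun p : E3 => p.1) (ContinuousLinearMap.fst ℝ ℝ (ℝ × ℝ)) p :=
    hasFDerivAt_fst
  have h1 : HasFDerivAt (fun p : E3 => p.2.1)
      ((ContinuousLinearMap.fst ℝ ℝ ℝ).comp (ContinuousLinearMap.snd ℝ ℝ (ℝ × ℝ))) p :=
    hasFDerivAt_fst.comp p hasFDerivAt_snd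
  have h2 : HasFDerivAt (fun p : E3 => p.2.2)
      ((ContinuousLinearMap.snd ℝ ℝ ℝ).comp (ContinuousLinearMap.snd ℝ ℝ (ℝ × ℝ))) p :=
    hasFDerivAt_snd.comp p hasFDerivAt_snd
  fin_cases j
  · unfold D; change fderiv ℝ (fun p : E3 => p.1) p _ = _; rw [h0.fderiv]
    fin_cases i <;> simp [ev]
  · unfold D; change fderiv ℝ (fun p : E3 => p.2.1) p _ = _; rw [h1.fderiv]
    fin_cases i <;> simp [ev]
  · unfold D; change fderiv ℝ (fun p : E3 => p.2.2) p _ = _; rw [h2.fderiv]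
    fin_cases i <;> simp [ev]

/-- The radial derivative `p · ∇F`. -/
def rad (F : E3 → ℝ) (p : E3) : ℝ := ∑ j, co p j * D j F p

lemma contDiff_rad : ContDiff ℝ ∞ (rad F) :=
  ContDiff.sum fun i _ => (contDiff_co i).mul (hF.D i)

lemma D_rad (i) (p) :
    D i (rad F) p = D i F p + rad (D i F) p := by
  unfold rad
  have hc := fun j => (contDiff_co j).differentiable (by simp) p
  rw [D_sum _ fun j _ => (hc j).fun_mul (differentiable_D hF j p)]
  simp only [D_mul (hc _) (differentiable_D hF _ p), D_co, sum_add_distrib]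
  congr 1
  · simp
  · exact sum_congr rfl fun j _ => by rw [D_comm hF]

lemma lap_rad (p) :
    lap (rad F) p = 2 * lap F p + rad (lap F) p := by
  have e : ∀ i, D i (rad F) = fun p => D i F p + rad (D i F) p := fun i => funext fun p =>
    D_rad hF i p
  have hD := hF.D
  have h : ∀ i, D i (D i (rad F)) p = 2 * D i (D i F) p + rad (D i (D i F)) p := fun i => by
    rw [e, D_add (differentiable_D hF i p) ((contDiff_rad (hD i)).differentiable (by simp) p),
      D_rad (hD i)]
    ring
  simp only [lap, h, sum_add_distrib, mul_sum, rad]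
  congr 1
  rw [Finset.sum_comm]
  refine sum_congr rfl fun j _ => ?_
  rw [← mul_sum]
  congr 1
  exact (D_sum _ (fun i _ => differentiable_D (hD i) i p) j).symm

end

lemma Test.cpt_gradSq (hg : Test g) : HasCompactSupport (gradSq g) := by
  have h3 : ∀ i, HasCompactSupport (fun p => D i g p ^ 2) := fun i =>
    (hg.cpt.D i).comp_left (g := fun t : ℝ => t ^ 2) (by simp)
  have e : gradSq g = ((fun p => D 0 g p ^ 2) + fun p => D 1 g p ^ 2) + fun p => D 2 g p ^ 2 := by
    ext p
    simp [gradSq, Fin.sum_univ_three]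
  rw [e]
  exact ((h3 0).add (h3 1)).add (h3 2)

/-- Factoring a function out of the quadratic form (ground state substitution). -/
lemma form_mul (hQ : Continuous Q) (hg : Test g) (hψ : ContDiff ℝ ∞ ψ) :
    form Q (fun p => g p * ψ p) = ∫ p, (ψ p ^ 2 * gradSq g p
      + g p ^ 2 * (ψ p * (- lap ψ p + (1 - 2 * Q p) * ψ p))) := by
  have hF : ∀ i, ContDiff ℝ ∞ (fun p => g p ^ 2 * (ψ p * D i ψ p)) := fun i =>
    (hg.smooth.pow 2).mul (hψ.mul (hψ.D i))
  have hc : ∀ i, HasCompactSupport (fun p => g p ^ 2 * (ψ p * D i ψ p)) := fun i =>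
    (hg.cpt.comp_left (g := fun t : ℝ => t ^ 2) (by simp)).mul_right
  have hz : ∫ p, ∑ i, D i (fun p => g p ^ 2 * (ψ p * D i ψ p)) p = 0 := by
    rw [integral_finsetSum _ fun i _ => (((hF i).D i).continuous
      |>.integrable_of_hasCompactSupport ((hc i).D i))]
    exact sum_eq_zero fun i _ => integral_D_eq_zero ((hF i).of_le (by simp)) (hc i) i
  have hdψ := fun p => hψ.differentiable (by simp) p
  have hdg := hg.diff
  have hi1 : Integrable (fun p => ψ p ^ 2 * gradSq g p
      + g p ^ 2 * (ψ p * (- lap ψ p + (1 - 2 * Q p) * ψ p))) := by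
    have hcg := continuous_gradSq hg.smooth
    have hl := (contDiff_lap hψ).continuous
    have hψ0 := hψ.continuous
    have hg0 := hg.smooth.continuous
    refine Integrable.add (Continuous.integrable_of_hasCompactSupport (by fun_prop) ?_)
      (Continuous.integrable_of_hasCompactSupport (by fun_prop)
        (hg.cpt.comp_left (g := fun t : ℝ => t ^ 2) (by simp)).mul_right)
    refine HasCompactSupport.mul_left (?_ : HasCompactSupport (gradSq g))
    exact hg.cpt_gradSq
  rw [← add_zero (∫ p, _), ← hz, ← integral_add hi1]
  · unfold form
    congr 1
    ext p
    have e1 : ∀ i, D i (fun p => g p * ψ p) p = D i g p * ψ p + g p * D i ψ p := fun i =>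
      D_mul (hdg p) (hdψ p) i
    have e2 : ∀ i, D i (fun p => g p ^ 2 * (ψ p * D i ψ p)) p
        = 2 * g p * D i g p * (ψ p * D i ψ p)
          + g p ^ 2 * (D i ψ p * D i ψ p + ψ p * D i (D i ψ) p) := fun i => by
      rw [D_mul ((hdg p).fun_pow 2) ((hdψ p).fun_mul (differentiable_D hψ i p)), D_sq (hdg p),
        D_mul (hdψ p) (differentiable_D hψ i p)]
    simp only [gradSq, e1, e2, lap, Fin.sum_univ_three]
    ring
  · exact integrable_finsetSum _ fun i _ => (((hF i).D i).continuous
      |>.integrable_of_hasCompactSupport ((hc i).D i))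

/-- Green's identity for functions in `SobH`. -/
lemma integral_grad_mul_grad (hh : SobH h) (hψ : SobH ψ)
    (hl : Integrable (fun p => h p * lap ψ p)) :
    ∫ p, ∑ i, D i h p * D i ψ p = - ∫ p, h p * lap ψ p := by
  have hi : Integrable (fun p => ∑ i, D i h p * D i ψ p) := integrable_finsetSum _ fun i _ =>
    (hh.dmemLp i).integrable_mul (hψ.dmemLp i)
  have hi2 : ∀ i, Integrable (fun p => h p * D i ψ p) := fun i =>
    hh.memLp.integrable_mul (hψ.dmemLp i)
  obtain ⟨K, hK, hb⟩ := exists_cut_bound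
  have key : ∀ n : ℕ, ∫ p, cut (n + 1) p * (∑ i, D i h p * D i ψ p)
      = - (∫ p, cut (n + 1) p * (h p * lap ψ p))
        - ∫ p, ∑ i, D i (cut (n + 1)) p * (h p * D i ψ p) := fun n => by
    have hF : ∀ i, ContDiff ℝ ∞ (fun p => cut (n + 1) p * (h p * D i ψ p)) := fun i =>
      (contDiff_cut _).mul (hh.smooth.mul (hψ.smooth.D i))
    have hcc : HasCompactSupport (cut ((n : ℝ) + 1)) := hasCompactSupport_cut (by positivity)
    have hc : ∀ i, HasCompactSupport (fun p => cut (n + 1) p * (h p * D i ψ p)) := fun i =>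
      hcc.mul_right
    have hz : ∫ p, ∑ i, D i (fun p => cut (n + 1) p * (h p * D i ψ p)) p = 0 := by
      rw [integral_finsetSum _ fun i _ => (((hF i).D i).continuous
        |>.integrable_of_hasCompactSupport ((hc i).D i))]
      exact sum_eq_zero fun i _ => integral_D_eq_zero ((hF i).of_le (by simp)) (hc i) i
    have c1 : Continuous (fun p => ∑ i, D i h p * D i ψ p) := continuous_finsetSum _ fun i _ =>
      (hh.smooth.D i).continuous.mul (hψ.smooth.D i).continuous
    have c2 := (contDiff_lap hψ.smooth).continuous
    have c3 := (contDiff_cut ((n : ℝ) + 1)).continuous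
    have c4 := hh.smooth.continuous
    have i1 : Integrable (fun p => cut (n + 1) p * (∑ i, D i h p * D i ψ p)) :=
      (c3.mul c1).integrable_of_hasCompactSupport hcc.mul_right
    have i2 : Integrable (fun p => cut (n + 1) p * (h p * lap ψ p)) :=
      (c3.mul (c4.mul c2)).integrable_of_hasCompactSupport hcc.mul_right
    have i3 : Integrable (fun p => ∑ i, D i (cut (n + 1)) p * (h p * D i ψ p)) :=
      integrable_finsetSum _ fun i _ => Continuous.integrable_of_hasCompactSupport
        (((contDiff_cut _).D i).continuous.mul
          (c4.mul (hψ.smooth.D i).continuous)) (hcc.D i).mul_right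
    have i12 : Integrable (fun p => cut (n + 1) p * (∑ i, D i h p * D i ψ p)
        + cut (n + 1) p * (h p * lap ψ p)) := i1.add i2
    have : (∫ p, cut (n + 1) p * (∑ i, D i h p * D i ψ p))
        + (∫ p, cut (n + 1) p * (h p * lap ψ p))
        + (∫ p, ∑ i, D i (cut (n + 1)) p * (h p * D i ψ p)) = 0 := by
      rw [← integral_add i1 i2, ← integral_add i12 i3, ← hz]
      congr 1
      ext p
      have e : ∀ i, D i (fun p => cut (n + 1) p * (h p * D i ψ p)) p
          = D i (cut (n + 1)) p * (h p * D i ψ p)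
            + cut (n + 1) p * (D i h p * D i ψ p + h p * D i (D i ψ) p) := fun i => by
        rw [D_cut_mul (fun p => (hh.diff p).fun_mul (differentiable_D hψ.smooth i p)),
          D_mul (hh.diff p) (differentiable_D hψ.smooth i p)]
      simp only [e, lap, Fin.sum_univ_three]
      ring
    linarith
  have l1 := tendsto_integral_cut_mul hi
  have l2 := tendsto_integral_cut_mul hl
  have l3 : Tendsto (fun n : ℕ => ∫ p, ∑ i, D i (cut (n + 1)) p * (h p * D i ψ p)) atTop (𝓝 0) := by
    have hsum : Integrable (fun p => ∑ i, |h p * D i ψ p|) :=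
      integrable_finsetSum _ fun i _ => (hi2 i).abs
    have : ∫ p : E3, (0 : ℝ) = 0 := by simp
    rw [← this]
    refine tendsto_integral_of_dominated_convergence (fun p => K * ∑ i, |h p * D i ψ p|)
      (fun n => ?_) (hsum.const_mul K) (fun n => .of_forall fun p => ?_)
      (.of_forall fun p => ?_)
    · refine Continuous.aestronglyMeasurable (continuous_finsetSum _ fun i _ => ?_)
      exact ((contDiff_cut _).D i).continuous.mul
          (hh.smooth.continuous.mul (hψ.smooth.D i).continuous)
    · rw [mul_sum]
      refine (norm_sum_le _ _).trans (sum_le_sum fun i _ => ?_)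
      rw [norm_mul]
      refine mul_le_mul_of_nonneg_right ?_ (norm_nonneg _)
      refine ((hb (n + 1) (by simp) i i p).1).trans (div_le_self hK.le (by simp))
    · have : Tendsto (fun n : ℕ => ∑ i, D i (cut (n + 1)) p * (h p * D i ψ p)) atTop
          (𝓝 (∑ i : Fin 3, 0 * (h p * D i ψ p))) :=
        tendsto_finsetSum _ fun i _ => (tendsto_D_cut i p).mul_const _
      simpa using this
  have l4 := l2.neg.sub l3
  simp_rw [← key] at l4
  rw [sub_zero] at l4
  exact tendsto_nhds_unique l1 l4

lemma rho_pos (hp : p ≠ 0) : 0 < rho p :=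
  (norm_pos_iff.2 hp).trans_le (norm_le_rho p)

lemma hasFDerivAt_rho (hp : p ≠ 0) :
    DifferentiableAt ℝ rho p ∧ ∀ i, D i rho p = co p i / rho p := by
  have h0 : p.1 ^ 2 + p.2.1 ^ 2 + p.2.2 ^ 2 ≠ 0 := by
    have := rho_pos hp
    unfold rho at this
    exact (sqrt_pos.1 this).ne'
  have hc : ∀ j, HasFDerivAt (fun p : E3 => co p j) (fderiv ℝ (fun p : E3 => co p j) p) p := fun j =>
    ((contDiff_co j).differentiable (by simp) p).hasFDerivAt
  have h1 := (((hc 0).pow 2).add ((hc 1).pow 2)).add ((hc 2).pow 2)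
  have h2 := h1.sqrt h0
  refine ⟨h2.differentiableAt, fun i => ?_⟩
  have e : D i rho p = _ := congrArg (fun L : E3 →L[ℝ] ℝ => L (ev i)) h2.fderiv
  rw [e]
  have hd : ∀ j, fderiv ℝ (fun p : E3 => co p j) p (ev i) = if i = j then 1 else 0 := fun j =>
    D_co i j p
  simp only [FunLike.coe_add, FunLike.coe_smul, Pi.add_apply, Pi.smul_apply, hd]
  change _ = co p i / √(p.1 ^ 2 + p.2.1 ^ 2 + p.2.2 ^ 2)
  have hs : √(p.1 ^ 2 + p.2.1 ^ 2 + p.2.2 ^ 2) ≠ 0 := (rho_pos hp).ne'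
  fin_cases i <;> simp [co] <;> field_simp

lemma D_radial {G : ℝ → ℝ} (hF : ∀ p, F p = G (rho p)) (hp : p ≠ 0)
    (hG : HasDerivAt G G' (rho p)) (i) : D i F p = G' * (co p i / rho p) := by
  obtain ⟨h1, h2⟩ := hasFDerivAt_rho hp
  have h3 := (hG.comp_hasFDerivAt p h1.hasFDerivAt).fderiv
  rw [← h2, show F = G ∘ rho from funext hF]
  unfold D
  rw [h3]
  simp

lemma gradSq_radial {G : ℝ → ℝ} (hF : ∀ p, F p = G (rho p))
    (hp : p ≠ 0) (hG : HasDerivAt G G' (rho p)) : gradSq F p = G' ^ 2 := by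
  have h := rho_pos hp
  simp only [gradSq, D_radial hF hp hG, mul_pow, div_pow, ← mul_sum, ← Finset.sum_div]
  rw [← rho_sq, div_self (by positivity), mul_one]

/-- `f'(r) / r`, extended to `r = 0`. -/
def kk (f : ℝ → ℝ) : ℝ → ℝ := dslope (deriv f) 0

lemma co_zero (i) : co 0 i = 0 := by fin_cases i <;> rfl

lemma rho_zero : rho 0 = 0 := by simp [rho]

lemma continuous_co (i) : Continuous (fun p : E3 => co p i) := (contDiff_co i).continuous

namespace Prof

variable {f : ℝ → ℝ}
variable (hf : Prof f)
include hf

lemma kk_of_ne (hx : x ≠ 0) : kk f x = deriv f x / x := by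
  rw [kk, dslope_of_ne _ hx, slope_def_field, hf.deriv_zero, sub_zero, sub_zero]

lemma continuous_kk : Continuous (kk f) := by
  rw [continuous_iff_continuousAt]
  intro x
  rcases eq_or_ne x 0 with rfl | hx
  · exact continuousAt_dslope_same.2 (hf.hasDerivAt_deriv 0).differentiableAt
  · exact (continuousAt_dslope_of_ne hx).2 (hf.hasDerivAt_deriv x).continuousAt

lemma kk_zero : kk f 0 = (f 0 - f 0 ^ 2) / 3 := by
  have h1 : kk f 0 = deriv (deriv f) 0 := dslope_same _ _
  have hA : Continuous (fun x => deriv (deriv f) x + 2 * kk f x) :=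
    hf.contDiff_deriv2.continuous.add (hf.continuous_kk.const_mul 2)
  have hB : Continuous (fun x => f x - f x ^ 2) := hf.continuous.sub (hf.continuous.pow 2)
  have heq : (fun x => deriv (deriv f) x + 2 * kk f x) = fun x => f x - f x ^ 2 := by
    refine hA.ext_on (dense_compl_singleton (0 : ℝ)) hB fun x hx => ?_
    have hx : x ≠ 0 := hx
    have := hf.ode x
    simp only
    rw [hf.kk_of_ne hx]
    field_simp
    linarith
  have := congrFun heq 0
  rw [← h1] at this
  linarith

lemma kk_neg (hx : 0 ≤ x) : kk f x < 0 := by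
  rcases hx.eq_or_lt with rfl | hx
  · rw [hf.kk_zero]
    have := hf.zero_ge
    nlinarith
  · rw [hf.kk_of_ne hx.ne']
    exact div_neg_of_neg_of_pos (hf.deriv_neg x hx) hx

lemma exists_kk_bound (hR : 0 ≤ R) :
    ∃ c > 0, ∃ C > 0, ∀ x, 0 ≤ x → x ≤ R → c ≤ - kk f x ∧ - kk f x ≤ C := by
  have hne : (Icc 0 R).Nonempty := ⟨0, le_rfl, hR⟩
  obtain ⟨a, ha, hmin⟩ := isCompact_Icc.exists_isMinOn hne hf.continuous_kk.neg.continuousOn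
  obtain ⟨b, hb, hmax⟩ := isCompact_Icc.exists_isMaxOn hne hf.continuous_kk.neg.continuousOn
  exact ⟨- kk f a, neg_pos.2 (hf.kk_neg ha.1), - kk f b, neg_pos.2 (hf.kk_neg hb.1),
    fun x h0 h1 => ⟨hmin ⟨h0, h1⟩, hmax ⟨h0, h1⟩⟩⟩

end Prof

lemma integrable_exp_neg_rho : Integrable (fun p : E3 => rexp (- rho p)) := by
  have h := integrable_one_add_norm (E := E3) (μ := volume) (r := 4) (by
    bound)
  refine (h.const_mul 128).mono' (by have := continuous_rho; fun_prop)
    (.of_forall fun p => ?_)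
  rw [norm_of_nonneg (exp_pos _).le, exp_neg, rpow_neg (by positivity)]
  have h1 := norm_le_rho p
  have h2 : (1 + ‖p‖) ^ (4 : ℝ) = (1 + ‖p‖) ^ 4 := by norm_cast
  have h3 : (1 + rho p) ^ 4 / 24 ≤ rexp (1 + rho p) := by
    linarith [pow_div_factorial_le_exp (1 + rho p) (by have := rho_nonneg p; positivity) 4]
  rw [h2, inv_le_iff_one_le_mul₀ (exp_pos _)]
  have h4 : (1 + ‖p‖) ^ 4 ≤ (1 + rho p) ^ 4 := by gcongr
  have h5 : rexp 1 ≤ 3 := exp_one_lt_three.le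
  rw [exp_add] at h3
  have h6 := exp_pos (rho p)
  have h7 : (1 + ‖p‖) ^ 4 ≤ 128 * rexp (rho p) := by nlinarith
  have h8 : 0 < (1 + ‖p‖) ^ 4 := by positivity
  calc 1 ≤ 128 * rexp (rho p) / (1 + ‖p‖) ^ 4 := (one_le_div h8).2 h7
    _ = _ := by ring

namespace GS

variable {f : ℝ → ℝ}
variable (hQ : GS f Q)
include hQ

lemma smooth : ContDiff ℝ ∞ Q := hQ.sob.smooth

lemma D_eq (i) (p) : D i Q p = co p i * kk f (rho p) := by
  have h1 : Continuous (D i Q) := (hQ.smooth.D i).continuous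
  have h2 : Continuous (fun p => co p i * kk f (rho p)) :=
    (continuous_co i).mul (hQ.prof.continuous_kk.comp continuous_rho)
  refine congrFun (h1.ext_on (dense_compl_singleton (0 : E3)) h2 fun p hp => ?_) p
  have hp : p ≠ 0 := hp
  rw [D_radial hQ.rad hp (hQ.prof.hasDerivAt _), hQ.prof.kk_of_ne (rho_pos hp).ne']
  ring

lemma rad_eq (p) : ZK.rad Q p = rho p * deriv f (rho p) := by
  simp only [ZK.rad, hQ.D_eq]
  rcases eq_or_ne p 0 with rfl | hp
  · simp [co_zero, rho_zero]
  · have h := rho_pos hp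
    rw [hQ.prof.kk_of_ne h.ne']
    have := rho_sq p
    simp only [← mul_assoc, ← pow_two, ← sum_mul, ← this]
    field_simp

lemma lap_D_eq (i) (p) :
    lap (D i Q) p = (1 - 2 * Q p) * D i Q p := by
  rw [lap_D hQ.smooth, show lap Q = fun p => Q p - Q p ^ 2 from funext hQ.eqn,
    D_sub (hQ.sob.diff p) ((hQ.sob.diff p).fun_pow 2), D_sq (hQ.sob.diff p)]
  ring

lemma lap_rad_eq (p) :
    lap (ZK.rad Q) p = 2 * (Q p - Q p ^ 2) + (1 - 2 * Q p) * ZK.rad Q p := by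
  rw [lap_rad hQ.smooth, show lap Q = fun p => Q p - Q p ^ 2 from funext hQ.eqn]
  simp only [ZK.rad, D_sub (hQ.sob.diff p) ((hQ.sob.diff p).fun_pow 2), D_sq (hQ.sob.diff p),
    mul_sum]
  grind

omit hQ in
lemma _root_.ZK.tendsto_comp_rho {G : ℝ → ℝ} (hG : Tendsto G atTop (𝓝 0)) :
    Tendsto (fun p => G (rho p)) (cocompact E3) (𝓝 0) := by
  refine hG.comp ?_
  exact tendsto_atTop_mono norm_le_rho tendsto_norm_cocompact_atTop

omit hQ in
lemma integrable_sq_of_sq_le {g : ℝ → ℝ} (hg : Continuous g)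
    (h : ∀ x ≥ 0, g x ^ 2 ≤ C * rexp (-x)) : Integrable (fun p => g (rho p) ^ 2) :=
  (integrable_exp_neg_rho.const_mul C).mono'
    ((hg.comp continuous_rho).pow 2).aestronglyMeasurable (.of_forall fun p => by
      rw [norm_of_nonneg (by positivity)]; exact h _ (rho_nonneg p))

/-- `ρ² Q²` is integrable. -/
lemma integrable_w_sq : Integrable (fun p => prw f (rho p) ^ 2) := by
  obtain ⟨C, -, h⟩ := hQ.prof.exists_decay_sq
  exact integrable_sq_of_sq_le hQ.prof.continuous_w fun x hx => (h x hx).1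

end GS

/-- The scaling derivative of the ground state. -/
def scal (Q : E3 → ℝ) (p : E3) : ℝ := rad Q p + 2 * Q p

namespace GS

variable {f : ℝ → ℝ}
variable (hQ : GS f Q)
include hQ

lemma scal_eq (p) : scal Q p = prw' f (rho p) + f (rho p) := by
  rw [scal, hQ.rad_eq, hQ.rad, prw']
  ring

lemma contDiff_scal : ContDiff ℝ ∞ (scal Q) :=
  (contDiff_rad hQ.smooth).add (contDiff_const.mul hQ.smooth)

lemma lap_scal (p) :
    lap (scal Q) p = 2 * Q p + (1 - 2 * Q p) * scal Q p := by
  have e : scal Q = fun p => ZK.rad Q p + 2 * Q p := rfl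
  rw [e, lap_add (contDiff_rad hQ.smooth) (contDiff_const.mul hQ.smooth), hQ.lap_rad_eq,
    lap_const_mul 2 hQ.smooth, hQ.eqn]
  ring

lemma sob_scal : SobH (scal Q) where
  smooth := hQ.contDiff_scal
  sq := by
    obtain ⟨C, -, hC⟩ := hQ.prof.exists_decay_sq
    have h := (((memLp_two_iff_integrable_sq
      (hQ.prof.continuous_w'.comp continuous_rho).aestronglyMeasurable).2
      (integrable_sq_of_sq_le hQ.prof.continuous_w' fun x hx => (hC x hx).2)).add
      hQ.sob.memLp).integrable_sq
    refine h.congr (.of_forall fun p => ?_)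
    simp [hQ.scal_eq, hQ.rad]
  dsq i := by
    have hg : Integrable (fun p => 2 * gradSq Q p + 2 * ((1 + f 0) ^ 2 * prw f (rho p) ^ 2)) :=
      (hQ.sob.integrable_gradSq.const_mul 2).add
        ((hQ.integrable_w_sq.const_mul ((1 + f 0) ^ 2)).const_mul 2)
    refine hg.mono' ((hQ.contDiff_scal.D i).continuous.pow 2).aestronglyMeasurable ?_
    have hae : ∀ᵐ p : E3, p ≠ 0 := by
      rw [ae_iff]; simp
    filter_upwards [hae] with p hp
    rw [norm_of_nonneg (sq_nonneg _)]
    have h1 : D i (scal Q) p ^ 2 ≤ gradSq (scal Q) p :=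
      single_le_sum (f := fun i => D i (scal Q) p ^ 2) (fun i _ => sq_nonneg _)
        (mem_univ i)
    rw [gradSq_radial hQ.scal_eq hp ((hQ.prof.hasDerivAt_w' _).add (hQ.prof.hasDerivAt _))] at h1
    rw [gradSq_radial hQ.rad hp (hQ.prof.hasDerivAt _)]
    have h2 : (prw f (rho p) - prw f (rho p) * f (rho p)) ^ 2
        ≤ (1 + f 0) ^ 2 * prw f (rho p) ^ 2 := by
      have a1 := hQ.prof.pos (rho p)
      have a2 := hQ.prof.le_zero' (rho p)
      have : (1 - f (rho p)) ^ 2 ≤ (1 + f 0) ^ 2 := by nlinarith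
      have a3 := sq_nonneg (prw f (rho p))
      nlinarith
    nlinarith [sq_nonneg (prw f (rho p) - prw f (rho p) * f (rho p) - deriv f (rho p))]

lemma tendsto_scal : Tendsto (scal Q) (cocompact E3) (𝓝 0) := by
  obtain ⟨C, -, h⟩ := hQ.prof.exists_decay_sq
  have := tendsto_comp_rho (G := fun x => prw' f x + f x)
    (by simpa using (tendsto_of_sq_le fun x hx => (h x hx).2).2.add hQ.prof.lim)
  exact this.congr fun p => (hQ.scal_eq p).symm

lemma mass_pos : 0 < mass Q := by
  refine (integral_pos_iff_support_of_nonneg (fun p => sq_nonneg (Q p)) hQ.sob.sq).2 ?_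
  have : Function.support (fun p => Q p ^ 2) = univ := by
    ext p; simp [(hQ.pos p).ne']
  rw [this]
  simp

lemma integral_scal_mul : ∫ p, scal Q p * Q p = mass Q / 2 := by
  have hw : ∀ i, MemLp (fun p => co p i * Q p) 2 := fun i => by
    have hc := (continuous_co i).mul hQ.continuous
    refine (memLp_two_iff_integrable_sq hc.aestronglyMeasurable).2 <|
      hQ.integrable_w_sq.mono' (hc.pow 2).aestronglyMeasurable (.of_forall fun p => ?_)
    simp only [Pi.mul_apply]
    rw [norm_of_nonneg (sq_nonneg _), hQ.rad, prw, mul_pow, mul_pow]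
    have := abs_co_le_rho p i
    rw [← sq_abs (co p i)]
    gcongr
  have hdc : ∀ i p, DifferentiableAt ℝ (fun p => co p i * Q p) p := fun i p =>
    ((contDiff_co i).differentiable (by simp) p).fun_mul (hQ.sob.diff p)
  have i1 : ∀ i, Integrable (fun p => co p i * Q p * D i Q p) := fun i =>
    (hw i).integrable_mul (hQ.sob.dmemLp i)
  have key : ∀ i, ∫ p, co p i * Q p * D i Q p = - mass Q / 2 := fun i => by
    have hD : ∀ p, D i (fun p => co p i * Q p) p = Q p + co p i * D i Q p := fun p => by
      rw [D_mul ((contDiff_co i).differentiable (by simp) p) (hQ.sob.diff p), D_co]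
      simp
    have hi : Integrable (fun p => D i (fun p => co p i * Q p) p * Q p) := by
      refine (hQ.sob.sq.add (i1 i)).congr (.of_forall fun p => ?_)
      simp only [Pi.add_apply, hD]; ring
    have := integral_mul_fderiv_eq_neg_fderiv_mul_of_integrable (𝕜 := ℝ) (μ := (volume : Measure E3))
      (f := fun p => co p i * Q p) (g := Q) (v := ev i) hi (i1 i)
      ((hw i).integrable_mul hQ.sob.memLp) (fun p _ => hdc i p) (fun p _ => hQ.sob.diff p)
    change ∫ p, co p i * Q p * D i Q p = - ∫ p, D i (fun p => co p i * Q p) p * Q p at this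
    have e : ∫ p, D i (fun p => co p i * Q p) p * Q p = mass Q + ∫ p, co p i * Q p * D i Q p := by
      rw [mass, ← integral_add hQ.sob.sq (i1 i)]
      congr 1
      ext p
      rw [hD]; ring
    linarith
  have e : ∀ p, scal Q p * Q p = (∑ i, co p i * Q p * D i Q p) + 2 * Q p ^ 2 := fun p => by
    rw [scal, ZK.rad, add_mul, sum_mul]
    grind
  simp_rw [e]
  rw [integral_add (integrable_finsetSum _ fun i _ => i1 i) (hQ.sob.sq.const_mul 2),
    integral_finsetSum _ fun i _ => i1 i, integral_const_mul]
  simp only [key, Fin.sum_univ_three]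
  change _ + 2 * mass Q = _
  ring

end GS

/-- An even smooth bump on the line, equal to `1` on `[-1, 1]` and supported in `[-2, 2]`. -/
def bump1 : ContDiffBump (0 : ℝ) := ⟨1, 2, by norm_num, by norm_num⟩

/-- A smooth odd truncation vanishing on `[-ε, ε]`. -/
def trunc (ε s : ℝ) : ℝ := s - ε * ∫ t in (0 : ℝ)..(s / ε), bump1 t

lemma continuous_bump1 : Continuous bump1 := bump1.contDiff (n := 0) |>.continuous

lemma intervalIntegrable_bump1 (a b : ℝ) : IntervalIntegrable bump1 volume a b :=
  continuous_bump1.intervalIntegrable a b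

section
variable (hε : 0 < ε)
include hε

lemma hasDerivAt_trunc (s : ℝ) :
    HasDerivAt (trunc ε) (1 - bump1 (s / ε)) s := by
  have h1 : HasDerivAt (fun x => ∫ t in (0 : ℝ)..x, bump1 t) (bump1 (s / ε)) (s / ε) :=
    intervalIntegral.integral_hasDerivAt_right (intervalIntegrable_bump1 _ _)
      (continuous_bump1.stronglyMeasurableAtFilter _ _) continuous_bump1.continuousAt
  have h2 := (h1.comp s ((hasDerivAt_id s).div_const ε)).const_mul ε
  exact ((hasDerivAt_id s).sub h2).congr_deriv (by field_simp)

lemma contDiff_trunc : ContDiff ℝ ∞ (trunc ε) := by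
  rw [contDiff_infty_iff_deriv]
  refine ⟨fun s => (hasDerivAt_trunc hε s).differentiableAt, ?_⟩
  rw [show deriv (trunc ε) = fun s => 1 - bump1 (s / ε) from
    funext fun s => (hasDerivAt_trunc hε s).deriv]
  exact contDiff_const.sub (bump1.contDiff.comp (contDiff_id.div_const ε))

omit hε in
lemma trunc_neg (ε s : ℝ) : trunc ε (-s) = - trunc ε s := by
  have : ∫ t in (0 : ℝ)..(-s / ε), bump1 t = - ∫ t in (0 : ℝ)..(s / ε), bump1 t := by
    have h := intervalIntegral.integral_comp_neg (a := 0) (b := s / ε) (fun t => bump1 t)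
    simp only [bump1.neg, neg_zero] at h
    rw [neg_div, h, intervalIntegral.integral_symm]
  rw [trunc, this, trunc]
  ring

lemma trunc_eq_zero (hs : |s| ≤ ε) : trunc ε s = 0 := by
  have : ∫ t in (0 : ℝ)..(s / ε), bump1 t = ∫ t in (0 : ℝ)..(s / ε), 1 := by
    refine intervalIntegral.integral_congr fun t ht => ?_
    apply bump1.one_of_mem_closedBall
    have hse : |s / ε| ≤ 1 := by rw [abs_div, abs_of_pos hε, div_le_one hε]; exact hs
    have h2 : |t| ≤ |s / ε| := by
      have := Set.abs_sub_left_of_mem_uIcc ht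
      simpa using this
    simpa [bump1] using h2.trans hse
  rw [trunc, this]
  simp
  field_simp
  ring

lemma trunc_bounds (hs : 0 ≤ s) :
    0 ≤ trunc ε s ∧ trunc ε s ≤ s ∧ s - 2 * ε ≤ trunc ε s := by
  have h0 : 0 ≤ s / ε := by positivity
  have h1 : 0 ≤ ∫ t in (0 : ℝ)..(s / ε), bump1 t :=
    intervalIntegral.integral_nonneg h0 fun t _ => bump1.nonneg
  have h2 : ∫ t in (0 : ℝ)..(s / ε), bump1 t ≤ s / ε := by
    have := intervalIntegral.integral_mono_on h0 (intervalIntegrable_bump1 _ _)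
      (intervalIntegrable_const (c := (1 : ℝ))) fun t _ => bump1.le_one (x := t)
    simpa using this
  have h3 : ∫ t in (0 : ℝ)..(s / ε), bump1 t ≤ 2 := by
    rcases le_total (s / ε) 2 with h | h
    · linarith
    · rw [← intervalIntegral.integral_add_adjacent_intervals (intervalIntegrable_bump1 0 2)
        (intervalIntegrable_bump1 2 _)]
      have e : ∫ t in (2 : ℝ)..(s / ε), bump1 t = ∫ t in (2 : ℝ)..(s / ε), 0 := by
        refine intervalIntegral.integral_congr fun t ht => ?_
        rw [Set.uIcc_of_le h] at ht
        apply bump1.zero_of_le_dist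
        simpa [bump1, abs_of_nonneg (show 0 ≤ t by linarith [ht.1])] using ht.1
      have := intervalIntegral.integral_mono_on (show (0 : ℝ) ≤ 2 by norm_num)
        (intervalIntegrable_bump1 0 2)
        (intervalIntegrable_const (c := (1 : ℝ))) fun t _ => bump1.le_one (x := t)
      rw [e]
      simpa using this
  have h4 : ε * (s / ε) = s := by field_simp
  unfold trunc
  refine ⟨?_, ?_, ?_⟩ <;> nlinarith

lemma abs_trunc_le (s : ℝ) : |trunc ε s| ≤ |s| := by
  rcases le_total 0 s with h | h
  · have := trunc_bounds hε h
    grind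
  · have := trunc_bounds hε (neg_nonneg.2 h)
    rw [← abs_neg, ← trunc_neg, abs_of_nonneg this.1, abs_of_nonpos h]; exact this.2.1

lemma abs_trunc_sub_le (s : ℝ) : |s - trunc ε s| ≤ 2 * ε := by
  rcases le_total 0 s with h | h
  · have := trunc_bounds hε h
    grind
  · have := trunc_bounds hε (neg_nonneg.2 h)
    rw [trunc_neg] at this
    grind

lemma trunc_sq_le (s : ℝ) : trunc ε s ^ 2 ≤ s ^ 2 :=
  sq_le_sq.2 (abs_trunc_le hε s)

lemma sq_le_trunc_sq (s : ℝ) : s ^ 2 ≤ trunc ε s ^ 2 + 4 * ε * |s| := by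
  have h1 := abs_trunc_sub_le hε s
  have h2 := abs_trunc_le hε s
  have h3 : s ^ 2 - trunc ε s ^ 2 = (s - trunc ε s) * (s + trunc ε s) := by ring
  have h4 : (s - trunc ε s) * (s + trunc ε s) ≤ 2 * ε * (2 * |s|) := by
    refine (le_abs_self _).trans ?_
    rw [abs_mul]
    have := abs_add_le s (trunc ε s)
    gcongr
    linarith
  linarith

lemma D_trunc (hh : DifferentiableAt ℝ h p)
    (i) : D i (fun p => trunc ε (h p)) p = (1 - bump1 (h p / ε)) * D i h p := by
  have h1 := ((hasDerivAt_trunc hε (h p)).comp_hasFDerivAt p hh.hasFDerivAt).fderiv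
  unfold D
  rw [show (fun p => trunc ε (h p)) = trunc ε ∘ h from rfl, h1]
  simp

lemma gradSq_trunc_le (hh : DifferentiableAt ℝ h p) :
    gradSq (fun p => trunc ε (h p)) p ≤ gradSq h p := by
  refine sum_le_sum fun i _ => ?_
  rw [D_trunc hε hh, mul_pow]
  have h1 : 0 ≤ bump1 (h p / ε) := bump1.nonneg
  have h2 : bump1 (h p / ε) ≤ 1 := bump1.le_one
  have : (1 - bump1 (h p / ε)) ^ 2 ≤ 1 := by nlinarith
  nlinarith [sq_nonneg (D i h p)]

lemma test_trunc (hh : ContDiff ℝ ∞ h)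
    (h0 : Tendsto h (cocompact E3) (𝓝 0)) : Test (fun p => trunc ε (h p)) where
  smooth := (contDiff_trunc hε).comp hh
  cpt := by
    rw [hasCompactSupport_iff_eventuallyEq]
    have : ∀ᶠ p in cocompact E3, |h p| < ε := by
      have := h0.abs.eventually (gt_mem_nhds (by rwa [abs_zero]))
      exact this
    rw [coclosedCompact_eq_cocompact]
    filter_upwards [this] with p hp
    exact trunc_eq_zero hε hp.le

end

lemma Test.tendsto (hh : Test h) : Tendsto h (cocompact E3) (𝓝 0) :=
  hh.cpt.is_zero_at_infty

lemma test_div (hk : Test k) (hψ : ContDiff ℝ ∞ ψ)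
    (hz : ∀ p, ψ p = 0 → k =ᶠ[𝓝 p] 0) : Test (fun p => k p / ψ p) where
  smooth := by
    rw [contDiff_iff_contDiffAt]
    intro p
    by_cases hp : ψ p = 0
    · refine (contDiffAt_const (c := (0 : ℝ))).congr_of_eventuallyEq ?_
      filter_upwards [hz p hp] with q hq
      rw [hq]; simp
    · exact hk.smooth.contDiffAt.div hψ.contDiffAt hp
  cpt := by
    simp_rw [div_eq_mul_inv]
    exact hk.cpt.mul_right

lemma trunc_eventuallyEq_zero (hε : 0 < ε) (hh : Continuous h) (hp : |h p| < ε) : (fun p => trunc ε (h p)) =ᶠ[𝓝 p] 0 := by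
  filter_upwards [hh.abs.continuousAt.eventually (gt_mem_nhds hp)] with q hq
  exact trunc_eq_zero hε hq.le

namespace GS

variable {f : ℝ → ℝ}
variable (hQ : GS f Q)
include hQ

lemma integrable_mul_abs (hh : SobH h) : Integrable (fun p => Q p * |h p|) := by
  have := (hQ.sob.integrable_mul hh).abs
  refine this.congr (.of_forall fun p => ?_)
  simp only [abs_mul, abs_of_pos (hQ.pos p)]

lemma form_trunc_le (hε : 0 < ε) (hh : SobH h)
    (ht : SobH (fun p => trunc ε (h p))) :
    form Q (fun p => trunc ε (h p)) ≤ form Q h + 8 * ε * ∫ p, Q p * |h p| := by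
  rw [form, form, ← integral_const_mul,
    ← integral_add (hQ.integrable_form hh) ((hQ.integrable_mul_abs hh).const_mul _)]
  refine integral_mono (hQ.integrable_form ht)
    ((hQ.integrable_form hh).add ((hQ.integrable_mul_abs hh).const_mul _)) fun p => ?_
  simp only
  have h1 := gradSq_trunc_le hε (hh.diff p)
  have h2 := trunc_sq_le hε (h p)
  have h3 := sq_le_trunc_sq hε (h p)
  have h4 := hQ.pos p
  have h5 := abs_nonneg (h p)
  nlinarith [mul_le_mul_of_nonneg_left h3 h4.le]

/-- The potential only matters in a ball. -/
lemma exists_radius : ∃ R > 0, ∀ p, R ≤ rho p → Q p ≤ 1 / 4 := by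
  have := (hQ.prof.lim.eventually (gt_mem_nhds (show (0 : ℝ) < 1 / 4 by norm_num)))
  obtain ⟨r, hr⟩ := eventually_atTop.1 this
  refine ⟨max r 1, by positivity, fun p hp => ?_⟩
  rw [hQ.rad]
  grind

lemma mass_le_form_add (hR : ∀ p, R ≤ rho p → Q p ≤ 1 / 4) (hh : SobH h) :
    mass h ≤ 2 * form Q h + 4 * f 0 * ∫ p in {p | rho p < R}, h p ^ 2 := by
  have hm : MeasurableSet {p : E3 | rho p < R} := measurableSet_lt continuous_rho.measurable
    measurable_const
  rw [mass, form, ← integral_const_mul, ← integral_const_mul, ← integral_indicator hm,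
    ← integral_add ((hQ.integrable_form hh).const_mul 2)
      ((hh.sq.const_mul _).indicator hm)]
  refine integral_mono hh.sq (((hQ.integrable_form hh).const_mul 2).add
      ((hh.sq.const_mul _).indicator hm)) fun p => ?_
  simp only
  have h0 := gradSq_nonneg h p
  have h1 := sq_nonneg (h p)
  by_cases hp : rho p < R
  · rw [Set.indicator_of_mem (show p ∈ {p | rho p < R} from hp)]
    have := hQ.le p
    nlinarith
  · rw [Set.indicator_of_notMem (show p ∉ {p | rho p < R} from hp)]
    have := hR p (not_lt.1 hp)
    nlinarith

end GS

/-- The double integral of the squared differences of `g`. -/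
def osc2 {X : Type*} [MeasurableSpace X] (μ : Measure X) (g : X → ℝ) : ℝ≥0∞ :=
  ∫⁻ x, ∫⁻ x', ofReal ((g x - g x') ^ 2) ∂μ ∂μ

section osc2

variable {X Y : Type*} [MeasurableSpace X] [MeasurableSpace Y] {μ : Measure X} {ν : Measure Y}
lemma ofReal_sq_sub_le (a b c : ℝ) : ofReal ((a - c) ^ 2) ≤
    2 * ofReal ((a - b) ^ 2) + 2 * ofReal ((b - c) ^ 2) := by
  rw [← ENNReal.ofReal_ofNat, ← ENNReal.ofReal_mul (by norm_num), ← ENNReal.ofReal_mul (by norm_num),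
    ← ENNReal.ofReal_add (by positivity) (by positivity)]
  exact ENNReal.ofReal_le_ofReal (by nlinarith [sq_nonneg (a - b - (b - c))])

lemma osc2_prod_le [SFinite μ] [SFinite ν] {g : X × Y → ℝ} (hg : Measurable g) :
    osc2 (μ.prod ν) g ≤ 2 * ν univ * ∫⁻ y, osc2 μ (fun x => g (x, y)) ∂ν
      + 2 * μ univ * ∫⁻ x, osc2 ν (fun y => g (x, y)) ∂μ := by
  have h1 : osc2 (μ.prod ν) g ≤ ∫⁻ p, ∫⁻ q, (2 * ofReal ((g p - g (q.1, p.2)) ^ 2)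
      + 2 * ofReal ((g (q.1, p.2) - g q) ^ 2)) ∂(μ.prod ν) ∂(μ.prod ν) :=
    lintegral_mono fun p => lintegral_mono fun q => ofReal_sq_sub_le _ _ _
  refine h1.trans (le_of_eq ?_)
  have h2 : ∀ p : X × Y, ∫⁻ q, (2 * ofReal ((g p - g (q.1, p.2)) ^ 2)
      + 2 * ofReal ((g (q.1, p.2) - g q) ^ 2)) ∂(μ.prod ν)
      = 2 * ν univ * ∫⁻ x', ofReal ((g p - g (x', p.2)) ^ 2) ∂μ
        + 2 * ∫⁻ x', ∫⁻ y', ofReal ((g (x', p.2) - g (x', y')) ^ 2) ∂ν ∂μ := by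
    intro p
    have m1 : Measurable fun q : X × Y => ofReal ((g p - g (q.1, p.2)) ^ 2) := by
      fun_prop
    have m2 : Measurable fun q : X × Y => ofReal ((g (q.1, p.2) - g q) ^ 2) := by
      fun_prop
    rw [lintegral_add_left (m1.const_mul 2), lintegral_const_mul _ m1, lintegral_const_mul _ m2,
      lintegral_prod _ m1.aemeasurable, lintegral_prod _ m2.aemeasurable]
    simp only [lintegral_const]
    rw [lintegral_mul_const _ (by fun_prop)]
    ring
  simp only [h2]
  have m5 : Measurable fun r : (Y × X) × Y =>
      ofReal ((g (r.1.2, r.1.1) - g (r.1.2, r.2)) ^ 2) := by fun_prop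
  have m6 : Measurable fun r : Y × X =>
      ∫⁻ y', ofReal ((g (r.2, r.1) - g (r.2, y')) ^ 2) ∂ν := m5.lintegral_prod_right'
  have m8 : Measurable fun p : X × Y => ∫⁻ x',
      ∫⁻ y', ofReal ((g (x', p.2) - g (x', y')) ^ 2) ∂ν ∂μ :=
    m6.lintegral_prod_right'.comp measurable_snd
  have m3 : Measurable fun r : (X × Y) × X =>
      ofReal ((g r.1 - g (r.2, r.1.2)) ^ 2) := by fun_prop
  have m4 : Measurable fun p : X × Y => ∫⁻ x', ofReal ((g p - g (x', p.2)) ^ 2) ∂μ :=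
    m3.lintegral_prod_right'
  rw [lintegral_add_left (m4.const_mul _), lintegral_const_mul _ m4,
    lintegral_prod_symm _ m4.aemeasurable,
    lintegral_const_mul _ m8, lintegral_prod _ m8.aemeasurable]
  simp only [lintegral_const]
  rw [lintegral_lintegral_swap (μ := ν) (ν := μ) (f := fun y x' =>
    ∫⁻ y', ofReal ((g (x', y) - g (x', y')) ^ 2) ∂ν) m6.aemeasurable]
  unfold osc2
  ring

lemma osc2_smul_le {μ' : Measure X} {a : ℝ≥0∞} (ha : a ≠ ⊤) (h : μ ≤ a • μ') (g : X → ℝ) :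
    osc2 μ g ≤ a ^ 2 * osc2 μ' g := by
  unfold osc2
  calc ∫⁻ x, ∫⁻ x', ofReal ((g x - g x') ^ 2) ∂μ ∂μ
      ≤ ∫⁻ x, ∫⁻ x', ofReal ((g x - g x') ^ 2) ∂(a • μ') ∂(a • μ') :=
        lintegral_mono' h fun x => lintegral_mono' h fun _ => le_rfl
    _ = a ^ 2 * osc2 μ' g := by
        simp only [lintegral_smul_measure, smul_eq_mul]
        rw [lintegral_const_mul' _ _ ha]
        unfold osc2
        ring

lemma integral_sq_mul_measure_le [IsFiniteMeasure μ] {g : X → ℝ} (hg : Measurable g)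
    (hM : ∀ x, |g x| ≤ M) (hK : 0 ≤ K) (h : osc2 μ g ≤ ofReal K) :
    μ.real univ * ∫ x, g x ^ 2 ∂μ ≤ (∫ x, g x ∂μ) ^ 2 + K := by
  have i1 : Integrable g μ := Integrable.of_bound hg.aestronglyMeasurable M
    (.of_forall hM)
  have i2 : Integrable (fun x => g x ^ 2) μ :=
    Integrable.of_bound (hg.pow_const 2).aestronglyMeasurable (M ^ 2)
    (.of_forall fun x => by
      rw [norm_eq_abs, abs_pow]; bound)
  have e0 : ∀ x, Integrable (fun x' => (g x - g x') ^ 2) μ ∧ ∫ x', (g x - g x') ^ 2 ∂μ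
      = g x ^ 2 * μ.real univ - 2 * (∫ x', g x' ∂μ) * g x + ∫ x', g x' ^ 2 ∂μ := by
    intro x
    have i3 : Integrable (fun x' => g x ^ 2 - (2 * g x) * g x') μ :=
      (integrable_const _).sub (i1.const_mul _)
    simp only [sub_sq]
    refine ⟨i3.add i2, ?_⟩
    rw [integral_add i3 i2, integral_sub (integrable_const _) (i1.const_mul _), integral_const,
      integral_const_mul, smul_eq_mul]
    ring
  set m := ∫ x, g x ∂μ
  set q := ∫ x, g x ^ 2 ∂μ
  set V := μ.real univ
  have i5 : Integrable (fun x => g x ^ 2 * V - 2 * m * g x) μ := (i2.mul_const _).sub (i1.const_mul _)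
  have i6 : Integrable (fun x => g x ^ 2 * V - 2 * m * g x + q) μ := i5.add (integrable_const _)
  have e2 : osc2 μ g = ofReal (2 * V * q - 2 * m ^ 2) := by
    have h0 : ∀ᵐ x ∂μ, 0 ≤ g x ^ 2 * V - 2 * m * g x + q :=
      .of_forall fun x => (e0 x).2 ▸ integral_nonneg fun _ => sq_nonneg _
    simp only [osc2, fun x => ((ofReal_integral_eq_lintegral_ofReal (e0 x).1
      (.of_forall fun _ => sq_nonneg _)).symm.trans (by rw [(e0 x).2]))]
    rw [← ofReal_integral_eq_lintegral_ofReal i6 h0,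
      integral_add i5 (integrable_const _), integral_sub (i2.mul_const _) (i1.const_mul _),
      integral_const, integral_const_mul, integral_mul_const, smul_eq_mul]
    congr 1; ring
  rw [e2, ENNReal.ofReal_le_ofReal_iff hK] at h
  nlinarith

end osc2

lemma sq_sub_le_intervalIntegral {g g' : ℝ → ℝ} (hg : ∀ x, HasDerivAt g (g' x) x)
    (hg' : Continuous g') (hab : a ≤ b) :
    (g b - g a) ^ 2 ≤ (b - a) * ∫ s in a..b, g' s ^ 2 := by
  have h1 : ∫ s in a..b, g' s = g b - g a :=
    intervalIntegral.integral_eq_sub_of_hasDerivAt (fun x _ => hg x)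
      (hg'.intervalIntegrable _ _)
  have i2 : Integrable (fun s => g' s ^ 2) (volume.restrict (Ioc a b)) :=
    (intervalIntegrable_iff_integrableOn_Ioc_of_le hab).1 ((hg'.pow 2).intervalIntegrable a b)
  have := integral_mul_sq_le (memLp_const 1)
    ((memLp_two_iff_integrable_sq hg'.aestronglyMeasurable).2 i2)
  rw [intervalIntegral.integral_of_le hab] at h1 ⊢
  simp_all

/-- A weighted Poincaré inequality on an interval. -/
lemma osc2_withDensity_le {g g' w : ℝ → ℝ} (hg : ∀ x, HasDerivAt g (g' x) x) (hg' : Continuous g')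
    (hw : Continuous w) (hw0 : ∀ x, 0 ≤ w x) (hab : a ≤ b)
    (hm : MonotoneOn w (Icc a b)) (hM : w b ≤ M) :
    let μ := (volume.restrict (Ioc a b)).withDensity fun x => ofReal (w x)
    osc2 μ g ≤ ofReal (M * (b - a) ^ 3) * ∫⁻ s, ofReal (g' s ^ 2) ∂μ := by
  intro μ
  have hgc : Continuous g := continuous_iff_continuousAt.2 fun x => (hg x).continuousAt
  have lw : ∀ {F : ℝ → ℝ≥0∞}, Measurable F →
      ∫⁻ x, F x ∂μ = ∫⁻ x in Ioc a b, ofReal (w x) * F x := fun hF =>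
    lintegral_withDensity_eq_lintegral_mul _ (by fun_prop) hF
  have hM0 : 0 ≤ M := (hw0 b).trans hM
  have hba := sub_nonneg.2 hab
  set I := ∫ s in a..b, w s * g' s ^ 2 with hI
  have hc : Continuous fun s => w s * g' s ^ 2 := by fun_prop
  have h0 : ∀ s, 0 ≤ w s * g' s ^ 2 := fun s => mul_nonneg (hw0 s) (sq_nonneg _)
  have hI0 : 0 ≤ I := intervalIntegral.integral_nonneg hab fun s _ => h0 s
  have hIl : ∫⁻ s, ofReal (g' s ^ 2) ∂μ = ofReal I := by
    rw [lw (by fun_prop), hI, intervalIntegral.integral_of_le hab,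
      ofReal_integral_eq_lintegral_ofReal hc.integrableOn_Ioc (.of_forall h0)]
    simp_all
  have key : ∀ x ∈ Ioc a b, ∀ x' ∈ Ioc a b,
      w x * (w x' * (g x - g x') ^ 2) ≤ M * (b - a) * I := by
    intro x hx x' hx'
    wlog hxx : x ≤ x' generalizing x x'
    · grind
    have h1 := sq_sub_le_intervalIntegral hg hg' hxx
    have hxm := Set.Ioc_subset_Icc_self hx
    have h2 : w x * ∫ s in x..x', g' s ^ 2 ≤ I := by
      rw [← intervalIntegral.integral_const_mul]
      calc ∫ s in x..x', w x * g' s ^ 2 ≤ ∫ s in x..x', w s * g' s ^ 2 := by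
            refine intervalIntegral.integral_mono_on hxx
              (Continuous.intervalIntegrable (by fun_prop) _ _) (hc.intervalIntegrable _ _)
              fun s hs => mul_le_mul_of_nonneg_right
                (hm hxm ⟨hxm.1.trans hs.1, hs.2.trans hx'.2⟩ hs.1) (sq_nonneg _)
        _ ≤ I := intervalIntegral.integral_mono_interval hx.1.le hxx hx'.2
            (.of_forall h0) (hc.intervalIntegrable _ _)
    have h3 : (0 : ℝ) ≤ ∫ s in x..x', g' s ^ 2 :=
      intervalIntegral.integral_nonneg hxx fun s _ => sq_nonneg _
    have h4 : w x' ≤ M :=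
      (hm (Set.Ioc_subset_Icc_self hx') (right_mem_Icc.2 hab) hx'.2).trans hM
    calc w x * (w x' * (g x - g x') ^ 2)
        ≤ w x * (M * ((b - a) * ∫ s in x..x', g' s ^ 2)) := by
          rw [sub_sq_comm]
          have := hw0 x
          gcongr
          exact h1.trans (by gcongr; exacts [hx'.2, hx.1.le])
      _ = M * (b - a) * (w x * ∫ s in x..x', g' s ^ 2) := by ring
      _ ≤ _ := by gcongr
  have mi : Measurable fun r : ℝ × ℝ => ofReal ((g r.1 - g r.2) ^ 2) := by fun_prop
  have : SFinite μ := inferInstanceAs (SFinite (Measure.withDensity _ _))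
  have hconst : ∀ c : ℝ, ∫⁻ _ in Ioc a b, ofReal c = ofReal ((b - a) * c) := by
    simp [mul_comm, ENNReal.ofReal_mul' hba]
  rw [hIl, ← ENNReal.ofReal_mul (by positivity), osc2, lw mi.lintegral_prod_right',
    show M * (b - a) ^ 3 * I = (b - a) * ((b - a) * (M * (b - a) * I)) by ring, ← hconst]
  refine setLIntegral_mono' measurableSet_Ioc fun x hx => ?_
  rw [lw (by fun_prop), ← lintegral_const_mul _ (by fun_prop), ← hconst]
  refine setLIntegral_mono' measurableSet_Ioc fun x' hx' => ?_
  rw [← ENNReal.ofReal_mul (hw0 _), ← ENNReal.ofReal_mul (hw0 _)]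
  exact ENNReal.ofReal_le_ofReal (key x hx x' hx')

/-- The half box `(0, R] × (-R, R]²`. -/
def hbox (R : ℝ) : Set E3 := Ioc 0 R ×ˢ (Ioc (-R) R ×ˢ Ioc (-R) R)

lemma measurableSet_hbox (R : ℝ) : MeasurableSet (hbox R) :=
  measurableSet_Ioc.prod (measurableSet_Ioc.prod measurableSet_Ioc)

section
variable (hF : Differentiable ℝ F)
include hF

lemma hasDerivAt_fst (x : ℝ) (q : ℝ × ℝ) :
    HasDerivAt (fun a => F (a, q)) (D 0 F (x, q)) x := by
  have h : HasDerivAt (fun a : ℝ => ((a, q) : E3)) (1, 0, 0) x :=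
    (hasDerivAt_id x).prodMk (hasDerivAt_const x q)
  exact (hF (x, q)).hasFDerivAt.comp_hasDerivAt x h

lemma hasDerivAt_snd (x y z : ℝ) :
    HasDerivAt (fun b => F (x, b, z)) (D 1 F (x, y, z)) y := by
  have h : HasDerivAt (fun b : ℝ => ((x, b, z) : E3)) (0, 1, 0) y :=
    (hasDerivAt_const y x).prodMk ((hasDerivAt_id y).prodMk (hasDerivAt_const y z))
  exact (hF (x, y, z)).hasFDerivAt.comp_hasDerivAt y h

lemma hasDerivAt_thd (x y z : ℝ) :
    HasDerivAt (fun c => F (x, y, c)) (D 2 F (x, y, z)) z := by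
  have h : HasDerivAt (fun c : ℝ => ((x, y, c) : E3)) (0, 0, 1) z :=
    (hasDerivAt_const z x).prodMk ((hasDerivAt_const z y).prodMk (hasDerivAt_id z))
  exact (hF (x, y, z)).hasFDerivAt.comp_hasDerivAt z h

end

lemma exists_osc2_hbox (hR : 0 < R) : ∃ K : ℝ≥0∞, K ≠ ⊤ ∧ ∀ g : E3 → ℝ,
    ContDiff ℝ ∞ g →
    osc2 ((volume.restrict (hbox R)).withDensity fun p => ofReal (p.1 ^ 2)) g ≤
      K * ∫⁻ p, ofReal (gradSq g p)
        ∂((volume.restrict (hbox R)).withDensity fun p => ofReal (p.1 ^ 2)) := by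
  set μ := (volume.restrict (Ioc 0 R)).withDensity fun x => ofReal (x ^ 2) with hμ
  set ν : Measure ℝ := volume.restrict (Ioc (-R) R) with hν
  have hbm : (volume.restrict (hbox R)).withDensity (fun p => ofReal (p.1 ^ 2))
      = μ.prod (ν.prod ν) := by
    rw [hμ, prod_withDensity_left (by fun_prop), hν, Measure.prod_restrict, Measure.prod_restrict]
    rfl
  have hμf : μ univ ≠ ⊤ := by
    have := isFiniteMeasure_withDensity_ofReal
      (continuous_pow 2 : Continuous fun x : ℝ => x ^ 2).integrableOn_Ioc.2 (μ :=
        volume.restrict (Ioc 0 R))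
    exact measure_ne_top _ _
  have : SFinite μ := inferInstanceAs (SFinite (Measure.withDensity _ _))
  set A := ofReal (R ^ 2 * (R - 0) ^ 3)
  set B := ofReal (1 * (R - -R) ^ 3)
  set n := ν univ with hn
  have hνf : n ≠ ⊤ := measure_ne_top _ _
  have ho : ∀ f f' : ℝ → ℝ, (∀ x, HasDerivAt f (f' x) x) → Continuous f' →
      osc2 ν f ≤ B * ∫⁻ s, ofReal (f' s ^ 2) ∂ν := fun f f' hf hf' => by
    simpa only [ENNReal.ofReal_one, withDensity_const, one_smul] using osc2_withDensity_le hf hf'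
      continuous_const (w := fun _ => 1) (by simp) (a := -R) (b := R) (by linarith)
      (fun _ _ _ _ _ => le_rfl) le_rfl
  refine ⟨2 * (ν.prod ν) univ * A + 2 * μ univ * (2 * n * B + 2 * n * B), by finiteness, ?_⟩
  intro g hg
  rw [hbm]
  have hd : Differentiable ℝ g := hg.differentiable (by simp)
  have hD : ∀ i, Continuous (D i g) := fun i => (hg.D i).continuous
  have hgc := hg.continuous
  have hle : ∀ i p, D i g p ^ 2 ≤ gradSq g p := fun i p =>
    single_le_sum (f := fun i => D i g p ^ 2)
      (fun i _ => sq_nonneg _) (mem_univ i)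
  have mG : Measurable fun p => ofReal (gradSq g p) := by
    unfold gradSq
    have := hD
    fun_prop
  have t1 : ∫⁻ q, osc2 μ (fun x => g (x, q)) ∂(ν.prod ν) ≤
      A * ∫⁻ p, ofReal (gradSq g p) ∂(μ.prod (ν.prod ν)) := by
    rw [lintegral_prod_symm _ mG.aemeasurable, ← lintegral_const_mul _ mG.lintegral_prod_left']
    refine lintegral_mono fun q => ?_
    refine (osc2_withDensity_le (fun x => hasDerivAt_fst hd x q) (by fun_prop) (by fun_prop)
      sq_nonneg hR.le (fun _ hx _ _ h => pow_le_pow_left₀ hx.1 h 2) le_rfl).trans ?_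
    gcongr with x
    exact hle 0 _
  have t2 : ∀ x, osc2 (ν.prod ν) (fun q => g (x, q)) ≤
      (2 * n * B + 2 * n * B) * ∫⁻ q, ofReal (gradSq g (x, q)) ∂(ν.prod ν) := by
    intro x
    have mGx : Measurable fun q : ℝ × ℝ => ofReal (gradSq g (x, q)) :=
      mG.comp measurable_prodMk_left
    refine (osc2_prod_le (by fun_prop)).trans ?_
    rw [add_mul, mul_assoc (2 * n)]
    gcongr
    · rw [lintegral_prod_symm _ mGx.aemeasurable, ← lintegral_const_mul _ mGx.lintegral_prod_left']
      refine lintegral_mono fun z => ?_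
      refine (ho _ _ (fun y => hasDerivAt_snd hd x y z) (by fun_prop)).trans ?_
      gcongr with y
      exact hle 1 _
    · rw [lintegral_prod _ mGx.aemeasurable, ← lintegral_const_mul _ mGx.lintegral_prod_right']
      refine lintegral_mono fun y => ?_
      refine (ho _ _ (fun z => hasDerivAt_thd hd x y z) (by fun_prop)).trans ?_
      gcongr with z
      exact hle 2 _
  refine (osc2_prod_le hgc.measurable).trans ?_
  rw [add_mul, mul_assoc (2 * _), mul_assoc (2 * _)]
  gcongr
  rw [lintegral_prod _ mG.aemeasurable, ← lintegral_const_mul _ mG.lintegral_prod_right']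
  exact lintegral_mono t2

/-- A weighted Poincaré inequality on a half box. -/
lemma exists_hbox_poincare (hR : 0 < R) (hc : 0 < c) (hφ : Continuous φ) (h1 : ∀ p ∈ hbox R, c * p.1 ≤ φ p) (h2 : ∀ p ∈ hbox R, φ p ≤ C * p.1) :
    ∃ K, 0 ≤ K ∧ ∀ g, Test g → (∫ p in hbox R, φ p ^ 2) * ∫ p in hbox R, φ p ^ 2 * g p ^ 2 ≤
      (∫ p in hbox R, φ p ^ 2 * g p) ^ 2 + K * ∫ p in hbox R, φ p ^ 2 * gradSq g p := by
  obtain ⟨K, hK, hKg⟩ := exists_osc2_hbox hR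
  set β := (volume.restrict (hbox R)).withDensity fun p => ofReal (p.1 ^ 2) with hβ
  set γ := (volume.restrict (hbox R)).withDensity fun p => ofReal (φ p ^ 2) with hγ
  have hpos : ∀ p ∈ hbox R, 0 < p.1 := fun p hp => hp.1.1
  have mφ : Measurable fun p : E3 => ofReal (φ p ^ 2) := by fun_prop
  have dm : ∀ {v w : E3 → ℝ} {k : ℝ}, Continuous v → (∀ p ∈ hbox R, 0 ≤ w p ∧ w p ≤ k * v p) →
      (volume.restrict (hbox R)).withDensity (fun p => ofReal (w p ^ 2)) ≤ ofReal
        (k ^ 2) • (volume.restrict (hbox R)).withDensity fun p => ofReal (v p ^ 2) := by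
    intro v w k hv h
    rw [← withDensity_smul _ (by fun_prop)]
    refine withDensity_mono ?_
    filter_upwards [ae_restrict_mem (measurableSet_hbox R)] with p hp
    rw [Pi.smul_apply, smul_eq_mul, ← ENNReal.ofReal_mul (sq_nonneg _), ← mul_pow]
    exact ENNReal.ofReal_le_ofReal (pow_le_pow_left₀ (h p hp).1 (h p hp).2 2)
  have a1 : γ ≤ ofReal (C ^ 2) • β := dm continuous_fst fun p hp =>
    ⟨(mul_nonneg hc.le (hpos p hp).le).trans (h1 p hp), h2 p hp⟩
  have a2 : β ≤ ofReal ((c⁻¹) ^ 2) • γ := dm hφ fun p hp =>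
    ⟨(hpos p hp).le, (le_inv_mul_iff₀ hc).2 (h1 p hp)⟩
  set K' := ofReal (C ^ 2) ^ 2 * (K * ofReal ((c⁻¹) ^ 2)) with hK'
  have hK't : K' ≠ ⊤ := by finiteness
  have hbd : hbox R ⊆ Icc 0 R ×ˢ (Icc (-R) R ×ˢ Icc (-R) R) :=
    Set.prod_mono Set.Ioc_subset_Icc_self (Set.prod_mono Set.Ioc_subset_Icc_self
      Set.Ioc_subset_Icc_self)
  have hint : ∀ F : E3 → ℝ, Continuous F → IntegrableOn F (hbox R) := fun F hF =>
    (hF.continuousOn.integrableOn_compact (isCompact_Icc.prod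
      (isCompact_Icc.prod isCompact_Icc))).mono_set hbd
  have : IsFiniteMeasure γ :=
    isFiniteMeasure_withDensity_ofReal (hint _ (hφ.pow 2)).2
  have conv : ∀ F : E3 → ℝ, ∫ p, F p ∂γ = ∫ p in hbox R, φ p ^ 2 * F p := fun F => by
    rw [hγ, integral_withDensity_eq_integral_toReal_smul mφ (by simp)]
    simp [ENNReal.toReal_ofReal, sq_nonneg]
  refine ⟨K'.toReal, ENNReal.toReal_nonneg, fun g hg => ?_⟩
  have hgint : Integrable (gradSq g) γ :=
    (continuous_gradSq hg.smooth).integrable_of_hasCompactSupport hg.cpt_gradSq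
  have hG : ∫⁻ p, ofReal (gradSq g p) ∂γ
      = ofReal (∫ p in hbox R, φ p ^ 2 * gradSq g p) := by
    rw [← conv, ofReal_integral_eq_lintegral_ofReal hgint
      (.of_forall fun p => gradSq_nonneg g p)]
  have hosc : osc2 γ g ≤ ofReal (K'.toReal * ∫ p in hbox R, φ p ^ 2 * gradSq g p) := by
    rw [ENNReal.ofReal_mul ENNReal.toReal_nonneg, ENNReal.ofReal_toReal hK't, ← hG]
    refine (osc2_smul_le ENNReal.ofReal_ne_top a1 g).trans ?_
    rw [hK', mul_assoc, mul_assoc, ← smul_eq_mul (ofReal _), ← lintegral_smul_measure]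
    gcongr
    exact (hKg g hg.smooth).trans (by gcongr)
  obtain ⟨M, hM⟩ := hg.cpt.exists_bound_of_continuous hg.smooth.continuous
  have hnn : 0 ≤ ∫ p in hbox R, φ p ^ 2 * gradSq g p :=
    integral_nonneg fun p => mul_nonneg (sq_nonneg _) (gradSq_nonneg _ _)
  have := integral_sq_mul_measure_le hg.smooth.continuous.measurable hM
    (mul_nonneg ENNReal.toReal_nonneg hnn) hosc
  have e1 : γ.real univ = ∫ p in hbox R, φ p ^ 2 := by simpa using conv fun _ => 1
  grind

/-- Reflection of the first coordinate. -/
def rx : E3 →L[ℝ] E3 :=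
  (-ContinuousLinearMap.fst ℝ ℝ (ℝ × ℝ)).prod (ContinuousLinearMap.snd ℝ ℝ (ℝ × ℝ))

/-- Exchange of the first two coordinates. -/
def sxy : E3 →L[ℝ] E3 :=
  ((ContinuousLinearMap.fst ℝ ℝ ℝ).comp (ContinuousLinearMap.snd ℝ ℝ (ℝ × ℝ))).prod
    ((ContinuousLinearMap.fst ℝ ℝ (ℝ × ℝ)).prod
      ((ContinuousLinearMap.snd ℝ ℝ ℝ).comp (ContinuousLinearMap.snd ℝ ℝ (ℝ × ℝ))))

/-- Exchange of the first and the last coordinate. -/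
def sxz : E3 →L[ℝ] E3 :=
  ((ContinuousLinearMap.snd ℝ ℝ ℝ).comp (ContinuousLinearMap.snd ℝ ℝ (ℝ × ℝ))).prod
    (((ContinuousLinearMap.fst ℝ ℝ ℝ).comp (ContinuousLinearMap.snd ℝ ℝ (ℝ × ℝ))).prod
      (ContinuousLinearMap.fst ℝ ℝ (ℝ × ℝ)))

@[simp] lemma rx_apply (p : E3) : rx p = (-p.1, p.2) := rfl
@[simp] lemma sxy_apply (p : E3) : sxy p = (p.2.1, p.1, p.2.2) := rfl
@[simp] lemma sxz_apply (p : E3) : sxz p = (p.2.2, p.2.1, p.1) := rfl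

lemma iso_rx : Iso rx := fun p => by simp [rho]
lemma iso_sxy : Iso sxy := fun p => by
  simp only [rho, sxy_apply]; congr 1; ring
lemma iso_sxz : Iso sxz := fun p => by
  simp only [rho, sxz_apply]; congr 1; ring

/-- The open half space `x > 0`. -/
def hspace : Set E3 := {p | 0 < p.1}

lemma measurableSet_hspace : MeasurableSet hspace := measurableSet_lt measurable_const measurable_fst

lemma hbox_subset (R : ℝ) : hbox R ⊆ hspace := fun _ hp => hp.1.1

lemma integral_eq_two_mul_hspace (hF : Integrable F) (he : ∀ p, F (rx p) = F p) :
    ∫ p, F p = 2 * ∫ p in hspace, F p := by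
  have h0 : volume {p : E3 | p.1 = 0} = 0 := by
    have : {p : E3 | p.1 = 0} = {(0 : ℝ)} ×ˢ (univ : Set (ℝ × ℝ)) := by
      ext p; simp
    rw [this, Measure.volume_eq_prod, Measure.prod_prod]
    simp
  have h1 : ∫ p in hspaceᶜ, F p = ∫ p in hspace, F p := by
    rw [← integral_indicator measurableSet_hspace.compl, ← integral_indicator measurableSet_hspace,
      ← iso_rx.integral_comp (Set.indicator hspace F)]
    refine integral_congr_ae ?_
    have : ∀ᵐ p : E3, p.1 ≠ 0 := by
      rw [ae_iff]
      simpa using h0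
    filter_upwards [this] with p hp
    rcases lt_or_gt_of_ne hp with h | h
    · rw [Set.indicator_of_mem (show p ∈ hspaceᶜ from not_lt.2 h.le),
        Set.indicator_of_mem (show rx p ∈ hspace from by simpa [hspace] using h), he]
    · rw [Set.indicator_of_notMem (by simpa [hspace] using h),
        Set.indicator_of_notMem (by simpa [hspace] using h.le)]
  rw [← integral_add_compl measurableSet_hspace hF, h1]
  ring

lemma hbox_mono (h : R ≤ S) : hbox R ⊆ hbox S :=
  Set.prod_mono (Set.Ioc_subset_Ioc_right h) (Set.prod_mono
    (Set.Ioc_subset_Ioc (by linarith) h) (Set.Ioc_subset_Ioc (by linarith) h))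

lemma rho_le_of_mem_hbox (hp : p ∈ hbox R) : rho p ≤ 2 * R := by
  obtain ⟨⟨h1, h2⟩, ⟨h3, h4⟩, h5, h6⟩ := hp
  refine abs_le_of_sq_le_sq' ?_ (by linarith) |>.2
  rw [rho_sq, Fin.sum_univ_three]
  simp only [co, Matrix.cons_val]
  nlinarith

lemma mem_hbox_of_rho_lt (h : rho p < R) (hp : p ∈ hspace) : p ∈ hbox R := by
  have h0 := abs_le.1 ((abs_co_le_rho p 0).trans h.le)
  have h1 := abs_lt.1 ((abs_co_le_rho p 1).trans_lt h)
  have h2 := abs_lt.1 ((abs_co_le_rho p 2).trans_lt h)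
  exact ⟨⟨hp, h0.2⟩, ⟨h1.1, h1.2.le⟩, h2.1, h2.2.le⟩

lemma volume_hbox_ne_zero (hR : 0 < R) : volume (hbox R) ≠ 0 := by
  rw [hbox, Measure.volume_eq_prod, Measure.prod_prod, Measure.volume_eq_prod, Measure.prod_prod]
  simp only [volume_Ioc, ne_eq, mul_eq_zero, ENNReal.ofReal_eq_zero, not_or, not_le]
  exact ⟨by linarith, by linarith, by linarith⟩

lemma continuous_integrableOn_hbox (hF : Continuous F) (R : ℝ) :
    IntegrableOn F (hbox R) :=
  (hF.continuousOn.integrableOn_compact (isCompact_Icc.prod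
      (isCompact_Icc.prod isCompact_Icc))).mono_set
    (Set.prod_mono Set.Ioc_subset_Icc_self (Set.prod_mono Set.Ioc_subset_Icc_self
      Set.Ioc_subset_Icc_self))

namespace GS

variable {f : ℝ → ℝ}
lemma phi_pos (hQ : GS f Q) (hp : p ∈ hspace) : 0 < - D 0 Q p := by
  rw [hQ.D_eq]
  have h1 := hQ.prof.kk_neg (rho_nonneg p)
  have h2 : 0 < co p 0 := hp
  nlinarith

lemma exists_odd_local (hQ : GS f Q) (hR : 0 < R) : ∃ K, 0 ≤ K ∧ ∀ h, Test h →
    (∀ p, h (rx p) = - h p) →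
    (∫ p in hbox R, D 0 Q p ^ 2) * ∫ p in hbox R, h p ^ 2 ≤
      (∫ p in hbox R, D 0 Q p * h p) ^ 2 + K * form Q h := by
  set φ : E3 → ℝ := fun p => (-1) * D 0 Q p with hφ
  have hsm : ContDiff ℝ ∞ (D 0 Q) := hQ.smooth.D 0
  have hφs : ContDiff ℝ ∞ φ := contDiff_const.mul hsm
  have hφc := hφs.continuous
  obtain ⟨c, hc, C, -, hb⟩ := hQ.prof.exists_kk_bound (R := 2 * R) (by positivity)
  have hφv : ∀ p, φ p = p.1 * (- kk f (rho p)) := fun p => by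
    simp only [hφ, hQ.D_eq, co, Matrix.cons_val_zero]; ring
  obtain ⟨K, hK, hKg⟩ := exists_hbox_poincare hR hc hφc (C := C)
    (fun p hp => by
      rw [hφv, mul_comm]
      exact mul_le_mul_of_nonneg_left (hb _ (rho_nonneg p) (rho_le_of_mem_hbox hp)).1 hp.1.1.le)
    (fun p hp => by
      rw [hφv, mul_comm C]
      exact mul_le_mul_of_nonneg_left (hb _ (rho_nonneg p) (rho_le_of_mem_hbox hp)).2 hp.1.1.le)
  have hφz : ∀ p, φ p = 0 → p.1 = 0 := fun p hp => by
    rw [hφv] at hp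
    rcases mul_eq_zero.1 hp with h | h
    · exact h
    · linarith [hQ.prof.kk_neg (rho_nonneg p)]
  have hlφ : ∀ p, φ p * (- lap φ p + (1 - 2 * Q p) * φ p) = 0 := fun p => by
    rw [hφ, lap_const_mul _ hsm, hQ.lap_D_eq]; ring
  refine ⟨K, hK, fun h hh hodd => ?_⟩
  have hV : (∫ p in hbox R, D 0 Q p ^ 2) = ∫ p in hbox R, φ p ^ 2 := by simp [hφ]
  set V := ∫ p in hbox R, φ p ^ 2 with hVd
  have hV0 : 0 ≤ V := integral_nonneg fun p => sq_nonneg _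
  have hhc := hh.smooth.continuous
  set A := ∫ p in hbox R, |φ p|
  set B := ∫ p, Q p * |h p|
  set E := ∫ p in hbox R, |h p|
  have key : ∀ ε > 0, V * ∫ p in hbox R, h p ^ 2 ≤
      (|∫ p in hbox R, D 0 Q p * h p| + 2 * ε * A) ^ 2 + K * (form Q h + 8 * ε * B)
        + V * (4 * ε * E) := by
    intro ε hε
    have ht : Test (fun p => trunc ε (h p)) := test_trunc hε hh.smooth hh.tendsto
    have htc := ht.smooth.continuous
    have hg : Test (fun p => trunc ε (h p) / φ p) := test_div ht hφs fun p hp => by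
      refine trunc_eventuallyEq_zero hε hhc ?_
      have h1 : rx p = p := Prod.ext (by simp [hφz p hp]) rfl
      have h2 := hodd p
      rw [h1] at h2
      rw [show h p = 0 by linarith]
      simpa using hε
    have hmul : ∀ p, trunc ε (h p) / φ p * φ p = trunc ε (h p) := fun p => by
      by_cases hp : φ p = 0
      · have h1 : rx p = p := Prod.ext (by simp [hφz p hp]) rfl
        have h2 := hodd p
        rw [h1] at h2
        rw [show h p = 0 by linarith, hp, trunc_eq_zero hε (by simpa using hε.le)]
        simp
      · field_simp
    have hform : form Q (fun p => trunc ε (h p))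
        = ∫ p, φ p ^ 2 * gradSq (fun p => trunc ε (h p) / φ p) p := by
      have := form_mul hQ.continuous hg hφs
      simp only [hmul, hlφ, mul_zero, add_zero] at this
      exact this
    set g := fun p => trunc ε (h p) / φ p with hgd
    have hGi : Integrable (fun p => φ p ^ 2 * gradSq g p) :=
      ((hφc.pow 2).mul (continuous_gradSq hg.smooth)).integrable_of_hasCompactSupport (hg.cpt_gradSq.mul_left)
    have h1 := hKg g hg
    have h2 : ∫ p in hbox R, φ p ^ 2 * gradSq g p ≤ form Q h + 8 * ε * B := by
      refine le_trans ?_ (hQ.form_trunc_le hε hh.sob ht.sob)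
      rw [hform]
      exact setIntegral_le_integral hGi (.of_forall fun p =>
        mul_nonneg (sq_nonneg _) (gradSq_nonneg _ _))
    have h3 : ∫ p in hbox R, φ p ^ 2 * g p ^ 2 = ∫ p in hbox R, trunc ε (h p) ^ 2 := by
      congr 1; ext p
      rw [← hmul p]; ring
    have h4 : ∫ p in hbox R, φ p ^ 2 * g p = ∫ p in hbox R, φ p * trunc ε (h p) := by
      congr 1; ext p
      rw [← hmul p]; ring
    have h5 : |∫ p in hbox R, φ p * trunc ε (h p)| ≤ |∫ p in hbox R, D 0 Q p * h p|
        + 2 * ε * A := by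
      have e1 : ∫ p in hbox R, φ p * trunc ε (h p) = (∫ p in hbox R, φ p * h p)
          - ∫ p in hbox R, φ p * (h p - trunc ε (h p)) := by
        rw [← integral_sub (continuous_integrableOn_hbox (by fun_prop) R)
          (continuous_integrableOn_hbox (by fun_prop) R)]
        congr 1; ext p; ring
      have e2 : |∫ p in hbox R, φ p * (h p - trunc ε (h p))| ≤ 2 * ε * A := by
        refine (abs_integral_le_integral_abs).trans ?_
        rw [← integral_const_mul]
        refine integral_mono (continuous_integrableOn_hbox (by fun_prop) R)
          (continuous_integrableOn_hbox (by fun_prop) R) fun p => ?_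
        simp only [abs_mul]
        nlinarith [abs_trunc_sub_le hε (h p), abs_nonneg (φ p)]
      have e3 : |∫ p in hbox R, φ p * h p| = |∫ p in hbox R, D 0 Q p * h p| := by
        simp only [hφ, mul_assoc, integral_const_mul, abs_mul]
        simp
      rw [e1, ← e3]
      exact (abs_sub _ _).trans (by linarith)
    have h6 : ∫ p in hbox R, h p ^ 2 ≤ (∫ p in hbox R, trunc ε (h p) ^ 2) + 4 * ε * E := by
      rw [← integral_const_mul, ← integral_add (continuous_integrableOn_hbox (by fun_prop) R)
        (continuous_integrableOn_hbox (by fun_prop) R)]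
      exact integral_mono (continuous_integrableOn_hbox (by fun_prop) R)
        (continuous_integrableOn_hbox (by fun_prop) R) fun p => sq_le_trunc_sq hε _
    rw [h3, h4] at h1
    have h7 : (∫ p in hbox R, φ p * trunc ε (h p)) ^ 2 ≤
        (|∫ p in hbox R, D 0 Q p * h p| + 2 * ε * A) ^ 2 := by
      rw [← sq_abs]
      exact pow_le_pow_left₀ (abs_nonneg _) h5 2
    nlinarith [mul_le_mul_of_nonneg_left h6 hV0, mul_le_mul_of_nonneg_left h2 hK]
  rw [hV]
  have lim : Tendsto (fun ε => (|∫ p in hbox R, D 0 Q p * h p| + 2 * ε * A) ^ 2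
      + K * (form Q h + 8 * ε * B) + V * (4 * ε * E)) (𝓝[>] 0)
      (𝓝 ((|∫ p in hbox R, D 0 Q p * h p| + 2 * 0 * A) ^ 2
      + K * (form Q h + 8 * 0 * B) + V * (4 * 0 * E))) :=
    ((by fun_prop : Continuous fun ε : ℝ => (|∫ p in hbox R, D 0 Q p * h p| + 2 * ε * A) ^ 2
      + K * (form Q h + 8 * ε * B) + V * (4 * ε * E)).tendsto 0).mono_left nhdsWithin_le_nhds
  have := ge_of_tendsto lim (eventually_mem_nhdsWithin.mono key)
  simpa using this

/-- Coercivity on functions odd in the first variable, up to the kernel element `∂ₓQ`. -/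
lemma exists_odd_coercive (hQ : GS f Q) : ∃ κ > 0, ∃ C, 0 ≤ C ∧ ∀ h, Test h →
    (∀ p, h (rx p) = - h p) → κ * mass h ≤ form Q h + C * (∫ p, D 0 Q p * h p) ^ 2 := by
  obtain ⟨R₀, hR₀, hq⟩ := hQ.exists_radius
  have hDi : Integrable (fun p => D 0 Q p ^ 2) := hQ.sob.dsq 0
  set V := ∫ p in hbox R₀, D 0 Q p ^ 2 with hV
  have hVpos : 0 < V := by
    rw [hV, setIntegral_pos_iff_support_of_nonneg_ae
      (.of_forall fun p => sq_nonneg _) hDi.integrableOn]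
    have : Function.support (fun p => D 0 Q p ^ 2) ∩ hbox R₀ = hbox R₀ := by
      refine Set.inter_eq_right.2 fun p hp => ?_
      have := hQ.phi_pos (hbox_subset _ hp)
      simp only [Function.mem_support, ne_eq, pow_eq_zero_iff, OfNat.ofNat_ne_zero,
        not_false_eq_true]
      linarith
    rw [this]
    exact (volume_hbox_ne_zero hR₀).bot_lt
  have hf0 := hQ.f0_pos
  have hδ : Tendsto (fun n : ℕ => ∫ p in hspace \ hbox n, D 0 Q p ^ 2) atTop (𝓝 0) := by
    have := tendsto_setIntegral_of_antitone (μ := volume) (f := fun p => D 0 Q p ^ 2)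
      (s := fun n : ℕ => hspace \ hbox n)
      (fun n => measurableSet_hspace.diff (measurableSet_hbox n))
      (fun n m hnm => Set.sdiff_subset_sdiff_right (hbox_mono (by exact_mod_cast hnm)))
      ⟨0, hDi.integrableOn⟩
    have he : ⋂ n : ℕ, hspace \ hbox (n : ℝ) = ∅ := by
      refine Set.eq_empty_of_forall_notMem fun p hp => ?_
      obtain ⟨n, hn⟩ := exists_nat_gt (rho p)
      have := Set.mem_iInter.1 hp n
      exact this.2 (mem_hbox_of_rho_lt hn this.1)
    rw [he] at this
    simpa using this
  obtain ⟨n, hn1, hn2⟩ := ((hδ.eventually_le_const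
    (show 0 < V / (32 * f 0) by positivity)).and
      (tendsto_natCast_atTop_atTop.eventually_ge_atTop R₀)).exists
  set R : ℝ := (n : ℝ)
  have hR : 0 < R := hR₀.trans_le hn2
  obtain ⟨K, hK, hl⟩ := hQ.exists_odd_local hR
  refine ⟨(1 / 2) / (2 + 8 * f 0 * K / V), by positivity, (4 * f 0 / V), by positivity,
    fun h hh hodd => ?_⟩
  have hhc := hh.smooth.continuous
  have h1 := hQ.mass_le_form_add hq hh.sob
  have hloc := hl h hh hodd
  have hm0 := mass_nonneg h
  set J := ∫ p in hbox R, h p ^ 2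
  have hJ0 : 0 ≤ J := integral_nonneg fun p => sq_nonneg _
  have h2 : ∫ p in {p | rho p < R₀}, h p ^ 2 ≤ 2 * J := by
    have hms : MeasurableSet {p : E3 | rho p < R₀} :=
      measurableSet_lt continuous_rho.measurable measurable_const
    have e1 : ∫ p in {p | rho p < R₀}, h p ^ 2
        = 2 * ∫ p in hspace, Set.indicator {p | rho p < R₀} (fun p => h p ^ 2) p := by
      rw [← integral_indicator hms]
      refine integral_eq_two_mul_hspace (hh.sob.sq.indicator hms) fun p => ?_
      simp only [Set.indicator, Set.mem_ofPred_eq, iso_rx p, hodd p, neg_sq]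
    rw [e1]
    refine mul_le_mul_of_nonneg_left ?_ (by norm_num)
    have e2 : J = ∫ p, Set.indicator (hbox R) (fun p => h p ^ 2) p :=
      (integral_indicator (measurableSet_hbox R)).symm
    rw [e2, ← integral_indicator measurableSet_hspace]
    refine integral_mono ((hh.sob.sq.indicator hms).indicator measurableSet_hspace)
      (hh.sob.sq.indicator (measurableSet_hbox R)) fun p => ?_
    by_cases hp1 : p ∈ hspace
    · by_cases hp2 : rho p < R₀
      · have : p ∈ hbox R := mem_hbox_of_rho_lt (hp2.trans_le hn2) hp1
        simp [Set.indicator, hp1, hp2, this]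
      · simp only [Set.indicator, hp1, Set.mem_ofPred_eq, hp2, if_true, if_false]
        split_ifs <;> positivity
    · simp only [Set.indicator, hp1, if_false]
      split_ifs <;> positivity
  have h3 : V ≤ ∫ p in hbox R, D 0 Q p ^ 2 :=
    setIntegral_mono_set hDi.integrableOn (.of_forall fun p => sq_nonneg _)
      (hbox_mono hn2).eventuallyLE
  have hhi : Integrable (fun p => D 0 Q p * h p) :=
    (hQ.sob.dmemLp 0).integrable_mul hh.sob.memLp
  set m := ∫ p, D 0 Q p * h p with hm
  have h4 : (∫ p in hbox R, D 0 Q p * h p) ^ 2 ≤ m ^ 2 / 2 + 2 * (V / (32 * f 0)) * mass h := by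
    have e1 : m = 2 * ∫ p in hspace, D 0 Q p * h p := by
      refine integral_eq_two_mul_hspace hhi fun p => ?_
      rw [hodd, hQ.D_eq, hQ.D_eq, iso_rx p]
      simp [co]
    have e2 : ∫ p in hspace, D 0 Q p * h p = (∫ p in hbox R, D 0 Q p * h p)
        + ∫ p in hspace \ hbox R, D 0 Q p * h p := by
      rw [setIntegral_sdiff (measurableSet_hbox R) hhi.integrableOn (hbox_subset R)]
      ring
    have e3 : (∫ p in hspace \ hbox R, D 0 Q p * h p) ^ 2 ≤ V / (32 * f 0) * mass h := by
      refine (integral_mul_sq_le ((hQ.sob.dmemLp 0).restrict _)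
        (hh.sob.memLp.restrict _)).trans ?_
      refine mul_le_mul hn1 ?_ (integral_nonneg fun p => sq_nonneg _) (by positivity)
      exact setIntegral_le_integral hh.sob.sq (.of_forall fun p => sq_nonneg _)
    rw [e1, e2]
    nlinarith [sq_nonneg ((∫ p in hbox R, D 0 Q p * h p)
      + 2 * ∫ p in hspace \ hbox R, D 0 Q p * h p)]
  have h5 : V * J ≤ m ^ 2 / 2 + 2 * (V / (32 * f 0)) * mass h + K * form Q h := by
    nlinarith [mul_le_mul_of_nonneg_right h3 hJ0]
  have h6 : J ≤ m ^ 2 / (2 * V) + mass h / (16 * f 0) + K * form Q h / V := by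
    rw [← mul_le_mul_iff_right₀ hVpos]
    refine h5.trans (le_of_eq ?_)
    field_simp
    ring
  have h7 : mass h / 2 ≤ (2 + 8 * f 0 * K / V) * form Q h + 4 * f 0 / V * m ^ 2 := by
    have : 8 * f 0 * J ≤ 8 * f 0 * (m ^ 2 / (2 * V) + mass h / (16 * f 0) + K * form Q h / V) := by
      gcongr
    have e : 8 * f 0 * (m ^ 2 / (2 * V) + mass h / (16 * f 0) + K * form Q h / V)
        = 4 * f 0 / V * m ^ 2 + mass h / 2 + 8 * f 0 * K / V * form Q h := by
      field_simp
      ring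
    have h8 : 4 * f 0 * ∫ p in {p | rho p < R₀}, h p ^ 2 ≤ 4 * f 0 * (2 * J) := by gcongr
    linarith
  have hden : 0 < 2 + 8 * f 0 * K / V := by positivity
  rw [div_mul_eq_mul_div, div_le_iff₀ hden]
  have h9 : 4 * f 0 / V * m ^ 2 ≤ 4 * f 0 / V * m ^ 2 * (2 + 8 * f 0 * K / V) := by
    have : 0 ≤ 4 * f 0 / V * m ^ 2 := by positivity
    have h10 : 0 ≤ 8 * f 0 * K / V := by positivity
    nlinarith
  linarith

end GS

/-- The reflections of the coordinate axes. -/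
def ref : Fin 3 → E3 →L[ℝ] E3 := ![rx, sxy.comp (rx.comp sxy), sxz.comp (rx.comp sxz)]

@[simp] lemma ref_zero (p : E3) : ref 0 p = (-p.1, p.2.1, p.2.2) := rfl
@[simp] lemma ref_one (p : E3) : ref 1 p = (p.1, -p.2.1, p.2.2) := rfl
@[simp] lemma ref_two (p : E3) : ref 2 p = (p.1, p.2.1, -p.2.2) := rfl

lemma iso_ref (i) : Iso (ref i) := by
  fin_cases i
  · exact iso_rx
  · exact iso_sxy.comp (iso_rx.comp iso_sxy)
  · exact iso_sxz.comp (iso_rx.comp iso_sxz)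

lemma co_ref (i j) (p) : co (ref i p) j = if i = j then - co p j else co p j := by
  fin_cases i <;> fin_cases j <;> rfl

lemma ref_ref (i) (p) : ref i (ref i p) = p := by
  fin_cases i <;> simp [ref]

lemma Iso.integral_eq_zero {L : E3 →L[ℝ] E3} (hL : Iso L) (hF : ∀ p, F (L p) = - F p) : ∫ p, F p = 0 := by
  have h := hL.integral_comp F
  simp only [hF, integral_neg] at h
  linarith

lemma mass_const_mul (c : ℝ) (h) : mass (fun p => c * h p) = c ^ 2 * mass h := by
  simp only [mass, mul_pow, integral_const_mul]

lemma gradSq_const_mul (c : ℝ) (hh : Differentiable ℝ h) (p) :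
    gradSq (fun p => c * h p) p = c ^ 2 * gradSq h p := by
  simp only [gradSq, D_const_mul c (hh p), mul_pow, mul_sum]

lemma form_const_mul (Q) (c : ℝ) (hh : Differentiable ℝ h) :
    form Q (fun p => c * h p) = c ^ 2 * form Q h := by
  simp only [form, gradSq_const_mul c hh, ← integral_const_mul]
  congr 1; ext p; ring

/-- Symmetrization of `h` along a pair of linear maps. -/
def symz (R R' : E3 →L[ℝ] E3) (h : E3 → ℝ) (p : E3) : ℝ := 1 / 2 * (h (R p) + h (R' p))

/-- Functions even in each variable. -/
def Even3 (h : E3 → ℝ) : Prop := ∀ i p, h (ref i p) = h p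

/-- A pair of rotations, interchanged by two of the reflections, one of them `x ↦ -x`, and
commuting with the other one. -/
structure RotPair (R R' : E3 →L[ℝ] E3) : Prop where
  iso : Iso R
  iso' : Iso R'
  ref : ∀ i, (∀ p, R (ref i p) = ZK.ref i (R p) ∧ R' (ZK.ref i p) = ZK.ref i (R' p)) ∨
    (∀ p, R (ZK.ref i p) = ZK.ref i (R' p) ∧ R' (ZK.ref i p) = ZK.ref i (R p))
  zero : ∀ p, R (ZK.ref 0 p) = ZK.ref 0 (R' p) ∧ R' (ZK.ref 0 p) = ZK.ref 0 (R p)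
  other : ∃ i, i ≠ 0 ∧ ∀ p, R (ZK.ref i p) = ZK.ref i (R' p) ∧ R' (ZK.ref i p) = ZK.ref i (R p)

namespace RotPair

variable {R R' : E3 →L[ℝ] E3}
variable (hR : RotPair R R')
include hR

lemma even (he : Even3 h) : Even3 (symz R R' h) := fun i p => by
  unfold symz
  rcases hR.ref i with h1 | h1
  · rw [(h1 p).1, (h1 p).2, he, he]
  · rw [(h1 p).1, (h1 p).2, he, he, add_comm]

lemma test (hh : Test h) : Test (symz R R' h) :=
  ((hh.comp hR.iso).add (hh.comp hR.iso')).const_mul _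

lemma mass_add (hh : Test h) :
    mass (symz R R' h) + mass (fun p => 1 / 2 * (h (R p) - h (R' p))) = mass h := by
  have e := mass_parallelogram (hh.comp hR.iso).sob (hh.comp hR.iso').sob
  rw [mass_comp hR.iso, mass_comp hR.iso'] at e
  unfold symz
  rw [mass_const_mul, mass_const_mul]
  linarith

end RotPair

namespace GS

variable {f : ℝ → ℝ} {R R' : E3 →L[ℝ] E3}
variable (hQ : GS f Q)
include hQ

lemma exists_ref_odd_coercive : ∃ κ > 0, ∃ C, 0 ≤ C ∧ ∀ h, Test h → ∀ i,
    (∀ p, h (ref i p) = - h p) → κ * mass h ≤ form Q h + C * (∫ p, D i Q p * h p) ^ 2 := by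
  obtain ⟨κ, hκ, C, hC, H⟩ := hQ.exists_odd_coercive
  refine ⟨κ, hκ, C, hC, fun h hh i hodd => ?_⟩
  have aux : ∀ (L : E3 →L[ℝ] E3) (hL : Iso L), (∀ p, h (L (rx p)) = - h (L p)) →
      (∀ p, D 0 Q (L p) = D i Q p) → (∀ p, L (L p) = p) →
      κ * mass h ≤ form Q h + C * (∫ p, D i Q p * h p) ^ 2 := by
    intro L hL h1 h2 h3
    have h4 := H _ (hh.comp hL) h1
    rw [mass_comp hL, hQ.form_comp hL hh.diff, ← hL.integral_comp] at h4
    simpa only [h2, h3] using h4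
  fin_cases i
  · exact H h hh hodd
  · refine aux sxy iso_sxy (fun p => ?_) (fun p => ?_) fun p => rfl
    · exact hodd (sxy p)
    · rw [hQ.D_eq, hQ.D_eq, iso_sxy p]; rfl
  · refine aux sxz iso_sxz (fun p => ?_) (fun p => ?_) fun p => rfl
    · exact hodd (sxz p)
    · rw [hQ.D_eq, hQ.D_eq, iso_sxz p]; rfl

lemma D_ref (i j) (p) :
    D i Q (ref j p) = if j = i then - D i Q p else D i Q p := by
  rw [hQ.D_eq, hQ.D_eq, iso_ref j p, co_ref]
  split_ifs <;> ring

/-- Symmetrizing an even function along a pair of rotations does not increase a quadratic form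
that is nonnegative on odd functions. -/
lemma form_symz_le (hodd : ∀ h, Test h → (∀ p, h (ref 0 p) = - h p) →
      κ * mass h ≤ form Q h + C * (∫ p, D 0 Q p * h p) ^ 2)
    (hR : RotPair R R') (hh : Test h) (he : Even3 h) :
    form Q (symz R R' h) - κ * mass (symz R R' h) ≤ form Q h - κ * mass h := by
  have hd : Test (fun p => 1 / 2 * (h (R p) - h (R' p))) :=
    ((hh.comp hR.iso).sub (hh.comp hR.iso')).const_mul _
  have h0 : ∀ i, (∀ p, R (ref i p) = ref i (R' p) ∧ R' (ref i p) = ref i (R p)) → ∀ p,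
      1 / 2 * (h (R (ref i p)) - h (R' (ref i p))) = - (1 / 2 * (h (R p) - h (R' p))) := by
    intro i hi p
    rw [(hi p).1, (hi p).2, he, he]; ring
  obtain ⟨i, hi0, hi⟩ := hR.other
  have h1 := hodd _ hd (h0 0 hR.zero)
  have h2 : ∫ p, D 0 Q p * (1 / 2 * (h (R p) - h (R' p))) = 0 :=
    (iso_ref i).integral_eq_zero fun p => by
      rw [h0 i hi, hQ.D_ref, if_neg hi0]; ring
  rw [h2] at h1
  have h3 := hR.mass_add hh
  have e := hQ.form_parallelogram (hh.comp hR.iso).sob (hh.comp hR.iso').sob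
  rw [hQ.form_comp hR.iso hh.diff, hQ.form_comp hR.iso' hh.diff] at e
  have d1 := (hh.comp hR.iso).add (hh.comp hR.iso')
  have d2 := (hh.comp hR.iso).sub (hh.comp hR.iso')
  have e1 : form Q (symz R R' h) = (1 / 2) ^ 2 * form Q (fun p => h (R p) + h (R' p)) :=
    form_const_mul Q _ d1.diff
  have e2 : form Q (fun p => 1 / 2 * (h (R p) - h (R' p)))
      = (1 / 2) ^ 2 * form Q (fun p => h (R p) - h (R' p)) := form_const_mul Q _ d2.diff
  rw [e2] at h1
  rw [← h3, e1]
  linarith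

lemma integral_symz (hR : RotPair R R') (hh : Test h) :
    ∫ p, Q p * symz R R' h p = ∫ p, Q p * h p := by
  have h1 : ∀ {L : E3 →L[ℝ] E3}, Iso L → ∫ p, Q p * h (L p) = ∫ p, Q p * h p := fun hL => by
    rw [← hL.integral_comp fun p => Q p * h p]
    simp only [hQ.comp_iso hL]
  have hi : ∀ {L : E3 →L[ℝ] E3}, Iso L → Integrable (fun p => Q p * h (L p)) := fun hL =>
    hQ.integrable_mul ((hh.comp hL).smooth.continuous.integrable_of_hasCompactSupport
      (hh.comp hL).cpt)
  calc ∫ p, Q p * symz R R' h p = ∫ p, 1 / 2 * (Q p * h (R p) + Q p * h (R' p)) := by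
        congr 1; ext p; unfold symz; ring
    _ = ∫ p, Q p * h p := by
        rw [integral_const_mul, integral_add (hi hR.iso) (hi hR.iso'), h1 hR.iso, h1 hR.iso']
        ring

end GS

/-- Rotation about the third axis. -/
def rotz (θ : ℝ) : E3 →L[ℝ] E3 := LinearMap.toContinuousLinearMap
  { toFun := fun p => (cos θ * p.1 - sin θ * p.2.1, sin θ * p.1 + cos θ * p.2.1, p.2.2)
    map_add' := fun p q => by
      ext <;> simp <;> ring
    map_smul' := fun c p => by
      ext <;> simp <;> ring }

/-- Exchange of the last two coordinates. -/
def syz : E3 →L[ℝ] E3 := sxy.comp (sxz.comp sxy)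

/-- Rotation about the second axis. -/
def roty (θ : ℝ) : E3 →L[ℝ] E3 := syz.comp ((rotz θ).comp syz)

lemma rotz_apply (θ : ℝ) (p) :
    rotz θ p = (cos θ * p.1 - sin θ * p.2.1, sin θ * p.1 + cos θ * p.2.1, p.2.2) := rfl

lemma roty_apply (θ : ℝ) (p) :
    roty θ p = (cos θ * p.1 - sin θ * p.2.2, p.2.1, sin θ * p.1 + cos θ * p.2.2) := rfl

lemma iso_rotz (θ : ℝ) : Iso (rotz θ) := fun p => by
  simp only [rho, rotz_apply]
  congr 1
  linear_combination (p.1 ^ 2 + p.2.1 ^ 2) * sin_sq_add_cos_sq θ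

lemma iso_roty (θ : ℝ) : Iso (roty θ) :=
  (iso_sxy.comp (iso_sxz.comp iso_sxy)).comp
    ((iso_rotz θ).comp (iso_sxy.comp (iso_sxz.comp iso_sxy)))

lemma rotz_add (a b : ℝ) (p) : rotz a (rotz b p) = rotz (a + b) p := by
  simp only [rotz_apply, cos_add, sin_add, Prod.mk.injEq]
  exact ⟨by ring, by ring, trivial⟩

lemma roty_add (a b : ℝ) (p) : roty a (roty b p) = roty (a + b) p := by
  simp only [roty_apply, cos_add, sin_add, Prod.mk.injEq]
  exact ⟨by ring, trivial, by ring⟩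

lemma rotPair_rotz (θ : ℝ) : RotPair (rotz θ) (rotz (-θ)) where
  iso := iso_rotz θ
  iso' := iso_rotz _
  ref i := by
    fin_cases i
    · exact Or.inr fun p => by simp [rotz_apply]; constructor <;> ring
    · exact Or.inr fun p => by simp [rotz_apply]; constructor <;> ring
    · exact Or.inl fun p => by simp [rotz_apply]
  zero p := by simp [rotz_apply]; constructor <;> ring
  other := ⟨1, by decide, fun p => by simp [rotz_apply]; constructor <;> ring⟩

lemma rotPair_roty (θ : ℝ) : RotPair (roty θ) (roty (-θ)) where
  iso := iso_roty θ
  iso' := iso_roty _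
  ref i := by
    fin_cases i
    · exact Or.inr fun p => by simp [roty_apply]; constructor <;> ring
    · exact Or.inl fun p => by simp [roty_apply]
    · exact Or.inr fun p => by simp [roty_apply]; constructor <;> ring
  zero p := by simp [roty_apply]; constructor <;> ring
  other := ⟨2, by decide, fun p => by simp [roty_apply]; constructor <;> ring⟩

/-- Dyadic averaging over a one-parameter group of rotations. -/
def dyad (R : ℝ → E3 →L[ℝ] E3) : ℕ → ℝ → (E3 → ℝ) → E3 → ℝ
  | 0, _, h => h
  | k + 1, α, h => symz (R (α / 2)) (R (-(α / 2))) (dyad R k (α / 2) h)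

lemma dyad_induction {R : ℝ → E3 →L[ℝ] E3} {P : (E3 → ℝ) → Prop}
    (hP : ∀ h θ, P h → P (symz (R θ) (R (-θ)) h)) (hh : P h) :
    ∀ k α, P (dyad R k α h)
  | 0, _ => hh
  | k + 1, α => hP _ _ (dyad_induction hP hh k (α / 2))

lemma dyad_neg (R : ℝ → E3 →L[ℝ] E3) (h) : ∀ k α p,
    dyad R k α (fun p => - h p) p = - dyad R k α h p
  | 0, _, _ => rfl
  | k + 1, α, p => by
    simp only [dyad, symz, dyad_neg R h k]
    ring

lemma dyad_le {R : ℝ → E3 →L[ℝ] E3} (h0 : ∀ p, R 0 p = p)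
    (hadd : ∀ a b p, R a (R b p) = R (a + b) p) (hiso : ∀ θ, Iso (R θ)) (hM : ∀ p, rho p = r → h p ≤ M) : ∀ k α, 0 ≤ α → ∀ p, rho p = r → ∀ θ, |θ| ≤ α →
      ∃ θ', |θ' - θ| ≤ α / 2 ^ k ∧ dyad R k α h p ≤ M - (M - h (R θ' p)) / 2 ^ k
  | 0, α, hα, p, hp, θ, hθ => ⟨0, by simpa using hθ, by simp [dyad, h0]⟩
  | k + 1, α, hα, p, hp, θ, hθ => by
    have ih := dyad_le h0 hadd hiso hM k (α / 2) (by linarith)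
    have hr : ∀ θ, rho (R θ p) = r := fun θ => (hiso θ p).trans hp
    have hpk : (0 : ℝ) < 2 ^ k := by positivity
    have ub : ∀ q, rho q = r → dyad R k (α / 2) h q ≤ M := fun q hq => by
      obtain ⟨θ', -, h2⟩ := ih q hq 0 (by simpa using by linarith)
      have h3 := hM (R θ' q) ((hiso θ' q).trans hq)
      have : 0 ≤ (M - h (R θ' q)) / 2 ^ k := div_nonneg (by linarith) hpk.le
      linarith
    have hb := abs_le.1 hθ
    have main : ∀ σ : ℝ, |θ - σ| ≤ α / 2 → ∃ θ', |θ' - θ| ≤ α / 2 ^ (k + 1) ∧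
        dyad R k (α / 2) h (R σ p) ≤ M - (M - h (R θ' p)) / 2 ^ k := by
      intro σ hσ
      obtain ⟨θ', h1, h2⟩ := ih _ (hr σ) _ hσ
      refine ⟨θ' + σ, ?_, ?_⟩
      · rw [show θ' + σ - θ = θ' - (θ - σ) by ring, pow_succ']
        refine h1.trans (le_of_eq ?_)
        field_simp
      · rwa [hadd] at h2
    have half : ∀ x : ℝ, x / 2 ^ (k + 1) = x / 2 ^ k / 2 := fun x => by
      rw [pow_succ]; field_simp
    rcases le_total 0 θ with h | h
    · obtain ⟨θ', h1, h2⟩ := main (α / 2) (abs_le.2 ⟨by linarith, by linarith⟩)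
      refine ⟨θ', h1, ?_⟩
      have := ub _ (hr (-(α / 2)))
      simp only [dyad, symz, half]
      linarith
    · obtain ⟨θ', h1, h2⟩ := main (-(α / 2)) (abs_le.2 ⟨by linarith, by linarith⟩)
      refine ⟨θ', h1, ?_⟩
      have := ub _ (hr (α / 2))
      simp only [dyad, symz, half]
      linarith

lemma exists_angles (p) : ∃ θ φ : ℝ, |θ| ≤ π ∧ |φ| ≤ π ∧
    roty φ (rotz θ p) = (0, 0, rho p) := by
  set z : ℂ := ⟨p.1, p.2.1⟩ with hz
  set w : ℂ := ⟨‖z‖, p.2.2⟩ with hw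
  have z1 : ‖z‖ * cos z.arg = p.1 := Complex.norm_mul_cos_arg z
  have z2 : ‖z‖ * sin z.arg = p.2.1 := Complex.norm_mul_sin_arg z
  have w1 : ‖w‖ * cos w.arg = ‖z‖ := Complex.norm_mul_cos_arg w
  have w2 : ‖w‖ * sin w.arg = p.2.2 := Complex.norm_mul_sin_arg w
  have hwr : ‖w‖ = rho p := by
    have e1 : ‖z‖ ^ 2 = p.1 ^ 2 + p.2.1 ^ 2 := by
      rw [← Complex.normSq_eq_norm_sq, Complex.normSq_apply]; ring
    have e2 : ‖w‖ ^ 2 = rho p ^ 2 := by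
      rw [← Complex.normSq_eq_norm_sq, Complex.normSq_apply, rho_sq, Fin.sum_univ_three]
      simp only [co, Matrix.cons_val]
      rw [show w.re = ‖z‖ from rfl, show w.im = p.2.2 from rfl]
      linarith
    exact (pow_left_inj₀ (norm_nonneg _) (rho_nonneg _) two_ne_zero).1 e2
  have harg : |w.arg| ≤ π / 2 := Complex.abs_arg_le_pi_div_two_iff.2 (norm_nonneg z)
  have hb := abs_le.1 harg
  refine ⟨- z.arg, π / 2 - w.arg, by rw [abs_neg]; exact Complex.abs_arg_le_pi z,
    abs_le.2 ⟨by linarith [pi_pos], by linarith [pi_pos]⟩, ?_⟩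
  have e1 : rotz (- z.arg) p = (‖z‖, 0, p.2.2) := by
    rw [rotz_apply, cos_neg, sin_neg, ← z1, ← z2]
    refine Prod.ext ?_ (Prod.ext ?_ rfl)
    · simp only
      linear_combination ‖z‖ * sin_sq_add_cos_sq z.arg
    · simp only
      ring
  rw [e1, roty_apply, cos_pi_div_two_sub, sin_pi_div_two_sub]
  refine Prod.ext ?_ (Prod.ext rfl ?_)
  · simp only
    rw [← w1, ← w2]; ring
  · simp only
    rw [← hwr, ← w1, ← w2]
    linear_combination ‖w‖ * sin_sq_add_cos_sq w.arg

lemma rho_rotz_sub_le (a b : ℝ) (p) : rho (rotz a p - rotz b p) ≤ |a - b| * rho p := by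
  have h1 := one_sub_sq_div_two_le_cos (x := a - b)
  rw [cos_sub] at h1
  refine abs_le_of_sq_le_sq' ?_ (mul_nonneg (abs_nonneg _) (rho_nonneg _)) |>.2
  rw [mul_pow, sq_abs, rho_sq, rho_sq, Fin.sum_univ_three, Fin.sum_univ_three]
  simp only [co, Matrix.cons_val, rotz_apply, Prod.fst_sub, Prod.snd_sub, sub_self]
  have e : (cos a * p.1 - sin a * p.2.1 - (cos b * p.1 - sin b * p.2.1)) ^ 2 +
      (sin a * p.1 + cos a * p.2.1 - (sin b * p.1 + cos b * p.2.1)) ^ 2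
      = (p.1 ^ 2 + p.2.1 ^ 2) * (2 - 2 * (cos a * cos b + sin a * sin b)) := by
    linear_combination (p.1 ^ 2 + p.2.1 ^ 2) * (sin_sq_add_cos_sq a + sin_sq_add_cos_sq b)
  have h2 : (p.1 ^ 2 + p.2.1 ^ 2) * (2 - 2 * (cos a * cos b + sin a * sin b)) ≤
      (p.1 ^ 2 + p.2.1 ^ 2) * (a - b) ^ 2 :=
    mul_le_mul_of_nonneg_left (by linarith) (by positivity)
  rw [e]
  nlinarith [mul_nonneg (sq_nonneg (a - b)) (sq_nonneg p.2.2)]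

lemma rho_roty_sub_le (a b : ℝ) (p) : rho (roty a p - roty b p) ≤ |a - b| * rho p := by
  have hs : Iso syz := iso_sxy.comp (iso_sxz.comp iso_sxy)
  have e : roty a p - roty b p = syz (rotz a (syz p) - rotz b (syz p)) := by
    rw [map_sub]; rfl
  rw [e, hs, ← hs p]
  exact rho_rotz_sub_le a b _

/-- Averaging about the second and then about the third axis. -/
def dyad2 (k : ℕ) (h : E3 → ℝ) : E3 → ℝ := dyad rotz k π (dyad roty k π h)

lemma dyad2_neg (k : ℕ) (h) (p) : dyad2 k (fun p => - h p) p = - dyad2 k h p := by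
  unfold dyad2
  rw [← dyad_neg, show dyad roty k π (fun p => - h p) = fun p => - dyad roty k π h p from
    funext fun p => dyad_neg _ _ _ _ _]

lemma dyad2_le (hM : ∀ p, rho p = r → h p ≤ M) (hΛ : 0 ≤ Λ)
    (hL : ∀ p q, |h p - h q| ≤ Λ * rho (p - q)) (k : ℕ) (hp : rho p = r) :
    dyad2 k h p ≤ M ∧
      dyad2 k h p ≤ M - (M - h (0, 0, r) - Λ * (2 * r * π / 2 ^ k)) / 4 ^ k := by
  have hpk : (0 : ℝ) < 2 ^ k := by positivity
  obtain ⟨θ, φ, hθ, hφ, he⟩ := exists_angles p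
  have hy := dyad_le (R := roty) (fun p => by simp [roty_apply]) roty_add iso_roty hM k π pi_pos.le
  have hyM : ∀ q, rho q = r → dyad roty k π h q ≤ M := fun q hq => by
    obtain ⟨θ', -, h2⟩ := hy q hq 0 (by simpa using pi_pos.le)
    have h3 := hM (roty θ' q) ((iso_roty θ' q).trans hq)
    have : 0 ≤ (M - h (roty θ' q)) / 2 ^ k := div_nonneg (by linarith) hpk.le
    linarith
  obtain ⟨θ', h1, h2⟩ := dyad_le (R := rotz) (fun p => by simp [rotz_apply]) rotz_add iso_rotz hyM
    k π pi_pos.le p hp θ hθ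
  have hz := hyM (rotz θ' p) ((iso_rotz θ' p).trans hp)
  obtain ⟨φ', h3, h4⟩ := hy (rotz θ' p) ((iso_rotz θ' p).trans hp) φ hφ
  have hr : 0 ≤ r := hp ▸ rho_nonneg p
  constructor
  · have : 0 ≤ (M - dyad roty k π h (rotz θ' p)) / 2 ^ k := div_nonneg (by linarith) hpk.le
    unfold dyad2
    linarith
  · have d1 : |h (roty φ' (rotz θ' p)) - h (roty φ' (rotz θ p))| ≤ Λ * (r * π / 2 ^ k) := by
      refine (hL _ _).trans (mul_le_mul_of_nonneg_left ?_ hΛ)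
      rw [← map_sub, iso_roty]
      refine (rho_rotz_sub_le _ _ _).trans ?_
      rw [hp, mul_comm, mul_div_assoc]
      exact mul_le_mul_of_nonneg_left h1 hr
    have d2 : |h (roty φ' (rotz θ p)) - h (roty φ (rotz θ p))| ≤ Λ * (r * π / 2 ^ k) := by
      refine (hL _ _).trans (mul_le_mul_of_nonneg_left ?_ hΛ)
      refine (rho_roty_sub_le _ _ _).trans ?_
      rw [iso_rotz, hp, mul_comm, mul_div_assoc]
      exact mul_le_mul_of_nonneg_left h3 hr
    rw [he, hp] at d2
    have d3 : h (roty φ' (rotz θ' p)) ≤ h (0, 0, r) + Λ * (2 * r * π / 2 ^ k) := by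
      have e : Λ * (2 * r * π / 2 ^ k) = Λ * (r * π / 2 ^ k) + Λ * (r * π / 2 ^ k) := by ring
      linarith [(abs_le.1 d1).2, (abs_le.1 d2).2]
    have d4 : dyad2 k h p ≤ M - (M - h (roty φ' (rotz θ' p))) / 2 ^ k / 2 ^ k := by
      refine h2.trans ?_
      have : (M - h (roty φ' (rotz θ' p))) / 2 ^ k ≤ M - dyad roty k π h (rotz θ' p) := by linarith
      have := div_le_div_of_nonneg_right this hpk.le
      linarith
    refine d4.trans ?_
    rw [div_div, ← mul_pow]
    norm_num only
    have : (M - h (0, 0, r) - Λ * (2 * r * π / 2 ^ k)) / 4 ^ k ≤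
        (M - h (roty φ' (rotz θ' p))) / 4 ^ k :=
      div_le_div_of_nonneg_right (by linarith) (by positivity)
    linarith

/-- Iterated averaging makes a Lipschitz function nearly constant on a sphere. -/
lemma exists_nearly_const {P : (E3 → ℝ) → Prop}
    (hz : ∀ h θ, P h → P (symz (rotz θ) (rotz (-θ)) h))
    (hy : ∀ h θ, P h → P (symz (roty θ) (roty (-θ)) h)) (hΛ : 0 ≤ Λ) (hr : 0 < r)
    (hL : ∀ h, P h → ∀ p q, |h p - h q| ≤ Λ * rho (p - q)) (hB : ∀ h, P h → ∀ p, |h p| ≤ B)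
    (hh : P h) (hε : 0 < ε) :
    ∃ h', P h' ∧ ∃ c, |c| ≤ B ∧ ∀ p, rho p = r → |h' p - c| ≤ ε := by
  obtain ⟨k, hk⟩ := exists_nat_gt (Λ * (2 * r * π) / (ε / 4))
  have hk2 : Λ * (2 * r * π / 2 ^ k) ≤ ε / 4 := by
    have h1 : (k : ℝ) < 2 ^ k := by exact_mod_cast Nat.lt_two_pow_self
    rw [← mul_div_assoc, div_le_iff₀ (by positivity)]
    rw [div_lt_iff₀ (by positivity)] at hk
    nlinarith
  set w : ℝ := 1 / (4 * 4 ^ k) with hw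
  have hw0 : 0 < w := by positivity
  have hw1 : w < 1 := by
    rw [hw, div_lt_one (by positivity)]
    have : (1 : ℝ) ≤ 4 ^ k := one_le_pow₀ (by norm_num)
    linarith
  have step : ∀ h, P h → ∀ m M : ℝ, (∀ p, rho p = r → m ≤ h p ∧ h p ≤ M) → ε ≤ M - m →
      ∃ h', P h' ∧ ∃ m' M' : ℝ, m ≤ m' ∧ M' ≤ M ∧ (∀ p, rho p = r → m' ≤ h' p ∧ h' p ≤ M') ∧
        M' - m' ≤ (1 - w) * (M - m) := by
    intro h hh m M hmM hεM
    refine ⟨dyad2 k h, dyad_induction hz (dyad_induction hy hh k π) k π, ?_⟩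
    have up := fun p (hp : rho p = r) => dyad2_le (fun p hp => (hmM p hp).2) hΛ (hL h hh) k hp
    have dn := fun p (hp : rho p = r) => dyad2_le (h := fun p => - h p) (M := -m)
      (fun p hp => by linarith [(hmM p hp).1]) hΛ
      (fun p q => by rw [← neg_sub', abs_neg]; exact hL h hh p q) k hp
    simp only [dyad2_neg] at dn
    have hw4 : ∀ x, x / 4 ^ k = 4 * w * x := fun x => by rw [hw]; field_simp
    simp only [hw4] at up dn
    rcases le_total (h (0, 0, r)) ((m + M) / 2) with hc | hc
    · refine ⟨m, M - w * (M - m), le_rfl, by nlinarith, fun p hp => ⟨by linarith [(dn p hp).1], ?_⟩,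
        by linarith⟩
      have := (up p hp).2
      have h3 : w * (M - m) ≤ 4 * w * (M - h (0, 0, r) - Λ * (2 * r * π / 2 ^ k)) := by nlinarith
      linarith
    · refine ⟨m + w * (M - m), M, by nlinarith, le_rfl, fun p hp => ⟨?_, (up p hp).1⟩,
        by linarith⟩
      have := (dn p hp).2
      have h3 : w * (M - m) ≤ 4 * w * (-m - -h (0, 0, r) - Λ * (2 * r * π / 2 ^ k)) := by nlinarith
      linarith
  have iter : ∀ n : ℕ, ∃ h', P h' ∧ ∃ m M : ℝ, -B ≤ m ∧ M ≤ B ∧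
      (∀ p, rho p = r → m ≤ h' p ∧ h' p ≤ M) ∧ (M - m ≤ ε ∨ M - m ≤ (1 - w) ^ n * (2 * B)) := by
    intro n
    induction n with
    | zero => exact ⟨h, hh, -B, B, le_rfl, le_rfl, fun p _ => abs_le.1 (hB h hh p),
        Or.inr (by simp; linarith)⟩
    | succ n ih =>
      obtain ⟨h', hP', m, M, hm, hM, hmM, hor⟩ := ih
      rcases le_total (M - m) ε with h1 | h1
      · exact ⟨h', hP', m, M, hm, hM, hmM, Or.inl h1⟩
      · obtain ⟨h'', hP'', m', M', hm', hM', hmM', hd⟩ := step h' hP' m M hmM h1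
        refine ⟨h'', hP'', m', M', hm.trans hm', hM'.trans hM, hmM', ?_⟩
        rcases hor with h2 | h2
        · left
          nlinarith
        · right
          refine hd.trans ?_
          rw [pow_succ', mul_assoc]
          exact mul_le_mul_of_nonneg_left h2 (by linarith)
  have hlim : Tendsto (fun n : ℕ => (1 - w) ^ n * (2 * B)) atTop (𝓝 0) := by
    have := (tendsto_pow_atTop_nhds_zero_of_lt_one (r := 1 - w) (by linarith)
      (by linarith)).mul_const (2 * B)
    simpa using this
  obtain ⟨n, hn⟩ := (hlim.eventually_le_const hε).exists
  obtain ⟨h', hP', m, M, hm, hM, hmM, hor⟩ := iter n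
  have hMm : M - m ≤ ε := hor.elim id fun h => h.trans hn
  have hpole : rho ((0, 0, r) : E3) = r := by simp [rho, hr.le]
  have := hmM _ hpole
  exact ⟨h', hP', m, abs_le.2 ⟨hm, by linarith⟩, fun p hp => abs_le.2
    ⟨by linarith [(hmM p hp).1], by linarith [(hmM p hp).2]⟩⟩

lemma Test.exists_lipschitz (hh : Test h) :
    ∃ Λ, 0 ≤ Λ ∧ ∀ p q, |h p - h q| ≤ Λ * rho (p - q) := by
  obtain ⟨C, hC⟩ := hh.smooth.lipschitzWith_of_hasCompactSupport hh.cpt (by simp)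
  refine ⟨C, C.2, fun p q => ?_⟩
  have := hC.dist_le_mul p q
  rw [dist_eq, dist_eq_norm] at this
  exact this.trans (mul_le_mul_of_nonneg_left (norm_le_rho _) C.2)

lemma symz_lipschitz {R R' : E3 →L[ℝ] E3} (hR : Iso R) (hR' : Iso R') (hL : ∀ p q, |h p - h q| ≤ Λ * rho (p - q)) (p q) :
    |symz R R' h p - symz R R' h q| ≤ Λ * rho (p - q) := by
  have h1 := hL (R p) (R q)
  have h2 := hL (R' p) (R' q)
  rw [← map_sub, hR] at h1
  rw [← map_sub, hR'] at h2
  unfold symz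
  rw [abs_le] at *
  constructor <;> linarith [h1.1, h1.2, h2.1, h2.2]

lemma abs_symz_le {R R' : E3 →L[ℝ] E3} (hB : ∀ p, |h p| ≤ B) (p) :
    |symz R R' h p| ≤ B := by
  have h1 := hB (R p)
  have h2 := hB (R' p)
  unfold symz
  rw [abs_le] at *
  constructor <;> linarith [h1.1, h1.2, h2.1, h2.2]

namespace GS

variable {f : ℝ → ℝ}
variable (hQ : GS f Q)
include hQ

/-- An even function may be replaced by one that is nearly constant on a given sphere. -/
lemma exists_nearly_const (hr : 0 < r)
    (hodd : ∀ h, Test h → (∀ p, h (ref 0 p) = - h p) →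
      κ * mass h ≤ form Q h + C * (∫ p, D 0 Q p * h p) ^ 2)
    (hh : Test h) (he : Even3 h) : ∃ B, ∀ ε > 0, ∃ h', Test h' ∧
      form Q h' - κ * mass h' ≤ form Q h - κ * mass h ∧ (∫ p, Q p * h' p) = ∫ p, Q p * h p ∧
      mass h' ≤ mass h ∧ ∃ c, |c| ≤ B ∧ ∀ p, rho p = r → |h' p - c| ≤ ε := by
  obtain ⟨Λ, hΛ, hL⟩ := hh.exists_lipschitz
  obtain ⟨B, hB⟩ := hh.cpt.exists_bound_of_continuous hh.smooth.continuous
  refine ⟨B, fun ε hε => ?_⟩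
  let P : (E3 → ℝ) → Prop := fun h' => Test h' ∧ Even3 h' ∧
    (form Q h' - κ * mass h' ≤ form Q h - κ * mass h ∧ (∫ p, Q p * h' p) = ∫ p, Q p * h p ∧
      mass h' ≤ mass h) ∧ (∀ p q, |h' p - h' q| ≤ Λ * rho (p - q)) ∧ ∀ p, |h' p| ≤ B
  have hP : ∀ {R R'}, RotPair R R' → ∀ g, P g → P (symz R R' g) := by
    rintro R R' hR g ⟨h1, h2, ⟨h3, h4, h5⟩, h6, h7⟩
    refine ⟨hR.test h1, hR.even h2, ⟨(hQ.form_symz_le hodd hR h1 h2).trans h3,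
      (hQ.integral_symz hR h1).trans h4, ?_⟩, symz_lipschitz hR.iso hR.iso' h6, abs_symz_le h7⟩
    linarith [hR.mass_add h1, mass_nonneg (fun p => 1 / 2 * (g (R p) - g (R' p)))]
  obtain ⟨h', ⟨h1, -, ⟨h3, h4, h5⟩, -, -⟩, c, hc, hcc⟩ := ZK.exists_nearly_const (P := P)
    (fun g θ hg => hP (rotPair_rotz θ) g hg) (fun g θ hg => hP (rotPair_roty θ) g hg) hΛ hr
    (fun g hg => hg.2.2.2.1) (fun g hg => hg.2.2.2.2)
    (h := h) ⟨hh, he, ⟨le_rfl, rfl, le_rfl⟩, hL, hB⟩ hε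
  exact ⟨h', h1, h3, h4, h5, c, hc, hcc⟩
lemma rad_eq_theta (p) : ZK.rad Q p = - (Q p * Prof.theta f (rho p)) := by
  have h0 := hQ.prof.pos (rho p)
  rw [hQ.rad_eq, hQ.rad, Prof.theta]
  field_simp

/-- The comparison function `x·∇Q + aQ`. -/
def psi (a : ℝ) (Q : E3 → ℝ) (p : E3) : ℝ := ZK.rad Q p + a * Q p

lemma psi_eq (a : ℝ) (p) : psi a Q p = Q p * (a - Prof.theta f (rho p)) := by
  rw [psi, hQ.rad_eq_theta]; ring

lemma contDiff_psi (a : ℝ) : ContDiff ℝ ∞ (psi a Q) :=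
  (contDiff_rad hQ.smooth).add (contDiff_const.mul hQ.smooth)

lemma form_op_psi (har : (2 - a) * f r = 2) (p) :
    - lap (psi a Q) p + (1 - 2 * Q p) * psi a Q p = (2 - a) * Q p * (Q p - f r) := by
  have e : lap (psi a Q) p = lap (ZK.rad Q) p + a * lap Q p := by
    have h1 := lap_add (contDiff_rad hQ.smooth) (contDiff_const (c := a) |>.mul hQ.smooth) p
    rw [lap_const_mul a hQ.smooth] at h1
    exact h1
  rw [e, hQ.lap_rad_eq, hQ.eqn, psi]
  linear_combination (Q p) * har

lemma exists_local_coercive (hr : 0 < r) (h2 : Prof.theta f r < 2)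
    (har : (2 - Prof.theta f r) * f r = 2) (R : ℝ) :
    ∃ c > 0, ∀ k, Test k → (∀ p, rho p = r → k =ᶠ[𝓝 p] 0) →
      c * ∫ p in {p | rho p < R}, k p ^ 2 ≤ form Q k := by
  obtain ⟨c, hc, hcb⟩ := hQ.prof.exists_ratio_bound hr R
  set a := Prof.theta f r with ha
  refine ⟨(2 - a) * c, mul_pos (by linarith) hc, fun k hk hz => ?_⟩
  have hψ := hQ.contDiff_psi a
  have hz' : ∀ p, psi a Q p = 0 → k =ᶠ[𝓝 p] 0 := fun p hp => by
    apply hz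
    rw [hQ.psi_eq, mul_eq_zero, or_iff_right (hQ.pos p).ne'] at hp
    exact hQ.prof.theta_strictMonoOn.injOn (rho_nonneg p) hr.le (by linarith)
  have hg := test_div hk hψ hz'
  have hkg : k = fun p => (k p / psi a Q p) * psi a Q p := by
    ext p
    by_cases hp : psi a Q p = 0
    · rw [(hz' p hp).eq_of_nhds, hp]; simp
    · field_simp
  set g : E3 → ℝ := fun p => k p / psi a Q p with hgd
  have key : ∀ p, psi a Q p * (- lap (psi a Q) p + (1 - 2 * Q p) * psi a Q p)
      = (2 - a) * Q p ^ 2 * ((f r - Q p) * (Prof.theta f (rho p) - a)) := fun p => by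
    rw [hQ.form_op_psi har, hQ.psi_eq]; ring
  have key0 : ∀ p, 0 ≤ (f r - Q p) * (Prof.theta f (rho p) - a) := fun p => by
    obtain ⟨c', hc', hcb'⟩ := hQ.prof.exists_ratio_bound hr (rho p)
    have := hcb' (rho p) (rho_nonneg p) le_rfl
    rw [← hQ.rad] at this
    exact le_trans (by positivity) this
  have key1 : ∀ p, rho p < R → (2 - a) * c * k p ^ 2 ≤ g p ^ 2 *
      (psi a Q p * (- lap (psi a Q) p + (1 - 2 * Q p) * psi a Q p)) := fun p hp => by
    have h1 := hcb (rho p) (rho_nonneg p) hp.le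
    rw [← hQ.rad] at h1
    have h2' := mul_le_mul_of_nonneg_left h1
      (mul_nonneg (mul_nonneg (by linarith : 0 ≤ 2 - a) (sq_nonneg (Q p))) (sq_nonneg (g p)))
    have e : k p = g p * (Q p * (a - Prof.theta f (rho p))) := by
      rw [← hQ.psi_eq]; exact congrFun hkg p
    rw [key, e]
    linarith
  have hform := form_mul hQ.continuous hg hψ
  rw [← hkg] at hform
  rw [hform, ← integral_const_mul, ← integral_indicator
    (measurableSet_lt continuous_rho.measurable measurable_const)]
  have hcont : Continuous (fun p => psi a Q p ^ 2 * gradSq g p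
      + g p ^ 2 * (psi a Q p * (- lap (psi a Q) p + (1 - 2 * Q p) * psi a Q p))) := by
    have c1 := hψ.continuous
    have c2 := (contDiff_lap hψ).continuous
    have c3 := hQ.continuous
    have c4 := hg.smooth.continuous
    have c5 := continuous_gradSq hg.smooth
    fun_prop
  refine integral_mono_of_nonneg (ae_of_all _ fun p => ?_) ?_ (ae_of_all _ fun p => ?_)
  · apply Set.indicator_nonneg
    intro q _
    have : 0 ≤ 2 - a := by linarith
    positivity
  · refine hcont.integrable_of_hasCompactSupport ?_
    refine HasCompactSupport.add (f := fun p => psi a Q p ^ 2 * gradSq g p)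
      (Test.cpt_gradSq hg).mul_left ?_
    have : HasCompactSupport (fun p => g p ^ 2) := by
      have e : (fun p => g p ^ 2) = g * g := by ext p; simp [pow_two]
      rw [e]; exact hg.cpt.mul_left
    exact this.mul_right
  · have hn : 0 ≤ psi a Q p ^ 2 * gradSq g p := mul_nonneg (sq_nonneg _) (gradSq_nonneg _ _)
    by_cases hp : rho p < R
    · rw [Set.indicator_of_mem (by exact hp)]
      have := key1 p hp
      show _ ≤ _ + _
      linarith
    · rw [Set.indicator_of_notMem (by exact hp)]
      show _ ≤ _ + _
      rw [key]
      have h3 := mul_nonneg (mul_nonneg (by linarith : 0 ≤ 2 - a) (sq_nonneg (Q p))) (key0 p)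
      linarith [mul_nonneg (sq_nonneg (g p)) h3]

lemma form_sub_scal (hh : SobH h) (β : ℝ) :
    form Q h = form Q (fun p => h p - β * scal Q p) - 4 * β * (∫ p, Q p * h p)
      + β ^ 2 * mass Q := by
  have hΨ := hQ.sob_scal
  have iQh : Integrable (fun p => Q p * h p) :=
    hQ.sob.integrable_mul hh
  have iQΨ : Integrable (fun p => Q p * scal Q p) :=
    hQ.sob.integrable_mul hΨ
  have ihΨ : Integrable (fun p => h p * scal Q p) :=
    hh.integrable_mul hΨ
  have gen : ∀ k, SobH k → Integrable (fun p => k p * scal Q p) →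
      Integrable (fun p => Q p * k p) →
      ∫ p, (∑ i, D i k p * D i (scal Q) p + (1 - 2 * Q p) * (k p * scal Q p))
        = - 2 * ∫ p, Q p * k p := fun k hk ik iQk => by
    have i1 : Integrable (fun p => (1 - 2 * Q p) * (k p * scal Q p)) := hQ.integrable_pot ik
    have e0 : (fun p => k p * lap (scal Q) p)
        = fun p => 2 * (Q p * k p) + (1 - 2 * Q p) * (k p * scal Q p) := by
      ext p; rw [hQ.lap_scal]; ring
    have i2 : Integrable (fun p => k p * lap (scal Q) p) := by
      rw [e0]; exact (iQk.const_mul 2).add i1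
    have i3 : Integrable (fun p => ∑ i, D i k p * D i (scal Q) p) :=
      integrable_finsetSum _ fun i _ =>
        (hk.dmemLp i).integrable_mul (hΨ.dmemLp i)
    rw [integral_add i3 i1, integral_grad_mul_grad hk hΨ i2, e0,
      integral_add (iQk.const_mul 2) i1, integral_const_mul]
    ring
  have e1 := gen h hh ihΨ iQh
  have e2 := gen (scal Q) hΨ (by simpa [pow_two] using hΨ.sq) iQΨ
  have e3 : ∫ p, Q p * scal Q p = mass Q / 2 := by
    rw [← hQ.integral_scal_mul]; congr 1; ext p; ring
  have hg : SobH (fun p => h p - β * scal Q p) := hh.sub (hΨ.const_mul β)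
  have pw : ∀ p, gradSq (fun p => h p - β * scal Q p) p
      + (1 - 2 * Q p) * (h p - β * scal Q p) ^ 2
      = (gradSq h p + (1 - 2 * Q p) * h p ^ 2)
        - 2 * β * (∑ i, D i h p * D i (scal Q) p + (1 - 2 * Q p) * (h p * scal Q p))
        + β ^ 2 * (∑ i, D i (scal Q) p * D i (scal Q) p
          + (1 - 2 * Q p) * (scal Q p * scal Q p)) := fun p => by
    have d : ∀ i, D i (fun p => h p - β * scal Q p) p = D i h p - β * D i (scal Q) p := fun i => by
      rw [D_sub (hh.diff p) ((hΨ.diff p).const_mul β), D_const_mul β (hΨ.diff p)]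
    simp only [gradSq, d, Fin.sum_univ_three]
    ring
  have j1 := hQ.integrable_form hh
  have j2 : Integrable (fun p => 2 * β * (∑ i, D i h p * D i (scal Q) p
      + (1 - 2 * Q p) * (h p * scal Q p))) :=
    (Integrable.add (integrable_finsetSum _ fun i _ =>
      (hh.dmemLp i).integrable_mul (hΨ.dmemLp i))
      (hQ.integrable_pot ihΨ)).const_mul _
  have j3 : Integrable (fun p => β ^ 2 * (∑ i, D i (scal Q) p * D i (scal Q) p
          + (1 - 2 * Q p) * (scal Q p * scal Q p))) :=
    (Integrable.add (integrable_finsetSum _ fun i _ =>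
      (hΨ.dmemLp i).integrable_mul (hΨ.dmemLp i))
      (hQ.integrable_pot (by simpa [pow_two] using hΨ.sq))).const_mul _
  have j12 : Integrable (fun p => (gradSq h p + (1 - 2 * Q p) * h p ^ 2)
        - 2 * β * (∑ i, D i h p * D i (scal Q) p + (1 - 2 * Q p) * (h p * scal Q p))) := j1.sub j2
  have tot : form Q (fun p => h p - β * scal Q p)
      = form Q h - 2 * β * (- 2 * ∫ p, Q p * h p) + β ^ 2 * (- 2 * ∫ p, Q p * scal Q p) := by
    unfold form
    rw [integral_congr_ae (ae_of_all _ pw), integral_add j12 j3, integral_sub j1 j2,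
      integral_const_mul, integral_const_mul, e1, e2]
  rw [tot, e3]; ring

set_option maxHeartbeats 1000000 in
lemma exists_sphere_coercive (hr : 0 < r) (h2 : Prof.theta f r < 2)
    (har : (2 - Prof.theta f r) * f r = 2) : ∃ κ > 0, ∃ C, 0 ≤ C ∧ ∀ B N : ℝ, ∃ K, 0 ≤ K ∧
    ∀ ε > 0, ∀ c, |c| ≤ B → ∀ h, Test h → mass h ≤ N → (∀ p, rho p = r → |h p - c| < ε) →
      κ * mass h ≤ form Q h + C * (∫ p, Q p * h p) ^ 2 + ε * K := by
  obtain ⟨R, hR, hRQ⟩ := hQ.exists_radius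
  obtain ⟨c', hc', hloc⟩ := hQ.exists_local_coercive hr h2 har R
  have hM := hQ.mass_pos
  have hf0 := hQ.f0_pos
  have hm := hQ.prof.pos R
  have hΨ0 := mass_nonneg (scal Q)
  set A := 2 + 4 * f 0 / c' with hA
  have hA0 : 0 < A := by positivity
  set κ := min (1 / (2 * A)) (mass Q / (4 * (mass (scal Q) + 1))) with hκ
  have hκ0 : 0 < κ := lt_min (by positivity) (by positivity)
  have hκ1 : κ * (2 * A) ≤ 1 := by
    have := min_le_left (1 / (2 * A)) (mass Q / (4 * (mass (scal Q) + 1)))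
    rwa [← hκ, le_div_iff₀ (by positivity)] at this
  have hκ2 : κ * (4 * (mass (scal Q) + 1)) ≤ mass Q := by
    have := min_le_right (1 / (2 * A)) (mass Q / (4 * (mass (scal Q) + 1)))
    rwa [← hκ, le_div_iff₀ (by positivity)] at this
  refine ⟨κ, hκ0, 8 / mass Q, by positivity, fun B N => ?_⟩
  set N' := mass Q + (2 * |N| + 2 * (B ^ 2 * mass (scal Q))) with hN'
  have hN'0 : 0 ≤ N' := by positivity
  set K0 := 32 * f 0 / c' + 16 * f 0 / f R with hK0
  have hK00 : 0 ≤ K0 := by positivity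
  refine ⟨K0 * N' / A, by positivity, fun ε hε c hc h hh hN hs => ?_⟩
  set β := c / 2 with hβ
  set g : E3 → ℝ := fun p => h p - β * scal Q p with hg
  have hΨ := hQ.sob_scal
  have hgS : SobH g := hh.sob.sub (hΨ.const_mul β)
  have hgt : Tendsto g (cocompact E3) (𝓝 0) := by
    simpa using hh.tendsto.sub (hQ.tendsto_scal.const_mul β)
  have hT := test_trunc hε hgS.smooth hgt
  have hgs : ∀ p, rho p = r → |g p| < ε := fun p hp => by
    have e : scal Q p = 2 := by
      rw [scal, hQ.rad_eq_theta, hQ.rad, hp]; linarith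
    have : g p = h p - c := by simp only [hg, e, hβ]; ring
    rw [this]; exact hs p hp
  have h1 := hloc _ hT fun p hp => trunc_eventuallyEq_zero hε hgS.smooth.continuous (hgs p hp)
  have h2' := hQ.form_trunc_le hε hgS hT.sob
  have h3 := hQ.mass_le_form_add hRQ hgS
  have hI0 : 0 ≤ ∫ p, Q p * |g p| := integral_nonneg fun p =>
    mul_nonneg (hQ.pos p).le (abs_nonneg _)
  have hII := hQ.integrable_mul_abs hgS
  have h4 : ∫ p in {p | rho p < R}, g p ^ 2 ≤ (∫ p in {p | rho p < R}, trunc ε (g p) ^ 2)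
      + 4 * ε / f R * ∫ p, Q p * |g p| := by
    have hms : MeasurableSet {p : E3 | rho p < R} :=
      measurableSet_lt continuous_rho.measurable measurable_const
    have a1 : ∫ p in {p | rho p < R}, g p ^ 2 ≤ ∫ p in {p | rho p < R},
        (trunc ε (g p) ^ 2 + 4 * ε / f R * (Q p * |g p|)) := by
      refine setIntegral_mono_on hgS.sq.integrableOn
        ((hT.sob.sq.integrableOn).add ((hII.const_mul _).integrableOn)) hms fun p hp => ?_
      have b1 := sq_le_trunc_sq hε (g p)
      have b2 : f R ≤ Q p := by
        rw [hQ.rad]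
        exact hQ.prof.strictAntiOn.antitoneOn (rho_nonneg p) hR.le (le_of_lt hp)
      have b3 : 4 * ε * |g p| ≤ 4 * ε / f R * (Q p * |g p|) := by
        rw [div_mul_eq_mul_div, le_div_iff₀ hm]
        have := mul_le_mul_of_nonneg_left b2 (mul_nonneg (mul_nonneg zero_le_four hε.le)
          (abs_nonneg (g p)))
        linarith
      linarith
    rw [integral_add hT.sob.sq.integrableOn ((hII.const_mul _).integrableOn),
      integral_const_mul] at a1
    refine a1.trans (add_le_add le_rfl (mul_le_mul_of_nonneg_left ?_ (by positivity)))
    exact setIntegral_le_integral hII (ae_of_all _ fun p =>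
      mul_nonneg (hQ.pos p).le (abs_nonneg _))
  have hgm : mass g ≤ 2 * mass h + 2 * (β ^ 2 * mass (scal Q)) := by
    have := mass_parallelogram hh.sob (hΨ.const_mul β)
    rw [mass_const_mul] at this
    linarith [mass_nonneg (fun p => h p + β * scal Q p)]
  have hβB : β ^ 2 ≤ B ^ 2 := by
    rw [← sq_abs, ← sq_abs B]
    refine pow_le_pow_left₀ (abs_nonneg _) ?_ 2
    have : |β| = |c| / 2 := by rw [hβ, abs_div]; norm_num
    rw [this]
    linarith [abs_nonneg c, le_abs_self B]
  have hI : ∫ p, Q p * |g p| ≤ N' := by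
    have : ∫ p, Q p * |g p| ≤ ∫ p, (Q p ^ 2 + g p ^ 2) := by
      refine integral_mono hII (hQ.sob.sq.add hgS.sq) fun p => ?_
      have := sq_nonneg (Q p - |g p|)
      have e := sq_abs (g p)
      nlinarith [sq_nonneg (Q p), sq_nonneg (g p)]
    rw [integral_add hQ.sob.sq hgS.sq] at this
    have hb := mul_le_mul_of_nonneg_right hβB hΨ0
    have : ∫ p, Q p * |g p| ≤ mass Q + mass g := this
    linarith [le_abs_self N]
  set I := ∫ p, Q p * |g p|
  set J := ∫ p in {p | rho p < R}, trunc ε (g p) ^ 2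
  have h5 : mass g ≤ A * form Q g + ε * K0 * I := by
    have hJ : J ≤ (form Q g + 8 * ε * I) / c' := by
      rw [le_div_iff₀ hc']; linarith
    have h6 : mass g ≤ 2 * form Q g + 4 * f 0 * ((form Q g + 8 * ε * I) / c' + 4 * ε / f R * I) :=
      h3.trans (by gcongr; linarith)
    refine h6.trans (le_of_eq ?_)
    rw [hA, hK0]; field_simp; ring
  have h6 : mass g ≤ A * form Q g + ε * K0 * N' :=
    h5.trans (by gcongr)
  have h7 := hQ.form_sub_scal hh.sob β
  have h8 : mass h ≤ 2 * mass g + 2 * (β ^ 2 * mass (scal Q)) := by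
    have := mass_parallelogram hgS (hΨ.const_mul β)
    rw [mass_const_mul] at this
    have e : mass (fun p => g p + β * scal Q p) = mass h := by
      congr 1; ext p; simp [hg]
    rw [e] at this
    linarith [mass_nonneg (fun p => g p - β * scal Q p)]
  set X := ∫ p, Q p * h p
  have h9 : 4 * β * X ≤ β ^ 2 * mass Q / 2 + 8 / mass Q * X ^ 2 := by
    have e : β ^ 2 * mass Q / 2 + 8 / mass Q * X ^ 2 - 4 * β * X
        = (β * mass Q - 4 * X) ^ 2 / (2 * mass Q) := by field_simp; ring
    have : 0 ≤ (β * mass Q - 4 * X) ^ 2 / (2 * mass Q) := by positivity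
    linarith
  have h10 : κ * (2 * (β ^ 2 * mass (scal Q))) ≤ β ^ 2 * mass Q / 2 := by
    have := mul_le_mul_of_nonneg_left hκ2 (sq_nonneg β)
    have := mul_nonneg hκ0.le (sq_nonneg β)
    nlinarith
  have h11 : κ * (2 * mass g) ≤ form Q g + ε * (K0 * N' / A) := by
    have a1 : κ * (2 * mass g) * A ≤ mass g := by
      linarith [mul_le_mul_of_nonneg_right hκ1 (mass_nonneg g)]
    have a2 : (form Q g + ε * (K0 * N' / A)) * A = A * form Q g + ε * K0 * N' := by
      field_simp
    exact le_of_mul_le_mul_right (by rw [a2]; linarith) hA0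
  have h12 := mul_le_mul_of_nonneg_left h8 hκ0.le
  change form Q h = form Q g - 4 * β * X + β ^ 2 * mass Q at h7
  linarith

lemma exists_even_coercive : ∃ κ > 0, ∃ C, 0 ≤ C ∧ ∀ h, Test h → Even3 h →
    κ * mass h ≤ form Q h + C * (∫ p, Q p * h p) ^ 2 := by
  obtain ⟨r, hr, -, h2, har⟩ := hQ.prof.exists_rstar_theta
  obtain ⟨κ₁, hκ₁, C₁, -, hodd⟩ := hQ.exists_ref_odd_coercive
  obtain ⟨κ₂, hκ₂, C₂, hC₂, heven⟩ := hQ.exists_sphere_coercive hr h2 har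
  refine ⟨min κ₁ κ₂, lt_min hκ₁ hκ₂, C₂, hC₂, fun h hh he => ?_⟩
  obtain ⟨B, hB⟩ := hQ.exists_nearly_const (κ := min κ₁ κ₂) (C := C₁) hr
    (fun k hk hk0 => (mul_le_mul_of_nonneg_right (min_le_left _ _) (mass_nonneg k)).trans
      (hodd k hk 0 hk0)) hh he
  obtain ⟨K, hK, hKb⟩ := heven B (mass h)
  refine le_of_forall_pos_le_add fun δ hδ => ?_
  have hε : 0 < δ / (K + 1) := by positivity
  obtain ⟨h', t', f', i', m', c, hcB, hc⟩ := hB (δ / (K + 1) / 2) (by positivity)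
  have := hKb (δ / (K + 1)) hε c hcB h' t' m' fun p hp => (hc p hp).trans_lt (by linarith)
  rw [i'] at this
  have h3 : δ / (K + 1) * K ≤ δ := by
    rw [div_mul_eq_mul_div, div_le_iff₀ (by positivity)]; nlinarith
  linarith [mul_le_mul_of_nonneg_right (min_le_right κ₁ κ₂) (mass_nonneg h')]

end GS

/-- Even part under the `i`-th reflection. -/
def evPart (i : Fin 3) (h : E3 → ℝ) (p : E3) : ℝ := 1 / 2 * (h p + h (ref i p))

/-- Odd part under the `i`-th reflection. -/
def odPart (i : Fin 3) (h : E3 → ℝ) (p : E3) : ℝ := 1 / 2 * (h p - h (ref i p))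

lemma ref_comm (i j) (p) : ref i (ref j p) = ref j (ref i p) := by
  fin_cases i <;> fin_cases j <;> simp

lemma Test.evPart (hh : Test h) (i) : Test (evPart i h) :=
  (hh.add (hh.comp (iso_ref i))).const_mul _

lemma Test.odPart (hh : Test h) (i) : Test (odPart i h) :=
  (hh.sub (hh.comp (iso_ref i))).const_mul _

lemma odPart_ref (i) (h) (p) : odPart i h (ref i p) = - odPart i h p := by
  simp only [odPart, ref_ref]; ring

lemma evPart_ref (i) (h) (p) : evPart i h (ref i p) = evPart i h p := by
  simp only [evPart, ref_ref]; ring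

lemma evPart_ref_of_even {i j : Fin 3} (hh : ∀ p, h (ref j p) = h p) (p) :
    evPart i h (ref j p) = evPart i h p := by
  simp only [evPart, ref_comm i j, hh]

lemma mass_split (hh : Test h) (i) :
    mass (evPart i h) + mass (odPart i h) = mass h := by
  have hk := hh.comp (iso_ref i)
  have e1 : mass (evPart i h) = (1 / 2) ^ 2 * mass (fun p => h p + h (ref i p)) :=
    mass_const_mul _ _
  have e2 : mass (odPart i h) = (1 / 2) ^ 2 * mass (fun p => h p - h (ref i p)) :=
    mass_const_mul _ _
  have := mass_parallelogram hh.sob hk.sob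
  rw [mass_comp (iso_ref i)] at this
  rw [e1, e2]; linarith

namespace GS

variable {f : ℝ → ℝ}
lemma form_split (hQ : GS f Q) (hh : Test h) (i) :
    form Q (evPart i h) + form Q (odPart i h) = form Q h := by
  have hk := hh.comp (iso_ref i)
  have e1 : form Q (evPart i h) = (1 / 2) ^ 2 * form Q (fun p => h p + h (ref i p)) :=
    form_const_mul _ _ (hh.add hk).diff
  have e2 : form Q (odPart i h) = (1 / 2) ^ 2 * form Q (fun p => h p - h (ref i p)) :=
    form_const_mul _ _ (hh.sub hk).diff
  have := hQ.form_parallelogram hh.sob hk.sob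
  rw [hQ.form_comp (iso_ref i) hh.diff] at this
  rw [e1, e2]; linarith

lemma integral_evPart {i : Fin 3} (hF : ∀ p, F (ref i p) = F p)
    (hi : Integrable (fun p => F p * h p)) :
    ∫ p, F p * evPart i h p = ∫ p, F p * h p := by
  have hi2 := (iso_ref i).integrable_comp hi
  have e := (iso_ref i).integral_comp (fun p => F p * h p)
  have e2 : (fun p => F p * evPart i h p)
      = fun p => 1 / 2 * (F p * h p + F (ref i p) * h (ref i p)) := by
    ext p; rw [hF, evPart]; ring
  rw [e2, integral_const_mul, integral_add hi hi2, e]; ring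

lemma integral_odPart {i : Fin 3} (hF : ∀ p, F (ref i p) = - F p)
    (hi : Integrable (fun p => F p * h p)) :
    ∫ p, F p * odPart i h p = ∫ p, F p * h p := by
  have hi2 := (iso_ref i).integrable_comp hi
  have e := (iso_ref i).integral_comp (fun p => F p * h p)
  have e2 : (fun p => F p * odPart i h p)
      = fun p => 1 / 2 * (F p * h p + F (ref i p) * h (ref i p)) := by
    ext p; rw [hF, odPart]; ring
  rw [e2, integral_const_mul, integral_add hi hi2, e]; ring

variable (hQ : GS f Q)
include hQ

lemma integrable_mul_sob (hh : SobH h) : Integrable (fun p => Q p * h p) :=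
  hQ.sob.integrable_mul hh

lemma integrable_D_mul_sob (hh : SobH h) (i) :
    Integrable (fun p => D i Q p * h p) :=
  (hQ.sob.dmemLp i).integrable_mul hh.memLp

/-- The square of the distance from the orthogonality conditions. -/
def defect (Q h : E3 → ℝ) : ℝ := (∫ p, Q p * h p) ^ 2 + ∑ i, (∫ p, D i Q p * h p) ^ 2

lemma exists_mass_coercive : ∃ κ > 0, ∃ C, 0 ≤ C ∧ ∀ h, Test h →
    κ * mass h ≤ form Q h + C * defect Q h := by
  obtain ⟨κ₁, hκ₁, C₁, hC₁, hodd⟩ := hQ.exists_ref_odd_coercive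
  obtain ⟨κ₂, hκ₂, C₂, hC₂, heven⟩ := hQ.exists_even_coercive
  refine ⟨min κ₁ κ₂, lt_min hκ₁ hκ₂, max C₁ C₂, le_max_of_le_left hC₁, fun h hh => ?_⟩
  set κ := min κ₁ κ₂
  set C := max C₁ C₂
  have odd : ∀ k, Test k → ∀ i, κ * mass (odPart i k)
      ≤ form Q (odPart i k) + C * (∫ p, D i Q p * k p) ^ 2 := fun k hk i => by
    have h1 := hodd _ (hk.odPart i) i (odPart_ref i k)
    rw [integral_odPart (fun p => by rw [hQ.D_ref]; simp)
      (hQ.integrable_D_mul_sob hk.sob i)] at h1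
    linarith [mul_le_mul_of_nonneg_right (min_le_left κ₁ κ₂) (mass_nonneg (odPart i k)),
      mul_le_mul_of_nonneg_right (le_max_left C₁ C₂) (sq_nonneg (∫ p, D i Q p * k p))]
  have evn : ∀ k, Test k → Even3 k → κ * mass k
      ≤ form Q k + C * (∫ p, Q p * k p) ^ 2 := fun k hk he => by
    linarith [heven _ hk he,
      mul_le_mul_of_nonneg_right (min_le_right κ₁ κ₂) (mass_nonneg k),
      mul_le_mul_of_nonneg_right (le_max_right C₁ C₂) (sq_nonneg (∫ p, Q p * k p))]
  have keepD : ∀ k, Test k → ∀ i j, j ≠ i →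
      ∫ p, D i Q p * evPart j k p = ∫ p, D i Q p * k p := fun k hk i j hij =>
    integral_evPart (fun p => by rw [hQ.D_ref, if_neg hij]) (hQ.integrable_D_mul_sob hk.sob i)
  have keepQ : ∀ k, Test k → ∀ j,
      ∫ p, Q p * evPart j k p = ∫ p, Q p * k p := fun k hk j =>
    integral_evPart (fun p => hQ.comp_iso (iso_ref j) p) (hQ.integrable_mul_sob hk.sob)
  set h1 := evPart 0 h
  have t1 : Test h1 := hh.evPart 0
  set h2 := evPart 1 h1
  have t2 : Test h2 := t1.evPart 1
  set h3 := evPart 2 h2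
  have t3 : Test h3 := t2.evPart 2
  have e3 : Even3 h3 := by
    intro i
    fin_cases i
    · exact evPart_ref_of_even (evPart_ref_of_even (evPart_ref 0 h))
    · exact evPart_ref_of_even (evPart_ref 1 h1)
    · exact evPart_ref 2 h2
  have a0 := odd h hh 0
  have a1 := odd h1 t1 1
  have a2 := odd h2 t2 2
  have a3 := evn h3 t3 e3
  rw [keepD h hh 1 0 (by decide)] at a1
  rw [keepD h1 t1 2 1 (by decide), keepD h hh 2 0 (by decide)] at a2
  rw [keepQ h2 t2, keepQ h1 t1, keepQ h hh] at a3
  have m0 := mass_split hh 0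
  have m1 := mass_split t1 1
  have m2 := mass_split t2 2
  have f0 := hQ.form_split hh 0
  have f1 := hQ.form_split t1 1
  have f2 := hQ.form_split t2 2
  rw [defect, Fin.sum_univ_three, ← m0, ← m1, ← m2, ← f0, ← f1, ← f2]
  linarith

lemma exists_coercive_test : ∃ κ > 0, ∃ C, 0 ≤ C ∧ ∀ h, Test h →
    κ * (mass h + dmass h) ≤ form Q h + C * defect Q h := by
  obtain ⟨κ, hκ, C, hC, H⟩ := hQ.exists_mass_coercive
  have hf0 := hQ.f0_pos
  refine ⟨((1 + 2 * f 0) / κ + 1)⁻¹, by positivity, C, hC, fun h hh => ?_⟩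
  have h1 := H h hh
  have h2 := hQ.form_eq hh.sob
  have h3 : ∫ p, Q p * h p ^ 2 ≤ f 0 * mass h := by
    rw [mass, ← integral_const_mul]
    exact integral_mono (hQ.integrable_mul hh.sob.sq) (hh.sob.sq.const_mul _) fun p =>
      mul_le_mul_of_nonneg_right (hQ.le p) (sq_nonneg _)
  have h0 : 0 ≤ C * defect Q h := mul_nonneg hC (by unfold defect; positivity)
  rw [inv_mul_le_iff₀ (by positivity)]
  have h4 : mass h ≤ (form Q h + C * defect Q h) / κ := by rw [le_div_iff₀ hκ]; linarith
  have h5 : ((1 + 2 * f 0) / κ + 1) * (form Q h + C * defect Q h)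
      = (1 + 2 * f 0) * ((form Q h + C * defect Q h) / κ) + (form Q h + C * defect Q h) := by
    field_simp
  have h6 := mul_le_mul_of_nonneg_left h4 (by positivity : 0 ≤ 1 + 2 * f 0)
  have h7 := mass_nonneg h
  rw [h5]
  linarith

/-- Coercivity of the linearized operator modulo the ground state and its translations. -/
lemma exists_coercive : ∃ κ > 0, ∃ C, 0 ≤ C ∧ ∀ h, SobH h →
    κ * (mass h + dmass h) ≤ form Q h + C * defect Q h := by
  obtain ⟨κ, hκ, C, hC, H⟩ := hQ.exists_coercive_test
  refine ⟨κ, hκ, C, hC, fun h hh => ?_⟩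
  have tst : ∀ n : ℕ, Test (fun p => cut (n + 1) p * h p) := fun n =>
    ⟨(contDiff_cut _).mul hh.smooth, (hasCompactSupport_cut (by positivity)).mul_right⟩
  have lm := tendsto_mass_cut_mul hh
  have ld := tendsto_dmass_cut_mul hh
  have lq : Tendsto (fun n : ℕ => ∫ p, Q p * (cut (n + 1) p * h p) ^ 2) atTop
      (𝓝 (∫ p, Q p * h p ^ 2)) := by
    refine (tendsto_integral_cut_sq_mul (hQ.integrable_mul hh.sq)).congr fun n => ?_
    congr 1; ext p; ring
  have lin : ∀ F : E3 → ℝ, Integrable (fun p => F p * h p) →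
      Tendsto (fun n : ℕ => ∫ p, F p * (cut (n + 1) p * h p)) atTop (𝓝 (∫ p, F p * h p)) :=
    fun F hF => by
    refine (tendsto_integral_cut_mul hF).congr fun n => ?_
    congr 1; ext p; ring
  have lf : Tendsto (fun n : ℕ => form Q (fun p => cut (n + 1) p * h p)) atTop
      (𝓝 (form Q h)) := by
    rw [hQ.form_eq hh]
    exact ((ld.add lm).sub (lq.const_mul 2)).congr fun n => (hQ.form_eq (tst n).sob).symm
  have lde : Tendsto (fun n : ℕ => defect Q (fun p => cut (n + 1) p * h p)) atTop
      (𝓝 (defect Q h)) :=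
    ((lin _ (hQ.integrable_mul_sob hh)).pow 2).add
      (tendsto_finsetSum _ fun i _ => (lin _ (hQ.integrable_D_mul_sob hh i)).pow 2)
  exact le_of_tendsto_of_tendsto' ((lm.add ld).const_mul κ) (lf.add (lde.const_mul C))
    fun n => H _ (tst n)

end GS

/-- Regularised Newtonian kernel `(a + |p|²)^(-1/2)`. -/
def ker (a : ℝ) (p : E3) : ℝ := (√(a + ∑ i, co p i ^ 2))⁻¹

section ker


lemma sum_co_sq_nonneg (p) : 0 ≤ ∑ i, co p i ^ 2 := sum_nonneg fun _ _ => sq_nonneg _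

section
variable (ha : 0 < a)
include ha

lemma ker_pos (p) : 0 < ker a p :=
  inv_pos.2 (sqrt_pos.2 (by linarith [sum_co_sq_nonneg p]))

lemma ker_sq (p) : ker a p ^ 2 * (a + ∑ i, co p i ^ 2) = 1 := by
  have h : 0 < a + ∑ i, co p i ^ 2 := by linarith [sum_co_sq_nonneg p]
  rw [ker, inv_pow, sq_sqrt h.le, inv_mul_cancel₀ h.ne']

lemma contDiff_ker : ContDiff ℝ ∞ (ker a) := by
  have h : ∀ p : E3, 0 < a + ∑ i, co p i ^ 2 := fun p => by linarith [sum_co_sq_nonneg p]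
  refine ContDiff.inv (ContDiff.sqrt ?_ fun p => (h p).ne') fun p => (sqrt_pos.2 (h p)).ne'
  exact contDiff_const.add (ContDiff.sum fun i _ => (contDiff_co i).pow 2)

omit ha in
lemma D_pow (hf : DifferentiableAt ℝ f p) (n : ℕ) (i) :
    D i (fun x => f x ^ n) p = n * f p ^ (n - 1) * D i f p := by
  simp [D, fderiv_fun_pow n hf]

lemma differentiable_ker : Differentiable ℝ (ker a) :=
  (contDiff_ker ha).differentiable (by simp)

lemma D_ker (i) (p) : D i (ker a) p = - (co p i * ker a p ^ 3) := by
  have hd := differentiable_ker ha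
  have hc : ∀ j, Differentiable ℝ (fun p : E3 => co p j) := fun j =>
    (contDiff_co j).differentiable (by simp)
  have hs : Differentiable ℝ (fun p : E3 => ∑ j, co p j ^ 2) :=
    Differentiable.fun_sum fun j _ => (hc j).fun_pow 2
  have h1 : D i (fun p => ker a p ^ 2 * (a + ∑ j, co p j ^ 2)) p = 0 := by
    simp_rw [ker_sq ha]; simp [D]
  have h2 : D i (fun p : E3 => a + ∑ j, co p j ^ 2) p = 2 * co p i := by
    have h0 : D i (fun _ : E3 => a) p = 0 := by simp [D]
    rw [D_add (by fun_prop) (hs p), D_sum _ fun j _ => (hc j p).fun_pow 2, h0]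
    simp [D_sq (hc _ p), D_co]
  rw [D_mul ((hd p).fun_pow 2) ((hs p).const_add a), h2, D_sq (hd p)] at h1
  have h3 := ker_sq ha p
  have h4 := ker_pos ha p
  have h5 : D i (ker a) p * (ker a p ^ 2 * (a + ∑ j, co p j ^ 2))
      = - (co p i * ker a p ^ 3) := by
    have : ker a p * (D i (ker a) p * (ker a p * (a + ∑ j, co p j ^ 2)) + ker a p * ker a p * co p i) = 0 := by
      linear_combination (1 / 2 * ker a p) * h1
    rcases mul_eq_zero.1 this with h | h
    · exact absurd h h4.ne'
    · linear_combination (ker a p) * h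
  rwa [h3, mul_one] at h5

lemma lap_ker (p) : lap (ker a) p = - (3 * a * ker a p ^ 5) := by
  have hd := differentiable_ker ha
  have hc : ∀ j, Differentiable ℝ (fun p : E3 => co p j) := fun j =>
    (contDiff_co j).differentiable (by simp)
  have h1 : ∀ i, D i (D i (ker a)) p = - ker a p ^ 3 + 3 * co p i ^ 2 * ker a p ^ 5 := fun i => by
    have : D i (ker a) = fun p => (-1) * (co p i * ker a p ^ 3) := by
      ext p; rw [D_ker ha]; ring
    rw [this, D_const_mul _ ((hc i p).fun_mul ((hd p).fun_pow 3)),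
      D_mul (hc i p) ((hd p).fun_pow 3), D_pow (hd p), D_ker ha, D_co]
    simp; ring
  have h2 := ker_sq ha p
  simp only [lap, h1]
  simp only [Fin.sum_univ_three] at h2 ⊢
  linear_combination (3 * ker a p ^ 3) * h2

omit ha in
lemma norm_sq_le_sum (p) : ‖p‖ ^ 2 ≤ ∑ i, co p i ^ 2 := by
  rw [← rho_sq]
  exact pow_le_pow_left₀ (norm_nonneg _) (norm_le_rho p) 2

lemma integrable_ker_pow (ha1 : a ≤ 1) (k : ℕ) :
    Integrable (fun p => ker a p ^ (4 + k)) := by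
  have h0 : Integrable (fun p : E3 => (1 + ‖p‖) ^ (-4 : ℝ)) :=
    integrable_one_add_norm (by
      have : Module.finrank ℝ E3 = 3 := by simp [E3]
      rw [this]; norm_num)
  have hc := (contDiff_ker ha).continuous
  refine (h0.const_mul (4 / a ^ 2 * (√a)⁻¹ ^ k)).mono' (hc.pow _).aestronglyMeasurable
    (.of_forall fun p => ?_)
  have hk := ker_pos ha p
  have h1 := norm_sq_le_sum p
  have h2 := ker_sq ha p
  have hn := norm_nonneg p
  set s := ∑ i, co p i ^ 2
  have hk1 : ker a p ≤ (√a)⁻¹ :=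
    inv_anti₀ (sqrt_pos.2 ha) (sqrt_le_sqrt (by linarith [sum_co_sq_nonneg p]))
  rw [norm_of_nonneg (by positivity), pow_add, mul_right_comm]
  refine mul_le_mul ?_ (pow_le_pow_left₀ hk.le hk1 k) (by positivity) (by positivity)
  rw [rpow_neg (by positivity), ← div_eq_mul_inv, le_div_iff₀ (by positivity)]
  norm_cast
  have h3 : a * (1 + ‖p‖) ^ 2 ≤ 2 * (a + s) := by
    have : (1 + ‖p‖) ^ 2 ≤ 2 * (1 + ‖p‖ ^ 2) := by nlinarith [sq_nonneg (1 - ‖p‖)]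
    have h5 : a * ‖p‖ ^ 2 ≤ s := by nlinarith [sq_nonneg ‖p‖]
    nlinarith
  have h4 : ker a p ^ 2 * (1 + ‖p‖) ^ 2 ≤ 2 / a := by
    rw [le_div_iff₀ ha]
    nlinarith [sq_nonneg (ker a p)]
  calc ker a p ^ 4 * (1 + ‖p‖) ^ 4 = (ker a p ^ 2 * (1 + ‖p‖) ^ 2) ^ 2 := by ring
    _ ≤ (2 / a) ^ 2 := pow_le_pow_left₀ (by positivity) h4 2
    _ = 4 / a ^ 2 := by ring

lemma co_sq_mul_ker (i) (p) : co p i ^ 2 * ker a p ^ 2 ≤ 1 := by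
  have h2 := ker_sq ha p
  have h3 : co p i ^ 2 ≤ ∑ i, co p i ^ 2 :=
    single_le_sum (f := fun i => co p i ^ 2) (fun _ _ => sq_nonneg _) (mem_univ i)
  nlinarith [sq_nonneg (ker a p)]

lemma ker_sub (hb : 0 < b) (p) :
    (ker a p - ker b p) * (ker a p + ker b p) = (b - a) * ker a p ^ 2 * ker b p ^ 2 := by
  have h1 := ker_sq ha p
  have h2 := ker_sq hb p
  linear_combination (-(ker a p) ^ 2) * h2 + ker b p ^ 2 * h1

variable (hab : a ≤ b)
include hab

lemma ker_anti (p) : ker b p ≤ ker a p :=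
  inv_anti₀ (sqrt_pos.2 (by linarith [sum_co_sq_nonneg p])) (sqrt_le_sqrt (by linarith))

lemma ker_sub_le (p) :
    ker a p - ker b p ≤ (b - a) * ker a p ^ 3 := by
  have h1 := ker_sub ha (ha.trans_le hab) p
  have h2 := ker_anti ha hab p
  have h3 := ker_pos (ha.trans_le hab) p
  have h4 := ker_pos ha p
  by_contra! h
  have h5 : (b - a) * ker a p ^ 3 * ker a p < (ker a p - ker b p) * (ker a p + ker b p) :=
    mul_lt_mul h (by linarith) h4 (by linarith)
  rw [h1] at h5
  have : ker b p ^ 2 ≤ ker a p ^ 2 := by gcongr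
  have := mul_le_mul_of_nonneg_left this (mul_nonneg (sub_nonneg.2 hab) (sq_nonneg (ker a p)))
  nlinarith

lemma sobH_ker_sub (hb1 : b ≤ 1) :
    SobH (fun p => ker a p - ker b p) := by
  have hb := ha.trans_le hab
  have hs : ContDiff ℝ ∞ (fun p => ker a p - ker b p) := (contDiff_ker ha).sub (contDiff_ker hb)
  refine ⟨hs, ?_, fun i => ?_⟩
  · refine (integrable_ker_pow ha (hab.trans hb1) 2).mono'
      (hs.continuous.pow 2).aestronglyMeasurable (.of_forall fun p => ?_)
    have h1 := ker_sub_le ha hab p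
    have h2 := ker_anti ha hab p
    have h4 := ker_pos ha p
    rw [norm_of_nonneg (sq_nonneg _)]
    calc (ker a p - ker b p) ^ 2 ≤ (ker a p ^ 3) ^ 2 :=
          pow_le_pow_left₀ (by linarith) (h1.trans (by nlinarith [pow_pos h4 3])) 2
      _ = _ := by ring
  · refine ((integrable_ker_pow ha (hab.trans hb1) 0).const_mul 1).mono'
      ((hs.D i).continuous.pow 2).aestronglyMeasurable (.of_forall fun p => ?_)
    rw [D_sub (differentiable_ker ha p) (differentiable_ker hb p), D_ker ha, D_ker hb,
      norm_of_nonneg (sq_nonneg _)]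
    have h2 := ker_anti ha hab p
    have h3 := ker_pos hb p
    have h4 := ker_pos ha p
    have h5 : 0 ≤ ker a p ^ 3 - ker b p ^ 3 := sub_nonneg.2 (by gcongr)
    have h6 : (ker a p ^ 3 - ker b p ^ 3) ^ 2 ≤ (ker a p ^ 3) ^ 2 :=
      pow_le_pow_left₀ h5 (by linarith [pow_pos h3 3]) 2
    calc (-(co p i * ker a p ^ 3) - -(co p i * ker b p ^ 3)) ^ 2
        = co p i ^ 2 * (ker a p ^ 3 - ker b p ^ 3) ^ 2 := by ring
      _ ≤ co p i ^ 2 * (ker a p ^ 3) ^ 2 := by gcongr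
      _ = (co p i ^ 2 * ker a p ^ 2) * ker a p ^ (4 + 0) := by ring
      _ ≤ 1 * ker a p ^ (4 + 0) := by gcongr; exact co_sq_mul_ker ha i p

end

lemma integral_mul_D_sob (hf : SobH f) (hg : SobH g) (i) :
    ∫ p, f p * D i g p = - ∫ p, D i f p * g p :=
  integral_mul_fderiv_eq_neg_fderiv_mul_of_integrable
    ((hf.dmemLp i).integrable_mul hg.memLp)
    (hf.memLp.integrable_mul (hg.dmemLp i))
    (hf.integrable_mul hg) (fun p _ => hf.diff p) fun p _ => hg.diff p

lemma sobH_ker_pow (hb : 0 < b) (hb1 : b ≤ 1) : SobH (fun p => ker b p ^ 5) := by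
  have hs : ContDiff ℝ ∞ (fun p => ker b p ^ 5) := (contDiff_ker hb).pow 5
  refine ⟨hs, ?_, fun i => ?_⟩
  · simpa only [← pow_mul] using integrable_ker_pow hb hb1 6
  · refine ((integrable_ker_pow hb hb1 8).const_mul 25).mono'
      ((hs.D i).continuous.pow 2).aestronglyMeasurable (.of_forall fun p => ?_)
    rw [D_pow (differentiable_ker hb p), D_ker hb, norm_of_nonneg (sq_nonneg _)]
    have h3 := ker_pos hb p
    push_cast
    calc (5 * ker b p ^ (5 - 1) * -(co p i * ker b p ^ 3)) ^ 2
        = 25 * ((co p i ^ 2 * ker b p ^ 2) * ker b p ^ (4 + 8)) := by ring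
      _ ≤ 25 * (1 * ker b p ^ (4 + 8)) := by gcongr; exact co_sq_mul_ker hb i p
      _ = _ := by ring

/-- Majorant of the square of `ker a - ker b`. -/
def kerMaj (b : ℝ) (p : E3) : ℝ := min (‖p‖ ^ 2)⁻¹ (b ^ 2 * (‖p‖ ^ 6)⁻¹)

lemma measurable_kerMaj (b : ℝ) : Measurable (kerMaj b) := by unfold kerMaj; fun_prop

lemma kerMaj_nonneg (b : ℝ) (p) : 0 ≤ kerMaj b p := le_min (by positivity) (by positivity)

lemma ker_sub_sq_le (ha : 0 < a) (hab : a ≤ b) (hp : p ≠ 0) :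
    (ker a p - ker b p) ^ 2 ≤ kerMaj b p := by
  have h1 := ker_sub_le ha hab p
  have h2 := ker_anti ha hab p
  have h3 := ker_pos (ha.trans_le hab) p
  have h4 := ker_pos ha p
  have hp' : 0 < ‖p‖ := norm_pos_iff.2 hp
  have h5 : ker a p ^ 2 ≤ (‖p‖ ^ 2)⁻¹ := by
    rw [← one_div, le_div_iff₀ (by positivity), ← ker_sq ha p]
    gcongr
    linarith [norm_sq_le_sum p]
  refine le_min ((pow_le_pow_left₀ (by linarith) (by linarith : ker a p - ker b p ≤ ker a p) 2).trans
    h5) ?_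
  calc (ker a p - ker b p) ^ 2 ≤ (b * ker a p ^ 3) ^ 2 :=
        pow_le_pow_left₀ (by linarith) (h1.trans (by gcongr; linarith)) 2
    _ = b ^ 2 * (ker a p ^ 2) ^ 3 := by ring
    _ ≤ b ^ 2 * ((‖p‖ ^ 2)⁻¹) ^ 3 := by gcongr
    _ = _ := by rw [inv_pow, ← pow_mul]

lemma integrable_kerMaj_one : Integrable (kerMaj 1) := by
  have h0 : Integrable (fun p : E3 => (fun r : ℝ => 2 * ((r ^ 2)⁻¹ * (1 + r ^ 2)⁻¹)) ‖p‖) := by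
    rw [integrable_fun_norm_addHaar (volume : Measure E3)
      (f := fun r : ℝ => 2 * ((r ^ 2)⁻¹ * (1 + r ^ 2)⁻¹))]
    have h3 : Module.finrank ℝ E3 = 3 := by simp [E3]
    rw [h3]
    refine IntegrableOn.congr_fun (integrable_inv_one_add_sq.const_mul 2).integrableOn
      (fun r hr => ?_) measurableSet_Ioi
    have : (r : ℝ) ≠ 0 := ne_of_gt hr
    simp only [smul_eq_mul]
    field_simp
  refine h0.mono' (measurable_kerMaj 1).aestronglyMeasurable (.of_forall fun p => ?_)
  rw [norm_of_nonneg (kerMaj_nonneg _ _)]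
  rcases eq_or_ne p 0 with rfl | hp
  · simp [kerMaj]
  have hp' : 0 < ‖p‖ := norm_pos_iff.2 hp
  simp only []
  rw [← mul_inv, ← div_eq_mul_inv, le_div_iff₀ (by positivity)]
  rcases le_total ‖p‖ 1 with h | h
  · calc kerMaj 1 p * (‖p‖ ^ 2 * (1 + ‖p‖ ^ 2)) ≤ (‖p‖ ^ 2)⁻¹ * (‖p‖ ^ 2 * (1 + ‖p‖ ^ 2)) := by
          gcongr; exact min_le_left _ _
      _ = 1 + ‖p‖ ^ 2 := by field_simp
      _ ≤ 2 := by nlinarith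
  · calc kerMaj 1 p * (‖p‖ ^ 2 * (1 + ‖p‖ ^ 2))
        ≤ (1 ^ 2 * (‖p‖ ^ 6)⁻¹) * (‖p‖ ^ 2 * (1 + ‖p‖ ^ 2)) := by
          gcongr; exact min_le_right _ _
      _ = (1 + ‖p‖ ^ 2) / ‖p‖ ^ 4 := by field_simp
      _ ≤ 2 := by
          rw [div_le_iff₀ (by positivity)]
          nlinarith [one_le_pow₀ h (n := 2)]

lemma kerMaj_le_one (hb : 0 ≤ b) (hb1 : b ≤ 1) (p) : kerMaj b p ≤ kerMaj 1 p := by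
  unfold kerMaj
  gcongr

lemma integrable_kerMaj (hb : 0 ≤ b) (hb1 : b ≤ 1) : Integrable (kerMaj b) :=
  integrable_kerMaj_one.mono' (measurable_kerMaj b).aestronglyMeasurable
    (.of_forall fun p => by
      rw [norm_of_nonneg (kerMaj_nonneg _ _)]; exact kerMaj_le_one hb hb1 p)

lemma tendsto_inv_nat_add_one : Tendsto (fun n : ℕ => ((n : ℝ) + 1)⁻¹) atTop (𝓝 0) :=
  tendsto_inv_atTop_zero.comp (tendsto_natCast_atTop_atTop.atTop_add tendsto_const_nhds)

lemma exists_integral_kerMaj_le (hε : 0 < ε) :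
    ∃ b, 0 < b ∧ b ≤ 1 ∧ ∫ p, kerMaj b p ≤ ε := by
  have h : Tendsto (fun n : ℕ => ∫ p, kerMaj ((n : ℝ) + 1)⁻¹ p) atTop (𝓝 (∫ p : E3, (0 : ℝ))) := by
    refine tendsto_integral_of_dominated_convergence (kerMaj 1)
      (fun n => (measurable_kerMaj _).aestronglyMeasurable) integrable_kerMaj_one
      (fun n => .of_forall fun p => ?_) (.of_forall fun p => ?_)
    · rw [norm_of_nonneg (kerMaj_nonneg _ _)]
      exact kerMaj_le_one (by positivity) (inv_le_one_of_one_le₀ (by simp)) p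
    · have h2 : Tendsto (fun n : ℕ => (((n : ℝ) + 1)⁻¹) ^ 2 * (‖p‖ ^ 6)⁻¹) atTop (𝓝 0) := by
        simpa using (tendsto_inv_nat_add_one.pow 2).mul_const ((‖p‖ ^ 6)⁻¹)
      exact squeeze_zero (fun n => kerMaj_nonneg _ p) (fun n => min_le_right _ _) h2
  rw [integral_zero] at h
  obtain ⟨n, hn⟩ := (h.eventually (gt_mem_nhds hε)).exists
  exact ⟨_, by positivity, inv_le_one_of_one_le₀ (by simp), hn.le⟩

lemma ker_smul (ht : 0 < t) (p) : ker (t ^ 2) (t • p) = t⁻¹ * ker 1 p := by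
  have : t ^ 2 + ∑ i, co (t • p) i ^ 2 = t ^ 2 * (1 + ∑ i, co p i ^ 2) := by
    simp [co, Fin.sum_univ_three]; ring
  rw [ker, this, sqrt_mul (sq_nonneg t), sqrt_sq ht.le, mul_inv]; rfl

lemma tendsto_integral_ker (hg : Continuous g) (hC : ∀ p, |g p| ≤ C) :
    Tendsto (fun n : ℕ => ∫ p, ((n + 1 : ℝ)⁻¹ ^ 2 * ker ((n + 1 : ℝ)⁻¹ ^ 2) p ^ 5) * g p) atTop
      (𝓝 ((∫ p : E3, ker 1 p ^ 5) * g 0)) := by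
  have e : ∀ n : ℕ, ∫ p, ((n + 1 : ℝ)⁻¹ ^ 2 * ker ((n + 1 : ℝ)⁻¹ ^ 2) p ^ 5) * g p
      = ∫ p, ker 1 p ^ 5 * g ((n + 1 : ℝ)⁻¹ • p) := fun n => by
    have ht : 0 < (n + 1 : ℝ)⁻¹ := by positivity
    generalize (n + 1 : ℝ)⁻¹ = t at ht
    have h3 : Module.finrank ℝ E3 = 3 := by simp [E3]
    have := Measure.integral_comp_smul (volume : Measure E3)
      (fun p => (t ^ 2 * ker (t ^ 2) p ^ 5) * g p) t
    rw [h3, abs_of_pos (by positivity), smul_eq_mul, inv_mul_eq_div,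
      eq_div_iff (by positivity)] at this
    rw [← this, ← integral_mul_const]
    congr 1
    ext p
    rw [ker_smul ht]
    field_simp
  simp_rw [e]
  rw [← integral_mul_const]
  have hk := (contDiff_ker one_pos).continuous
  have hb := integrable_ker_pow one_pos le_rfl 1
  refine tendsto_integral_of_dominated_convergence (fun p => ker 1 p ^ 5 * C)
    (fun n => Continuous.aestronglyMeasurable (by fun_prop)) (hb.mul_const C)
    (fun n => .of_forall fun p => ?_) (.of_forall fun p => ?_)
  · rw [norm_mul, norm_of_nonneg (pow_nonneg (ker_pos one_pos p).le 5)]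
    exact mul_le_mul_of_nonneg_left (hC _) (pow_nonneg (ker_pos one_pos p).le 5)
  · refine Tendsto.const_mul _ ((hg.tendsto 0).comp ?_)
    simpa using tendsto_inv_nat_add_one.smul_const p

lemma D_translate (f) (q p) (i) :
    D i (fun x => f (q + x)) p = D i f (q + p) := by
  simp [D, fderiv_comp_add_left]

lemma SobH.translate (hf : SobH f) (q) : SobH (fun x => f (q + x)) where
  smooth := hf.smooth.comp (contDiff_const.add contDiff_id)
  sq := hf.sq.comp_add_left q
  dsq i := by simp_rw [D_translate]; exact (hf.dsq i).comp_add_left q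

lemma integral_translate (F : E3 → ℝ) (q : E3) : ∫ p, F (q + p) = ∫ p, F p :=
  integral_add_left_eq_self F q

/-- Anisotropic Sobolev bound with arbitrarily small top order constant. -/
theorem exists_sup_D_le (hε : 0 < ε) : ∃ C, 0 ≤ C ∧ ∀ f : E3 → ℝ, SobH f → SobH (D 0 f) →
    Integrable (fun p => D 0 (lap f) p ^ 2) → (∃ B, ∀ p, |D 0 f p| ≤ B) →
    ∀ p, |D 0 f p| ≤ ε * √(∫ p, D 0 (lap f) p ^ 2) + C * √(mass f) := by
  set c : ℝ := 3 * ∫ p : E3, ker 1 p ^ 5 with hc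
  have hc0 : 0 < c := by
    refine mul_pos (by norm_num) (integral_pos_of_integrable_nonneg_nonzero (x := 0)
      ((contDiff_ker one_pos).continuous.pow 5) (integrable_ker_pow one_pos le_rfl 1)
      (fun p => pow_nonneg (ker_pos one_pos p).le 5) (pow_pos (ker_pos one_pos 0) 5).ne')
  obtain ⟨b, hb, hb1, hbε⟩ := exists_integral_kerMaj_le (ε := (ε * c) ^ 2) (by positivity)
  set M := √(∫ p, D 0 (fun p => ker b p ^ 5) p ^ 2) with hM
  refine ⟨3 * b * M / c, by positivity, fun f hf hg hl ⟨B, hB⟩ => ?_⟩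
  have main : ∀ f : E3 → ℝ, SobH f → SobH (D 0 f) →
      Integrable (fun p => D 0 (lap f) p ^ 2) → (∀ p, |D 0 f p| ≤ B) →
      |D 0 f 0| ≤ ε * √(∫ p, D 0 (lap f) p ^ 2) + 3 * b * M / c * √(mass f) := by
    intro f hf hg hl hB
    set L := √(∫ p, D 0 (lap f) p ^ 2)
    have hm := (memLp_two_iff_integrable_sq
      ((contDiff_lap hf.smooth).D 0).continuous.aestronglyMeasurable).2 hl
    have hfin : ∀ n : ℕ, (n + 1 : ℝ)⁻¹ ^ 2 ≤ b →
        |3 * ∫ p, ((n + 1 : ℝ)⁻¹ ^ 2 * ker ((n + 1 : ℝ)⁻¹ ^ 2) p ^ 5) * D 0 f p|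
          ≤ ε * c * L + 3 * b * M * √(mass f) := fun n => by
      have ha : 0 < (n + 1 : ℝ)⁻¹ ^ 2 := by positivity
      generalize (n + 1 : ℝ)⁻¹ ^ 2 = a at ha
      intro hab
      have hΦ := sobH_ker_sub ha hab hb1
      have e1 : ∀ p, lap (fun p => ker a p - ker b p) p
          = - (3 * (a * ker a p ^ 5)) + 3 * b * ker b p ^ 5 := fun p => by
        have := lap_add (contDiff_ker ha) (contDiff_const.mul (contDiff_ker hb) (f := fun _ => (-1 : ℝ))) p
        rw [lap_const_mul _ (contDiff_ker hb), lap_ker ha, lap_ker hb] at this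
        simp only [← sub_eq_add_neg, neg_one_mul] at this
        rw [this]; ring
      have i1 : Integrable (fun p => (ker a p - ker b p) * D 0 (lap f) p) :=
        hΦ.memLp.integrable_mul hm
      have k5a := sobH_ker_pow ha (hab.trans hb1)
      have k5b := sobH_ker_pow hb hb1
      have i2 : Integrable (fun p => ker a p ^ 5 * D 0 f p) :=
        k5a.integrable_mul hg
      have i3 : Integrable (fun p => ker b p ^ 5 * D 0 f p) :=
        k5b.integrable_mul hg
      have e0 : (fun p => D 0 f p * lap (fun p => ker a p - ker b p) p)
          = fun p => -(3 * a) * (ker a p ^ 5 * D 0 f p) + 3 * b * (ker b p ^ 5 * D 0 f p) := by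
        ext p; rw [e1]; ring
      have e2 := congrArg (∫ p, · p) e0
      simp only [integral_add (i2.const_mul (-(3 * a))) (i3.const_mul (3 * b)),
        integral_const_mul] at e2
      have i4 : Integrable (fun p => D 0 f p * lap (fun p => ker a p - ker b p) p) := by
        rw [e0]; exact (i2.const_mul _).add (i3.const_mul _)
      have g1 := integral_grad_mul_grad hg hΦ i4
      have g2 := integral_grad_mul_grad hΦ hg (by simpa only [lap_D hf.smooth] using i1)
      simp only [lap_D hf.smooth] at g2
      have g3 : ∫ p, ∑ i, D i (D 0 f) p * D i (fun p => ker a p - ker b p) p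
          = ∫ p, ∑ i, D i (fun p => ker a p - ker b p) p * D i (D 0 f) p := by
        simp_rw [mul_comm]
      have e3 : 3 * ∫ p, (a * ker a p ^ 5) * D 0 f p
          = - (∫ p, (ker a p - ker b p) * D 0 (lap f) p)
            - 3 * b * ∫ p, D 0 (fun p => ker b p ^ 5) p * f p := by
        rw [integral_mul_D_sob k5b hf 0] at e2
        simp_rw [mul_assoc, integral_const_mul]
        linarith
      have b1 := abs_integral_mul_le_sqrt hΦ.memLp hm
      have b2 := abs_integral_mul_le_sqrt (k5b.dmemLp 0) hf.memLp
      have b3 : √(∫ p, (ker a p - ker b p) ^ 2) ≤ ε * c := by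
        rw [sqrt_le_left (by positivity)]
        refine (integral_mono_ae hΦ.sq (integrable_kerMaj hb.le hb1) ?_).trans hbε
        filter_upwards [Measure.ae_ne volume (0 : E3)] with p hp using ker_sub_sq_le ha hab hp
      rw [e3]
      have b4 : √(∫ p, (ker a p - ker b p) ^ 2) * L ≤ ε * c * L := by gcongr
      refine (abs_sub _ _).trans ?_
      rw [abs_neg, abs_mul, abs_of_pos (by positivity : 0 < 3 * b), mul_assoc (3 * b)]
      refine add_le_add (b1.trans b4) ?_
      gcongr
      exact b2
    have ht := (tendsto_integral_ker hg.smooth.continuous hB).const_mul 3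
    have h1 : Tendsto (fun n : ℕ => (n + 1 : ℝ)⁻¹ ^ 2) atTop (𝓝 0) := by
      simpa using tendsto_inv_nat_add_one.pow 2
    have := le_of_tendsto ht.abs ((h1.eventually (ge_mem_nhds hb)).mono hfin)
    rw [← mul_assoc, ← hc, abs_mul, abs_of_pos hc0] at this
    rw [show ε * L + 3 * b * M / c * √(mass f) = (ε * c * L + 3 * b * M * √(mass f)) / c by
      field_simp, le_div_iff₀ hc0]
    linarith
  intro p
  have e1 : D 0 (fun x => f (p + x)) = fun x => D 0 f (p + x) := by ext x; exact D_translate f p x 0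
  have e2 : lap (fun x => f (p + x)) = fun x => lap f (p + x) := by
    ext x
    simp only [lap]
    refine sum_congr rfl fun i _ => ?_
    rw [show D i (fun x => f (p + x)) = fun x => D i f (p + x) by ext x; exact D_translate f p x i,
      D_translate]
  have e3 : D 0 (lap fun x => f (p + x)) = fun x => D 0 (lap f) (p + x) := by
    rw [e2]; ext x; exact D_translate _ p x 0
  have := main (fun x => f (p + x)) (hf.translate p) (by rw [e1]; exact hg.translate p)
    (by rw [e3]; exact hl.comp_add_left p) (by rw [e1]; exact fun x => hB _)
  rw [e1, e3] at this
  simpa [mass, integral_translate (fun x => D 0 (lap f) x ^ 2) p,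
    integral_translate (fun x => f x ^ 2) p] using this

end ker

/-- Convolution of real functions on `E3`. -/
def conv (h κ : E3 → ℝ) (p : E3) : ℝ := ∫ q, h q * κ (p - q)

variable {κ : E3 → ℝ}
lemma conv_eq (h κ) :
    conv h κ = convolution h κ (ContinuousLinearMap.mul ℝ ℝ) volume := rfl

section
variable (hκ : Test κ)
include hκ

lemma Test.D (i) : Test (D i κ) := ⟨hκ.smooth.D i, hκ.cpt.D i⟩

lemma Test.integrable : Integrable κ :=
  hκ.smooth.continuous.integrable_of_hasCompactSupport hκ.cpt

lemma Test.reflect (p) : Test (fun q => κ (p - q)) :=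
  ⟨hκ.smooth.comp (contDiff_const.sub contDiff_id),
    hκ.cpt.comp_homeomorph (Homeomorph.subLeft p)⟩

lemma Test.lap : Test (lap κ) := by
  have : ZK.lap κ = fun p => ZK.D 0 (ZK.D 0 κ) p + ZK.D 1 (ZK.D 1 κ) p + ZK.D 2 (ZK.D 2 κ) p := by
    funext p; simp [ZK.lap, Fin.sum_univ_three]
  rw [this]
  exact (((hκ.D 0).D 0).add ((hκ.D 1).D 1)).add ((hκ.D 2).D 2)

end

lemma D_reflect (hκ : Differentiable ℝ κ) (p q) (i) :
    D i (fun q => κ (p - q)) q = - D i κ (p - q) := by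
  have h1 : HasFDerivAt (fun q : E3 => p - q) (-ContinuousLinearMap.id ℝ E3) q :=
    (hasFDerivAt_id q).const_sub p
  have := ((hκ (p - q)).hasFDerivAt.comp q h1).fderiv
  simp only [D]
  rw [show (fun q => κ (p - q)) = κ ∘ (fun q => p - q) from rfl, this]
  simp

lemma mass_reflect (κ) (p) : ∫ q, κ (p - q) ^ 2 = mass κ :=
  integral_sub_left_eq_self (fun q => κ q ^ 2) volume p

section
variable (hh : MemLp h 2)
include hh

variable (hκ : Test κ)
include hκ

/-- Pointwise bound of a convolution by Cauchy-Schwarz. -/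
lemma abs_conv_le (p) :
    |conv h κ p| ≤ √(mass h) * √(mass κ) := by
  have := abs_integral_mul_le_sqrt hh (hκ.reflect p).sob.memLp
  rwa [mass_reflect] at this

lemma contDiff_conv : ContDiff ℝ ∞ (conv h κ) := by
  rw [conv_eq]
  exact hκ.cpt.contDiff_convolution_right _ (hh.locallyIntegrable (by norm_num)) hκ.smooth

lemma D_conv (i) :
    D i (conv h κ) = conv h (D i κ) := by
  funext p
  have hl := hh.locallyIntegrable (by norm_num)
  have := (hκ.cpt.hasFDerivAt_convolution_right (ContinuousLinearMap.mul ℝ ℝ) hl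
    (hκ.smooth.of_le (by simp)) p).fderiv
  rw [conv_eq, conv_eq, D, this, convolution_precompR_apply _ hl (hκ.cpt.fderiv ℝ)
    (hκ.smooth.continuous_fderiv (by simp))]
  rfl

omit hh in
omit hκ in
lemma integrable_kernel_prod (hF : Integrable F) (hκ : Integrable κ) :
    Integrable (fun z : E3 × E3 => F z.2 * κ (z.1 - z.2)) (volume.prod volume) :=
  hF.convolution_integrand (ContinuousLinearMap.mul ℝ ℝ) hκ

/-- Young's inequality `L² * L¹ ⊂ L²`. -/
lemma conv_sq :
    Integrable (fun p => conv h κ p ^ 2) ∧ mass (conv h κ) ≤ (∫ p, |κ p|) ^ 2 * mass h := by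
  have hb : ∀ p, conv h κ p ^ 2 ≤ (∫ q, |κ q|) * conv (fun q => h q ^ 2) (fun q => |κ q|) p := by
    intro p
    have hc : Continuous fun q => √|κ (p - q)| := (hκ.reflect p).smooth.continuous.abs.sqrt
    obtain ⟨B, hB⟩ := (hκ.reflect p).cpt.exists_bound_of_continuous
      (hκ.reflect p).smooth.continuous
    have e1 : ∀ q, √|κ (p - q)| ^ 2 = |κ (p - q)| := fun q => sq_sqrt (abs_nonneg _)
    have i1 : Integrable fun q => √|κ (p - q)| ^ 2 := by
      simp_rw [e1]; exact (hκ.reflect p).integrable.abs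
    have i2 : Integrable fun q => (h q * √|κ (p - q)|) ^ 2 := by
      simp_rw [mul_pow, e1]
      exact hh.integrable_sq.mul_bdd (c := B) (hκ.reflect p).smooth.continuous.abs.aestronglyMeasurable
        (.of_forall fun q => by simpa using hB q)
    have h3 : |conv h κ p| ≤ ∫ q, √|κ (p - q)| * (|h q| * √|κ (p - q)|) := by
      refine abs_integral_le_integral_abs.trans (le_of_eq (integral_congr_ae (Eventually.of_forall
        fun q => ?_)))
      simp only [abs_mul]
      linear_combination -|h q| * e1 q
    have h4 := integral_mul_sq_le ((memLp_two_iff_integrable_sq hc.aestronglyMeasurable).2 i1)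
      ((memLp_two_iff_integrable_sq (hh.1.norm.mul hc.aestronglyMeasurable)).2
        (by simpa [mul_pow] using i2))
    have e2 : ∫ q, √|κ (p - q)| ^ 2 = ∫ q, |κ q| := by
      simp_rw [e1]; exact integral_sub_left_eq_self (fun q => |κ q|) volume p
    have e3 : ∫ q, (‖h q‖ * √|κ (p - q)|) ^ 2 = conv (fun q => h q ^ 2) (fun q => |κ q|) p := by
      simp_rw [mul_pow, e1]; simp [conv]
    simp only [norm_eq_abs, Pi.mul_apply] at h4 e3
    rw [e2, e3] at h4
    calc conv h κ p ^ 2 = |conv h κ p| ^ 2 := (sq_abs _).symm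
      _ ≤ _ := (pow_le_pow_left₀ (abs_nonneg _) h3 2).trans h4
  have hi : Integrable (conv (fun q => h q ^ 2) (fun q => |κ q|)) :=
    hh.integrable_sq.integrable_convolution (ContinuousLinearMap.mul ℝ ℝ) hκ.integrable.abs
  have he : ∫ p, conv (fun q => h q ^ 2) (fun q => |κ q|) p = mass h * ∫ q, |κ q| :=
    integral_convolution (ContinuousLinearMap.mul ℝ ℝ) hh.integrable_sq hκ.integrable.abs
  have hint : Integrable (fun p => conv h κ p ^ 2) :=
    (hi.const_mul (∫ q, |κ q|)).mono'
      ((contDiff_conv hh hκ).continuous.pow 2).aestronglyMeasurable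
      (.of_forall fun p => by rw [norm_of_nonneg (sq_nonneg _)]; exact hb p)
  refine ⟨hint, (integral_mono hint (hi.const_mul _) hb).trans (le_of_eq ?_)⟩
  rw [integral_const_mul, he]; ring

lemma sob_conv : SobH (conv h κ) :=
  ⟨contDiff_conv hh hκ, (conv_sq hh hκ).1, fun i => by
    rw [D_conv hh hκ]; exact (conv_sq hh (hκ.D i)).1⟩

lemma lap_conv : lap (conv h κ) = conv h (lap κ) := by
  funext p
  simp only [lap, D_conv hh hκ, D_conv hh (hκ.D _)]
  simp only [conv]
  rw [← integral_finsetSum]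
  · simp only [lap, mul_sum]
  · exact fun i _ => hh.integrable_mul (((hκ.D i).D i).reflect p).sob.memLp

omit hκ in
lemma integral_conv_mul (hg : MemLp g 2) (hκ : Test κ) :
    ∫ p, conv h κ p * g p = ∫ q, h q * conv g (fun z => κ (-z)) q := by
  have i1 := integrable_kernel_prod hh.integrable_sq hκ.integrable.abs
  have hκ' : Integrable fun z => |κ (-z)| := hκ.integrable.abs.comp_neg
  have i2 := (integrable_kernel_prod hg.integrable_sq hκ').swap
  have hm : AEStronglyMeasurable (fun z : E3 × E3 => h z.2 * κ (z.1 - z.2) * g z.1)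
      (volume.prod volume) :=
    (hh.1.comp_snd.mul (hκ.smooth.continuous.comp (continuous_fst.sub
      continuous_snd)).aestronglyMeasurable).mul hg.1.comp_fst
  have key : Integrable (fun z : E3 × E3 => h z.2 * κ (z.1 - z.2) * g z.1)
      (volume.prod volume) := by
    refine (i1.add i2).mono' hm (.of_forall fun z => ?_)
    simp only [Pi.add_apply, Function.comp, Prod.fst_swap, Prod.snd_swap, neg_sub, norm_eq_abs,
      abs_mul]
    have := mul_nonneg (abs_nonneg (κ (z.1 - z.2))) (sq_nonneg (|h z.2| - |g z.1|))
    rw [← sq_abs (h z.2), ← sq_abs (g z.1)]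
    nlinarith [mul_nonneg (abs_nonneg (κ (z.1 - z.2)))
      (add_nonneg (sq_nonneg |h z.2|) (sq_nonneg |g z.1|))]
  calc ∫ p, conv h κ p * g p = ∫ p, ∫ q, h q * κ (p - q) * g p := by
        simp_rw [conv, integral_mul_const]
    _ = ∫ q, ∫ p, h q * κ (p - q) * g p := integral_integral_swap key
    _ = _ := by
        simp_rw [conv, ← integral_const_mul]
        simp only [neg_sub, mul_assoc, mul_comm (κ _)]

end

lemma conv_D (hh : SobH h) (hκ : Test κ) (i) :
    conv h (D i κ) = conv (D i h) κ := by
  funext p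
  have := integral_mul_D_eq_neg (hκ.reflect p).smooth hh.smooth (hκ.reflect p).cpt i
  simp only [D_reflect hκ.diff, neg_mul, integral_neg, neg_neg] at this
  simp only [conv]
  rw [← integral_congr_ae (.of_forall fun q => mul_comm (D i κ (p - q)) (h q)), ← this]
  simp only [mul_comm]

/-- An even probability density in `C_c^∞`, supported in the ball of radius `η`. -/
structure Moll (η : ℝ) (k : E3 → ℝ) : Prop extends Test k where
  nonneg : ∀ p, 0 ≤ k p
  even : ∀ p, k (-p) = k p
  int : ∫ p, k p = 1
  supp : ∀ p, k p ≠ 0 → ‖p‖ ≤ η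

lemma exists_moll (hη : 0 < η) : ∃ k, Moll η k := by
  let b : ContDiffBump (0 : E3) := ⟨η / 2, η, by linarith, by linarith⟩
  refine ⟨b.normed volume, ⟨b.contDiff_normed, b.hasCompactSupport_normed⟩, b.nonneg_normed,
    b.normed_neg, b.integral_normed, fun p hp => ?_⟩
  have : p ∈ Function.support (b.normed volume) := hp
  rw [b.support_normed_eq] at this
  exact (mem_ball_zero_iff.1 this).le

namespace Moll


variable (hk : Moll η k)
include hk

lemma int_abs : ∫ p, |k p| = 1 := by
  simp_rw [abs_of_nonneg (hk.nonneg _)]; exact hk.int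

lemma mass_conv_le (hh : MemLp h 2) : mass (conv h k) ≤ mass h := by
  have := (conv_sq hh hk.toTest).2
  rwa [hk.int_abs, one_pow, one_mul] at this

omit hk in
lemma conv_eq' (h k) (p) : conv h k p = ∫ z, k z * h (p - z) := by
  rw [← integral_sub_left_eq_self (fun z => k z * h (p - z)) volume p]
  simp [conv, mul_comm]

lemma abs_conv_le_sup (hB : ∀ p, |h p| ≤ B) (p) :
    |conv h k p| ≤ B := by
  rw [conv_eq']
  calc |∫ z, k z * h (p - z)| ≤ ∫ z, k z * B := by
        rw [← norm_eq_abs]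
        refine norm_integral_le_of_norm_le (hk.integrable.mul_const B)
          (.of_forall fun z => ?_)
        rw [norm_eq_abs, abs_mul, abs_of_nonneg (hk.nonneg z)]
        exact mul_le_mul_of_nonneg_left (hB _) (hk.nonneg z)
    _ = B := by rw [integral_mul_const, hk.int, one_mul]

lemma integral_conv_mul (hh : MemLp h 2) (hg : MemLp g 2) :
    ∫ p, conv h k p * g p = ∫ q, h q * conv g k q := by
  rw [ZK.integral_conv_mul hh hg hk.toTest]
  simp_rw [hk.even]

end Moll

/-- The increment of an `H¹` function is bounded by its gradient. -/
lemma mass_increment_le (hh : SobH h) (z) :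
    mass (fun p => h (p - z) - h p) ≤ 3 * ‖z‖ ^ 2 * dmass h := by
  have hcg := continuous_gradSq hh.smooth
  have hpt : ∀ p, (h (p - z) - h p) ^ 2 ≤
      ∫ s in Icc (0:ℝ) 1, 3 * ‖z‖ ^ 2 * gradSq h (p - s • z) := by
    intro p
    let G : ℝ → ℝ := fun s => fderiv ℝ h (p - s • z) (-z)
    have hG : Continuous G := by
      have := hh.smooth.continuous_fderiv (by simp)
      fun_prop
    have hd : ∀ s, HasDerivAt (fun s : ℝ => h (p - s • z)) (G s) s := fun s => by
      have h1 : HasDerivAt (fun s : ℝ => p - s • z) (-z) s := by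
        simpa using ((hasDerivAt_id s).smul_const z).const_sub p
      exact (hh.diff _).hasFDerivAt.comp_hasDerivAt s h1
    have h1 : ∫ s in (0:ℝ)..1, G s = h (p - z) - h p := by
      rw [intervalIntegral.integral_eq_sub_of_hasDerivAt (fun s _ => hd s)
        (hG.intervalIntegrable _ _)]
      simp
    rw [intervalIntegral.integral_of_le zero_le_one, ← integral_Icc_eq_integral_Ioc] at h1
    have h2 := integral_mul_sq_le (μ := volume.restrict (Icc (0:ℝ) 1)) (memLp_const 1)
      ((memLp_two_iff_integrable_sq hG.aestronglyMeasurable).2 (hG.pow 2).integrableOn_Icc)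
    simp only [one_mul, h1, one_pow, integral_const, smul_eq_mul, mul_one, measureReal_restrict_apply,
      MeasurableSet.univ, Set.univ_inter, volume_real_Icc, sub_zero, max_eq_left zero_le_one]
      at h2
    refine h2.trans (setIntegral_mono_on (hG.pow 2).integrableOn_Icc ?_ measurableSet_Icc
      fun s _ => ?_)
    · refine Continuous.integrableOn_Icc ?_
      fun_prop
    · have h3 : |G s| ≤ ‖fderiv ℝ h (p - s • z)‖ * ‖z‖ := by
        simpa [G] using (fderiv ℝ h (p - s • z)).le_opNorm (-z)
      calc G s ^ 2 = |G s| ^ 2 := (sq_abs _).symm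
        _ ≤ (‖fderiv ℝ h (p - s • z)‖ * ‖z‖) ^ 2 := pow_le_pow_left₀ (abs_nonneg _) h3 2
        _ = ‖fderiv ℝ h (p - s • z)‖ ^ 2 * ‖z‖ ^ 2 := mul_pow _ _ _
        _ ≤ 3 * gradSq h (p - s • z) * ‖z‖ ^ 2 :=
            mul_le_mul_of_nonneg_right (norm_fderiv_sq_le _ _) (sq_nonneg _)
        _ = _ := by ring
  have hint : Integrable (fun x : ℝ × E3 => 3 * ‖z‖ ^ 2 * gradSq h (x.2 - x.1 • z))
      ((volume.restrict (Icc (0:ℝ) 1)).prod volume) := by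
    rw [integrable_prod_iff (by fun_prop)]
    refine ⟨Eventually.of_forall fun s => (hh.integrable_gradSq.comp_sub_right (s • z)).const_mul _,
      ?_⟩
    have : ∀ s : ℝ, ∫ p, ‖3 * ‖z‖ ^ 2 * gradSq h (p - s • z)‖ = 3 * ‖z‖ ^ 2 * ∫ p, gradSq h p := by
      intro s
      have : ∀ p, ‖3 * ‖z‖ ^ 2 * gradSq h (p - s • z)‖ = 3 * ‖z‖ ^ 2 * gradSq h (p - s • z) :=
        fun p => norm_of_nonneg (mul_nonneg (by positivity) (gradSq_nonneg _ _))
      simp_rw [this, integral_const_mul]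
      rw [integral_sub_right_eq_self (gradSq h) (s • z)]
    simp_rw [this]
    exact integrable_const _
  have hi : Integrable (fun p => ∫ s in Icc (0:ℝ) 1, 3 * ‖z‖ ^ 2 * gradSq h (p - s • z)) :=
    hint.integral_prod_right
  have hl : Integrable (fun p => (h (p - z) - h p) ^ 2) :=
    hi.mono' (by have := hh.smooth.continuous; fun_prop)
      (.of_forall fun p => by rw [norm_of_nonneg (sq_nonneg _)]; exact hpt p)
  refine (integral_mono hl hi hpt).trans (le_of_eq ?_)
  rw [← integral_integral_swap (f := fun s p => 3 * ‖z‖ ^ 2 * gradSq h (p - s • z)) hint]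
  simp_rw [integral_const_mul, fun s : ℝ => integral_sub_right_eq_self (μ := volume) (gradSq h) (s • z)]
  simp [dmass]

lemma Moll.mass_conv_sub_le (hk : Moll η k) (hh : SobH h) :
    mass (fun p => conv h k p - h p) ≤ 3 * η ^ 2 * dmass h := by
  have hkc := hk.smooth.continuous
  have hhc := hh.smooth.continuous
  have hks : HasCompactSupport fun z => √(k z) := hk.cpt.comp_left (g := sqrt) sqrt_zero
  have hci : ∀ p, Integrable fun z => k z * h (p - z) := fun p =>
    Continuous.integrable_of_hasCompactSupport (by fun_prop) hk.cpt.mul_right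
  have hpt : ∀ p, (conv h k p - h p) ^ 2 ≤ ∫ z, k z * (h (p - z) - h p) ^ 2 := by
    intro p
    have e : conv h k p - h p = ∫ z, √(k z) * (√(k z) * (h (p - z) - h p)) := by
      have : ∀ z, √(k z) * (√(k z) * (h (p - z) - h p)) = k z * h (p - z) - k z * h p := fun z => by
        rw [← mul_assoc, mul_self_sqrt (hk.nonneg z)]; ring
      simp_rw [this]
      rw [integral_sub (hci p) (hk.integrable.mul_const _), integral_mul_const, hk.int,
        Moll.conv_eq', one_mul]
    have e2 : ∀ z, (√(k z) * (h (p - z) - h p)) ^ 2 = k z * (h (p - z) - h p) ^ 2 := fun z => by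
      rw [mul_pow, sq_sqrt (hk.nonneg z)]
    have := integral_mul_sq_le (hkc.sqrt.memLp_of_hasCompactSupport hks)
      (Continuous.memLp_of_hasCompactSupport (μ := volume)
        (f := fun z => √(k z) * (h (p - z) - h p)) (by fun_prop) hks.mul_right)
    rw [← e] at this
    simpa [sq_sqrt (hk.nonneg _), hk.int, e2] using this
  have hint : Integrable (fun x : E3 × E3 => k x.2 * (h (x.1 - x.2) - h x.1) ^ 2)
      (volume.prod volume) := by
    have i1 := (hh.sq.mul_prod hk.integrable).const_mul 2
    have i2 := (integrable_kernel_prod hk.integrable hh.sq).const_mul 2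
    refine (i1.add i2).mono' (by fun_prop) (.of_forall fun x => ?_)
    rw [norm_of_nonneg (mul_nonneg (hk.nonneg _) (sq_nonneg _))]
    simp only [Pi.add_apply]
    nlinarith [mul_nonneg (hk.nonneg x.2) (sq_nonneg (h (x.1 - x.2) + h x.1))]
  have hi : Integrable (fun p => ∫ z, k z * (h (p - z) - h p) ^ 2) := hint.integral_prod_left
  have hl : Integrable (fun p => (conv h k p - h p) ^ 2) :=
    hi.mono' (by have := (contDiff_conv hh.memLp hk.toTest).continuous; fun_prop)
      (.of_forall fun p => by rw [norm_of_nonneg (sq_nonneg _)]; exact hpt p)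
  refine (integral_mono hl hi hpt).trans ?_
  rw [integral_integral_swap (f := fun p z => k z * (h (p - z) - h p) ^ 2) hint]
  simp_rw [integral_const_mul]
  have hz : ∀ z, k z * ∫ p, (h (p - z) - h p) ^ 2 ≤ k z * (3 * η ^ 2 * dmass h) := by
    intro z
    by_cases h0 : k z = 0
    · simp [h0]
    refine mul_le_mul_of_nonneg_left ((mass_increment_le hh z).trans ?_) (hk.nonneg z)
    have := hk.supp z h0
    have hd := dmass_nonneg h
    gcongr
  refine (integral_mono_of_nonneg (.of_forall fun z => mul_nonneg (hk.nonneg z)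
    (integral_nonneg fun p => sq_nonneg _)) (hk.integrable.mul_const _)
    (.of_forall hz)).trans ?_
  rw [integral_mul_const, hk.int, one_mul]

section ode

variable {H : Type*} [NormedAddCommGroup H] [InnerProductSpace ℝ H]
/-- Radial truncation onto the ball of radius `r`. -/
def radTrunc (r : ℝ) (x : H) : H := (r / max r ‖x‖) • x

lemma norm_radTrunc_le (hr : 0 < r) (x : H) : ‖radTrunc r x‖ ≤ r := by
  have hm : 0 < max r ‖x‖ := lt_max_of_lt_left hr
  rw [radTrunc, norm_smul, norm_of_nonneg (by positivity), div_mul_eq_mul_div, div_le_iff₀ hm]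
  exact mul_le_mul_of_nonneg_left (le_max_right _ _) hr.le

lemma radTrunc_eq (hr : 0 < r) {x : H} (hx : ‖x‖ ≤ r) : radTrunc r x = x := by
  rw [radTrunc, max_eq_left hx, div_self hr.ne', one_smul]

lemma norm_radTrunc_sub_le (hr : 0 < r) (x y : H) :
    ‖radTrunc r x - radTrunc r y‖ ≤ 2 * ‖x - y‖ := by
  have hx : 0 < max r ‖x‖ := lt_max_of_lt_left hr
  have hy : 0 < max r ‖y‖ := lt_max_of_lt_left hr
  have e : radTrunc r x - radTrunc r y =
      (r / max r ‖x‖) • (x - y) + (r / max r ‖x‖ - r / max r ‖y‖) • y := by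
    simp only [radTrunc, smul_sub, sub_smul]; abel
  have h1 : r / max r ‖x‖ ≤ 1 := (div_le_one hx).2 (le_max_left _ _)
  have h2 : |r / max r ‖x‖ - r / max r ‖y‖| * ‖y‖ ≤ ‖x - y‖ := by
    have : r / max r ‖x‖ - r / max r ‖y‖ = (r / max r ‖x‖) * ((max r ‖y‖ - max r ‖x‖) / max r ‖y‖) := by
      field_simp
    rw [this, abs_mul, abs_of_nonneg (by positivity), abs_div, abs_of_pos hy, mul_assoc]
    have h3 : |max r ‖y‖ - max r ‖x‖| ≤ ‖x - y‖ := by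
      refine (abs_max_sub_max_le_max r ‖y‖ r ‖x‖).trans ?_
      rw [sub_self, abs_zero, max_eq_right (abs_nonneg _), abs_sub_comm]
      exact abs_norm_sub_norm_le x y
    have h4 : |max r ‖y‖ - max r ‖x‖| / max r ‖y‖ * ‖y‖ ≤ ‖x - y‖ := by
      rw [div_mul_eq_mul_div, div_le_iff₀ hy]
      exact mul_le_mul h3 (le_max_right _ _) (norm_nonneg _) (norm_nonneg _)
    calc _ ≤ 1 * ‖x - y‖ := mul_le_mul h1 h4 (by positivity) zero_le_one
      _ = _ := one_mul _
  rw [e]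
  refine (norm_add_le _ _).trans ?_
  rw [norm_smul, norm_smul, norm_of_nonneg (by positivity : 0 ≤ r / max r ‖x‖), norm_eq_abs]
  nlinarith [mul_le_mul_of_nonneg_right h1 (norm_nonneg (x - y))]

/-- Global solvability of a conservative quadratic ODE in a Hilbert space. -/
lemma exists_quadratic_flow [CompleteSpace H] (L : H →L[ℝ] H) (B : H →L[ℝ] H →L[ℝ] H)
    (hc : ∀ v, inner ℝ v (L v + B v v) = 0) (v₀ : H) (hT : 0 < T) :
    ∃ v : ℝ → H, v 0 = v₀ ∧ ∀ t ∈ Icc 0 T,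
      HasDerivAt v (L (v t) + B (v t) (v t)) t ∧ ‖v t‖ = ‖v₀‖ := by
  set r : ℝ := ‖v₀‖ + 1 with hr_def
  have hr : 0 < r := by positivity
  let F : H → H := fun x => L (radTrunc r x) + B (radTrunc r x) (radTrunc r x)
  let M : NNReal := ⟨‖L‖ * r + ‖B‖ * r * r, by positivity⟩
  let K : NNReal := ⟨(‖L‖ + 2 * ‖B‖ * r) * 2, by positivity⟩
  have hM : ∀ x, ‖F x‖ ≤ M := fun x => by
    have h := norm_radTrunc_le hr x
    refine (norm_add_le _ _).trans (add_le_add ?_ ?_)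
    · exact (L.le_opNorm _).trans (by gcongr)
    · exact (B.le_opNorm₂ _ _).trans (by gcongr)
  have hK : LipschitzWith K F := LipschitzWith.of_dist_le_mul fun x y => by
    rw [dist_eq_norm, dist_eq_norm]
    have e : F x - F y = L (radTrunc r x - radTrunc r y) + B (radTrunc r x) (radTrunc r x - radTrunc r y)
        + B (radTrunc r x - radTrunc r y) (radTrunc r y) := by
      simp only [F, map_sub, _root_.sub_apply]; abel
    have h := norm_radTrunc_le hr x
    have h' := norm_radTrunc_le hr y
    have hd := norm_radTrunc_sub_le hr x y
    rw [e]
    calc _ ≤ ‖L‖ * ‖radTrunc r x - radTrunc r y‖ + ‖B‖ * r * ‖radTrunc r x - radTrunc r y‖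
          + ‖B‖ * ‖radTrunc r x - radTrunc r y‖ * r := by
          refine (norm_add_le _ _).trans (add_le_add ((norm_add_le _ _).trans (add_le_add
            (L.le_opNorm _) ?_)) ?_)
          · exact (B.le_opNorm₂ _ _).trans (by gcongr)
          · exact (B.le_opNorm₂ _ _).trans (by gcongr)
      _ = (‖L‖ + 2 * ‖B‖ * r) * ‖radTrunc r x - radTrunc r y‖ := by ring
      _ ≤ (‖L‖ + 2 * ‖B‖ * r) * (2 * ‖x - y‖) := by gcongr
      _ = _ := by change _ = (‖L‖ + 2 * ‖B‖ * r) * 2 * ‖x - y‖; ring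
  have h0 : (0:ℝ) ∈ Icc (-1) (T + 1) := ⟨by norm_num, by linarith⟩
  have hPL : IsPicardLindelof (fun _ => F) (tmin := -1) (tmax := T + 1) ⟨0, h0⟩ v₀
      (M * ⟨T + 1, by positivity⟩) 0 M K :=
    ⟨fun _ _ => hK.lipschitzOnWith, fun _ _ => continuousOn_const, fun _ _ x _ => hM x, by
      change (M : ℝ) * max (T + 1 - 0) (0 - (-1)) ≤ (M : ℝ) * (T + 1) - 0
      rw [max_eq_left (by linarith)]
      simp⟩
  obtain ⟨v, hv0, hv⟩ := hPL.exists_eq_forall_mem_Icc_hasDerivWithinAt₀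
  have hd : ∀ t ∈ Icc 0 T, HasDerivAt v (F (v t)) t := fun t ht =>
    (hv t ⟨by linarith [ht.1], by linarith [ht.2]⟩).hasDerivAt
      (Icc_mem_nhds (by linarith [ht.1]) (by linarith [ht.2]))
  have hin : ∀ x, inner ℝ x (F x) = 0 := fun x => by
    have hm : 0 < max r ‖x‖ := lt_max_of_lt_left hr
    have h := hc (radTrunc r x)
    have e : x = (max r ‖x‖ / r) • radTrunc r x := by
      rw [radTrunc, smul_smul, div_mul_div_cancel₀ hr.ne', div_self hm.ne', one_smul]
    nth_rw 1 [e]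
    rw [real_inner_smul_left, h, mul_zero]
  have hn : ∀ t ∈ Icc 0 T, ‖v t‖ ^ 2 = ‖v 0‖ ^ 2 := by
    refine constant_of_has_deriv_right_zero (fun t ht => ?_) fun t ht => ?_
    · exact ((hd t ht).norm_sq.continuousAt).continuousWithinAt
    · have := (hd t ⟨ht.1, ht.2.le⟩).norm_sq
      rw [hin, mul_zero] at this
      exact this.hasDerivWithinAt
  have hn' : ∀ t ∈ Icc 0 T, ‖v t‖ = ‖v₀‖ := fun t ht => by
    have := hn t ht
    rw [show v 0 = v₀ from hv0] at this
    exact (pow_left_inj₀ (norm_nonneg _) (norm_nonneg _) two_ne_zero).1 this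
  refine ⟨v, hv0, fun t ht => ⟨?_, hn' t ht⟩⟩
  have := hd t ht
  simp only [F] at this
  rwa [radTrunc_eq hr (by rw [hn' t ht]; linarith)] at this

end ode


/-- Twofold mollification. -/
def dconv (k f : E3 → ℝ) : E3 → ℝ := conv (conv f k) k

lemma integrable_conv (hf : MemLp f 2) (hκ : Test κ) (p) :
    Integrable fun q => f q * κ (p - q) :=
  hf.integrable_mul (hκ.reflect p).sob.memLp

lemma conv_add (hf : MemLp f 2) (hg : MemLp g 2) (hκ : Test κ) (p) :
    conv (fun p => f p + g p) κ p = conv f κ p + conv g κ p := by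
  simp only [conv, add_mul]
  exact integral_add (integrable_conv hf hκ p) (integrable_conv hg hκ p)

lemma conv_const_mul (c : ℝ) (p) : conv (fun p => c * f p) κ p = c * conv f κ p := by
  simp only [conv, mul_assoc, integral_const_mul]

lemma conv_congr (hfg : f =ᵐ[volume] g) : conv f κ = conv g κ := by
  funext p
  exact integral_congr_ae (hfg.mono fun q hq => by simp only [hq])

lemma SobH.mul_bdd (hf : SobH f) (hg : SobH g) (ha : ∀ p, |f p| ≤ a)
    (hb : ∀ p, |g p| ≤ b) : SobH (fun p => f p * g p) where
  smooth := hf.smooth.mul hg.smooth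
  sq := (hf.memLp.mul (memLp_top_of_bound hg.meas b (.of_forall hb)) (r := 2)
    |>.integrable_sq).congr (.of_forall fun p => by simp [mul_comm])
  dsq i := by
    simp_rw [fun p => D_mul (hf.diff p) (hg.diff p) i]
    exact (((memLp_top_of_bound hg.meas b (.of_forall hb)).mul (hf.dmemLp i) (r := 2)).add
      ((hg.dmemLp i).mul (memLp_top_of_bound hf.meas a (.of_forall ha)))).integrable_sq

lemma integral_mul_D_self (hf : SobH f) (i) : ∫ p, f p * D i f p = 0 := by
  have := integral_mul_D_sob hf hf i
  simp only [mul_comm (D i f _)] at this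
  linarith

namespace Moll

variable (hk : Moll η k)
include hk

variable (hf : MemLp f 2)
include hf

lemma sob1 : SobH (conv f k) := sob_conv hf hk.toTest

lemma sob : SobH (dconv k f) :=
  sob_conv (hk.sob1 hf).memLp hk.toTest

lemma D_conv_conv (hκ : Test κ) (i) :
    D i (conv (conv f κ) k) = conv (conv f (D i κ)) k := by
  rw [D_conv (sob_conv hf hκ).memLp hk.toTest, conv_D (sob_conv hf hκ) hk.toTest, D_conv hf hκ]

lemma lap_dconv :
    lap (dconv k f) = conv (conv f (ZK.lap k)) k := by
  have hD := fun i => sob_conv hf ((hk.D i).D i)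
  rw [← lap_conv hf hk.toTest]
  funext p
  have e : ∀ i, D i (D i (conv f k)) = conv f (D i (D i k)) := fun i => by
    rw [D_conv hf hk.toTest, D_conv hf (hk.D i)]
  change ∑ i, D i (D i (conv (conv f k) k)) p = ∫ q, (∑ i, D i (D i (conv f k)) q) * k (p - q)
  simp only [e, hk.D_conv_conv hf hk.toTest, hk.D_conv_conv hf (hk.D _), sum_mul]
  rw [integral_finsetSum]
  · rfl
  · exact fun i _ => integrable_conv (hD i).memLp hk.toTest p

lemma D_lap_dconv :
    D 0 (ZK.lap (dconv k f)) = conv (conv f (D 0 (ZK.lap k))) k := by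
  rw [hk.lap_dconv hf, hk.D_conv_conv hf hk.lap]

lemma sob_D (i) : SobH (D i (dconv k f)) := by
  rw [dconv, hk.D_conv_conv hf hk.toTest]
  exact sob_conv (sob_conv hf (hk.D i)).memLp hk.toTest

lemma sob_lap : SobH (ZK.lap (dconv k f)) := by
  rw [hk.lap_dconv hf]
  exact sob_conv (sob_conv hf hk.lap).memLp hk.toTest

lemma sob_D_lap : SobH (D 0 (ZK.lap (dconv k f))) := by
  rw [hk.D_lap_dconv hf]
  exact sob_conv (sob_conv hf (hk.lap.D 0)).memLp hk.toTest

lemma mass_dconv_le : mass (dconv k f) ≤ mass f :=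
  (hk.mass_conv_le (hk.sob1 hf).memLp).trans (hk.mass_conv_le hf)

lemma abs_dconv_le (p) :
    |dconv k f p| ≤ √(mass f) * √(mass k) :=
  (abs_conv_le (hk.sob1 hf).memLp hk.toTest p).trans
    (mul_le_mul_of_nonneg_right (sqrt_le_sqrt (hk.mass_conv_le hf)) (sqrt_nonneg _))

omit hf in
lemma abs_dconv_le_sup (hB : ∀ p, |f p| ≤ B) (p) :
    |dconv k f p| ≤ B := hk.abs_conv_le_sup (hk.abs_conv_le_sup hB) p

lemma integral_dconv_mul (hg : MemLp g 2) :
    ∫ p, dconv k f p * g p = ∫ p, f p * dconv k g p := by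
  rw [dconv, hk.integral_conv_mul (hk.sob1 hf).memLp hg,
    hk.integral_conv_mul hf (hk.sob1 hg).memLp, dconv]

omit hf in
/-- Twofold mollification is `O(η)`-close to the identity. -/
lemma mass_dconv_sub_le (hf : SobH f) :
    mass (fun p => dconv k f p - f p) ≤ 12 * η ^ 2 * dmass f := by
  have h1 := hk.mass_conv_sub_le (hk.sob1 hf.memLp)
  have h2 := hk.mass_conv_sub_le hf
  have h3 : dmass (conv f k) ≤ dmass f := by
    rw [(hk.sob1 hf.memLp).dmass_eq, hf.dmass_eq]
    refine sum_le_sum fun i _ => ?_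
    rw [D_conv hf.memLp hk.toTest, conv_D hf hk.toTest]
    exact hk.mass_conv_le (hf.dmemLp i)
  have i1 := (hk.sob hf.memLp).sub (hk.sob1 hf.memLp)
  have i2 := (hk.sob1 hf.memLp).sub hf
  have h4 : mass (fun p => dconv k f p - f p) ≤ 2 * mass (fun p => dconv k f p - conv f k p)
      + 2 * mass (fun p => conv f k p - f p) := by
    simp only [mass]
    rw [← integral_const_mul, ← integral_const_mul, ← integral_add (i1.sq.const_mul 2)
      (i2.sq.const_mul 2)]
    refine integral_mono ((hk.sob hf.memLp).sub hf).sq ((i1.sq.const_mul 2).add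
      (i2.sq.const_mul 2)) fun p => ?_
    nlinarith [sq_nonneg ((dconv k f p - conv f k p) - (conv f k p - f p))]
  have : 3 * η ^ 2 * dmass (conv f k) ≤ 3 * η ^ 2 * dmass f := by gcongr
  simp only [dconv] at *
  linarith

lemma integral_mul_D_dconv (hg : MemLp g 2)
    (i) : ∫ p, f p * D i (dconv k g) p = - ∫ p, D i (dconv k f) p * g p := by
  rw [dconv, dconv, hk.D_conv_conv hg hk.toTest, hk.D_conv_conv hf hk.toTest,
    ← hk.integral_conv_mul hf (sob_conv hg (hk.D i)).memLp,
    hk.integral_conv_mul (sob_conv hf (hk.D i)).memLp hg, ← D_conv hg hk.toTest,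
    ← D_conv hf hk.toTest]
  exact integral_mul_D_sob (hk.sob1 hf) (hk.sob1 hg) i

lemma integral_mul_D_lap_dconv :
    ∫ p, f p * D 0 (ZK.lap (dconv k f)) p = 0 := by
  rw [hk.D_lap_dconv hf, ← hk.integral_conv_mul hf (sob_conv hf (hk.lap.D 0)).memLp]
  have e : conv f (D 0 (ZK.lap k)) = fun p => ∑ i, D i (D 0 (conv f (D i k))) p := by
    rw [← D_conv hf hk.lap, ← lap_conv hf hk.toTest]
    funext p
    have hs := contDiff_conv hf hk.toTest
    change D 0 (fun q => ∑ i, D i (D i (conv f k)) q) p = _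
    rw [D_sum _ fun i _ => differentiable_D (hs.D i) i p]
    refine sum_congr rfl fun i _ => ?_
    rw [D_comm (hs.D i), D_conv hf hk.toTest]
  have hS := fun i => sob_conv hf ((hk.D i).D 0)
  simp_rw [e, mul_sum]
  rw [integral_finsetSum]
  · refine sum_eq_zero fun i _ => ?_
    rw [D_conv hf (hk.D i), integral_mul_D_sob (hk.sob1 hf) (hS i) i, D_conv hf hk.toTest,
      ← D_conv hf (hk.D i), integral_mul_D_self (sob_conv hf (hk.D i)), neg_zero]
  · intro i _
    rw [D_conv hf (hk.D i)]
    exact (hk.sob1 hf).memLp.integrable_mul ((hS i).dmemLp i)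

end Moll

/-- The conserved energy functional. -/
def energy (f : E3 → ℝ) : ℝ := 1 / 2 * dmass f - 1 / 3 * ∫ p, f p ^ 3

/-- The Hilbert space `L²(ℝ³)`. -/
abbrev L2 := Lp ℝ 2 (volume : Measure E3)

lemma L2.inner_eq (a b : L2) : inner ℝ a b = ∫ p, a p * b p := by
  rw [MeasureTheory.L2.inner_def]
  simp [mul_comm]

lemma L2.norm_sq (a : L2) : ‖a‖ ^ 2 = mass a := by
  rw [← real_inner_self_eq_norm_sq, L2.inner_eq, mass]
  simp_rw [sq]

lemma L2.norm_toLp (hf : MemLp f 2) : ‖hf.toLp f‖ = √(mass f) := by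
  rw [← sqrt_sq (norm_nonneg _), L2.norm_sq, mass, mass]
  congr 1
  exact integral_congr_ae (hf.coeFn_toLp.mono fun p hp => by simp only [hp])

/-- Convolution with a test function as an operator on `L²`. -/
def convL (hκ : Test κ) : L2 →L[ℝ] L2 :=
  LinearMap.mkContinuous
    { toFun := fun v => (sob_conv (Lp.memLp v) hκ).memLp.toLp _
      map_add' := fun v w => by
        rw [← MemLp.toLp_add]
        congr 1
        rw [conv_congr (Lp.coeFn_add v w)]
        funext p
        exact conv_add (Lp.memLp v) (Lp.memLp w) hκ p
      map_smul' := fun c v => by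
        simp only [RingHom.id_apply]
        rw [← MemLp.toLp_const_smul]
        congr 1
        rw [conv_congr (Lp.coeFn_smul c v)]
        funext p
        exact conv_const_mul c p } (∫ p, |κ p|) fun v => by
    simp only [LinearMap.coe_mk, AddHom.coe_mk]
    rw [L2.norm_toLp, ← sqrt_sq (norm_nonneg v), L2.norm_sq,
      ← sqrt_sq (integral_nonneg fun p => abs_nonneg (κ p)), ← sqrt_mul (sq_nonneg _)]
    exact sqrt_le_sqrt (conv_sq (Lp.memLp v) hκ).2

lemma convL_ae (hκ : Test κ) (v : L2) : convL hκ v =ᵐ[volume] conv v κ :=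
  (sob_conv (Lp.memLp v) hκ).memLp.coeFn_toLp

lemma hasDerivAt_conv {v : ℝ → L2} {w : L2} (hv : HasDerivAt v w t) (hκ : Test κ)
    (p) : HasDerivAt (fun s => conv (v s) κ p) (conv w κ p) t := by
  have e : ∀ a : L2, conv a κ p = inner ℝ a ((hκ.reflect p).sob.memLp.toLp _) := fun a => by
    rw [L2.inner_eq]
    exact integral_congr_ae ((hκ.reflect p).sob.memLp.coeFn_toLp.mono fun q hq => by
      simp only [hq])
  simp_rw [e]
  simpa using hv.inner ℝ (hasDerivAt_const t _)

lemma hasDerivAt_dconv {v : ℝ → L2} {w : L2} (hv : HasDerivAt v w t) (hk : Test k)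
    (p) : HasDerivAt (fun s => dconv k (v s) p) (dconv k w p) t := by
  have := hasDerivAt_conv ((convL hk).hasFDerivAt.comp_hasDerivAt t hv) hk p
  simp only [Function.comp_def, conv_congr (convL_ae hk _)] at this
  exact this


namespace Moll

variable (hk : Moll η k)
include hk

lemma dconv_sq_sob (hf : MemLp f 2) (hg : MemLp g 2) :
    SobH (fun p => dconv k f p * dconv k g p) :=
  (hk.sob hf).mul_bdd (hk.sob hg) (hk.abs_dconv_le hf) (hk.abs_dconv_le hg)

lemma dconv_add (hf : MemLp f 2) (hg : MemLp g 2) :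
    dconv k (fun p => f p + g p) = fun p => dconv k f p + dconv k g p := by
  funext p
  rw [dconv, funext (conv_add hf hg hk.toTest)]
  exact conv_add (hk.sob1 hf).memLp (hk.sob1 hg).memLp hk.toTest p

omit hk in
lemma dconv_const_mul (c : ℝ) : dconv k (fun p => c * f p) = fun p => c * dconv k f p := by
  funext p
  rw [dconv, funext (conv_const_mul c), conv_const_mul]
  rfl

omit hk in
lemma dconv_congr (hfg : f =ᵐ[volume] g) : dconv k f = dconv k g := by
  rw [dconv, conv_congr hfg, dconv]

lemma dconv_D (hf : SobH f) (i) :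
    D i (dconv k f) = dconv k (D i f) := by
  rw [dconv, hk.D_conv_conv hf.memLp hk.toTest, conv_D hf hk.toTest, dconv]

lemma dconv_lap (hf : SobH f) (hd : ∀ i, SobH (D i f)) :
    ZK.lap (dconv k f) = dconv k (ZK.lap f) := by
  have e : conv (ZK.lap f) k = fun p => ∑ i, conv (D i (D i f)) k p := by
    funext p
    change ∫ q, (∑ i, D i (D i f) q) * k (p - q) = _
    simp only [sum_mul]
    exact integral_finsetSum _ fun i _ => integrable_conv
      ((hd i).dmemLp i) hk.toTest p
  have e2 : conv f (ZK.lap k) = conv (ZK.lap f) k := by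
    rw [e, ← lap_conv hf.memLp hk.toTest]
    funext p
    change ∑ i, D i (D i (conv f k)) p = _
    refine sum_congr rfl fun i _ => ?_
    rw [D_conv hf.memLp hk.toTest, conv_D hf hk.toTest, D_conv (hd i).memLp hk.toTest,
      conv_D (hd i) hk.toTest]
  rw [hk.lap_dconv hf.memLp, e2, dconv]

end Moll

/-- The regularized product `(a, b) ↦ dconv a * dconv b` on `L²`. -/
def prodL (hk : Moll η k) : L2 →L[ℝ] L2 →L[ℝ] L2 :=
  LinearMap.mkContinuous₂
    (LinearMap.mk₂ ℝ
      (fun a b : L2 => (hk.dconv_sq_sob (Lp.memLp a) (Lp.memLp b)).memLp.toLp _)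
      (fun a a' b => by
        rw [← MemLp.toLp_add]
        congr 1
        rw [Moll.dconv_congr (Lp.coeFn_add a a')]
        exact (congrArg (fun F p => F p * dconv k b p)
          (hk.dconv_add (Lp.memLp a) (Lp.memLp a'))).trans (funext fun p => add_mul _ _ _))
      (fun c a b => by
        rw [← MemLp.toLp_const_smul]
        congr 1
        rw [Moll.dconv_congr (Lp.coeFn_smul c a)]
        exact (congrArg (fun F p => F p * dconv k b p)
          (Moll.dconv_const_mul c)).trans (funext fun p => mul_assoc _ _ _))
      (fun a b b' => by
        rw [← MemLp.toLp_add]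
        congr 1
        rw [Moll.dconv_congr (Lp.coeFn_add b b')]
        exact (congrArg (fun F p => dconv k a p * F p)
          (hk.dconv_add (Lp.memLp b) (Lp.memLp b'))).trans (funext fun p => mul_add _ _ _))
      (fun c a b => by
        rw [← MemLp.toLp_const_smul]
        congr 1
        rw [Moll.dconv_congr (Lp.coeFn_smul c b)]
        exact (congrArg (fun F p => dconv k a p * F p)
          (Moll.dconv_const_mul c)).trans (funext fun p => mul_left_comm _ _ _)))
    (√(mass k)) fun a b => by
      rw [LinearMap.mk₂_apply, L2.norm_toLp]
      have h1 := hk.abs_dconv_le (Lp.memLp a)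
      have hb := hk.sob (Lp.memLp b)
      have : mass (fun p => dconv k a p * dconv k b p) ≤ (√(mass a) * √(mass k)) ^ 2 * mass b := by
        refine le_trans ?_ (mul_le_mul_of_nonneg_left (hk.mass_dconv_le (Lp.memLp b))
          (sq_nonneg _))
        change ∫ p, (dconv k a p * dconv k b p) ^ 2
          ≤ (√(mass a) * √(mass k)) ^ 2 * ∫ p, dconv k b p ^ 2
        rw [← integral_const_mul]
        refine integral_mono (hk.dconv_sq_sob (Lp.memLp a) (Lp.memLp b)).sq
          (hb.sq.const_mul _) fun p => ?_
        simp only [mul_pow (dconv k a p)]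
        exact mul_le_mul_of_nonneg_right (sq_le_sq' (neg_le_of_abs_le (h1 p))
          (le_of_abs_le (h1 p))) (sq_nonneg _)
      refine (sqrt_le_sqrt this).trans (le_of_eq ?_)
      rw [sqrt_mul (sq_nonneg _), sqrt_sq (by positivity), ← L2.norm_sq, ← L2.norm_sq,
        sqrt_sq (norm_nonneg _), sqrt_sq (norm_nonneg _)]
      ring

lemma prodL_ae (hk : Moll η k) (a b : L2) :
    prodL hk a b =ᵐ[volume] fun p => dconv k a p * dconv k b p :=
  (hk.dconv_sq_sob (Lp.memLp a) (Lp.memLp b)).memLp.coeFn_toLp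

lemma convL_convL_ae (hk : Moll η k) (hκ : Test κ) (a : L2) :
    convL hk.toTest (convL hκ a) =ᵐ[volume] conv (conv a κ) k := by
  refine (convL_ae _ _).trans (.of_forall fun p => ?_)
  rw [conv_congr (convL_ae _ _)]

/-- The flow of the mollified equation, together with its first time derivative. -/
lemma exists_moll_flow (hk : Moll η k) (hf : MemLp f 2) (hT : 0 < T) :
    ∃ v w w' : ℝ → L2, v 0 =ᵐ[volume] f ∧ ∀ t ∈ Icc 0 T,
      HasDerivAt v (w t) t ∧ HasDerivAt w (w' t) t ∧ mass (v t) = mass f ∧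
      (w t =ᵐ[volume] fun p => -(D 0 (lap (dconv k (v t))) p
        + D 0 (dconv k fun q => dconv k (v t) q * dconv k (v t) q) p)) ∧
      (w' t =ᵐ[volume] fun p => -(D 0 (lap (dconv k (w t))) p
        + 2 * D 0 (dconv k fun q => dconv k (v t) q * dconv k (w t) q) p)) := by
  have hk' := hk.toTest
  let A : L2 →L[ℝ] L2 := -(convL hk' ∘L convL (hk'.D 0))
  let L : L2 →L[ℝ] L2 := -(convL hk' ∘L convL (hk'.lap.D 0))
  let B : L2 →L[ℝ] L2 →L[ℝ] L2 := (ContinuousLinearMap.compL ℝ L2 L2 L2 A).comp (prodL hk)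
  have hL : ∀ a : L2, L a =ᵐ[volume] fun p => -D 0 (lap (dconv k a)) p := fun a => by
    filter_upwards [Lp.coeFn_neg (convL hk' (convL (hk'.lap.D 0) a)),
      convL_convL_ae hk (hk'.lap.D 0) a] with p h1 h2
    rw [hk.D_lap_dconv (Lp.memLp a), ← h2]
    exact h1
  have hB : ∀ a b : L2, B a b =ᵐ[volume]
      fun p => -D 0 (dconv k fun q => dconv k a q * dconv k b q) p := fun a b => by
    filter_upwards [Lp.coeFn_neg (convL hk' (convL (hk'.D 0) (prodL hk a b))),
      convL_convL_ae hk (hk'.D 0) (prodL hk a b)] with p h1 h2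
    rw [dconv, hk.D_conv_conv (hk.dconv_sq_sob (Lp.memLp a) (Lp.memLp b)).memLp hk',
      ← conv_congr (prodL_ae hk a b), ← h2]
    exact h1
  have hc : ∀ a : L2, inner ℝ a (L a + B a a) = 0 := fun a => by
    have ha := Lp.memLp a
    have hs := hk.sob ha
    have hss := hk.dconv_sq_sob ha ha
    have e1 : inner ℝ a (L a) = 0 := by
      rw [L2.inner_eq, ← neg_eq_zero, ← integral_neg, ← hk.integral_mul_D_lap_dconv ha]
      exact integral_congr_ae ((hL a).mono fun p hp => by simp only [hp]; ring)
    have e2 : inner ℝ a (B a a) = ∫ p, D 0 (dconv k a) p * (dconv k a p * dconv k a p) := by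
      rw [L2.inner_eq, ← neg_inj, ← hk.integral_mul_D_dconv ha hss.memLp, ← integral_neg]
      exact integral_congr_ae ((hB a a).mono fun p hp => by simp only [hp]; ring)
    have e3 := integral_mul_D_sob hs hss 0
    simp only [fun p => D_mul (hs.diff p) (hs.diff p) 0] at e3
    have e4 : ∫ p, dconv k a p * (D 0 (dconv k a) p * dconv k a p + dconv k a p * D 0 (dconv k a) p)
        = 2 * ∫ p, D 0 (dconv k a) p * (dconv k a p * dconv k a p) := by
      rw [← integral_const_mul]
      exact integral_congr_ae (.of_forall fun p => by ring)
    rw [inner_add_right, e1, e2]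
    linarith
  obtain ⟨v, h0, hv⟩ := exists_quadratic_flow L B hc (hf.toLp f) hT
  refine ⟨v, fun t => L (v t) + B (v t) (v t), fun t => L (L (v t) + B (v t) (v t)) +
    (B (L (v t) + B (v t) (v t)) (v t) + B (v t) (L (v t) + B (v t) (v t))),
    h0 ▸ hf.coeFn_toLp, fun t ht => ?_⟩
  obtain ⟨hd, hn⟩ := hv t ht
  refine ⟨hd, ?_, ?_, ?_, ?_⟩
  · refine (L.hasFDerivAt.comp_hasDerivAt t hd).add ?_
    exact (B.hasFDerivAt.comp_hasDerivAt t hd).clm_apply hd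
  · rw [← L2.norm_sq, hn, L2.norm_toLp, sq_sqrt (mass_nonneg f)]
  · filter_upwards [Lp.coeFn_add (L (v t)) (B (v t) (v t)), hL (v t), hB (v t) (v t)]
      with p h1 h2 h3
    rw [h1, Pi.add_apply, h2, h3]
    ring
  · beta_reduce
    generalize L (v t) + B (v t) (v t) = w
    filter_upwards [Lp.coeFn_add (L w) (B w (v t) + B (v t) w),
      Lp.coeFn_add (B w (v t)) (B (v t) w), hL w, hB w (v t), hB (v t) w] with p h1 h2 h3 h4 h5
    rw [h1, Pi.add_apply, h2, Pi.add_apply, h3, h4, h5]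
    simp only [mul_comm (dconv k w _)]
    ring


/-- Functions on `ℝ³` underlying a Schwartz function. -/
def Sch (f : E3 → ℝ) : Prop := ∃ S : SchwartzMap E3 ℝ, ⇑S = f

namespace Sch

variable (hf : Sch f)
include hf

lemma smooth : ContDiff ℝ ∞ f := by
  obtain ⟨S, rfl⟩ := hf
  exact S.smooth ⊤

lemma D (i) : Sch (D i f) := by
  obtain ⟨S, rfl⟩ := hf
  exact ⟨LineDeriv.lineDerivOp (ev i) S, funext fun p =>
    SchwartzMap.lineDerivOp_apply_eq_fderiv (ev i) S p⟩

lemma add (hg : Sch g) : Sch (fun p => f p + g p) := by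
  obtain ⟨S, rfl⟩ := hf
  obtain ⟨T, rfl⟩ := hg
  exact ⟨S + T, rfl⟩

lemma lap : Sch (lap f) := by
  have : ZK.lap f = fun p => ZK.D 0 (ZK.D 0 f) p + ZK.D 1 (ZK.D 1 f) p + ZK.D 2 (ZK.D 2 f) p :=
    funext fun p => Fin.sum_univ_three _
  rw [this]
  exact (((hf.D 0).D 0).add ((hf.D 1).D 1)).add ((hf.D 2).D 2)

lemma sq : Integrable fun p => f p ^ 2 := by
  obtain ⟨S, rfl⟩ := hf
  exact (S.memLp 2 volume).integrable_sq

lemma sob : SobH f := ⟨hf.smooth, hf.sq, fun i => (hf.D i).sq⟩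

lemma bdd : ∃ B, ∀ p, |f p| ≤ B := by
  obtain ⟨S, rfl⟩ := hf
  exact ⟨_, fun p => SchwartzMap.norm_le_seminorm ℝ S p⟩

end Sch

lemma mass_congr (hfg : f =ᵐ[volume] g) : mass f = mass g :=
  integral_congr_ae (hfg.mono fun p hp => by simp only [hp])

lemma mass_add_le (hf : MemLp f 2) (hg : MemLp g 2) :
    mass (fun p => -(f p + g p)) ≤ 2 * mass f + 2 * mass g := by
  simp only [mass]
  rw [← integral_const_mul, ← integral_const_mul, ← integral_add (hf.integrable_sq.const_mul 2)
    (hg.integrable_sq.const_mul 2)]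
  refine integral_mono (hf.add hg).neg.integrable_sq ((hf.integrable_sq.const_mul 2).add
    (hg.integrable_sq.const_mul 2)) fun p => ?_
  simp only
  nlinarith [sq_nonneg (f p - g p)]

/-- The `L²` integral of `∂ₓ(f²)`. -/
lemma mass_D_sq_le (hf : SobH f) (hΛ : ∀ p, |D 0 f p| ≤ Λ) :
    mass (D 0 fun q => f q * f q) ≤ 4 * Λ ^ 2 * mass f := by
  rw [mass, mass, ← integral_const_mul]
  have e : ∀ p, D 0 (fun q => f q * f q) p ^ 2 = 4 * D 0 f p ^ 2 * f p ^ 2 := fun p => by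
    rw [D_mul (hf.diff p) (hf.diff p)]; ring
  have hb : ∀ p, D 0 f p ^ 2 ≤ Λ ^ 2 := fun p =>
    sq_le_sq' (neg_le_of_abs_le (hΛ p)) (le_of_abs_le (hΛ p))
  simp_rw [e]
  refine integral_mono_of_nonneg (.of_forall fun p => by positivity)
    (hf.sq.const_mul _) (.of_forall fun p => ?_)
  have := hb p
  simp only
  gcongr

namespace Moll

lemma bdd_D (hk : Moll η k) (hf : MemLp f 2) (i) :
    ∃ B, ∀ p, |D i (dconv k f) p| ≤ B := by
  rw [dconv, hk.D_conv_conv hf hk.toTest]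
  exact ⟨_, abs_conv_le (sob_conv hf (hk.D i)).memLp hk.toTest⟩

lemma mass_D_dconv_sq_le (hk : Moll η k) (hf : MemLp f 2) (hΛ : ∀ p, |D 0 (dconv k f) p| ≤ Λ) :
    mass (D 0 (dconv k fun q => dconv k f q * dconv k f q)) ≤ 4 * Λ ^ 2 * mass f := by
  have hs := hk.dconv_sq_sob hf hf
  rw [hk.dconv_D hs]
  refine (hk.mass_dconv_le (hs.dmemLp 0)).trans ?_
  exact (mass_D_sq_le (hk.sob hf) hΛ).trans
    (mul_le_mul_of_nonneg_left (hk.mass_dconv_le hf) (by positivity))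

end Moll

/-- Along the mollified flow, `∂ₓW` is controlled by the time derivative. -/
lemma exists_sup_D_flow (m : ℝ) : ∃ C, 0 ≤ C ∧ ∀ (η : ℝ) (k f w : E3 → ℝ), Moll η k →
    MemLp f 2 → MemLp w 2 → mass f = m →
    (w =ᵐ[volume] fun p => -(D 0 (lap (dconv k f)) p
      + D 0 (dconv k fun q => dconv k f q * dconv k f q) p)) →
    ∀ p, |D 0 (dconv k f) p| ≤ 2 * √(mass w) + C := by
  have hε : 0 < 1 / (6 * (√m + 1)) := by positivity
  obtain ⟨C, hC, h⟩ := exists_sup_D_le hε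
  refine ⟨2 * (C * √m), by positivity, fun η k f w hk hf hw hm he => ?_⟩
  obtain ⟨B, hB⟩ := hk.bdd_D hf 0
  set Λ := ⨆ p, |D 0 (dconv k f) p| with hΛd
  have hΛ : ∀ p, |D 0 (dconv k f) p| ≤ Λ := le_ciSup (f := fun p => |D 0 (dconv k f) p|)
    ⟨B, by rintro _ ⟨p, rfl⟩; exact hB p⟩
  have hΛ0 : 0 ≤ Λ := (abs_nonneg _).trans (hΛ 0)
  have hs := hk.sob_D_lap hf
  have hQ := hk.sob_D (hk.dconv_sq_sob hf hf).memLp 0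
  have h1 : mass (D 0 (lap (dconv k f))) ≤ 2 * mass w + 8 * Λ ^ 2 * m := by
    have := mass_add_le hw hQ.memLp
    rw [← mass_congr (f := D 0 (lap (dconv k f))) (he.mono fun p hp => by rw [hp]; ring)] at this
    have h2 := hk.mass_D_dconv_sq_le hf hΛ
    rw [hm] at h2
    linarith
  have hm0 : 0 ≤ m := hm ▸ mass_nonneg f
  have h2 : √(mass (D 0 (lap (dconv k f)))) ≤ 2 * √(mass w) + 3 * (Λ * √m) := by
    refine sqrt_le_iff.2 ⟨by positivity, h1.trans ?_⟩
    nlinarith [sq_sqrt hm0, sq_sqrt (mass_nonneg w), mul_nonneg (sqrt_nonneg (mass w))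
      (mul_nonneg hΛ0 (sqrt_nonneg m)), mass_nonneg w, mul_nonneg (sq_nonneg Λ) hm0]
  have h3 : 1 / (6 * (√m + 1)) * (2 * √(mass w) + 3 * (Λ * √m)) ≤ √(mass w) + Λ / 2 := by
    rw [div_mul_eq_mul_div, div_le_iff₀ (by positivity)]
    nlinarith [mul_nonneg (sqrt_nonneg (mass w)) (sqrt_nonneg m), sqrt_nonneg (mass w)]
  have h4 : Λ ≤ √(mass w) + Λ / 2 + C * √m := ciSup_le fun p => by
    have := h _ (hk.sob hf) (hk.sob_D hf 0) hs.sq ⟨B, hB⟩ p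
    have h5 : √(mass (dconv k f)) ≤ √m := sqrt_le_sqrt (hm ▸ hk.mass_dconv_le hf)
    have h6 := mul_le_mul_of_nonneg_left h2 hε.le
    have h7 := mul_le_mul_of_nonneg_left h5 hC
    change _ ≤ _ * √(mass (D 0 (lap (dconv k f)))) + _ at this
    linarith
  intro p
  linarith [hΛ p]

/-- The growth rate of the time derivative along the mollified flow. -/
lemma integral_flow_growth (hk : Moll η k) (hv : MemLp v 2)
    (hw : MemLp w 2)
    (he : w' =ᵐ[volume] fun p => -(D 0 (lap (dconv k w)) p
      + 2 * D 0 (dconv k fun q => dconv k v q * dconv k w q) p))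
    (hΛ : ∀ p, |D 0 (dconv k v) p| ≤ Λ) : ∫ p, w p * w' p ≤ Λ * mass w := by
  have sv := hk.sob hv
  have sw := hk.sob hw
  have svw := hk.dconv_sq_sob hv hw
  have sww := hk.dconv_sq_sob hw hw
  have i1 := hw.integrable_mul (hk.sob_D_lap hw).memLp
  have i2 := hw.integrable_mul (hk.sob_D svw.memLp 0).memLp
  have e1 : ∫ p, w p * w' p = -(∫ p, w p * D 0 (lap (dconv k w)) p)
      - 2 * ∫ p, w p * D 0 (dconv k fun q => dconv k v q * dconv k w q) p := by
    rw [← integral_neg, ← integral_const_mul]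
    refine .trans (integral_congr_ae (he.mono fun p hp => ?_)) (integral_sub i1.neg (i2.const_mul 2))
    simp [hp]; ring
  have e2 := integral_mul_D_sob sv sww 0
  have e3 : ∫ p, dconv k v p * D 0 (fun q => dconv k w q * dconv k w q) p
      = 2 * ∫ p, D 0 (dconv k w) p * (dconv k v p * dconv k w p) := by
    rw [← integral_const_mul]
    refine integral_congr_ae (.of_forall fun p => ?_)
    simp only [D_mul (sw.diff p) (sw.diff p)]
    ring
  rw [hk.integral_mul_D_lap_dconv hw, hk.integral_mul_D_dconv hw svw.memLp] at e1
  have e4 : ∫ p, w p * w' p = ∫ p, - (D 0 (dconv k v) p * (dconv k w p * dconv k w p)) := by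
    rw [integral_neg]; linarith
  rw [e4]
  refine le_trans ?_ (mul_le_mul_of_nonneg_left (hk.mass_dconv_le hw)
    ((abs_nonneg _).trans (hΛ 0)))
  rw [mass, ← integral_const_mul]
  refine integral_mono ((sv.dmemLp 0).integrable_mul sww.memLp).neg
    (sw.sq.const_mul _) fun p => ?_
  simp only
  nlinarith [neg_le_of_abs_le (hΛ p), mul_self_nonneg (dconv k w p)]

/-- Bounds for the mollified flow, uniform in the mollification parameter. -/
lemma exists_flow_bounds (hf : Sch f) : ∃ δ > 0, ∃ Λ M : ℝ, ∀ η k, Moll η k →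
    ∃ v w : ℝ → L2, v 0 =ᵐ[volume] f ∧ ∀ t ∈ Icc 0 δ,
      HasDerivAt v (w t) t ∧ mass (v t) = mass f ∧
      (w t =ᵐ[volume] fun p => -(D 0 (lap (dconv k (v t))) p
        + D 0 (dconv k fun q => dconv k (v t) q * dconv k (v t) q) p)) ∧
      mass (w t) ≤ M ∧ ∀ p, |D 0 (dconv k (v t)) p| ≤ Λ := by
  obtain ⟨C, hC, hsup⟩ := exists_sup_D_flow (mass f)
  obtain ⟨b, hb⟩ := (hf.D 0).bdd
  have hL := (hf.lap.D 0).sob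
  set N := 2 * mass (D 0 (lap f)) + 8 * b ^ 2 * mass f + 1 with hN
  have hN0 : 0 < N := by
    have := mass_nonneg (D 0 (lap f))
    have := mul_nonneg (sq_nonneg b) (mass_nonneg f)
    simp only [hN]; linarith
  set M₁ := 2 * (2 * √(2 * N) + C) * (2 * N) + 1 with hM₁
  have hM0 : 0 < M₁ := by positivity
  refine ⟨N / M₁, by positivity, 2 * √(2 * N) + C, 2 * N, fun η k hk => ?_⟩
  obtain ⟨v, w, w', h0, hv⟩ := exists_moll_flow hk hf.sob.memLp (T := N / M₁) (by positivity)
  have hd0 : dconv k (v 0) = dconv k f := Moll.dconv_congr h0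
  have hw0 : mass (w 0) ≤ N := by
    obtain ⟨-, -, -, he, -⟩ := hv 0 ⟨le_rfl, by positivity⟩
    rw [mass_congr he, hd0]
    have hfm := hf.sob.memLp
    refine (mass_add_le (hk.sob_D_lap hfm).memLp
      (hk.sob_D (hk.dconv_sq_sob hfm hfm).memLp 0).memLp).trans ?_
    have h1 : mass (D 0 (lap (dconv k f))) ≤ mass (D 0 (lap f)) := by
      rw [hk.dconv_lap hf.sob fun i => (hf.D i).sob, hk.dconv_D hf.lap.sob]
      exact hk.mass_dconv_le hL.memLp
    have h2 := hk.mass_D_dconv_sq_le hfm (Λ := b) fun p => by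
      rw [hk.dconv_D hf.sob]; exact hk.abs_dconv_le_sup hb p
    rw [hN]; linarith
  have hbd : ∀ t ∈ Icc 0 (N / M₁), mass (w t) ≤ N + M₁ * t := by
    have hderiv : ∀ t ∈ Icc 0 (N / M₁), HasDerivAt (fun s => mass (w s))
        (2 * ∫ p, w t p * w' t p) t := fun t ht => by
      have := (hv t ht).2.1.norm_sq
      simpa only [L2.norm_sq, L2.inner_eq] using this
    refine image_le_of_deriv_right_lt_deriv_boundary (B := fun t => N + M₁ * t)
      (B' := fun _ => M₁)
      (fun t ht => (hderiv t ht).continuousAt.continuousWithinAt)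
      (fun t ht => (hderiv t ⟨ht.1, ht.2.le⟩).hasDerivWithinAt) (by simpa using hw0)
      (fun t => ((hasDerivAt_id t).const_mul M₁ |>.const_add N).congr_deriv (by simp))
      fun t ht heq => ?_
    obtain ⟨h1, h2, h3, h4, h5⟩ := hv t ⟨ht.1, ht.2.le⟩
    have hle : mass (w t) ≤ 2 * N := by
      linarith [(lt_div_iff₀ hM0).1 ht.2]
    have h6 := integral_flow_growth hk (Lp.memLp (v t)) (Lp.memLp (w t)) h5
      (hsup η k _ _ hk (Lp.memLp _) (Lp.memLp _) h3 h4)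
    have h7 : (2 * √(mass (w t)) + C) * mass (w t) ≤ (2 * √(2 * N) + C) * (2 * N) :=
      mul_le_mul (by have := sqrt_le_sqrt hle; linarith) hle (mass_nonneg _) (by positivity)
    rw [hM₁]; linarith
  refine ⟨v, w, h0, fun t ht => ?_⟩
  obtain ⟨h1, h2, h3, h4, h5⟩ := hv t ht
  have hle : mass (w t) ≤ 2 * N := by
    linarith [(le_div_iff₀ hM0).1 ht.2, hbd t ht]
  refine ⟨h1, h3, h4, hle, fun p => (hsup η k _ _ hk (Lp.memLp _) (Lp.memLp _) h3 h4 p).trans ?_⟩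
  linarith [sqrt_le_sqrt hle]


lemma mass_convL (hκ : Test κ) (a : L2) : ‖convL hκ a‖ ^ 2 = mass (conv a κ) := by
  rw [L2.norm_sq, mass_congr (convL_ae hκ a)]

/-- The energy conserved by the mollified flow. -/
def modEnergy (k f : E3 → ℝ) : ℝ :=
  1 / 2 * ∑ i, mass (conv f (D i k)) - 1 / 3 * ∫ p, dconv k f p * (dconv k f p * dconv k f p)

namespace Moll

variable (hk : Moll η k)
include hk

lemma integral_dconv_prod (a b c : L2) :
    inner ℝ (convL hk.toTest (convL hk.toTest a)) (prodL hk b c)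
      = ∫ p, dconv k a p * (dconv k b p * dconv k c p) := by
  rw [L2.inner_eq]
  refine integral_congr_ae ?_
  filter_upwards [convL_convL_ae hk hk.toTest a, prodL_ae hk b c] with p h1 h2
  rw [h1, h2]
  rfl

lemma hasDerivAt_modEnergy {v : ℝ → L2} {w : L2} (hv : HasDerivAt v w t)
    (he : w =ᵐ[volume] fun p => -(D 0 (lap (dconv k (v t))) p
      + D 0 (dconv k fun q => dconv k (v t) q * dconv k (v t) q) p)) :
    HasDerivAt (fun s => modEnergy k (v s)) 0 t := by
  have hk' := hk.toTest
  have mv := Lp.memLp (v t)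
  have mw := Lp.memLp w
  have hss := hk.dconv_sq_sob mv mv
  have h1 : HasDerivAt (fun s => ∑ i, mass (conv (v s) (D i k)))
      (∑ i, 2 * ∫ p, conv (v t) (D i k) p * conv w (D i k) p) t := by
    refine HasDerivAt.fun_sum fun i _ => ?_
    have := ((convL (hk'.D i)).hasFDerivAt.comp_hasDerivAt t hv).norm_sq
    simp only [Function.comp_def, mass_convL] at this
    refine this.congr_deriv ?_
    rw [L2.inner_eq]
    congr 1
    refine integral_congr_ae ?_
    filter_upwards [convL_ae (hk'.D i) (v t), convL_ae (hk'.D i) w] with p h1 h2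
    rw [h1, h2]
  have h2 : HasDerivAt (fun s => ∫ p, dconv k (v s) p * (dconv k (v s) p * dconv k (v s) p))
      (3 * ∫ p, dconv k w p * (dconv k (v t) p * dconv k (v t) p)) t := by
    have d1 := ((convL hk' ∘L convL hk').hasFDerivAt.comp_hasDerivAt t hv)
    have d2 := ((prodL hk).hasFDerivAt.comp_hasDerivAt t hv).clm_apply hv
    have := d1.inner ℝ d2
    simp only [Function.comp_def, ContinuousLinearMap.comp_apply, inner_add_right,
      hk.integral_dconv_prod] at this
    refine this.congr_deriv ?_
    have e : ∀ p, dconv k (v t) p * (dconv k w p * dconv k (v t) p)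
        = dconv k w p * (dconv k (v t) p * dconv k (v t) p) := fun p => by ring
    have e' : ∀ p, dconv k (v t) p * (dconv k (v t) p * dconv k w p)
        = dconv k w p * (dconv k (v t) p * dconv k (v t) p) := fun p => by ring
    simp only [e, e']
    ring
  refine ((h1.const_mul (1 / 2)).sub (h2.const_mul (1 / 3))).congr_deriv ?_
  have sv := hk.sob1 mv
  have sw := hk.sob1 mw
  have sl := sob_conv mv hk'.lap
  have el := lap_conv mv hk'
  have e1 : ∑ i, ∫ p, conv (v t) (D i k) p * conv w (D i k) p
      = - ∫ p, w p * ZK.lap (dconv k (v t)) p := by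
    have := (integral_finsetSum _ fun i _ => (sw.dmemLp i).integrable_mul (sv.dmemLp i)).symm.trans
      (integral_grad_mul_grad sw sv (by rw [el]; exact sw.integrable_mul sl))
    rw [el, hk.integral_conv_mul mw sl.memLp, ← hk.lap_dconv mv] at this
    rw [← this]
    refine sum_congr rfl fun i _ => ?_
    rw [D_conv mw hk', D_conv mv hk']
    simp only [mul_comm, Pi.mul_apply]
  have e2 := hk.integral_dconv_mul mw hss.memLp
  have sG := (hk.sob_lap mv).add (hk.sob hss.memLp)
  have i1 := mw.integrable_mul (hk.sob_lap mv).memLp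
  have i2 := mw.integrable_mul (hk.sob hss.memLp).memLp
  have e3 : (∫ p, w p * ZK.lap (dconv k (v t)) p)
      + ∫ p, w p * dconv k (fun q => dconv k (v t) q * dconv k (v t) q) p = 0 := by
    refine (integral_add i1 i2).symm.trans ?_
    rw [← neg_eq_zero, ← integral_neg, ← integral_mul_D_self sG 0]
    refine integral_congr_ae (he.mono fun p hp => ?_)
    simp only [Pi.mul_apply, hp, D_add ((hk.sob_lap mv).diff p) ((hk.sob hss.memLp).diff p)]
    ring
  rw [← mul_sum, e1, e2]
  linarith

lemma energy_dconv_le (hf : MemLp f 2) :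
    energy (dconv k f) ≤ modEnergy k f := by
  have : dmass (dconv k f) ≤ ∑ i, mass (conv f (D i k)) := by
    rw [(hk.sob hf).dmass_eq]
    refine sum_le_sum fun i _ => ?_
    rw [dconv, hk.D_conv_conv hf hk.toTest]
    exact hk.mass_conv_le (sob_conv hf (hk.D i)).memLp
  have e : ∀ p, dconv k f p ^ 3 = dconv k f p * (dconv k f p * dconv k f p) := fun p => by ring
  simp only [energy, modEnergy, e]
  linarith

lemma modEnergy_le (hη : 0 ≤ η) (hf : SobH f) (hb : ∀ p, |f p| ≤ b) :
    modEnergy k f ≤ energy f + 4 * b * √(mass f) * √(dmass f) * η := by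
  have h1 : ∑ i, mass (conv f (D i k)) ≤ dmass f := by
    rw [hf.dmass_eq]
    refine sum_le_sum fun i _ => ?_
    rw [conv_D hf hk.toTest]
    exact hk.mass_conv_le (hf.dmemLp i)
  have hW := hk.sob hf.memLp
  have hd := hW.sub hf
  have hbW := hk.abs_dconv_le_sup hb
  have hb0 : 0 ≤ b := (abs_nonneg _).trans (hb 0)
  have hmd : √(mass fun p => dconv k f p - f p) ≤ 4 * η * √(dmass f) := by
    refine sqrt_le_iff.2 ⟨by positivity, (hk.mass_dconv_sub_le hf).trans ?_⟩
    rw [mul_pow, sq_sqrt (dmass_nonneg f)]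
    nlinarith [mul_nonneg (sq_nonneg η) (dmass_nonneg f)]
  have hmW : √(mass (dconv k f)) ≤ √(mass f) := sqrt_le_sqrt (hk.mass_dconv_le hf.memLp)
  have j1 := (hd.integrable_mul hf).abs
  have j2 := (hd.integrable_mul hW).abs
  have c1 := integral_abs_mul_le_sqrt hd.memLp hf.memLp
  have c2 := integral_abs_mul_le_sqrt hd.memLp hW.memLp
  have i1 : Integrable fun p => f p ^ 3 := by
    simpa only [pow_succ (f _) 2] using hf.sq.mul_bdd hf.meas (.of_forall hb)
  have i2 : Integrable fun p => dconv k f p ^ 3 := by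
    simpa only [pow_succ (dconv k f _) 2] using
      hW.sq.mul_bdd hW.meas (.of_forall hbW)
  have h2 : (∫ p, f p ^ 3) - ∫ p, dconv k f p ^ 3 ≤ 12 * b * √(mass f) * √(dmass f) * η := by
    rw [← integral_sub i1 i2]
    have h3 : ∫ p, (f p ^ 3 - dconv k f p ^ 3) ≤
        ∫ p, (2 * b * |(dconv k f p - f p) * f p| + b * |(dconv k f p - f p) * dconv k f p|) := by
      refine integral_mono (i1.sub i2) ((j1.const_mul (2 * b)).add (j2.const_mul b)) fun p => ?_
      simp only [abs_mul]
      have e : f p ^ 3 - dconv k f p ^ 3 = (f p - dconv k f p) *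
        (f p ^ 2 + f p * dconv k f p + dconv k f p ^ 2) := by ring
      have a1 : |f p ^ 2 + f p * dconv k f p + dconv k f p ^ 2|
          ≤ b * |f p| + |f p| * b + b * |dconv k f p| := by
        refine (abs_add_three _ _ _).trans ?_
        rw [abs_mul, abs_pow, abs_pow, sq, sq]
        gcongr
        exacts [hb p, hbW p, hbW p]
      rw [e]
      refine (le_abs_self _).trans ?_
      rw [abs_mul, abs_sub_comm]
      nlinarith [mul_le_mul_of_nonneg_left a1 (abs_nonneg (dconv k f p - f p))]
    rw [integral_add (j1.const_mul (2 * b)) (j2.const_mul b), integral_const_mul,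
      integral_const_mul] at h3
    simp only [abs_mul] at h3
    have c3 : √(mass fun p => dconv k f p - f p) * √(mass f) ≤ 4 * η * √(dmass f) * √(mass f) := by
      gcongr
    have c4 : √(mass fun p => dconv k f p - f p) * √(mass (dconv k f))
        ≤ 4 * η * √(dmass f) * √(mass f) := by gcongr
    linarith [mul_le_mul_of_nonneg_left (c1.trans c3) hb0,
      mul_le_mul_of_nonneg_left (c2.trans c4) hb0]
  have e : ∀ p, dconv k f p * (dconv k f p * dconv k f p) = dconv k f p ^ 3 := fun p => by ring
  simp only [energy, modEnergy, e]
  linarith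

end Moll

/-- Approximate solutions with Schwartz data, with bounds uniform in the mollification
parameter on a common time interval. -/
lemma exists_approx (hf : Sch f) : ∃ δ > 0, ∃ Λ M : ℝ, ∀ η k, 0 < η → Moll η k →
    ∃ v w : ℝ → L2, v 0 =ᵐ[volume] f ∧ ∀ t ∈ Icc 0 δ,
      HasDerivAt v (w t) t ∧ mass (v t) = mass f ∧
      (w t =ᵐ[volume] fun p => -(D 0 (lap (dconv k (v t))) p
        + D 0 (dconv k fun q => dconv k (v t) q * dconv k (v t) q) p)) ∧
      mass (w t) ≤ M ∧ (∀ p, |D 0 (dconv k (v t)) p| ≤ Λ) ∧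
      energy (dconv k (v t)) ≤ energy f + M * η := by
  obtain ⟨δ, hδ, Λ, M, h⟩ := exists_flow_bounds hf
  obtain ⟨b, hb⟩ := hf.bdd
  refine ⟨δ, hδ, Λ, max M (4 * b * √(mass f) * √(dmass f)), fun η k hη hk => ?_⟩
  obtain ⟨v, w, h0, hv⟩ := h η k hk
  refine ⟨v, w, h0, fun t ht => ?_⟩
  obtain ⟨h1, h2, h3, h4, h5⟩ := hv t ht
  refine ⟨h1, h2, h3, h4.trans (le_max_left _ _), h5, ?_⟩
  have hder : ∀ s ∈ Icc 0 δ, HasDerivAt (fun s => modEnergy k (v s)) 0 s := fun s hs =>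
    hk.hasDerivAt_modEnergy (hv s hs).1 (hv s hs).2.2.1
  have hc := constant_of_has_deriv_right_zero
    (fun s hs => (hder s hs).continuousAt.continuousWithinAt)
    (fun s hs => (hder s ⟨hs.1, hs.2.le⟩).hasDerivWithinAt) t ht
  have e0 : modEnergy k (v 0) = modEnergy k f := by
    simp only [modEnergy, conv_congr h0, Moll.dconv_congr h0]
  linarith [hk.modEnergy_le hη.le hf.sob hb,
    hk.energy_dconv_le (Lp.memLp (v t)),
    mul_le_mul_of_nonneg_right (le_max_right M (4 * b * √(mass f) * √(dmass f))) hη.le]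

variable {χ V : E3 → ℝ} {e e' : ℝ → E3 → ℝ} {L κ ρ : ℝ}
section
variable (hχ : Test χ)
include hχ

lemma Test.mul (hg : ContDiff ℝ ∞ g) : Test (fun p => χ p * g p) :=
  ⟨hχ.smooth.mul hg, HasCompactSupport.mul_right (f := χ) (f' := g) hχ.cpt⟩

lemma Test.integrable_mul (hg : Continuous g) : Integrable fun p => χ p * g p :=
  (hχ.smooth.continuous.mul hg).integrable_of_hasCompactSupport
    (HasCompactSupport.mul_right (f := χ) (f' := g) hχ.cpt)

lemma Test.integral_D (i) : ∫ p, ZK.D i χ p = 0 :=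
  integral_D_eq_zero (hχ.smooth.of_le (by simp)) hχ.cpt i

omit hχ in
lemma test_cut (n : ℕ) : Test (cut (n + 1)) :=
  ⟨contDiff_cut _, hasCompactSupport_cut (by positivity)⟩

/-- Growth of a localized mass under a differential inequality. -/
lemma cut_growth (h0 : ∀ p, 0 ≤ χ p) (hab : a ≤ b)
    (hc : ∀ t ∈ Icc a b, Continuous (e t)) (hc' : ∀ t ∈ Icc a b, Continuous (e' t))
    (hd : ∀ t ∈ Icc a b, ∀ p, HasDerivAt (fun s => e s p) (e' t p) t)
    (hC : ∀ t ∈ Icc a b, ∀ p ∈ tsupport χ, |e t p| ≤ C ∧ |e' t p| ≤ C) (hL : 0 ≤ L)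
    (h0c : 0 ≤ c) (hX : ∀ t ∈ Icc a b,
      ∫ p, χ p * (2 * e t p * e' t p) ≤ L * (∫ p, χ p * e t p ^ 2) + c) :
    ∫ p, χ p * e b p ^ 2 ≤ ((∫ p, χ p * e a p ^ 2) + c * (b - a)) * exp (L * (b - a)) := by
  set X : ℝ → ℝ := fun t => ∫ p, χ p * e t p ^ 2
  have hb : ∀ t ∈ Icc a b, ∀ p, ∀ y z, |y| ≤ |e t p| → |z| ≤ |e t p| + |e' t p| →
      ‖χ p * (y * z)‖ ≤ χ p * (2 * C ^ 2) := fun t ht p y z hy hz => by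
    rw [norm_mul, norm_of_nonneg (h0 p), norm_mul]
    by_cases hp : p ∈ tsupport χ
    · obtain ⟨h1, h2⟩ := hC t ht p hp
      have : ‖y‖ * ‖z‖ ≤ C * (C + C) := mul_le_mul (hy.trans h1) (hz.trans (add_le_add h1 h2))
        (norm_nonneg _) ((abs_nonneg _).trans h1)
      exact mul_le_mul_of_nonneg_left (by linarith) (h0 p)
    · simp [image_eq_zero_of_notMem_tsupport hp]
  have hI : Integrable fun p => χ p * (2 * C ^ 2) := hχ.integrable.mul_const _
  have hm : ∀ t ∈ Icc a b, AEStronglyMeasurable (fun p => χ p * e t p ^ 2) :=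
    fun t ht => (hχ.smooth.continuous.mul ((hc t ht).pow 2)).aestronglyMeasurable
  have hXc : ContinuousOn X (Icc a b) := continuousOn_of_dominated hm
    (fun t ht => Eventually.of_forall fun p => by
      rw [sq]; exact hb t ht p _ _ le_rfl (by linarith [abs_nonneg (e' t p)])) hI
    (.of_forall fun p t ht =>
      ((hd t ht p).continuousAt.pow 2).const_mul (χ p) |>.continuousWithinAt)
  have hXd : ∀ t ∈ Ioo a b, HasDerivAt X (∫ p, χ p * (2 * e t p * e' t p)) t := fun t ht => by
    have hI' := hI.const_mul 2
    refine (hasDerivAt_integral_of_dominated_loc_of_deriv_le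
      (F' := fun t p => χ p * (2 * e t p * e' t p)) (Ioo_mem_nhds ht.1 ht.2)
      (eventually_of_mem (Ioo_mem_nhds ht.1 ht.2) fun s hs => hm s (Set.Ioo_subset_Icc_self hs)) ?_ ?_
      (.of_forall fun p s hs => ?_) hI' (.of_forall fun p s hs => ?_)).2
    · exact hχ.integrable_mul ((hc t (Set.Ioo_subset_Icc_self ht)).pow 2)
    · have := Set.Ioo_subset_Icc_self ht
      exact (hχ.smooth.continuous.mul (((hc t this).const_mul 2).mul
        (hc' t this))).aestronglyMeasurable
    · have := hb s (Set.Ioo_subset_Icc_self hs) p (e s p) (e' s p) le_rfl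
        (by linarith [abs_nonneg (e s p)])
      rw [show χ p * (2 * e s p * e' s p) = 2 * (χ p * (e s p * e' s p)) by ring, norm_mul,
        norm_two]
      linarith
    · exact (((hd s (Set.Ioo_subset_Icc_self hs) p).fun_pow 2).const_mul (χ p)).congr_deriv
        (by simp)
  have hG := antitoneOn_of_deriv_nonpos (convex_Icc a b)
    (f := fun t => X t * exp (-(L * (t - a))) - c * (t - a)) (by fun_prop) (fun t ht => ?_)
    (fun t ht => ?_) (left_mem_Icc.2 hab) (right_mem_Icc.2 hab) hab
  · simp only [sub_self, mul_zero, neg_zero, exp_zero, mul_one, sub_zero] at hG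
    rw [exp_neg] at hG
    have := exp_pos (L * (b - a))
    have h2 : X b * (exp (L * (b - a)))⁻¹ ≤ X a + c * (b - a) := by linarith
    rwa [← div_eq_mul_inv, div_le_iff₀ this] at h2
  all_goals
    rw [interior_Icc] at ht
    have hD := ((hXd t ht).fun_mul (((((hasDerivAt_id t).sub_const a).const_mul L).fun_neg).exp)).fun_sub
      (((hasDerivAt_id t).sub_const a).const_mul c)
    simp only [id] at hD
  · exact hD.differentiableAt.differentiableWithinAt
  · rw [hD.deriv]
    have h1 := hX t (Set.Ioo_subset_Icc_self ht)
    have h2 : exp (-(L * (t - a))) ≤ 1 :=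
      exp_le_one_iff.2 (neg_nonpos.2 (mul_nonneg hL (by linarith [ht.1])))
    change _ ≤ L * X t + c at h1
    nlinarith [exp_pos (-(L * (t - a)))]

/-- The localized mass flux of the linearized equation. -/
lemma flux_le {e : E3 → ℝ} (h0 : ∀ p, 0 ≤ χ p) (h1 : ∀ i p, |D i χ p| ≤ κ)
    (h2 : ∀ i p, |D 0 (D i χ) p| ≤ κ) (he : SobH e) (h3 : Integrable fun p => |e p| ^ 3)
    (hV : ContDiff ℝ ∞ V) (hb : ∀ p, |V p| ≤ b) (hΛ : ∀ p, |D 0 V p| ≤ Λ) :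
    -(∫ p, χ p * (2 * e p * (D 0 (lap e) p + D 0 (fun q => e q * e q + 2 * (V q * e q)) p)))
      ≤ 2 * Λ * (∫ p, χ p * e p ^ 2)
        + κ * ((3 + 2 * b) * mass e + 6 * dmass e + 2 * ∫ p, |e p| ^ 3) := by
  have hD := fun i => he.smooth.D i
  have hDχ := fun i => hχ.D i
  have hT : ∀ i, Test (fun q => χ q * (e q * D i (D 0 e) q)) := fun i =>
    hχ.mul (he.smooth.mul ((hD 0).D i))
  have hT2 : ∀ i, Test (fun q => D i χ q * (e q * D i e q)) := fun i =>
    (hDχ i).mul (he.smooth.mul (hD i))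
  have hT3 : ∀ i, Test (fun q => χ q * (D i e q * D i e q)) := fun i =>
    hχ.mul ((hD i).mul (hD i))
  have hT4 : Test (fun q => χ q * (2 / 3 * (e q * (e q * e q)) + V q * (e q * e q))) :=
    hχ.mul (by have := he.smooth; fun_prop)
  have dχ := hχ.diff
  have de := he.diff
  have dV : Differentiable ℝ V := hV.differentiable (by simp)
  have ddχ := fun i => (hDχ i).diff
  have dde := fun i => differentiable_D he.smooth i
  have ddde := fun i j => differentiable_D (hD j) i
  have hJ := fun i => (((hT i).D i).integrable.sub' ((hT2 i).D 0).integrable).sub'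
    (((hT3 i).D 0).integrable.const_mul (1 / 2))
  have hJ' := (integrable_finsetSum Finset.univ fun i _ => hJ i).const_mul 2
  have hJ4 := (hT4.D 0).integrable.const_mul 2
  have hI1 : Integrable fun p => χ p * (2 * e p * (D 0 (lap e) p
      + D 0 (fun q => e q * e q + 2 * (V q * e q)) p)) :=
    hχ.integrable_mul ((he.smooth.continuous.const_mul 2).mul
      (((contDiff_lap he.smooth).D 0).continuous.add
        (ContDiff.D (by have := he.smooth; fun_prop) 0).continuous))
  have hI2 := (hχ.integrable_mul (he.smooth.continuous.fun_pow 2)).const_mul (2 * Λ)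
  have hI4 := (he.sq.const_mul (3 + 2 * b)).fun_add (he.integrable_gradSq.const_mul 6)
  have hI3 := (hI4.fun_add (h3.const_mul 2)).const_mul κ
  have hM := integral_mono (hJ'.fun_add hJ4) (hI1.fun_add (hI2.fun_add hI3)) fun p => ?_
  · rw [integral_add hI1 (hI2.fun_add hI3), integral_add hI2 hI3, integral_add hJ' hJ4] at hM
    simp only [integral_const_mul] at hM
    rw [integral_add hI4 (h3.const_mul 2), integral_add (he.sq.const_mul _)
      (he.integrable_gradSq.const_mul _), integral_finsetSum _ fun i _ => hJ i, hT4.integral_D,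
      sum_eq_zero fun i _ => ?_] at hM
    · simp only [integral_const_mul] at hM
      simp only [mass, dmass]
      linarith
    · rw [integral_sub (((hT i).D i).integrable.sub' ((hT2 i).D 0).integrable)
        (((hT3 i).D 0).integrable.const_mul _), integral_sub ((hT i).D i).integrable
        ((hT2 i).D 0).integrable, integral_const_mul, (hT i).integral_D, (hT2 i).integral_D,
        (hT3 i).integral_D]
      simp
  simp only
  have hl : D 0 (lap e) p = ∑ i, D i (D i (D 0 e)) p := (lap_D he.smooth 0 p).symm
  have hz : ∀ i, D i (fun q => χ q * (e q * D i (D 0 e) q)) p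
      - D 0 (fun q => D i χ q * (e q * D i e q)) p
      - 1 / 2 * D 0 (fun q => χ q * (D i e q * D i e q)) p ≤ χ p * e p * D i (D i (D 0 e)) p
        + κ * (1 / 2 * (e p ^ 2 + D 0 e p ^ 2 + 3 * D i e p ^ 2)) := fun i => by
    rw [D_mul (dχ p) (by fun_prop), D_mul (de p) (ddde i 0 p), D_mul (ddχ i p) (by fun_prop),
      D_mul (de p) (dde i p), D_mul (dχ p) (by fun_prop), D_mul (dde i p) (dde i p),
      D_comm he.smooth i 0]
    have a1 := abs_le.1 (h1 i p)
    have a2 := abs_le.1 (h2 i p)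
    have a3 := abs_le.1 (h1 0 p)
    nlinarith [mul_nonneg (sub_nonneg.2 a1.2) (sq_nonneg (D 0 e p - D i e p)),
      mul_nonneg (neg_le_iff_add_nonneg.1 a1.1) (sq_nonneg (D 0 e p + D i e p)),
      mul_nonneg (sub_nonneg.2 a2.2) (sq_nonneg (e p - D i e p)),
      mul_nonneg (neg_le_iff_add_nonneg.1 a2.1) (sq_nonneg (e p + D i e p)),
      mul_nonneg (neg_le_iff_add_nonneg.1 a3.1) (sq_nonneg (D i e p))]
  have hs := sum_le_sum fun i (_ : i ∈ Finset.univ) => hz i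
  rw [sum_add_distrib, ← mul_sum, ← hl, ← mul_sum, ← mul_sum,
    sum_add_distrib, ← mul_sum, Finset.sum_const, Finset.card_fin, nsmul_eq_mul,
    Nat.cast_ofNat] at hs
  have hg : gradSq e p = ∑ i, D i e p ^ 2 := rfl
  rw [D_add (by fun_prop) (by fun_prop), D_const_mul _ (by fun_prop), D_mul (de p) (de p),
    D_mul (dV p) (de p), D_mul (dχ p) (by fun_prop), D_add (by fun_prop) (by fun_prop),
    D_const_mul _ (by fun_prop), D_mul (de p) (by fun_prop), D_mul (dV p) (by fun_prop),
    D_mul (de p) (de p), hg]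
  have g0 : D 0 e p ^ 2 ≤ ∑ i, D i e p ^ 2 :=
    single_le_sum (fun i _ => sq_nonneg (D i e p)) (mem_univ 0)
  have hκ := (abs_nonneg _).trans (h1 0 p)
  have c1 : χ p * e p ^ 2 * -Λ ≤ χ p * e p ^ 2 * D 0 V p :=
    mul_le_mul_of_nonneg_left (neg_le_of_abs_le (hΛ p)) (mul_nonneg (h0 p) (sq_nonneg _))
  have c2 : D 0 χ p * (2 / 3 * e p ^ 3 + V p * e p ^ 2) ≤ κ * (|e p| ^ 3 + b * e p ^ 2) := by
    refine (le_abs_self _).trans ?_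
    rw [abs_mul]
    refine mul_le_mul (h1 0 p) ((abs_add_le _ _).trans ?_) (abs_nonneg _) hκ
    rw [abs_mul, abs_mul, abs_pow, abs_of_pos (by norm_num : (0 : ℝ) < 2 / 3),
      abs_of_nonneg (sq_nonneg (e p))]
    nlinarith [hb p, sq_nonneg (e p), pow_nonneg (abs_nonneg (e p)) 3]
  linarith [mul_le_mul_of_nonneg_left g0 hκ]

end

variable {u : ℝ → E3 → ℝ} {N : ℝ}
/-- The squared `H¹` norm. -/
def sob1 (f : E3 → ℝ) : ℝ := mass f + dmass f

lemma sob1_sub_le (hf : SobH f) (hg : SobH g) :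
    sob1 (fun p => f p - g p) ≤ 2 * sob1 f + 2 * sob1 g := by
  simp only [sob1]
  linarith [mass_parallelogram hf hg, dmass_parallelogram hf hg,
    mass_nonneg fun p => f p + g p, dmass_nonneg fun p => f p + g p]

lemma exists_cube_le : ∃ K : ℝ, 0 < K ∧ ∀ f, SobH f →
    Integrable (fun p => |f p| ^ 3) ∧ ∫ p, |f p| ^ 3 ≤ dmass f + K * mass f ^ 3 := by
  obtain ⟨K, hK, h⟩ := exists_gn
  refine ⟨K, hK, fun f hf => ⟨(h f hf).1, ?_⟩⟩
  have hd := dmass_nonneg f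
  have hm : 0 ≤ K * mass f ^ 3 := by have := mass_nonneg f; positivity
  refine (pow_le_pow_iff_left₀ (by positivity) (by positivity) (by norm_num : 4 ≠ 0)).1
    ((h f hf).2.trans ?_)
  have : 0 ≤ dmass f ^ 4 + 3 * dmass f ^ 3 * (K * mass f ^ 3)
    + 6 * dmass f ^ 2 * (K * mass f ^ 3) ^ 2 + 4 * dmass f * (K * mass f ^ 3) ^ 3
    + (K * mass f ^ 3) ^ 4 := by positivity
  nlinarith

/-- Solutions of the Zakharov–Kuznetsov equation, in Schwartz class at each time. -/
structure Sol (u : ℝ → E3 → ℝ) : Prop where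
  smooth : ContDiff ℝ ∞ fun q : ℝ × E3 => u q.1 q.2
  sch : ∀ t, Sch (u t)
  eqn : ∀ t p, deriv (fun s => u s p) t
    = -(D 0 (lap (u t)) p + D 0 (fun q => u t q * u t q) p)

namespace Sol

lemma hasDerivAt (hu : Sol u) (t : ℝ) (p) : HasDerivAt (fun s => u s p)
    (-(D 0 (lap (u t)) p + D 0 (fun q => u t q * u t q) p)) t := by
  rw [← hu.eqn]
  exact (hu.smooth.comp (contDiff_id.prodMk contDiff_const)
    |>.differentiable (by simp) t).hasDerivAt

lemma sob (hu : Sol u) (t : ℝ) : SobH (u t) := (hu.sch t).sob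

/-- Growth of the distance of a solution to a comparison function. -/
lemma growth (hu : Sol u) (hab : a ≤ b) {W W' r : ℝ → E3 → ℝ} (hN : ∀ t ∈ Icc a b, sob1 (u t) ≤ N)
    (hW : ∀ t ∈ Icc a b, SobH (W t) ∧ sob1 (W t) ≤ N ∧ Continuous (W' t) ∧
      (∀ p, HasDerivAt (fun s => W s p) (W' t p) t) ∧ (∀ p, |W t p| ≤ c) ∧ (∀ p, |W' t p| ≤ c) ∧
      (∀ p, |D 0 (W t) p| ≤ Λ) ∧
      (∀ p, W' t p = r t p - (D 0 (lap (W t)) p + D 0 (fun q => W t q * W t q) p)) ∧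
      ∀ n : ℕ, |∫ p, cut (n + 1) p * ((u t p - W t p) * r t p)| ≤ ρ) (hΛ : 0 ≤ Λ) (hρ : 0 ≤ ρ) :
    mass (fun p => u b p - W b p)
      ≤ (mass (fun p => u a p - W a p) + 2 * ρ * (b - a)) * exp (2 * Λ * (b - a)) := by
  obtain ⟨K, hK, hc3⟩ := exists_cube_le
  obtain ⟨κ, hκ, hcut⟩ := exists_cut_bound
  set e : ℝ → E3 → ℝ := fun t p => u t p - W t p
  have he : ∀ t ∈ Icc a b, SobH (e t) := fun t ht => (hu.sob t).sub (hW t ht).1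
  have heN : ∀ t ∈ Icc a b, sob1 (e t) ≤ 4 * N := fun t ht =>
    (sob1_sub_le (hu.sob t) (hW t ht).1).trans (by linarith [hN t ht, (hW t ht).2.1])
  set U' : ℝ → E3 → ℝ := fun t p => -(D 0 (lap (u t)) p + D 0 (fun q => u t q * u t q) p)
  have hU : Continuous fun q : ℝ × E3 => U' q.1 q.2 := by
    have h1 : ∀ q : ℝ × E3, U' q.1 q.2 = fderiv ℝ (fun q : ℝ × E3 => u q.1 q.2) q (1, 0) :=
      fun q => by
        have := (hu.smooth.differentiable (by simp) q).hasFDerivAt.comp_hasDerivAt_of_eq q.1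
          ((hasDerivAt_id q.1).prodMk (hasDerivAt_const q.1 q.2)) rfl
        exact (hu.hasDerivAt q.1 q.2).unique this
    simp_rw [h1]
    exact (hu.smooth.continuous_fderiv (by simp)).clm_apply continuous_const
  have hUt : ∀ t, Continuous (U' t) := fun t => hU.comp (Continuous.prodMk_right t)
  have h0N : 0 ≤ N := (add_nonneg (mass_nonneg _) (dmass_nonneg _)).trans
    (hN a (left_mem_Icc.2 hab))
  have h0c : 0 ≤ c := (abs_nonneg _).trans ((hW a (left_mem_Icc.2 hab)).2.2.2.2.1 0)
  set B : ℝ := (3 + 2 * c) * (4 * N) + 6 * (4 * N) + 2 * (4 * N + K * (4 * N) ^ 3)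
  have main : ∀ n : ℕ, ∫ p, cut (n + 1) p * e b p ^ 2 ≤ ((∫ p, cut (n + 1) p * e a p ^ 2)
      + (κ / ((n : ℝ) + 1) * B + 2 * ρ) * (b - a)) * exp (2 * Λ * (b - a)) := fun n => by
    have hχ := test_cut n
    have hn : (1 : ℝ) ≤ n + 1 := by linarith [n.cast_nonneg (α := ℝ)]
    have hK1 := (isCompact_Icc (a := a) (b := b)).prod hχ.cpt
    obtain ⟨C₁, h1⟩ := hK1.exists_bound_of_continuousOn hu.smooth.continuous.continuousOn
    obtain ⟨C₂, h2⟩ := hK1.exists_bound_of_continuousOn hU.continuousOn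
    refine cut_growth (e' := fun t p => U' t p - W' t p) (C := max C₁ C₂ + c) hχ
      (cut_nonneg _) hab (fun t ht => (he t ht).smooth.continuous)
      (fun t ht => (hUt t).sub (hW t ht).2.2.1)
      (fun t ht p => (hu.hasDerivAt t p).sub ((hW t ht).2.2.2.1 p)) (fun t ht p hp => ?_)
      (by positivity) (by positivity) fun t ht => ?_
    · have h1 := h1 (t, p) ⟨ht, hp⟩
      have h2 := h2 (t, p) ⟨ht, hp⟩
      have h3 := (hW t ht).2.2.2.2
      exact ⟨(abs_sub _ _).trans (add_le_add (h1.trans (le_max_left _ _)) (h3.1 p)),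
        (abs_sub _ _).trans (add_le_add (h2.trans (le_max_right _ _)) (h3.2.1 p))⟩
    · obtain ⟨w1, -, w2, -, w3, -, w4, w5, w6⟩ := hW t ht
      obtain ⟨i3, b3⟩ := hc3 _ (he t ht)
      have hf := flux_le hχ (cut_nonneg _) (fun i p => (hcut _ hn i 0 p).1)
        (fun i p => (hcut _ hn i 0 p).2) (he t ht) i3 w1.smooth w3 w4
      have hm := mass_nonneg (e t)
      have hd := dmass_nonneg (e t)
      have hs : mass (e t) + dmass (e t) ≤ 4 * N := heN t ht
      have hB : (3 + 2 * c) * mass (e t) + 6 * dmass (e t) + 2 * ∫ p, |e t p| ^ 3 ≤ B := by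
        have : mass (e t) ^ 3 ≤ (4 * N) ^ 3 := by gcongr; linarith
        have := mul_le_mul_of_nonneg_left this hK.le
        have : (3 + 2 * c) * mass (e t) ≤ (3 + 2 * c) * (4 * N) := by gcongr; linarith
        linarith
      have hB := mul_le_mul_of_nonneg_left hB (by positivity : 0 ≤ κ / ((n : ℝ) + 1))
      have e0 := (he t ht).smooth
      have hr : Continuous (r t) := by
        have : r t = fun p => W' t p + (D 0 (lap (W t)) p + D 0 (fun q => W t q * W t q) p) :=
          funext fun p => by rw [w5]; ring
        rw [this]
        exact w2.add (((contDiff_lap w1.smooth).D 0).continuous.add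
          ((w1.smooth.mul w1.smooth).D 0).continuous)
      have key : ∀ p, cut (n + 1) p * (2 * e t p * (U' t p - W' t p))
          = -(cut (n + 1) p * (2 * e t p * (D 0 (lap (e t)) p
            + D 0 (fun q => e t q * e t q + 2 * (W t q * e t q)) p)))
            - 2 * (cut (n + 1) p * (e t p * r t p)) := fun p => by
        have hl : D 0 (lap (u t)) p = D 0 (lap (e t)) p + D 0 (lap (W t)) p := by
          rw [← D_add ((contDiff_lap e0).differentiable (by simp) p)
            ((contDiff_lap w1.smooth).differentiable (by simp) p)]
          exact congrArg (D 0 · p) (funext fun q => by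
            rw [← lap_add e0 w1.smooth]; simp [e])
        have hq : D 0 (fun q => u t q * u t q) p
            = D 0 (fun q => e t q * e t q + 2 * (W t q * e t q)) p
              + D 0 (fun q => W t q * W t q) p := by
          have := (he t ht).diff
          have := w1.diff
          rw [← D_add (by fun_prop) (by fun_prop)]
          exact congrArg (D 0 · p) (funext fun q => by simp only [e]; ring)
        simp only [U', w5, hl, hq]
        ring
      simp_rw [key]
      rw [integral_sub, integral_neg, integral_const_mul]
      · linarith [(abs_le.1 (w6 n)).1]
      · refine (hχ.integrable_mul ((e0.continuous.const_mul 2).mul ((ContDiff.D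
          (contDiff_lap e0) 0).continuous.add (ContDiff.D ?_ 0).continuous))).neg
        have := w1.smooth
        fun_prop
      · exact (hχ.integrable_mul (e0.continuous.mul hr)).const_mul 2
  refine le_of_tendsto_of_tendsto' (tendsto_integral_cut_mul (he b (right_mem_Icc.2 hab)).sq) ?_
    main
  have h1 := tendsto_one_div_add_atTop_nhds_zero_nat (𝕜 := ℝ)
  have := (((tendsto_integral_cut_mul (he a (left_mem_Icc.2 hab)).sq).add
    ((((h1.const_mul κ).mul_const B).add_const (2 * ρ)).mul_const (b - a))).mul_const
    (exp (2 * Λ * (b - a))))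
  simpa [mass, mul_one_div, div_eq_mul_inv] using this

end Sol

variable {G : E3 → ℝ}
lemma energy_add (hf : SobH f) (hh : SobH h) (hb : ∀ p, |f p| ≤ b)
    (hl : Integrable fun p => h p * lap f p) :
    Integrable (fun p => f p * h p ^ 2) ∧ energy (fun p => f p + h p)
      = energy f - (∫ p, h p * (lap f p + f p * f p)) + 1 / 2 * dmass h - (∫ p, f p * h p ^ 2)
        - 1 / 3 * ∫ p, h p ^ 3 := by
  obtain ⟨K, -, hK⟩ := exists_cube_le
  have cube : ∀ {f}, SobH f → Integrable fun p => f p ^ 3 := fun {f} hf =>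
    (hK f hf).1.mono' (hf.smooth.continuous.pow 3).aestronglyMeasurable
      (.of_forall fun p => by simp)
  have hfb : ∀ {F : E3 → ℝ}, Integrable F → Integrable fun p => f p * F p := fun hF =>
    hF.bdd_mul (c := b) hf.meas (.of_forall hb)
  have i1 := hfb (hf.integrable_mul hh)
  have i2 := hfb hh.sq
  have i3 : ∀ i, Integrable fun p => D i h p * D i f p := fun i =>
    (hh.dmemLp i).integrable_mul (hf.dmemLp i)
  have e1 := integral_grad_mul_grad hh hf hl
  have i4 : Integrable fun p => ∑ i, D i h p * D i f p := integrable_finsetSum _ fun i _ => i3 i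
  have e2 : dmass (fun p => f p + h p)
      = dmass f + (2 * (∫ p, ∑ i, D i h p * D i f p) + dmass h) := by
    simp only [dmass]
    rw [← integral_const_mul, ← integral_add (i4.const_mul 2) hh.integrable_gradSq,
      ← integral_add hf.integrable_gradSq ((i4.const_mul 2).fun_add hh.integrable_gradSq)]
    refine integral_congr_ae (.of_forall fun p => ?_)
    simp only [gradSq, D_add (hf.diff p) (hh.diff p), mul_sum, ← sum_add_distrib]
    exact sum_congr rfl fun i _ => by ring
  have e3 : ∫ p, (f p + h p) ^ 3 = (∫ p, f p ^ 3) + (3 * (∫ p, f p * (f p * h p))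
      + (3 * (∫ p, f p * h p ^ 2) + ∫ p, h p ^ 3)) := by
    rw [← integral_const_mul, ← integral_const_mul, ← integral_add (i2.const_mul 3) (cube hh),
      ← integral_add (i1.const_mul 3) ((i2.const_mul 3).fun_add (cube hh)),
      ← integral_add (cube hf) ((i1.const_mul 3).fun_add ((i2.const_mul 3).fun_add (cube hh)))]
    exact integral_congr_ae (.of_forall fun p => by ring)
  have e4 : ∫ p, h p * (lap f p + f p * f p)
      = (∫ p, h p * lap f p) + ∫ p, f p * (f p * h p) := by
    rw [← integral_add hl i1]
    exact integral_congr_ae (.of_forall fun p => by ring)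
  exact ⟨i2, by simp only [energy]; rw [e2, e3, e4, e1]; ring⟩

lemma exists_dmass_le : ∃ K : ℝ, 0 < K ∧ ∀ f, SobH f →
    |∫ p, f p ^ 3| ≤ dmass f + K * mass f ^ 3 ∧ dmass f ≤ 6 * energy f + K * mass f ^ 3 := by
  obtain ⟨K, hK, h⟩ := exists_cube_le
  refine ⟨2 * K, by positivity, fun f hf => ?_⟩
  have h1 := abs_integral_le_integral_abs (f := fun p => f p ^ 3) (μ := volume)
  simp only [abs_pow] at h1
  have h2 := (h f hf).2
  have h3 : 0 ≤ K * mass f ^ 3 := by have := mass_nonneg f; positivity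
  have h4 := le_of_abs_le (h1.trans h2)
  exact ⟨by linarith, by simp only [energy]; linarith⟩

/-- Lower semicontinuity of the energy for the `L²` topology. -/
lemma Sch.energy_lsc (hf : Sch f) (hε : 0 < ε) : ∃ δ > 0, ∀ g, SobH g →
    mass (fun p => g p - f p) ≤ δ → energy f ≤ energy g + ε := by
  obtain ⟨K, hK, hc⟩ := exists_dmass_le
  obtain ⟨B, hB⟩ := hf.bdd
  have hG : SobH (fun p => ZK.lap f p + f p * f p) :=
    hf.lap.sob.add (hf.sob.mul_bdd hf.sob hB hB)
  set m := mass (fun p => ZK.lap f p + f p * f p)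
  have hB0 := (abs_nonneg _).trans (hB 0)
  have ht : Tendsto (fun δ : ℝ => √δ * √m + B * δ + K * δ ^ 3) (𝓝[>] 0) (𝓝 0) := by
    have : Continuous fun δ : ℝ => √δ * √m + B * δ + K * δ ^ 3 := by fun_prop
    simpa using (this.tendsto 0).mono_left nhdsWithin_le_nhds
  obtain ⟨δ, h1, hδ⟩ := ((ht.eventually (gt_mem_nhds hε)).and self_mem_nhdsWithin).exists
  refine ⟨δ, hδ, fun g hg hm => ?_⟩
  have hh := hg.sub hf.sob
  obtain ⟨i1, e⟩ := energy_add hf.sob hh hB (hh.integrable_mul hf.lap.sob)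
  simp only [add_sub_cancel] at e
  have b1 := (abs_le.1 (abs_integral_mul_le_sqrt hh.memLp hG.memLp)).2
  have b2 : ∫ p, f p * (g p - f p) ^ 2 ≤ B * mass (fun p => g p - f p) := by
    rw [mass, ← integral_const_mul]
    exact integral_mono i1 (hh.sq.const_mul B) fun p =>
      mul_le_mul_of_nonneg_right (le_of_abs_le (hB p)) (sq_nonneg _)
  have b3 := le_of_abs_le (hc _ hh).1
  have hm0 := mass_nonneg fun p => g p - f p
  have b4 : √(mass fun p => g p - f p) * √m ≤ √δ * √m := by gcongr
  have b5 : K * mass (fun p => g p - f p) ^ 3 ≤ K * δ ^ 3 := by gcongr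
  have b6 : B * mass (fun p => g p - f p) ≤ B * δ := by gcongr
  have := dmass_nonneg fun p => g p - f p
  change _ ≤ √(mass fun p => g p - f p) * √m at b1
  have : 0 ≤ K * δ ^ 3 := by positivity
  linarith

lemma Moll.abs_integral_mul_dconv_sub_le (hk : Moll η k) (hg : SobH g) (hG : MemLp G 2) :
    |∫ p, g p * (dconv k G p - G p)| ≤ √(12 * η ^ 2 * dmass g) * √(mass G) := by
  have hd := (hk.sob hg.memLp).sub hg
  have e : ∫ p, g p * (dconv k G p - G p) = ∫ p, (dconv k g p - g p) * G p := by
    simp_rw [mul_sub, sub_mul]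
    rw [integral_sub, integral_sub, hk.integral_dconv_mul hg.memLp hG]
    · exact (hk.sob hg.memLp).memLp.integrable_mul hG
    · exact hg.memLp.integrable_mul hG
    · exact hg.integrable_mul (hk.sob hG)
    · exact hg.memLp.integrable_mul hG
  rw [e]
  refine (abs_integral_mul_le_sqrt hd.memLp hG).trans ?_
  exact mul_le_mul (sqrt_le_sqrt (hk.mass_dconv_sub_le hg)) le_rfl (sqrt_nonneg _) (sqrt_nonneg _)

lemma exists_dmass_cut_mul_le : ∃ K, 0 ≤ K ∧ ∀ f, SobH f → ∀ n : ℕ,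
    dmass (fun p => cut (n + 1) p * f p) ≤ K * sob1 f := by
  obtain ⟨κ, hκ, hc⟩ := exists_cut_bound
  refine ⟨6 * κ ^ 2 + 2, by positivity, fun f hf n => ?_⟩
  have hn : (1 : ℝ) ≤ n + 1 := by linarith [n.cast_nonneg (α := ℝ)]
  have hI := (hf.sq.const_mul (6 * κ ^ 2 + 2)).fun_add (hf.integrable_gradSq.const_mul (6 * κ ^ 2 + 2))
  rw [sob1, mul_add, mass, dmass, dmass, ← integral_const_mul, ← integral_const_mul,
    ← integral_add (hf.sq.const_mul _) (hf.integrable_gradSq.const_mul _)]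
  refine integral_mono (SobH.cut_mul hf.smooth n).integrable_gradSq hI fun p => ?_
  have h1 : ∀ i, D i (fun p => cut (n + 1) p * f p) p ^ 2
      ≤ 2 * κ ^ 2 * f p ^ 2 + 2 * D i f p ^ 2 := fun i => by
    rw [D_cut_mul hf.diff]
    have h2 : |D i (cut (n + 1)) p| ≤ κ := (hc _ hn i 0 p).1.trans (div_le_self hκ.le hn)
    have h3 := mul_le_mul_of_nonneg_right (sq_le_sq.2 (h2.trans (le_abs_self κ)))
      (sq_nonneg (f p))
    have h4 := mul_le_mul_of_nonneg_right (pow_le_one₀ (n := 2) (cut_nonneg (n + 1) p)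
      (cut_le_one (n + 1) p)) (sq_nonneg (D i f p))
    nlinarith [sq_nonneg (D i (cut (n + 1)) p * f p - cut (n + 1) p * D i f p)]
  have h2 := sum_le_sum fun i (_ : i ∈ Finset.univ) => h1 i
  rw [sum_add_distrib, Finset.sum_const, Finset.card_fin, nsmul_eq_mul, Nat.cast_ofNat,
    ← mul_sum] at h2
  change gradSq _ p ≤ 3 * _ + 2 * gradSq f p at h2
  simp only
  nlinarith [sq_nonneg κ, sq_nonneg (f p), gradSq_nonneg f p,
    mul_nonneg (sq_nonneg κ) (gradSq_nonneg f p)]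

namespace Sol

lemma local_energy_le (hu : Sol u) (hN : ∀ t ∈ Icc 0 b, sob1 (u t) ≤ N) :
    ∃ δ > 0, ∀ t ∈ Icc 0 b, t ≤ δ → energy (u t) ≤ energy (u 0) := by
  obtain ⟨δ, hδ, Λ, M, H⟩ := exists_approx (hu.sch 0)
  obtain ⟨K, hK, hd⟩ := exists_dmass_le
  obtain ⟨K', hK', hcut⟩ := exists_dmass_cut_mul_le
  refine ⟨δ, hδ, fun t ht htδ => le_of_forall_pos_le_add fun ε hε => ?_⟩
  obtain ⟨δ', hδ', hlsc⟩ := (hu.sch t).energy_lsc (half_pos hε)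
  set m := mass (u 0)
  set N' := max N (m + (6 * (energy (u 0) + |M|) + K * m ^ 3))
  set ρ : ℝ → ℝ := fun η => √(12 * η ^ 2 * (K' * (4 * N'))) * √(2 * M + 2 * (4 * Λ ^ 2 * m))
  have hlim : Tendsto (fun η => (12 * η ^ 2 * dmass (u 0) + 2 * ρ η * (t - 0))
      * exp (2 * Λ * (t - 0))) (𝓝[>] 0) (𝓝 0) := by
    have : Continuous fun η => (12 * η ^ 2 * dmass (u 0) + 2 * ρ η * (t - 0))
      * exp (2 * Λ * (t - 0)) := by fun_prop
    simpa [ρ] using (this.tendsto 0).mono_left nhdsWithin_le_nhds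
  have hlim2 : Tendsto (fun η => M * η) (𝓝[>] 0) (𝓝 0) := by
    simpa using ((continuous_const_mul M).tendsto 0).mono_left nhdsWithin_le_nhds
  obtain ⟨η, ⟨⟨h1, h2⟩, h3⟩, h4⟩ := (((hlim.eventually (gt_mem_nhds hδ')).and
    (hlim2.eventually (gt_mem_nhds (half_pos hε)))).and (Ioo_mem_nhdsGT one_pos)).and
      self_mem_nhdsWithin |>.exists
  obtain ⟨k, hk⟩ := exists_moll h3.1
  obtain ⟨v, w, hv0, H⟩ := H η k h3.1 hk
  have hts : ∀ s ∈ Icc 0 t, s ∈ Icc 0 δ := fun s hs => ⟨hs.1, hs.2.trans htδ⟩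
  have h0 := hts 0 (left_mem_Icc.2 ht.1)
  have hWt := hk.sob (Lp.memLp (v t))
  refine (hlsc _ hWt ?_).trans (by linarith [(H t (hts t (right_mem_Icc.2 ht.1))).2.2.2.2.2])
  have hsym : ∀ f g : E3 → ℝ, mass (fun p => f p - g p) = mass fun p => g p - f p := fun f g =>
    integral_congr_ae (.of_forall fun p => by ring)
  rw [hsym]
  have hgr := hu.growth ht.1 (W := fun s => dconv k (v s)) (W' := fun s => dconv k (w s))
    (r := fun s p => dconv k (w s) p + (D 0 (lap (dconv k (v s))) p
      + D 0 (fun q => dconv k (v s) q * dconv k (v s) q) p)) (N := N') (Λ := Λ) (ρ := ρ η)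
    (c := max (√m * √(mass k)) (√M * √(mass k)))
    (fun s hs => (hN s ⟨hs.1, hs.2.trans ht.2⟩).trans (le_max_left _ _)) (fun s hs => ?_)
    ((abs_nonneg _).trans ((H 0 h0).2.2.2.2.1 0)) (by positivity)
  · refine hgr.trans (le_trans ?_ h1.le)
    gcongr
    rw [Moll.dconv_congr hv0, hsym]
    exact hk.mass_dconv_sub_le (hu.sob 0)
  obtain ⟨d1, d2, d3, d4, d5, d6⟩ := H s (hts s hs)
  have hm := Lp.memLp (v s)
  have hS := hk.sob hm
  have hmW : mass (dconv k (v s)) ≤ m := (hk.mass_dconv_le hm).trans d2.le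
  have hMη : M * η ≤ |M| := (mul_le_mul_of_nonneg_right (le_abs_self M) h3.1.le).trans
    (mul_le_of_le_one_right (abs_nonneg M) h3.2.le)
  have hWN : sob1 (dconv k (v s)) ≤ N' := by
    refine le_trans ?_ (le_max_right _ _)
    have := (hd _ hS).2
    have h5 : K * mass (dconv k (v s)) ^ 3 ≤ K * m ^ 3 := by
      have := mass_nonneg (dconv k (v s)); gcongr
    simp only [sob1]
    linarith
  refine ⟨hS, hWN, (hk.sob (Lp.memLp (w s))).smooth.continuous,
    hasDerivAt_dconv d1 hk.toTest, fun p => ?_, fun p => ?_, d5, fun p => by ring, fun n => ?_⟩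
  · exact ((hk.abs_dconv_le hm p).trans (by rw [d2])).trans (le_max_left _ _)
  · exact ((hk.abs_dconv_le (Lp.memLp (w s)) p).trans (by gcongr)).trans (le_max_right _ _)
  have hF := hk.dconv_sq_sob hm hm
  set F := fun q => dconv k (v s) q * dconv k (v s) q
  have hDF : MemLp (fun p => -1 * D 0 F p) 2 :=
    (hF.dmemLp 0).const_mul (-1)
  have hG := (Lp.memLp (w s)).add hDF
  have hgn : SobH fun p => cut (n + 1) p * (u s p - dconv k (v s) p) :=
    SobH.cut_mul ((hu.sob s).sub hS).smooth n
  have e : ∫ p, cut (n + 1) p * ((u s p - dconv k (v s) p) * (dconv k (w s) p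
      + (D 0 (lap (dconv k (v s))) p + D 0 F p)))
      = ∫ p, cut (n + 1) p * (u s p - dconv k (v s) p)
        * (dconv k (fun q => w s q + -1 * D 0 F q) p - (w s p + -1 * D 0 F p)) := by
    rw [hk.dconv_add (Lp.memLp (w s)) hDF, Moll.dconv_const_mul, ← hk.dconv_D hF]
    exact integral_congr_ae (d3.mono fun p hp => by simp only [hp]; ring)
  rw [e]
  refine (hk.abs_integral_mul_dconv_sub_le hgn hG).trans ?_
  have hmG : mass (fun q => w s q + -1 * D 0 F q) ≤ 2 * M + 2 * (4 * Λ ^ 2 * m) := by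
    have h5 := mass_add_le (Lp.memLp (w s)) hDF
    have h6 := mass_D_sq_le hS d5
    have h7 : 4 * Λ ^ 2 * mass (dconv k (v s)) ≤ 4 * Λ ^ 2 * m := by gcongr
    rw [mass_const_mul] at h5
    simp only [mass, neg_sq] at h5 h6 h7 d4 ⊢
    linarith
  have h8 : dmass (fun p => cut (n + 1) p * (u s p - dconv k (v s) p)) ≤ K' * (4 * N') := by
    refine (hcut _ ((hu.sob s).sub hS) n).trans (mul_le_mul_of_nonneg_left
      ((sob1_sub_le (hu.sob s) hS).trans ?_) hK')
    linarith [(hN s ⟨hs.1, hs.2.trans ht.2⟩).trans (le_max_left _ _ : N ≤ N')]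
  exact mul_le_mul (sqrt_le_sqrt (by gcongr)) (sqrt_le_sqrt hmG) (sqrt_nonneg _) (sqrt_nonneg _)

end Sol


lemma D_comp_neg (f) (i) : D i (fun p => f (-p)) = fun p => -D i f (-p) := by
  ext p
  have := (ContinuousLinearEquiv.neg (M := E3) ℝ).comp_right_fderiv (f := f) (x := p)
  exact (congrArg (· (ev i)) this).trans (map_neg (fderiv ℝ f (-p)) (ev i))

lemma D_neg (f) (i) : D i (fun p => -f p) = fun p => -D i f p := by
  ext p
  simp [D, fderiv_fun_neg]

lemma lap_comp_neg (f) : lap (fun p => f (-p)) = fun p => lap f (-p) := by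
  ext p
  simp only [lap, D_comp_neg, D_neg, neg_neg]

lemma mass_comp_neg (f) : mass (fun p => f (-p)) = mass f :=
  integral_neg_eq_self (fun p => f p ^ 2) volume

lemma dmass_comp_neg (f) : dmass (fun p => f (-p)) = dmass f := by
  simp only [dmass, gradSq, D_comp_neg, neg_sq]
  exact integral_neg_eq_self (fun p => ∑ i, D i f p ^ 2) volume

lemma energy_comp_neg (f) : energy (fun p => f (-p)) = energy f := by
  simp only [energy, dmass_comp_neg, integral_neg_eq_self (fun p => f p ^ 3) volume]

lemma sob1_comp_neg (f) : sob1 (fun p => f (-p)) = sob1 f := by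
  simp only [sob1, mass_comp_neg, dmass_comp_neg]

/-- Pointwise convergence together with conservation of the mass gives convergence in `L²`. -/
lemma tendsto_mass_sub_of_mass_eq {F : ℕ → E3 → ℝ} (hF : ∀ n, SobH (F n)) (hf : SobH f)
    (hp : ∀ p, Tendsto (fun n => F n p) atTop (𝓝 (f p))) (hm : ∀ n, mass (F n) = mass f) :
    Tendsto (fun n => mass fun p => F n p - f p) atTop (𝓝 0) := by
  refine tendsto_order.2 ⟨fun ε hε => Eventually.of_forall fun n => hε.trans_le (mass_nonneg _),
    fun ε hε => by_contra fun hc => ?_⟩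
  obtain ⟨φ, hφ, hφ'⟩ := extraction_of_frequently_atTop (not_eventually.1 hc)
  have h := (integrable_and_integral_le_of_tendsto (F := fun n p => (F (φ n) p + f p) ^ 2)
    (f := fun p => (f p + f p) ^ 2) (b := fun _ => 4 * mass f - ε) (B := 4 * mass f - ε)
    (fun n => ((hF _).add hf).sq) (fun n p => sq_nonneg _)
    (fun p => (((hp p).comp hφ.tendsto_atTop).add_const _).pow 2) (fun n => ?_)
    tendsto_const_nhds).2
  · have e : ∫ p, (f p + f p) ^ 2 = 4 * mass f := by
      rw [mass, ← integral_const_mul]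
      exact integral_congr_ae (.of_forall fun p => by ring)
    linarith
  · have h1 := mass_parallelogram (hF (φ n)) hf
    have h2 := hφ' n
    have h3 := hm (φ n)
    change mass (fun p => F (φ n) p + f p) ≤ _
    linarith

lemma exists_sob1_le : ∃ Ψ : ℝ → ℝ, ∀ f g N, SobH f → SobH g →
    mass f = mass g ∧ energy f = energy g → sob1 g ≤ N → sob1 f ≤ Ψ N := by
  obtain ⟨K, hK, h⟩ := exists_dmass_le
  refine ⟨fun N => 6 * N + 3 * K * N ^ 3, fun f g N hf hg he hN => ?_⟩
  have h1 := (h f hf).2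
  have h2 := neg_le_of_abs_le (h g hg).1
  have hm := mass_nonneg g
  have hd := dmass_nonneg g
  have h3 : K * mass g ^ 3 ≤ K * N ^ 3 := by
    gcongr
    exact (le_add_of_nonneg_right hd).trans hN
  rw [he.1, he.2] at h1
  simp only [sob1, energy, he.1] at h1 hN ⊢
  linarith

namespace Sol

variable (hu : Sol u)
include hu

lemma neg : Sol fun t p => u (-t) (-p) where
  smooth := hu.smooth.comp contDiff_neg
  sch t := by
    obtain ⟨S, hS⟩ := hu.sch (-t)
    exact ⟨SchwartzMap.compCLMOfContinuousLinearEquiv ℝ (ContinuousLinearEquiv.neg ℝ) S, by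
      ext p; simp [← hS]⟩
  eqn t p := by
    rw [deriv_comp_neg (f := fun s => u s (-p)), hu.eqn, lap_comp_neg, D_comp_neg,
      D_comp_neg (fun q => u (-t) q * u (-t) q)]
    ring

lemma shift (r : ℝ) : Sol fun t => u (r + t) where
  smooth := hu.smooth.comp ((contDiff_const.add contDiff_fst).prodMk contDiff_snd)
  sch t := hu.sch _
  eqn t p := by rw [deriv_comp_const_add (f := fun s => u s p), hu.eqn]

lemma tendsto {x : ℕ → ℝ} (hx : Tendsto x atTop (𝓝 t)) (p) :
    Tendsto (fun n => u (x n) p) atTop (𝓝 (u t p)) :=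
  ((hu.smooth.continuous.comp (Continuous.prodMk_left p)).tendsto t).comp hx

lemma tendsto_D {x : ℕ → ℝ} (hx : Tendsto x atTop (𝓝 t)) (i)
    (p) : Tendsto (fun n => D i (u (x n)) p) atTop (𝓝 (D i (u t) p)) := by
  have h1 : ∀ t, D i (u t) p = fderiv ℝ (fun q : ℝ × E3 => u q.1 q.2) (t, p) (0, ev i) := fun t => by
    have := (hu.smooth.differentiable (by simp) (t, p)).hasFDerivAt.comp p
      (hasFDerivAt_prodMk_right t p)
    exact congrArg (· (ev i)) this.fderiv
  simp_rw [h1]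
  exact ((((hu.smooth.continuous_fderiv (by simp)).comp
    (Continuous.prodMk_left p)).clm_apply continuous_const).tendsto t).comp hx

lemma isClosed_sob1_le (N : ℝ) : IsClosed {t | sob1 (u t) ≤ N} := by
  refine isSeqClosed_iff_isClosed.1 fun x t hx hxt => ?_
  have e : ∀ t, sob1 (u t) = ∫ p, (u t p ^ 2 + gradSq (u t) p) := fun t =>
    (integral_add (hu.sob t).sq (hu.sob t).integrable_gradSq).symm
  simp only [Set.mem_ofPred_eq, e] at hx ⊢
  exact (integrable_and_integral_le_of_tendsto
    (fun n => (hu.sob (x n)).sq.fun_add (hu.sob (x n)).integrable_gradSq)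
    (fun n p => add_nonneg (sq_nonneg _) (gradSq_nonneg _ p))
    (fun p => ((hu.tendsto hxt p).pow 2).add
      (tendsto_finsetSum _ fun i _ => (hu.tendsto_D hxt i p).pow 2)) hx tendsto_const_nhds).2

section
variable (hab : a ≤ b)
include hab

variable (hN : ∀ t ∈ Icc a b, sob1 (u t) ≤ N)
include hN

lemma mass_le :
    mass (u b) ≤ mass (u a) := by
  have h0 : ∀ i, D i (fun _ : E3 => (0 : ℝ)) = fun _ => 0 := fun i => by ext p; simp [D]
  have hl : lap (fun _ : E3 => (0 : ℝ)) = fun _ => 0 := by ext p; simp [lap, h0]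
  have hS : SobH (fun _ : E3 => (0 : ℝ)) := ⟨contDiff_const, by simp, fun i => by simp [h0]⟩
  have h := hu.growth hab (W := fun _ _ => 0) (W' := fun _ _ => 0) (r := fun _ _ => 0) (c := 0)
    (Λ := 0) (ρ := 0) hN (fun t ht => ⟨hS, ?_, continuous_const, fun p => hasDerivAt_const _ _,
      by simp, by simp, by simp [h0], by simp [h0, hl], by simp⟩) le_rfl le_rfl
  · simpa using h
  · have := (add_nonneg (mass_nonneg _) (dmass_nonneg _)).trans (hN t ht)
    simpa [sob1, mass, dmass, gradSq, h0] using this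

lemma mass_eq :
    mass (u b) = mass (u a) := by
  refine (hu.mass_le hab hN).antisymm ?_
  have := hu.neg.mass_le (neg_le_neg hab) (N := N) fun t ht => by
    rw [sob1_comp_neg]
    exact hN _ ⟨le_neg_of_le_neg ht.2, neg_le_of_neg_le ht.1⟩
  simpa only [mass_comp_neg, neg_neg] using this

lemma energy_le :
    energy (u b) ≤ energy (u a) := by
  have hm : ∀ t ∈ Icc a b, mass (u t) = mass (u a) := fun t ht =>
    hu.mass_eq ht.1 fun s hs => hN s ⟨hs.1, hs.2.trans ht.2⟩
  refine IsClosed.Icc_subset_of_forall_exists_gt (s := {t | energy (u t) ≤ energy (u a)}) ?_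
    (le_refl (energy (u a))) (fun t ht y hy => ?_) (right_mem_Icc.2 hab)
  · refine isSeqClosed_iff_isClosed.1 fun x t hx hxt => ?_
    have ht := isClosed_Icc.mem_of_tendsto hxt (.of_forall fun n => (hx n).2)
    refine ⟨le_of_forall_pos_le_add (α := ℝ) fun ε hε => ?_, ht⟩
    obtain ⟨δ, hδ, h⟩ := (hu.sch t).energy_lsc hε
    obtain ⟨n, hn⟩ := ((tendsto_mass_sub_of_mass_eq (fun n => hu.sob (x n)) (hu.sob t)
      (hu.tendsto hxt) fun n => (hm _ (hx n).2).trans (hm t ht).symm).eventually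
        (gt_mem_nhds hδ)).exists
    exact (h _ (hu.sob _) hn.le).trans (add_le_add_left (hx n).1 ε)
  · obtain ⟨δ, hδ, h⟩ := (hu.shift t).local_energy_le (b := b - t) (N := N) fun s hs =>
      hN _ ⟨by linarith [hs.1, ht.2.1], by linarith [hs.2]⟩
    set s := min (min δ (b - t)) (y - t)
    have h0 : 0 < s := lt_min (lt_min hδ (sub_pos.2 ht.2.2)) (sub_pos.2 hy)
    have h1 : s ≤ y - t := min_le_right _ _
    refine ⟨t + s, (h s ⟨h0.le, (min_le_left _ _).trans (min_le_right _ _)⟩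
      ((min_le_left _ _).trans (min_le_left _ _))).trans ?_, by linarith, by linarith⟩
    simpa using ht.1

lemma conserved_of_le :
    mass (u b) = mass (u a) ∧ energy (u b) = energy (u a) := by
  refine ⟨hu.mass_eq hab hN, (hu.energy_le hab hN).antisymm ?_⟩
  have := hu.neg.energy_le (neg_le_neg hab) (N := N) fun t ht => by
    rw [sob1_comp_neg]
    exact hN _ ⟨le_neg_of_le_neg ht.2, neg_le_of_neg_le ht.1⟩
  simpa only [energy_comp_neg, neg_neg] using this

/-- The `H¹` norm is bounded near a given time. -/
def BddAt (u : ℝ → E3 → ℝ) (t : ℝ) : Prop := ∃ N, ∀ᶠ s in 𝓝 t, sob1 (u s) ≤ N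

omit hN in
lemma conserved_of_bddAt (h : ∀ t ∈ Ioc a b, BddAt u t) :
    mass (u b) = mass (u a) ∧ energy (u b) = energy (u a) := by
  obtain ⟨Ψ, hΨ⟩ := exists_sob1_le
  refine hu.conserved_of_le hab (N := max (Ψ (sob1 (u b))) (sob1 (u a))) fun s hs => ?_
  rcases hs.1.eq_or_lt with rfl | has
  · exact le_max_right _ _
  obtain ⟨N, hN⟩ := isCompact_Icc.induction_on (s := Icc s b)
    (p := fun S => ∃ N, ∀ r ∈ S, sob1 (u r) ≤ N) ⟨0, by simp⟩
    (fun S T hST ⟨N, hN⟩ => ⟨N, fun r hr => hN r (hST hr)⟩)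
    (fun S T ⟨N, hN⟩ ⟨N', hN'⟩ => ⟨max N N', fun r hr => hr.elim
      (fun hr => (hN r hr).trans (le_max_left _ _)) fun hr => (hN' r hr).trans (le_max_right _ _)⟩)
    (fun r hr => by
      obtain ⟨N, hN⟩ := h r ⟨has.trans_le hr.1, hr.2⟩
      exact ⟨_, mem_nhdsWithin_of_mem_nhds hN, N, fun _ h => h⟩)
  have := hu.conserved_of_le hs.2 hN
  exact (hΨ _ _ _ (hu.sob s) (hu.sob b) ⟨this.1.symm, this.2.symm⟩ le_rfl).trans (le_max_left _ _)

end

omit hu in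
lemma bddAt_neg (t : ℝ) : BddAt (fun t p => u (-t) (-p)) t ↔ BddAt u (-t) := by
  simp only [BddAt, sob1_comp_neg, nhds_neg]
  rfl

lemma bddAt (t : ℝ) : BddAt u t := by
  obtain ⟨Ψ, hΨ⟩ := exists_sob1_le
  by_contra ht
  have hcl : ∀ u, IsClosed {t | ¬BddAt u t} := fun u => isOpen_compl_iff.1 <| by
    refine isOpen_iff_mem_nhds.2 fun t ht => ?_
    obtain ⟨N, hN⟩ := not_not.1 ht
    exact (eventually_eventually_nhds.2 hN).mono fun s hs => not_not.2 ⟨N, hs⟩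
  have right : ∀ {u}, Sol u → ∀ {x ε N}, ¬BddAt u x →
      (∀ y, ¬BddAt u y → |y - x| < ε → sob1 (u y) ≤ N) →
      ∀ t, x ≤ t → t < x + ε → sob1 (u t) ≤ Ψ N := fun {u} hu {x ε N} hx h t hxt ht => by
    obtain ⟨a, ha, ha'⟩ := (isCompact_Icc.inter_left (hcl u)).exists_isGreatest
      (s := {t | ¬BddAt u t} ∩ Icc x t) ⟨x, hx, le_rfl, hxt⟩
    refine hΨ _ _ _ (hu.sob t) (hu.sob a) (hu.conserved_of_bddAt ha.2.2 fun s hs =>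
      by_contra fun hc => hs.1.not_ge (ha' ⟨hc, ha.2.1.trans hs.1.le, hs.2⟩)) (h a ha.1 ?_)
    rw [abs_of_nonneg (sub_nonneg.2 ha.2.1)]
    linarith [ha.2.2]
  have : Nonempty {t | ¬BddAt u t} := ⟨⟨t, ht⟩⟩
  have : CompleteSpace {t | ¬BddAt u t} := (hcl u).completeSpace_coe
  obtain ⟨n, ⟨x, hx⟩, hn⟩ := nonempty_interior_of_iUnion_of_closed
    (f := fun (n : ℕ) => ((↑) : {t | ¬BddAt u t} → ℝ) ⁻¹' {t | sob1 (u t) ≤ n})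
    (fun n => (hu.isClosed_sob1_le n).preimage continuous_subtype_val)
    (Set.iUnion_eq_univ_iff.2 fun x => exists_nat_ge (sob1 (u x)))
  obtain ⟨ε, hε, h⟩ := Metric.mem_nhds_iff.1 (mem_interior_iff_mem_nhds.1 hn)
  have h' : ∀ y, ¬BddAt u y → |y - x| < ε → sob1 (u y) ≤ n := fun y hy hyx =>
    h (show (⟨y, hy⟩ : {t | ¬BddAt u t}) ∈ Metric.ball ⟨x, hx⟩ ε from hyx)
  refine hx ⟨Ψ n, Metric.eventually_nhds_iff.2 ⟨ε, hε, fun t ht => ?_⟩⟩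
  rw [dist_eq, abs_lt] at ht
  rcases le_total x t with hxt | hxt
  · exact right hu hx h' t hxt (by linarith)
  · have := right hu.neg (x := -x) (ε := ε) (N := n) (by rwa [bddAt_neg, neg_neg])
      (fun y hy hyx => ?_) (-t) (neg_le_neg hxt) (by linarith)
    · simpa only [sob1_comp_neg, neg_neg] using this
    · rw [sob1_comp_neg]
      exact h' _ ((bddAt_neg y).not.1 hy) 
        (by rwa [show -y - x = -(y - -x) by ring, abs_neg])

/-- Conservation of the mass and of the energy. -/
lemma conserved (t : ℝ) : mass (u t) = mass (u 0) ∧ energy (u t) = energy (u 0) := by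
  rcases le_total 0 t with h | h
  · exact hu.conserved_of_bddAt h fun s _ => hu.bddAt s
  · have := hu.conserved_of_bddAt h fun s _ => hu.bddAt s
    exact ⟨this.1.symm, this.2.symm⟩

lemma tendsto_mass_sub (t : ℝ) :
    Tendsto (fun s => mass fun p => u s p - u t p) (𝓝 t) (𝓝 0) :=
  tendsto_of_seq_tendsto fun x hx => tendsto_mass_sub_of_mass_eq (fun n => hu.sob (x n)) (hu.sob t)
    (hu.tendsto hx) fun _ => (hu.conserved _).1.trans (hu.conserved t).1.symm

end Sol

variable {f : ℝ → ℝ}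
lemma mass_add (hv : SobH v) (hh : SobH h) :
    mass (fun p => v p + h p) = mass v + 2 * (∫ p, v p * h p) + mass h := by
  have hI := (hv.integrable_mul hh).const_mul 2
  rw [mass, mass, mass, ← integral_const_mul, ← integral_add hv.sq hI,
    ← integral_add (hv.sq.fun_add hI) hh.sq]
  exact integral_congr_ae (.of_forall fun p => by ring)

lemma mass_translate (v) (a) : mass (fun p => v (a + p)) = mass v :=
  integral_translate (fun p => v p ^ 2) a

lemma energy_translate (v) (a) : energy (fun p => v (a + p)) = energy v := by
  simp only [energy, dmass, gradSq, D_translate,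
    integral_translate (fun p => ∑ i, D i v p ^ 2) a, integral_translate (fun p => v p ^ 3) a]

namespace GS

variable (hQ : GS f Q)
include hQ

lemma tendsto : Tendsto Q (cocompact E3) (𝓝 0) :=
  (tendsto_comp_rho hQ.prof.lim).congr fun p => (hQ.rad p).symm

lemma abs_D_le (i) : ∃ B, ∀ p, |D i Q p| ≤ B := by
  have ht : Tendsto (fun p => |D i Q p|) (cocompact E3) (𝓝 0) := by
    refine squeeze_zero (fun p => abs_nonneg _) (fun p => ?_)
      (tendsto_comp_rho (G := fun x => |deriv f x|) (by simpa using hQ.prof.tendsto_deriv.abs))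
    rw [hQ.D_eq]
    rcases eq_or_ne p 0 with rfl | hp
    · simp [co_zero]
    · have h := rho_pos hp
      rw [hQ.prof.kk_of_ne h.ne', abs_mul, abs_div, abs_of_pos h, mul_div_left_comm]
      exact mul_le_of_le_one_right (abs_nonneg _) (div_le_one_of_le₀ (abs_co_le_rho p i) h.le)
  by_cases h0 : ∃ q, 0 < |D i Q q|
  · obtain ⟨q, hq⟩ := h0
    obtain ⟨x, hx⟩ := (hQ.smooth.D i).continuous.abs.exists_forall_ge' q
      ((ht.eventually (gt_mem_nhds hq)).mono fun _ => le_of_lt)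
    exact ⟨_, hx⟩
  · exact ⟨0, fun p => not_lt.1 fun h => h0 ⟨p, h⟩⟩

/-- The translate of `v` closest to `Q` in `L²` has an orthogonal defect. -/
lemma exists_orthogonal (hv : Sch v) {b : E3}
    (hb : mass (fun p => v (b + p) - Q p) < mass Q) :
    ∃ a, mass (fun p => v (a + p) - Q p) ≤ mass (fun p => v (b + p) - Q p) ∧
      ∀ i, ∫ p, D i Q p * (v (a + p) - Q p) = 0 := by
  obtain ⟨S, hS⟩ := hv
  have hvI : Integrable v := by rw [← hS]; exact S.integrable
  have hv : Sch v := ⟨S, hS⟩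
  set Φ : E3 → ℝ := fun a => ∫ p, v p * Q (p - a)
  have hQa : ∀ a, Continuous fun p => Q (p - a) := fun a => hQ.continuous.comp (by fun_prop)
  have hm : ∀ a, AEStronglyMeasurable (fun p => v p * Q (p - a)) volume := fun a =>
    (hv.smooth.continuous.mul (hQa a)).aestronglyMeasurable
  have hbd : ∀ a p, ‖v p * Q (p - a)‖ ≤ |v p| * f 0 := fun a p => by
    rw [norm_mul, norm_of_nonneg (hQ.pos _).le]
    exact mul_le_mul_of_nonneg_left (hQ.le _) (abs_nonneg _)
  have hI : Integrable fun p => |v p| * f 0 := hvI.abs.mul_const _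
  have hc : Continuous Φ := continuous_of_dominated hm (fun a => Eventually.of_forall (hbd a)) hI
    (.of_forall fun p => continuous_const.mul (hQ.continuous.comp (by fun_prop)))
  have ht : Tendsto Φ (cocompact E3) (𝓝 0) := by
    have : (cocompact E3).IsCountablyGenerated := by
      rw [← Metric.cobounded_eq_cocompact, ← comap_norm_atTop]
      infer_instance
    have := tendsto_integral_filter_of_dominated_convergence (F := fun a p => v p * Q (p - a))
      (f := fun _ => 0) _ (.of_forall hm)
      (.of_forall fun a => Eventually.of_forall (hbd a)) hI (.of_forall fun p =>
        by simpa using (hQ.tendsto.comp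
          (Homeomorph.subLeft p).isClosedEmbedding.tendsto_cocompact).const_mul (v p))
    simpa using this
  have hΦ : ∀ a, mass (fun p => v (a + p) - Q p) = mass v + mass Q - 2 * Φ a := fun a => by
    have h1 := mass_add (hv.sob.translate a) ((hQ.sob).const_mul (-1))
    have h2 := integral_translate (fun p => v p * Q (p - a)) a
    simp only [add_sub_cancel_left] at h2
    rw [mass_translate, mass_const_mul] at h1
    simp only [neg_one_mul, ← sub_eq_add_neg, mul_neg, integral_neg, h2] at h1
    rw [h1]
    ring
  have hb0 : 0 < Φ b := by linarith [hΦ b, mass_nonneg v]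
  obtain ⟨a, ha⟩ := hc.exists_forall_ge' b ((ht.eventually (gt_mem_nhds hb0)).mono fun _ => le_of_lt)
  refine ⟨a, by linarith [hΦ a, hΦ b, ha b], fun i => ?_⟩
  obtain ⟨B, hB⟩ := hQ.abs_D_le i
  have hd := (hasDerivAt_integral_of_dominated_loc_of_deriv_le (μ := volume) (x₀ := (0 : ℝ))
    (F := fun s p => v p * Q (p - (a + s • ev i))) (F' := fun s p => v p * -D i Q (p - (a + s • ev i)))
    (bound := fun p => |v p| * B) (s := univ) univ_mem (.of_forall fun s => hm _)
    (hI.mono' (hm _) (.of_forall (hbd _)))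
    (hv.smooth.continuous.mul ((hQ.smooth.D i).continuous.comp
      (by fun_prop)).neg).aestronglyMeasurable
    (.of_forall fun p s _ => by
      rw [norm_mul, norm_neg]; exact mul_le_mul_of_nonneg_left (hB _) (abs_nonneg _))
    (hvI.abs.mul_const _) (.of_forall fun p s _ => by
      have h1 : HasDerivAt (fun s : ℝ => p - (a + s • ev i)) (-ev i) s := by
        simpa using (((hasDerivAt_id s).smul_const (ev i)).const_add a).const_sub p
      exact (((hQ.sob.diff _).hasFDerivAt.comp_hasDerivAt s h1).const_mul (v p)).congr_deriv
        (by simp [D]))).2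
  have h0 := IsLocalMax.hasDerivAt_eq_zero (.of_forall fun s => by
    simpa [Φ] using ha (a + s • ev i)) hd
  have h2 := integral_translate (fun p => v p * D i Q (p - a)) a
  simp only [zero_smul, add_zero, mul_neg, integral_neg, neg_eq_zero] at h0
  simp only [add_sub_cancel_left, h0] at h2
  have h3 := integral_mul_D_self hQ.sob i
  simp only [mul_sub]
  rw [integral_sub (hQ.integrable_D_mul_sob (hv.sob.translate a) i)
    (hQ.integrable_D_mul_sob hQ.sob i)]
  simp only [mul_comm (D i Q _), h2, h3, sub_zero]

lemma action_add (hh : SobH h) :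
    energy (fun p => Q p + h p) + 1 / 2 * mass (fun p => Q p + h p)
      = energy Q + 1 / 2 * mass Q + 1 / 2 * form Q h - 1 / 3 * ∫ p, h p ^ 3 := by
  have hb : ∀ p, |Q p| ≤ f 0 := fun p => by rw [abs_of_pos (hQ.pos p)]; exact hQ.le p
  have hl : ∀ p, h p * (lap Q p + Q p * Q p) = Q p * h p := fun p => by rw [hQ.eqn]; ring
  have hI : Integrable fun p => h p * lap Q p := by
    simp only [hQ.eqn]
    exact ((hQ.integrable_mul_sob hh).sub'
      (hQ.integrable_mul (hQ.integrable_mul_sob hh))).congr (.of_forall fun p => by ring)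
  have h1 := (energy_add hQ.sob hh hb hI).2
  simp only [hl] at h1
  rw [h1, mass_add hQ.sob hh, hQ.form_eq hh]
  ring

set_option maxHeartbeats 1000000 in
/-- Near the orbit of the ground state, the conservation laws control the `H¹` distance to it. -/
lemma exists_modulation : ∃ ε > 0, ∃ K > 0, ∀ v w α b, Sch v → SobH w →
    mass v = mass w → energy v = energy w → 0 ≤ α → α ≤ 1 → sob1 (fun p => w p - Q p) ≤ α ^ 2 →
    mass (fun p => v (b + p) - Q p) ≤ ε → ∃ a, sob1 (fun p => v (a + p) - Q p) ≤ K * α ^ 2 := by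
  obtain ⟨κ, hκ, C, hC, hco⟩ := hQ.exists_coercive
  obtain ⟨K₁, hK₁, hgn⟩ := exists_gn
  obtain ⟨K₂, hK₂, hcub⟩ := exists_dmass_le
  have hlim : ∀ {F : ℝ → ℝ}, Continuous F → F 0 = 0 → Tendsto F (𝓝[>] 0) (𝓝 0) := fun hF h0 => by
    simpa only [h0] using (hF.tendsto 0).mono_left nhdsWithin_le_nhds
  obtain ⟨ε, ⟨⟨h1, h2⟩, h3⟩, hε⟩ := ((((hlim (F := fun ε => K₁ * ε ^ 2) (by fun_prop)
    (by simp)).eventually (gt_mem_nhds (show 0 < (κ / 4) ^ 4 by positivity))).and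
    ((hlim (F := fun ε => C * ε) (by fun_prop) (by simp)).eventually
      (gt_mem_nhds (show 0 < κ / 4 by positivity)))).and
    (Ioo_mem_nhdsGT hQ.mass_pos)).and self_mem_nhdsWithin |>.exists
  have hmQ := hQ.mass_pos
  refine ⟨ε, hε, 2 * (2 + K₂ + C * (3 * mass Q + 1)) / κ, by positivity,
    fun v w α b hv hw hm he hα hα1 hwα hb => ?_⟩
  obtain ⟨a, ha, ho⟩ := hQ.exists_orthogonal hv (hb.trans_lt h3.2)
  have ha := ha.trans hb
  refine ⟨a, ?_⟩
  have hh := (hv.sob.translate a).sub hQ.sob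
  have hk := hw.sub hQ.sob
  have e1 := hQ.action_add hh
  have e2 := hQ.action_add hk
  have e3 := mass_add hQ.sob hh
  have e4 := mass_add hQ.sob hk
  have e5 := hQ.form_eq hk
  simp only [add_sub_cancel] at e1 e2 e3 e4
  rw [energy_translate, mass_translate] at e1
  rw [mass_translate] at e3
  have hco := hco _ hh
  simp only [defect, ho, ne_eq, OfNat.ofNat_ne_zero, not_false_eq_true, zero_pow,
    Finset.sum_const_zero, add_zero] at hco
  set h : E3 → ℝ := fun p => v (a + p) - Q p
  set k : E3 → ℝ := fun p => w p - Q p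
  have hdk := dmass_nonneg k
  have hmk := mass_nonneg k
  have hdh := dmass_nonneg h
  have hmh := mass_nonneg h
  simp only [sob1] at hwα ⊢
  have hα2 : α ^ 2 ≤ 1 := pow_le_one₀ hα hα1
  have hpot : 0 ≤ ∫ p, Q p * k p ^ 2 :=
    integral_nonneg fun p => mul_nonneg (hQ.pos p).le (sq_nonneg _)
  have hck := neg_le_of_abs_le (hcub k hk).1
  have hmk1 : mass k ≤ 1 := by linarith
  have hmk3 : K₂ * mass k ^ 3 ≤ K₂ * α ^ 2 := by
    gcongr
    exact (pow_le_of_le_one hmk hmk1 (by norm_num)).trans (by linarith)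
  have hcube : ∫ p, h p ^ 3 ≤ κ / 4 * (mass h + dmass h) := by
    have hs : 0 ≤ mass h + dmass h := by positivity
    have h4 := (hgn h hh).2
    have h5 : K₁ * mass h ^ 3 * dmass h ^ 3 ≤ (κ / 4 * (mass h + dmass h)) ^ 4 := calc
      _ = K₁ * mass h ^ 2 * (mass h * dmass h ^ 3) := by ring
      _ ≤ K₁ * ε ^ 2 * ((mass h + dmass h) * (mass h + dmass h) ^ 3) := by gcongr <;> linarith
      _ ≤ (κ / 4) ^ 4 * ((mass h + dmass h) * (mass h + dmass h) ^ 3) := by gcongr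
      _ = _ := by ring
    have h6 := abs_integral_le_integral_abs (f := fun p => h p ^ 3) (μ := volume)
    simp only [abs_pow] at h6
    exact (le_of_abs_le h6).trans (le_of_pow_le_pow_left₀ (by norm_num) (by positivity) (h4.trans h5))
  have hq : (∫ p, Q p * h p) ^ 2 ≤ (3 * mass Q + 1) * α ^ 2 + 3 / 4 * (ε * mass h) := by
    have h4 : (∫ p, Q p * k p) ^ 2 ≤ mass Q * mass k :=
      integral_mul_sq_le hQ.sob.memLp hk.memLp
    have h5 : mass Q * mass k ≤ mass Q * α ^ 2 := by gcongr; linarith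
    have h6 : mass h ^ 2 ≤ ε * mass h := by rw [sq]; gcongr
    have h7 : mass k ^ 2 ≤ α ^ 2 := (pow_le_of_le_one hmk hmk1 two_ne_zero).trans (by linarith)
    rw [show ∫ p, Q p * h p = (∫ p, Q p * k p) + mass k / 2 - mass h / 2 by linarith]
    have h8 : ∀ a b c : ℝ, (a + b - c) ^ 2 ≤ 3 * (a ^ 2 + b ^ 2 + c ^ 2) := fun a b c => by
      linarith [sq_nonneg (a - b), sq_nonneg (b + c), sq_nonneg (a + c)]
    linarith [h8 (∫ p, Q p * k p) (mass k / 2) (mass h / 2)]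
  have hCq := mul_le_mul_of_nonneg_left hq hC
  have hCε : C * (ε * mass h) ≤ κ / 4 * mass h := by rw [← mul_assoc]; gcongr
  have hκd : 0 ≤ κ * dmass h := by positivity
  have hX : 0 ≤ K₂ * α ^ 2 := by positivity
  have hY : 0 ≤ C * ((3 * mass Q + 1) * α ^ 2) := by positivity
  have hκm : 0 ≤ κ * mass h := by positivity
  rw [div_mul_eq_mul_div, le_div_iff₀ hκ]
  linarith

/-- Orbital stability for solutions on `E3`. -/
lemma exists_orbital : ∃ α₀ > 0, ∃ C > 0, ∀ α, 0 < α → α ≤ α₀ → ∀ u, Sol u →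
    sob1 (fun p => u 0 p - Q p) ≤ α ^ 2 →
    ∀ t, ∃ a, sob1 (fun p => u t (a + p) - Q p) ≤ (C * α) ^ 2 := by
  obtain ⟨ε, hε, K, hK, H⟩ := hQ.exists_modulation
  have hlim : Tendsto (fun α : ℝ => (4 * K + 1) * α ^ 2) (𝓝[>] 0) (𝓝 0) := by
    have : Continuous fun α : ℝ => (4 * K + 1) * α ^ 2 := by fun_prop
    simpa using (this.tendsto 0).mono_left nhdsWithin_le_nhds
  obtain ⟨α₀, ⟨h1, h2⟩, h3⟩ := ((hlim.eventually (gt_mem_nhds hε)).and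
    (Ioo_mem_nhdsGT one_pos)).and self_mem_nhdsWithin |>.exists
  refine ⟨α₀, h2.1, √K, sqrt_pos.2 hK, fun α hα hα0 u hu h0 => ?_⟩
  have hsmall : (4 * K + 1) * α ^ 2 < ε := lt_of_le_of_lt (by gcongr) h1
  have hKα : 0 ≤ K * α ^ 2 := by positivity
  have hα2 := sq_nonneg α
  have H' : ∀ t b, mass (fun p => u t (b + p) - Q p) ≤ ε →
      ∃ a, sob1 (fun p => u t (a + p) - Q p) ≤ K * α ^ 2 := fun t b =>
    H (u t) (u 0) α b (hu.sch t) (hu.sob 0) (hu.conserved t).1 (hu.conserved t).2 hα.le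
      (hα0.trans h2.2.le) h0
  set T := {t | ∃ b, mass (fun p => u t (b + p) - Q p) ≤ ε}
  have near : ∀ s t, t ∈ T → mass (fun p => u s p - u t p) < ε / 4 → s ∈ T := fun s t ⟨b, hb⟩ hst => by
    obtain ⟨a, ha⟩ := H' t b hb
    have h4 := mass_parallelogram (((hu.sob s).translate a).sub ((hu.sob t).translate a))
      (((hu.sob t).translate a).sub hQ.sob)
    rw [mass_translate (fun p => u s p - u t p)] at h4
    simp only [sub_add_sub_cancel] at h4
    simp only [sob1] at ha
    refine ⟨a, ?_⟩
    linarith [dmass_nonneg fun p => u t (a + p) - Q p, mass_nonneg fun p =>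
      u s (a + p) - u t (a + p) - (u t (a + p) - Q p)]
  have hT : IsClopen T := by
    refine ⟨isClosed_of_closure_subset fun t ht => ?_, isOpen_iff_mem_nhds.2 fun t ht => ?_⟩
    · obtain ⟨s, hs, hsT⟩ := mem_closure_iff_nhds.1 ht _
        ((hu.tendsto_mass_sub t).eventually (gt_mem_nhds (show 0 < ε / 4 by positivity)))
      refine near t s hsT (lt_of_eq_of_lt ?_ hs)
      exact integral_congr_ae (.of_forall fun p => by ring)
    · exact ((hu.tendsto_mass_sub t).eventually (gt_mem_nhds (show 0 < ε / 4 by positivity))).mono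
        fun s hs => near s t ht hs
  intro t
  have h5 : t ∈ T := by
    rw [hT.eq_univ ⟨0, 0, ?_⟩]
    · trivial
    · simp only [zero_add, sob1] at h0 ⊢
      linarith [dmass_nonneg fun p => u 0 p - Q p]
  obtain ⟨b, hb⟩ := h5
  rw [mul_pow, sq_sqrt hK.le]
  exact H' t b hb

end GS

lemma _root_.IsSchwartzCurve.sol {u : ℝ → ℝ → ℝ → ℝ → ℝ} (hu : IsSchwartzCurve u)
    (he : IsZKSolution u) : Sol fun t p => u t p.1 p.2.1 p.2.2 := by
  have hsch : ∀ t, Sch fun p : E3 => u t p.1 p.2.1 p.2.2 := fun t => by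
    obtain ⟨S, hS⟩ := hu.2 0 t
    exact ⟨S, funext fun p => by simpa using hS p.1 p.2.1 p.2.2⟩
  refine ⟨hu.1, hsch, fun t ⟨x, y, z⟩ => ?_⟩
  have hs := (hsch t).smooth
  have hl := (hsch t).lap.sob
  have h2 := ((hs.mul hs).differentiable (by simp))
  have h1 := he t x y z
  have e : ∀ a, lap3 (u t) a y z = lap (fun p : E3 => u t p.1 p.2.1 p.2.2) (a, y, z) := fun a =>
    lap3_eq_lap hs a y z
  simp only [e] at h1
  rw [deriv_fst_eq_D (F := fun p => lap (fun p : E3 => u t p.1 p.2.1 p.2.2) p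
    + u t p.1 p.2.1 p.2.2 ^ 2) (by simp only [pow_two]; exact hl.diff.add h2)] at h1
  simp only [pow_two] at h1
  rw [D_add (hl.diff _) (h2 _)] at h1
  exact eq_neg_of_add_eq_zero_left h1

lemma H1norm_eq (hF : SobH F) : H1norm (fun x y z => F (x, y, z)) = √(sob1 F) := by
  rw [H1norm, H1normSq_eq hF, sob1]

end ZK

/-- orbital stability of the ZK ground state soliton. -/
theorem zk_orbital_stability :
    ∃ α₀ > (0 : ℝ), ∃ C > (0 : ℝ), ∀ Q : ℝ → ℝ → ℝ → ℝ, IsGroundState Q →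
      ∀ α : ℝ, 0 < α → α ≤ α₀ →
        ∀ u : ℝ → ℝ → ℝ → ℝ → ℝ, IsSchwartzCurve u → IsZKSolution u →
          H1norm (fun x y z => u 0 x y z - Q x y z) ≤ α →
          ∃ c a₁ a₂ a₃ : ℝ → ℝ, ∀ t ≥ (0 : ℝ), 0 < c t ∧
            H1norm (fun x y z =>
                (c t) ^ 2 * u t (c t * x + a₁ t) (c t * y + a₂ t) (c t * z + a₃ t)
                  - Q x y z) ≤ C * α := by
  by_cases hex : ∃ Q, IsGroundState Q
  swap
  · exact ⟨1, one_pos, 1, one_pos, fun Q hQ => (hex ⟨Q, hQ⟩).elim⟩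
  obtain ⟨Q₀, hQ₀⟩ := hex
  obtain ⟨α₀, hα₀, C, hC, H⟩ := hQ₀.gs.exists_orbital
  refine ⟨α₀, hα₀, C, hC, fun Q hQ α hα hα0 u hu he h0 => ?_⟩
  obtain rfl := hQ.eq hQ₀
  have hS := hu.sol he
  have hsq : ∀ {F : ZK.E3 → ℝ}, ZK.SobH F → ∀ {r : ℝ}, 0 ≤ r →
      (H1norm (fun x y z => F (x, y, z)) ≤ r ↔ ZK.sob1 F ≤ r ^ 2) := fun hF r hr => by
    rw [ZK.H1norm_eq hF, sqrt_le_left hr]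
  choose a ha using H α hα hα0 _ hS ((hsq ((hS.sob 0).sub hQ.gs.sob) hα.le).1 h0)
  refine ⟨fun _ => 1, fun t => (a t).1, fun t => (a t).2.1, fun t => (a t).2.2, fun t _ =>
    ⟨one_pos, ?_⟩⟩
  have := (hsq (((hS.sob t).translate (a t)).sub hQ.gs.sob) (by positivity)).2 (ha t)
  simp only [one_pow, one_mul, add_comm _ (a t).1, add_comm _ (a t).2.1, add_comm _ (a t).2.2]
  exact this
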